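/- Let l(x) = exp(log x / (log₂ x · (log₃ x)³)), where log₂ and log₃ are the second and third iterated logarithms. Suppose θ : ℕ → ℝ satisfies max(2, n) ≤ θ(n) ≤ n f(n) for all n ≥ 1, where f(x) ≪ l(x), f(x) is non-decreasing, and (log f(x))/log x is eventually decreasing. Then B(x) = c_θ x / log x · (1 + O(E(x))) for x ≥ 2, where E(x) = ∫_x^∞ (log f(y)) / (y log² y) dy, and the positive constant c_θ is given by c_θ = (1 − e^{−γ})^{−1} Σ_{n ∈ B_θ} (1/n) ( Σ_{p ≤ θ(n), p prime} (log p)/(p−1) − log n ) ∏_{p ≤ θ(n), p prime} (1 − 1/p). -/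

import Mathlib

open Real MeasureTheory

/-- The set `B_θ`: `1 ∈ B_θ`, and `n = p₁^{α₁}⋯p_k^{α_k}` (with `p₁ < ⋯ < p_k`) belongs to
`B_θ` iff `p_i ≤ θ(p₁^{α₁}⋯p_{i-1}^{α_{i-1}})` for all `i`. -/
def Bset (θ : ℕ → ℝ) : Set ℕ :=
  {n | 0 < n ∧ ∀ p : ℕ, p.Prime → p ∣ n →
    (p : ℝ) ≤ θ (∏ q ∈ n.primeFactors.filter (· < p), q ^ n.factorization q)}

open Classical in
/-- `B x = #{n ∈ B_θ : n ≤ x}`. -/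
noncomputable def Bcount (θ : ℕ → ℝ) (x : ℝ) : ℝ :=
  (((Finset.Icc 1 ⌊x⌋₊).filter (fun n => n ∈ Bset θ)).card : ℝ)

/-- The primes `p ≤ y`. -/
noncomputable def primesUpTo (y : ℝ) : Finset ℕ :=
  (Finset.range (⌊y⌋₊ + 1)).filter Nat.Prime

/-- `l(x) = exp(log x / (log₂ x · log₃³ x))`. -/
noncomputable def lfun (x : ℝ) : ℝ :=
  Real.exp (Real.log x / (Real.log (Real.log x) * (Real.log (Real.log (Real.log x))) ^ 3))

/-- `E(x) = ∫_x^∞ log f(y) / (y log² y) dy`. -/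
noncomputable def Efun (f : ℝ → ℝ) (x : ℝ) : ℝ :=
  ∫ y in Set.Ioi x, Real.log (f y) / (y * (Real.log y) ^ 2)

/-- `c_θ = (1-e^{-γ})⁻¹ ∑_{n ∈ B_θ} (1/n)(∑_{p ≤ θ(n)} log p/(p-1) - log n) ∏_{p ≤ θ(n)} (1-1/p)`. -/
noncomputable def cθ (θ : ℕ → ℝ) : ℝ :=
  (1 - Real.exp (-Real.eulerMascheroniConstant))⁻¹ *
    ∑' n : Bset θ, (1 / (n : ℝ)) *
      ((∑ p ∈ primesUpTo (θ n), Real.log p / ((p : ℝ) - 1)) - Real.log n) *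
      ∏ p ∈ primesUpTo (θ n), (1 - 1 / (p : ℝ))

set_option linter.all false
set_option linter.unusedVariables false
set_option linter.unusedSimpArgs false
set_option linter.unusedTactic false
set_option linter.unreachableTactic false

section PNT1
open Complex Filter Topology

lemma zt_pt {s : ℂ} (hs : 0 ≤ s.re) {n : ℕ} (hn : 1 ≤ n) {x : ℝ} (hx : (n:ℝ) ≤ x) (hx1 : x ≤ n + 1)
    {θ : ℝ} (h0 : 0 ≤ θ) (h1 : θ ≤ 1) :
    ‖(n:ℂ) ^ (-s) - (x:ℂ) ^ (-s)‖ ≤ 2 * ‖s‖ ^ θ * (n:ℝ) ^ (-(s.re + θ)) := by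
  have n0 : (0:ℝ) < n := by exact_mod_cast hn
  have x0 : 0 < x := by linarith
  set v := ‖(n:ℂ) ^ (-s) - (x:ℂ) ^ (-s)‖
  have A : v ≤ 2 * (n:ℝ) ^ (-s.re) := by
    refine (norm_sub_le _ _).trans ?_
    have e1 : ‖(n:ℂ) ^ (-s)‖ = (n:ℝ) ^ (-s.re) := by
      have := norm_cpow_eq_rpow_re_of_pos n0 (-s); simpa using this
    rw [e1, norm_cpow_eq_rpow_re_of_pos x0, neg_re]
    have := Real.rpow_le_rpow_of_nonpos n0 hx (by linarith : -s.re ≤ 0)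
    linarith
  have B : v ≤ ‖s‖ * (n:ℝ) ^ (-s.re - 1) := by
    have hd : ∀ y ∈ Set.Icc (n:ℝ) x, HasDerivWithinAt (fun y : ℝ => (y:ℂ) ^ (-s))
        (-s * (y:ℂ) ^ (-s - 1)) (Set.Icc (n:ℝ) x) y := by
      intro y hy
      by_cases h : s = 0
      · subst h; simpa using hasDerivWithinAt_const _ _ _
      exact (hasDerivAt_ofReal_cpow_const (by linarith [hy.1]) (by simpa using h)).hasDerivWithinAt
    have := (convex_Icc (n:ℝ) x).norm_image_sub_le_of_norm_hasDerivWithin_le (C := ‖s‖ * (n:ℝ) ^ (-s.re - 1)) hd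
      (fun y hy => by
        have y0 : 0 < y := by linarith [hy.1]
        rw [norm_mul, norm_neg, norm_cpow_eq_rpow_re_of_pos y0]
        gcongr
        simpa using Real.rpow_le_rpow_of_nonpos n0 hy.1 (by linarith : -s.re-1 ≤ 0))
      (Set.right_mem_Icc.2 hx) (Set.left_mem_Icc.2 hx)
    refine this.trans ?_
    rw [Real.norm_eq_abs, abs_sub_comm, abs_of_nonneg (by linarith)]
    exact mul_le_of_le_one_right (by positivity) (by linarith)
  have v0 : 0 ≤ v := norm_nonneg _
  calc v = v ^ (1 - θ) * v ^ θ := by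
        rw [← Real.rpow_add_of_nonneg v0 (by linarith) h0]; simp
    _ ≤ (2 * (n:ℝ) ^ (-s.re)) ^ (1 - θ) * (‖s‖ * (n:ℝ) ^ (-s.re - 1)) ^ θ := by
        gcongr
    _ = 2 ^ (1 - θ) * ‖s‖ ^ θ * (n:ℝ) ^ (-(s.re + θ)) := by
        rw [Real.mul_rpow (by norm_num) (by positivity), Real.mul_rpow (by positivity) (by positivity),
          ← Real.rpow_mul n0.le, ← Real.rpow_mul n0.le]
        rw [show -(s.re + θ) = -s.re * (1 - θ) + (-s.re - 1) * θ by ring, Real.rpow_add n0]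
        ring
    _ ≤ _ := by
        gcongr
        calc (2:ℝ) ^ (1 - θ) ≤ 2 ^ (1:ℝ) := Real.rpow_le_rpow_of_exponent_le (by norm_num) (by linarith)
          _ = 2 := by simp

noncomputable def zt (n : ℕ) (s : ℂ) : ℂ :=
  (s - 1) * (n:ℂ) ^ (-s) + (((n + 1 : ℕ):ℂ) ^ (1 - s) - (n:ℂ) ^ (1 - s))

lemma zt_bd {s : ℂ} (hs : 0 ≤ s.re) {n : ℕ} (hn : 1 ≤ n) {θ : ℝ} (h0 : 0 ≤ θ) (h1 : θ ≤ 1) :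
    ‖zt n s‖ ≤ ‖s - 1‖ * (2 * ‖s‖ ^ θ * (n:ℝ) ^ (-(s.re + θ))) := by
  have n0 : (0:ℝ) < n := by exact_mod_cast hn
  by_cases h : s = 1
  · subst h; simp [zt]
  have h' : (1 - s) ≠ 0 := sub_ne_zero.2 (Ne.symm h)
  have hI : ∫ x in (n:ℝ)..(n+1:ℝ), (x:ℂ) ^ (-s) =
      (((n + 1 : ℕ):ℂ) ^ (1 - s) - (n:ℂ) ^ (1 - s)) / (1 - s) := by
    rw [integral_cpow]
    · push_cast; ring_nf
    · right
      refine ⟨fun h2 => h (by simpa using h2), ?_⟩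
      rw [Set.uIcc_of_le (by linarith)]; simp; omega
  have : zt n s = (s - 1) * ∫ x in (n:ℝ)..(n+1:ℝ), ((n:ℂ) ^ (-s) - (x:ℂ) ^ (-s)) := by
    rw [intervalIntegral.integral_sub (by simp) ?_, hI]
    · simp [zt]; field_simp; ring
    · apply intervalIntegral.intervalIntegrable_cpow
      right; rw [Set.uIcc_of_le (by linarith)]; simp; omega
  rw [this, norm_mul]
  gcongr
  refine (intervalIntegral.norm_integral_le_of_norm_le_const (C := 2 * ‖s‖ ^ θ * (n:ℝ) ^ (-(s.re + θ))) ?_).trans ?_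
  · intro x hx
    rw [Set.uIoc_of_le (by linarith)] at hx
    exact zt_pt hs hn hx.1.le hx.2 h0 h1
  · simp

lemma zt_sum {s : ℂ} (hs : 1 < s.re) : riemannZeta₁ s = 1 + ∑' n : ℕ, zt (n + 1) s := by
  have s1 : s ≠ 1 := by rintro rfl; simp at hs
  have hz : riemannZeta₁ s = (s - 1) * riemannZeta s := by
    rw [riemannZeta_eq_inv_sub_mul s1]; field_simp [sub_ne_zero.2 s1]
  have ha : HasSum (fun n : ℕ => (((n + 1 : ℕ):ℂ)) ^ (-s)) (riemannZeta s) := by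
    rw [zeta_eq_tsum_one_div_nat_add_one_cpow hs]
    have h := (Complex.summable_one_div_nat_cpow.2 hs)
    have := ((summable_nat_add_iff 1).2 h).hasSum
    simp only [one_div, ← cpow_neg] at this ⊢
    push_cast at this ⊢
    exact this
  have hb : Tendsto (fun N : ℕ => ∑ n ∈ Finset.range N, zt (n + 1) s) atTop (𝓝 ((s - 1) * riemannZeta s + (0 - 1))) := by
    have e : ∀ N : ℕ, ∑ n ∈ Finset.range N, zt (n + 1) s =
        (s - 1) * ∑ n ∈ Finset.range N, ((n + 1 : ℕ):ℂ) ^ (-s) + ((((N + 1 : ℕ):ℂ)) ^ (1 - s) - 1) := by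
      intro N
      have := Finset.sum_range_sub (fun n : ℕ => (((n + 1 : ℕ):ℂ)) ^ (1 - s)) N
      simp only [zt, Finset.sum_add_distrib, this, Finset.mul_sum]; simp
    simp only [e]
    refine (ha.tendsto_sum_nat.const_mul _).add (Tendsto.sub_const ?_ _)
    rw [tendsto_zero_iff_norm_tendsto_zero]
    have : ∀ N : ℕ, ‖((N + 1 : ℕ):ℂ) ^ (1 - s)‖ = ((N + 1 : ℕ):ℝ) ^ (-(s.re - 1)) := fun N => by
      have := norm_cpow_eq_rpow_re_of_pos (x := ((N + 1 : ℕ):ℝ)) (by positivity) (1 - s)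
      simpa using this
    simp only [this]
    exact (tendsto_rpow_neg_atTop (by linarith)).comp (tendsto_natCast_atTop_atTop.comp (tendsto_add_atTop_nat 1))
  have hsum : Summable (fun n : ℕ => zt (n + 1) s) := by
    refine Summable.of_norm_bounded (g := fun n : ℕ => ‖s - 1‖ * (2 * ‖s‖ ^ (0:ℝ) * ((n + 1 : ℕ):ℝ) ^ (-(s.re + 0))))
      (((summable_nat_add_iff 1).2 (Real.summable_nat_rpow.2 (by linarith))).mul_left _ |>.mul_left _)
      (fun n => zt_bd (by linarith) (by omega) le_rfl (by norm_num))
  rw [tendsto_nhds_unique hsum.hasSum.tendsto_sum_nat hb, hz]; ring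

lemma zt_sum' {s : ℂ} (hs : 39/40 < s.re) : riemannZeta₁ s = 1 + ∑' n : ℕ, zt (n + 1) s := by
  have hU : IsOpen {s : ℂ | 39/40 < s.re} := isOpen_lt continuous_const continuous_re
  have hd : DifferentiableOn ℂ (fun s => 1 + ∑' n : ℕ, zt (n + 1) s) {s : ℂ | 39/40 < s.re} := by
    refine DifferentiableOn.const_add (1:ℂ) ?_
    intro s0 hs0
    set V := {s : ℂ | 39/40 < s.re} ∩ Metric.ball s0 1
    have hV : IsOpen V := hU.inter Metric.isOpen_ball
    have : DifferentiableOn ℂ (fun s => ∑' n : ℕ, zt (n + 1) s) V := by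
      refine differentiableOn_tsum_of_summable_norm (u := fun n : ℕ => (‖s0‖ + 2) * (2 * (‖s0‖ + 1) ^ (1/20:ℝ) * ((n + 1 : ℕ):ℝ) ^ (-(41/40:ℝ))))
        (((summable_nat_add_iff 1).2 (Real.summable_nat_rpow.2 (by norm_num))).mul_left _ |>.mul_left _) ?_ hV ?_
      · intro n
        have h1 : ((n:ℂ) + 1) ≠ 0 := by exact_mod_cast Nat.succ_ne_zero n
        have h2 : ((n:ℂ) + 1 + 1) ≠ 0 := by exact_mod_cast Nat.succ_ne_zero (n+1)
        unfold zt
        push_cast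
        refine Differentiable.differentiableOn ?_
        intro s
        refine DifferentiableAt.add (DifferentiableAt.mul (by fun_prop) ?_) (DifferentiableAt.sub ?_ ?_)
        · exact DifferentiableAt.const_cpow (by fun_prop) (Or.inl h1)
        · exact DifferentiableAt.const_cpow (by fun_prop) (Or.inl h2)
        · exact DifferentiableAt.const_cpow (by fun_prop) (Or.inl h1)
      · intro n s hs
        have hsn : ‖s‖ ≤ ‖s0‖ + 1 := by
          have := hs.2; rw [Metric.mem_ball, dist_eq_norm] at this
          linarith [norm_le_norm_add_norm_sub' s s0]
        have hre : 39/40 < s.re := hs.1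
        refine (zt_bd (θ := 1/20) (by linarith) (by omega) (by norm_num) (by norm_num)).trans ?_
        gcongr
        · have := norm_sub_le s 1; rw [norm_one] at this; linarith
        · exact_mod_cast Nat.succ_pos n
        · linarith
    exact (this.differentiableAt (hV.mem_nhds ⟨hs0, by simp⟩)).differentiableWithinAt
  have := AnalyticOnNhd.eqOn_of_preconnected_of_eventuallyEq (z₀ := (2:ℂ))
    ((differentiable_riemannZeta₁.differentiableOn (s := {s : ℂ | 39/40 < s.re})).analyticOnNhd hU)
    (hd.analyticOnNhd hU) (convex_halfSpace_re_gt _).isPreconnected (by norm_num) (by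
      filter_upwards [(isOpen_lt continuous_const continuous_re).mem_nhds (show (1:ℝ) < (2:ℂ).re by norm_num)] with s hs
      exact zt_sum hs)
  exact this hs

lemma zeta1_bd : ∃ C : ℝ, 0 < C ∧ ∀ s : ℂ, 39/40 < s.re → s.re ≤ 3 →
    ‖riemannZeta₁ s‖ ≤ C * (1 + |s.im|) ^ (21/20:ℝ) := by
  have hS : Summable (fun n : ℕ => ((n + 1 : ℕ):ℝ) ^ (-(41/40:ℝ))) :=
    (summable_nat_add_iff 1).2 (Real.summable_nat_rpow.2 (by norm_num))
  set S := ∑' n : ℕ, ((n + 1 : ℕ):ℝ) ^ (-(41/40:ℝ))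
  have S0 : 0 ≤ S := tsum_nonneg fun n => by positivity
  refine ⟨1 + 4 * (2 * 3 ^ (1/20:ℝ) * S), by positivity, fun s hs hs3 => ?_⟩
  have t0 := abs_nonneg s.im
  have n3 : ‖s‖ ≤ 3 * (1 + |s.im|) := by
    have := Complex.norm_le_abs_re_add_abs_im s
    rw [abs_of_nonneg (by linarith : 0 ≤ s.re)] at this; linarith
  have n4 : ‖s - 1‖ ≤ 4 * (1 + |s.im|) := by
    have := norm_sub_le s 1; rw [norm_one] at this; linarith
  rw [zt_sum' hs]
  have hb : ∀ n : ℕ, ‖zt (n + 1) s‖ ≤ 4 * (2 * 3 ^ (1/20:ℝ)) * (1 + |s.im|) ^ (21/20:ℝ) * ((n + 1 : ℕ):ℝ) ^ (-(41/40:ℝ)) := by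
    intro n
    refine (zt_bd (θ := 1/20) (by linarith) (by omega) (by norm_num) (by norm_num)).trans ?_
    calc _ ≤ 4 * (1 + |s.im|) * (2 * (3 * (1 + |s.im|)) ^ (1/20:ℝ) * ((n + 1 : ℕ):ℝ) ^ (-(41/40:ℝ))) := by
          gcongr
          · exact_mod_cast Nat.succ_pos n
          · linarith
      _ = _ := by
          rw [Real.mul_rpow (by norm_num) (by positivity), show (21/20:ℝ) = 1 + 1/20 by norm_num,
            Real.rpow_add (by positivity), Real.rpow_one]; ring
  have := tsum_of_norm_bounded (hS.hasSum.mul_left (4 * (2 * 3 ^ (1/20:ℝ)) * (1 + |s.im|) ^ (21/20:ℝ))) hb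
  refine (norm_add_le _ _).trans ?_
  have h1 : 1 ≤ (1 + |s.im|) ^ (21/20:ℝ) := Real.one_le_rpow (by linarith) (by norm_num)
  rw [norm_one]; nlinarith [this]
end PNT1

section PNT2
open Complex Filter Topology

lemma zeta1_deriv_bd : ∃ C : ℝ, 0 < C ∧ ∀ s : ℂ, 79/80 ≤ s.re → s.re ≤ 2 →
    ‖deriv riemannZeta₁ s‖ ≤ C * (1 + |s.im|) ^ (21/20:ℝ) := by
  obtain ⟨C, C0, hC⟩ := zeta1_bd
  refine ⟨C * 2 ^ (21/20:ℝ) / (1/100), by positivity, fun s h1 h2 => ?_⟩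
  have t0 := abs_nonneg s.im
  refine (norm_deriv_le_of_forall_mem_sphere_norm_le (R := 1/100) (C := C * (2 * (1 + |s.im|)) ^ (21/20:ℝ)) (by norm_num) differentiable_riemannZeta₁.diffContOnCl ?_).trans (le_of_eq ?_)
  · intro z hz
    have hz' : ‖z - s‖ = 1/100 := by simpa [dist_eq_norm] using hz
    have hr := abs_re_le_norm (z - s); have hi := abs_im_le_norm (z - s)
    rw [hz', sub_re, abs_le] at hr; rw [hz', sub_im] at hi
    refine (hC z (by linarith) (by linarith)).trans ?_
    gcongr
    have := abs_sub_abs_le_abs_sub z.im s.im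
    linarith
  · rw [Real.mul_rpow (by norm_num) (by positivity)]; ring

lemma zeta1_ne {s : ℂ} (hs : 1 ≤ s.re) : riemannZeta₁ s ≠ 0 := by
  by_cases h : s = 1
  · simp [h]
  · have h1 := riemannZeta_ne_zero_of_one_le_re hs
    rw [riemannZeta_eq_inv_sub_mul h] at h1
    exact right_ne_zero_of_mul h1

lemma zeta_341 {x : ℝ} (hx : 0 < x) (t : ℝ) :
    1 ≤ ‖riemannZeta (1 + x)‖ ^ 3 * ‖riemannZeta (1 + x + I * t)‖ ^ 4 * ‖riemannZeta (1 + x + 2 * I * t)‖ := by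
  have := DirichletCharacter.norm_LFunction_product_ge_one (1 : DirichletCharacter ℂ 1) hx t
  rw [one_pow, DirichletCharacter.LFunctionTrivChar, DirichletCharacter.LFunction_modOne_eq] at this
  simpa [norm_mul, norm_pow] using this

lemma zeta1_low1 : ∃ c : ℝ, 0 < c ∧ ∀ x t : ℝ, 0 < x → x ≤ 1 → 1 ≤ |t| →
    c * x ^ 3 * (1 + |t|) ^ (79/20:ℝ) ≤ ‖riemannZeta₁ (1 + x + I * t)‖ ^ 4 := by
  obtain ⟨C, C0, hC⟩ := zeta1_bd
  refine ⟨1 / (C ^ 4 * 2 ^ (21/20:ℝ) * 2 ^ 5), by positivity, fun x t x0 x1 ht => ?_⟩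
  have h := zeta_341 x0 t
  have e1 : (1 + x : ℂ) ≠ 1 := by simp [x0.ne']
  have t0 : t ≠ 0 := by rintro rfl; simp at ht; linarith
  have e2 : (1 + x + I * t : ℂ) ≠ 1 := by
    intro h; have := congrArg im h; simp at this; exact t0 this
  have e3 : (1 + x + 2 * I * t : ℂ) ≠ 1 := by
    intro h; have := congrArg im h; simp at this; exact t0 this
  rw [riemannZeta_eq_inv_sub_mul e1, riemannZeta_eq_inv_sub_mul e2, riemannZeta_eq_inv_sub_mul e3] at h
  simp only [norm_mul, norm_inv] at h
  have b1 : ‖(1 + x - 1 : ℂ)‖ = x := by simp [abs_of_pos x0]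
  have b2 : |t| ≤ ‖(1 + x + I * t - 1 : ℂ)‖ := by
    have := abs_im_le_norm (1 + x + I * t - 1 : ℂ); simpa using this
  have b3 : |t| ≤ ‖(1 + x + 2 * I * t - 1 : ℂ)‖ := by
    have := abs_im_le_norm (1 + x + 2 * I * t - 1 : ℂ); simp [abs_mul] at this ; linarith
  have c1 : ‖riemannZeta₁ (1 + x)‖ ≤ C := by
    have := hC (1 + x) (by simp; linarith) (by simp; linarith); simpa using this
  have c3 : ‖riemannZeta₁ (1 + x + 2 * I * t)‖ ≤ C * (2 * (1 + |t|)) ^ (21/20:ℝ) := by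
    have := hC (1 + x + 2 * I * t) (by simp; linarith) (by simp; linarith)
    refine this.trans ?_
    gcongr; simp [abs_mul]; linarith
  rw [b1] at h
  set a := ‖riemannZeta₁ (1 + x + I * t)‖
  have tp : 0 < |t| := by linarith
  have h2 : 1 ≤ (x⁻¹ * C) ^ 3 * (|t|⁻¹ * a) ^ 4 * (|t|⁻¹ * (C * (2 * (1 + |t|)) ^ (21/20:ℝ))) := by
    refine h.trans ?_
    gcongr
  rw [Real.mul_rpow (by norm_num) (by positivity)] at h2
  have h3 : x ^ 3 * |t| ^ 5 ≤ C ^ 4 * 2 ^ (21/20:ℝ) * (1 + |t|) ^ (21/20:ℝ) * a ^ 4 := by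
    have := mul_le_mul_of_nonneg_left h2 (by positivity : 0 ≤ x ^ 3 * |t| ^ 5)
    rw [mul_one] at this
    refine this.trans (le_of_eq ?_)
    field_simp
  have h4 : (1 + |t|) ^ 5 ≤ 2 ^ 5 * |t| ^ 5 := by
    rw [← mul_pow]; gcongr; linarith
  have h5 : (1 + |t|) ^ (79/20:ℝ) * (1 + |t|) ^ (21/20:ℝ) = (1 + |t|) ^ 5 := by
    rw [← Real.rpow_add (by positivity)]; norm_num
  have p : 0 < (1 + |t|) ^ (21/20:ℝ) := by positivity
  rw [one_div, mul_assoc, inv_mul_le_iff₀ (by positivity)]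
  refine le_of_mul_le_mul_right ?_ p
  calc x ^ 3 * (1 + |t|) ^ (79/20:ℝ) * (1 + |t|) ^ (21/20:ℝ) = x ^ 3 * (1 + |t|) ^ 5 := by rw [mul_assoc, h5]
    _ ≤ x ^ 3 * (2 ^ 5 * |t| ^ 5) := by gcongr
    _ = 2 ^ 5 * (x ^ 3 * |t| ^ 5) := by ring
    _ ≤ 2 ^ 5 * (C ^ 4 * 2 ^ (21/20:ℝ) * (1 + |t|) ^ (21/20:ℝ) * a ^ 4) := by gcongr
    _ = _ := by ring

lemma zeta1_low : ∃ c κ : ℝ, 0 < c ∧ 0 < κ ∧ κ ≤ 1/80 ∧ ∀ s : ℂ, 1 - κ * (1 + |s.im|) ^ (-(1/4):ℝ) ≤ s.re → s.re ≤ 2 →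
    c * (1 + |s.im|) ^ (4/5:ℝ) ≤ ‖riemannZeta₁ s‖ := by
  obtain ⟨C, C0, hC⟩ := zeta1_deriv_bd
  obtain ⟨b, b0, hb⟩ := zeta1_low1
  have diff : ∀ x y t : ℝ, 79/80 ≤ x → x ≤ y → y ≤ 2 →
      ‖riemannZeta₁ (y + I * t)‖ - C * (1 + |t|) ^ (21/20:ℝ) * (y - x) ≤ ‖riemannZeta₁ (x + I * t)‖ := by
    intro x y t hx hxy hy
    have := (convex_Icc x y).norm_image_sub_le_of_norm_hasDerivWithin_le (f := fun u : ℝ => riemannZeta₁ (u + I * t))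
      (f' := fun u : ℝ => deriv riemannZeta₁ (u + I * t)) (C := C * (1 + |t|) ^ (21/20:ℝ)) (fun u hu => by
        have h1 : HasDerivAt (fun u : ℝ => (u + I * t : ℂ)) 1 u := by
          simpa using (Complex.ofRealCLM.hasDerivAt (x := u)).add_const (I * t)
        have := (differentiable_riemannZeta₁ (u + I * t)).hasDerivAt.comp u h1
        simpa [Function.comp_def] using this.hasDerivWithinAt) (fun u hu => by
          have := hC (u + I * t) (by simp; linarith [hu.1]) (by simp; linarith [hu.2])
          simpa using this) (Set.left_mem_Icc.2 hxy) (Set.right_mem_Icc.2 hxy)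
    rw [Real.norm_eq_abs, abs_of_nonneg (by linarith : 0 ≤ y - x)] at this
    have h2 := norm_sub_norm_le (riemannZeta₁ (y + I * t)) (riemannZeta₁ (x + I * t))
    linarith
  -- compact part
  obtain ⟨m, m0, hm⟩ : ∃ m > 0, ∀ x t : ℝ, 1 ≤ x → x ≤ 2 → |t| ≤ 1 → m ≤ ‖riemannZeta₁ (x + I * t)‖ := by
    have hK : IsCompact ((fun p : ℝ × ℝ => (p.1 + I * p.2 : ℂ)) '' (Set.Icc 1 2 ×ˢ Set.Icc (-1) 1)) :=
      (isCompact_Icc.prod isCompact_Icc).image (by fun_prop)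
    obtain ⟨z, ⟨p, hp, hpz⟩, hz⟩ := hK.exists_isMinOn ⟨_, (1, 0), by simp, rfl⟩
      (f := fun z => ‖riemannZeta₁ z‖) (differentiable_riemannZeta₁.continuous.norm.continuousOn)
    refine ⟨‖riemannZeta₁ z‖, norm_pos_iff.2 (zeta1_ne ?_), fun x t h1 h2 h3 => hz ⟨(x, t), ⟨⟨h1, h2⟩, abs_le.1 h3⟩, rfl⟩⟩
    rw [← hpz]; simpa using hp.1.1
  set κ := min (1/80) (min (m / (8 * C)) (b / (4 * C) ^ 4)) with hκ
  have κ0 : 0 < κ := by positivity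
  have k1 : κ ≤ 1/80 := min_le_left _ _
  have k2 : κ * (8 * C) ≤ m := by rw [← le_div_iff₀ (by positivity)]; exact (min_le_right _ _).trans (min_le_left _ _)
  have k3 : κ * (4 * C) ^ 4 ≤ b := by rw [← le_div_iff₀ (by positivity)]; exact (min_le_right _ _).trans (min_le_right _ _)
  refine ⟨min (m / 4) (2 * κ * C), κ, by positivity, κ0, k1, fun s hs hs2 => ?_⟩
  obtain ⟨x, t, rfl⟩ : ∃ x t : ℝ, s = x + I * t := ⟨s.re, s.im, by rw [mul_comm]; exact (re_add_im s).symm⟩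
  have hre : (x + I * t : ℂ).re = x := by simp
  have him : (x + I * t : ℂ).im = t := by simp
  rw [hre, him] at hs; rw [hre] at hs2; rw [him]
  have t0 := abs_nonneg t
  have q1 : (1 + |t|) ^ (-(1/4):ℝ) ≤ 1 := Real.rpow_le_one_of_one_le_of_nonpos (by linarith) (by norm_num)
  have q0 : 0 < (1 + |t|) ^ (-(1/4):ℝ) := by positivity
  have q2 : (1 + |t|) ^ (21/20:ℝ) * (1 + |t|) ^ (-(1/4):ℝ) = (1 + |t|) ^ (4/5:ℝ) := by
    rw [← Real.rpow_add (by positivity)]; norm_num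
  have xl : 79/80 ≤ x := by nlinarith
  by_cases ht : |t| ≤ 1
  · have p1 : (1 + |t|) ^ (4/5:ℝ) ≤ 2 := by
      calc (1 + |t|) ^ (4/5:ℝ) ≤ (1 + |t|) ^ (1:ℝ) := Real.rpow_le_rpow_of_exponent_le (by linarith) (by norm_num)
        _ ≤ 2 := by rw [Real.rpow_one]; linarith
    have p0 : 0 ≤ (1 + |t|) ^ (4/5:ℝ) := by positivity
    have : m / 2 ≤ ‖riemannZeta₁ (x + I * t)‖ := by
      by_cases hx : 1 ≤ x
      · linarith [hm x t hx hs2 ht]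
      · have d := diff x 1 t xl (by linarith) (by norm_num)
        have m1 := hm 1 t le_rfl (by norm_num) ht
        have : C * (1 + |t|) ^ (21/20:ℝ) * (1 - x) ≤ m / 2 := by
          calc C * (1 + |t|) ^ (21/20:ℝ) * (1 - x) ≤ C * (1 + |t|) ^ (21/20:ℝ) * (κ * (1 + |t|) ^ (-(1/4):ℝ)) := by
                gcongr; linarith
            _ = κ * C * (1 + |t|) ^ (4/5:ℝ) := by rw [← q2]; ring
            _ ≤ κ * C * 2 := by gcongr
            _ ≤ m / 2 := by linarith
        linarith
    calc _ ≤ m / 4 * 2 := by gcongr; exact min_le_left _ _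
      _ ≤ _ := by linarith
  · push Not at ht
    have key : ∀ y : ℝ, κ * (1 + |t|) ^ (-(1/4):ℝ) ≤ y → y ≤ 1 → 4 * κ * C * (1 + |t|) ^ (4/5:ℝ) ≤ ‖riemannZeta₁ ((1 + y : ℝ) + I * t)‖ := by
      intro y hy hy1
      have y0 : 0 < y := lt_of_lt_of_le (by positivity) hy
      have h1 := hb y t y0 hy1 ht.le
      have h2 : (4 * κ * C * (1 + |t|) ^ (4/5:ℝ)) ^ 4 ≤ ‖riemannZeta₁ (1 + y + I * t)‖ ^ 4 := by
        refine le_trans ?_ h1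
        calc (4 * κ * C * (1 + |t|) ^ (4/5:ℝ)) ^ 4 = (κ * (4 * C) ^ 4) * κ ^ 3 * ((1 + |t|) ^ (4/5:ℝ)) ^ 4 := by ring
          _ ≤ b * κ ^ 3 * ((1 + |t|) ^ (4/5:ℝ)) ^ 4 := by gcongr
          _ = b * (κ * (1 + |t|) ^ (-(1/4):ℝ)) ^ 3 * (1 + |t|) ^ (79/20:ℝ) := by
              have : ((1 + |t|) ^ (4/5:ℝ)) ^ 4 = ((1 + |t|) ^ (-(1/4):ℝ)) ^ 3 * (1 + |t|) ^ (79/20:ℝ) := by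
                rw [← Real.rpow_mul_natCast (by positivity), ← Real.rpow_mul_natCast (by positivity), ← Real.rpow_add (by positivity)]
                norm_num
              rw [this]; ring
          _ ≤ _ := by gcongr
      have := le_of_pow_le_pow_left₀ (by norm_num) (norm_nonneg _) h2
      push_cast; exact this
    have goal2 : 2 * κ * C * (1 + |t|) ^ (4/5:ℝ) ≤ ‖riemannZeta₁ (x + I * t)‖ := by
      by_cases hx : 1 + κ * (1 + |t|) ^ (-(1/4):ℝ) ≤ x
      · have := key (x - 1) (by linarith) (by linarith)
        rw [show (1 + (x - 1)) = x by ring] at this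
        have : 0 ≤ 2 * κ * C * (1 + |t|) ^ (4/5:ℝ) := by positivity
        linarith
      · push Not at hx
        have k := key (κ * (1 + |t|) ^ (-(1/4):ℝ)) le_rfl (by nlinarith)
        have d := diff x (1 + κ * (1 + |t|) ^ (-(1/4):ℝ)) t xl hx.le (by nlinarith)
        have : C * (1 + |t|) ^ (21/20:ℝ) * (1 + κ * (1 + |t|) ^ (-(1/4):ℝ) - x) ≤ 2 * κ * C * (1 + |t|) ^ (4/5:ℝ) := by
          calc _ ≤ C * (1 + |t|) ^ (21/20:ℝ) * (2 * κ * (1 + |t|) ^ (-(1/4):ℝ)) := by gcongr; linarith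
            _ = _ := by rw [← q2]; ring
        linarith
    refine le_trans ?_ goal2
    gcongr; exact min_le_right _ _

noncomputable def FF (s : ℂ) : ℂ := -(1 + deriv riemannZeta₁ s / riemannZeta₁ s) / s

lemma FF_bd : ∃ C : ℝ, ∀ s : ℂ, 1 < s.re → s.re ≤ 3/2 → ‖iteratedDeriv 3 FF s‖ ≤ C := by
  obtain ⟨C, C0, hC⟩ := zeta1_deriv_bd
  obtain ⟨c, κ, c0, κ0, κ1, hc⟩ := zeta1_low
  refine ⟨(3).factorial * (5 * (1 + C / c) * 2 ^ (1/4:ℝ) ) / (κ / 2) ^ 3, fun s h1 h2 => ?_⟩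
  have t0 := abs_nonneg s.im
  set R := κ / 2 * (1 + |s.im|) ^ (-(1/4):ℝ) with hR
  have q1 : (1 + |s.im|) ^ (-(1/4):ℝ) ≤ 1 := Real.rpow_le_one_of_one_le_of_nonpos (by linarith) (by norm_num)
  have R0 : 0 < R := by positivity
  have R1 : R ≤ 1/160 := by nlinarith
  have im1 : ∀ z : ℂ, ‖z - s‖ ≤ R → 1 + |z.im| ≤ 2 * (1 + |s.im|) ∧ 1 + |s.im| ≤ 2 * (1 + |z.im|) ∧ 1 - R ≤ z.re ∧ z.re ≤ 2 := by
    intro z hz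
    have hr := abs_re_le_norm (z - s); have hi := abs_im_le_norm (z - s)
    rw [sub_re] at hr; rw [sub_im] at hi
    have := abs_le.1 (hr.trans hz)
    have a1 := abs_sub_abs_le_abs_sub z.im s.im
    have a2 := abs_sub_abs_le_abs_sub s.im z.im
    rw [abs_sub_comm] at a2
    have := abs_nonneg z.im
    exact ⟨by linarith, by linarith, by linarith, by linarith⟩
  have low : ∀ z : ℂ, ‖z - s‖ ≤ R → c * (1 + |z.im|) ^ (4/5:ℝ) ≤ ‖riemannZeta₁ z‖ := by
    intro z hz
    obtain ⟨a1, a2, a3, a4⟩ := im1 z hz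
    refine hc z ?_ a4
    have : R ≤ κ * (1 + |z.im|) ^ (-(1/4):ℝ) := by
      have h3 : (1 + |s.im|) ^ (-(1/4):ℝ) ≤ 2 * (1 + |z.im|) ^ (-(1/4):ℝ) := by
        have := Real.rpow_le_rpow_of_nonpos (by positivity) a1 (by norm_num : -(1/4:ℝ) ≤ 0)
        rw [Real.mul_rpow (by norm_num) (by positivity)] at this
        have h4 : (1/2:ℝ) ≤ 2 ^ (-(1/4):ℝ) := by
          calc (1/2:ℝ) = 2 ^ (-1:ℝ) := by rw [Real.rpow_neg_one]; norm_num
            _ ≤ _ := Real.rpow_le_rpow_of_exponent_le (by norm_num) (by norm_num)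
        have h5 : 0 ≤ (1 + |s.im|) ^ (-(1/4):ℝ) := by positivity
        nlinarith
      rw [hR]; nlinarith
    linarith
  have ne : ∀ z : ℂ, ‖z - s‖ ≤ R → riemannZeta₁ z ≠ 0 ∧ z ≠ 0 := by
    intro z hz
    refine ⟨norm_pos_iff.1 (lt_of_lt_of_le ?_ (low z hz)), ?_⟩
    · have := abs_nonneg z.im; positivity
    · rintro rfl; have := (im1 0 hz).2.2.1; simp at this; linarith
  have hd : DifferentiableOn ℂ FF (Metric.closedBall s R) := by
    intro z hz
    rw [Metric.mem_closedBall, dist_eq_norm] at hz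
    have := ne z hz
    have h1 : DifferentiableAt ℂ (deriv riemannZeta₁) z := by
      have := (differentiable_riemannZeta₁.contDiff (n := 2)).differentiable_deriv_two
      exact this z
    refine DifferentiableAt.differentiableWithinAt ?_
    unfold FF
    exact (((differentiableAt_const _).add (h1.div (differentiable_riemannZeta₁ z) this.1)).neg.div differentiableAt_id this.2)
  have := norm_iteratedDeriv_le_of_forall_mem_sphere_norm_le 3 R0 (DifferentiableOn.diffContOnCl (by rwa [closure_ball _ R0.ne']) : DiffContOnCl ℂ FF (Metric.ball s R))
    (C := (5 * (1 + C / c) * 2 ^ (1/4:ℝ)) * (1 + |s.im|) ^ (-(3/4):ℝ)) (fun z hz => by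
      have hz' : ‖z - s‖ ≤ R := by simpa [dist_eq_norm] using (le_of_eq hz)
      obtain ⟨a1, a2, a3, a4⟩ := im1 z hz'
      have z0 := abs_nonneg z.im
      have hz1 : (1 + |s.im|) / 5 ≤ ‖z‖ := by
        have g1 := abs_re_le_norm z; have g2 := abs_im_le_norm z
        have g3 := le_abs_self z.re
        linarith
      have l := low z hz'
      have u := hC z (by linarith) a4
      have d1 : ‖deriv riemannZeta₁ z / riemannZeta₁ z‖ ≤ C / c * (1 + |z.im|) ^ (1/4:ℝ) := by
        rw [norm_div, div_le_iff₀ (lt_of_lt_of_le (by positivity) l)]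
        calc _ ≤ C * (1 + |z.im|) ^ (21/20:ℝ) := u
          _ = C / c * (1 + |z.im|) ^ (1/4:ℝ) * (c * (1 + |z.im|) ^ (4/5:ℝ)) := by
              rw [show (21/20:ℝ) = 1/4 + 4/5 by norm_num, Real.rpow_add (by positivity)]; field_simp
          _ ≤ _ := by gcongr
      have d2 : ‖1 + deriv riemannZeta₁ z / riemannZeta₁ z‖ ≤ (1 + C / c) * (2 * (1 + |s.im|)) ^ (1/4:ℝ) := by
        refine (norm_add_le _ _).trans ?_
        have o : 1 ≤ (1 + |z.im|) ^ (1/4:ℝ) := Real.one_le_rpow (by linarith) (by norm_num)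
        have o2 : (1 + |z.im|) ^ (1/4:ℝ) ≤ (2 * (1 + |s.im|)) ^ (1/4:ℝ) := by gcongr
        have : 0 ≤ C / c := by positivity
        rw [norm_one]; nlinarith
      unfold FF
      rw [norm_div, norm_neg]
      calc _ ≤ (1 + C / c) * (2 * (1 + |s.im|)) ^ (1/4:ℝ) / ((1 + |s.im|) / 5) := by gcongr
        _ = _ := by
          rw [Real.mul_rpow (by norm_num) (by positivity), show (-(3/4):ℝ) = 1/4 - 1 by norm_num, Real.rpow_sub (by positivity), Real.rpow_one]
          field_simp)
  refine this.trans (le_of_eq ?_)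
  have e : ((1 + |s.im|) ^ (-(1/4):ℝ)) ^ 3 = (1 + |s.im|) ^ (-(3/4):ℝ) := by
    rw [← Real.rpow_mul_natCast (by positivity)]; norm_num
  have p : (1 + |s.im|) ^ (-(3/4):ℝ) ≠ 0 := by positivity
  rw [hR, mul_pow, e]; field_simp
end PNT2

section PNT3
open Set Filter Topology

noncomputable def rr (u : ℝ) : ℝ := exp (-u) * Chebyshev.psi (exp u) - 1

lemma rr_bd (u : ℝ) : |rr u| ≤ 7 := by
  have h1 := Chebyshev.psi_le_const_mul_self (exp_pos u).le
  have h2 := Chebyshev.psi_nonneg (exp u)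
  have h4 : log 4 < 2 := by
    rw [show (4:ℝ) = 2 * 2 by norm_num, Real.log_mul (by norm_num) (by norm_num)]
    linarith [Real.log_two_lt_d9]
  have h3 : exp (-u) * Chebyshev.psi (exp u) ≤ exp (-u) * ((log 4 + 4) * exp u) := by gcongr
  have h5 : exp (-u) * exp u = 1 := by rw [← exp_add]; simp
  have h6 : 0 ≤ exp (-u) * Chebyshev.psi (exp u) := by positivity
  rw [rr, abs_le]; constructor <;> nlinarith

lemma rr_meas : Measurable rr := by
  unfold rr
  exact ((by fun_prop : Measurable fun u : ℝ => exp (-u)).mul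
    (Chebyshev.psi_mono.measurable.comp Real.measurable_exp)).sub_const 1

noncomputable def GG (k : ℕ) (s : ℂ) : ℂ := ∫ u in Ioi (0:ℝ), ((u:ℂ)^k * rr u) * Complex.exp (-s * u)

lemma pexp_int (k : ℕ) {b : ℝ} (hb : 0 < b) :
    IntegrableOn (fun u : ℝ => 7 * (u ^ k * exp (-b * u))) (Ioi 0) := by
  have := integrableOn_rpow_mul_exp_neg_mul_rpow (p := 1) (s := k) (b := b)
    (by have : (0:ℝ) ≤ k := k.cast_nonneg
        linarith) one_pos hb
  simp only [rpow_one, rpow_natCast] at this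
  exact this.const_mul 7

lemma GG_meas (k : ℕ) (s : ℂ) :
    AEStronglyMeasurable (fun u : ℝ => ((u:ℂ)^k * rr u) * Complex.exp (-s * u)) (volume.restrict (Ioi 0)) := by
  have := rr_meas
  exact Measurable.aestronglyMeasurable (by fun_prop)

lemma GG_pt (k : ℕ) {s : ℂ} {b : ℝ} (hb : b ≤ s.re) {u : ℝ} (hu : 0 < u) :
    ‖((u:ℂ)^k * rr u) * Complex.exp (-s * u)‖ ≤ 7 * (u ^ k * exp (-b * u)) := by
  rw [norm_mul, norm_mul, norm_pow, Complex.norm_exp]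
  simp only [Complex.norm_real, norm_eq_abs, abs_of_pos hu]
  have h1 : exp ((-s * (u:ℂ)).re) ≤ exp (-b * u) := by
    apply exp_le_exp.2; simp; nlinarith
  have := rr_bd u
  calc u^k * |rr u| * exp ((-s * (u:ℂ)).re) ≤ u^k * 7 * exp (-b * u) := by gcongr
    _ = _ := by ring

lemma GG_int (k : ℕ) {s : ℂ} (hs : 0 < s.re) :
    IntegrableOn (fun u : ℝ => ((u:ℂ)^k * rr u) * Complex.exp (-s * u)) (Ioi 0) :=
  (pexp_int k hs).mono' (GG_meas k s)
    ((ae_restrict_iff' measurableSet_Ioi).2 (Eventually.of_forall fun _ hu => GG_pt k le_rfl hu))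

lemma GG_deriv (k : ℕ) {s : ℂ} (hs : 0 < s.re) : HasDerivAt (GG k) (-GG (k+1) s) s := by
  have ho : {z : ℂ | s.re / 2 < z.re} ∈ 𝓝 s :=
    (isOpen_lt continuous_const Complex.continuous_re).mem_nhds (by simp; linarith)
  have := (hasDerivAt_integral_of_dominated_loc_of_deriv_le
    (F := fun (z : ℂ) (u : ℝ) => ((u:ℂ)^k * rr u) * Complex.exp (-z * u))
    (F' := fun (z : ℂ) (u : ℝ) => -(((u:ℂ)^(k+1) * rr u) * Complex.exp (-z * u)))
    (μ := volume.restrict (Ioi 0)) (bound := fun u => 7 * (u ^ (k+1) * exp (-(s.re/2) * u)))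
    ho (Eventually.of_forall fun z => GG_meas k z) (GG_int k hs) (GG_meas (k+1) s).neg
    ((ae_restrict_iff' measurableSet_Ioi).2 (Eventually.of_forall fun u hu z hz => by
      rw [norm_neg]; exact GG_pt (k+1) (le_of_lt hz) hu))
    (pexp_int (k+1) (by linarith))
    (Eventually.of_forall fun u z _ => by
      have h : HasDerivAt (fun z : ℂ => -z * u) (-u) z := by
        simpa using (hasDerivAt_id z).neg.mul_const (u:ℂ)
      have := (h.cexp).const_mul ((u:ℂ)^k * rr u)
      refine this.congr_deriv ?_; simp only [pow_succ]; ring)).2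
  rw [integral_neg] at this
  exact this

lemma FF_eq {s : ℂ} (hs : 0 < s.re) : FF (1 + s) = GG 0 s := by
  have hs1 : 1 < (1 + s).re := by simpa using hs
  have hne : (1 + s) ≠ 1 := by intro h; rw [h] at hs1; simp at hs1
  have hs0 : s ≠ 0 := by intro h; simp [h] at hs
  have h1s : 1 + s ≠ 0 := by intro h; rw [h] at hs1; simp at hs1; linarith
  have hz := zeta1_ne hs1.le
  have key := LSeries_eq_mul_integral_of_nonneg (fun n => ArithmeticFunction.vonMangoldt n)
    (r := 1) zero_le_one hs1 (by
      refine Asymptotics.IsBigO.of_bound (log 4 + 4) (Eventually.of_forall fun n => ?_)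
      have h1 := Chebyshev.psi_le_const_mul_self (Nat.cast_nonneg (α := ℝ) n)
      have h2 : Chebyshev.psi n = ∑ k ∈ Finset.Icc 1 n, ArithmeticFunction.vonMangoldt k := by
        simp [Chebyshev.psi]; rfl
      rw [← h2, norm_eq_abs, abs_of_nonneg (Chebyshev.psi_nonneg _)]
      simpa using h1) (fun n => ArithmeticFunction.vonMangoldt_nonneg)
  rw [ArithmeticFunction.LSeries_vonMangoldt_eq_deriv_riemannZeta_div hs1,
    deriv_riemannZeta_eq_neg_inv_sub_sq_mul_add hne, riemannZeta_eq_inv_sub_mul hne] at key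
  have him : (Ioi (1:ℝ)) = exp '' (Ioi 0) := by
    ext x; constructor
    · intro hx; exact ⟨log x, log_pos hx, exp_log (by linarith [mem_Ioi.1 hx])⟩
    · rintro ⟨y, hy, rfl⟩; exact one_lt_exp_iff.2 hy
  rw [him, integral_image_eq_integral_abs_deriv_smul measurableSet_Ioi
    (fun x _ => (Real.hasDerivAt_exp x).hasDerivWithinAt) (Real.exp_injective.injOn)] at key
  have e1 : ∫ u in Ioi (0:ℝ), |exp u| • ((∑ k ∈ Finset.Icc 1 ⌊exp u⌋₊, ((ArithmeticFunction.vonMangoldt k : ℝ) : ℂ)) *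
      ((exp u : ℝ):ℂ) ^ (-(1 + s + 1))) = GG 0 s + ∫ u in Ioi (0:ℝ), Complex.exp (-s * u) := by
    rw [GG, ← integral_add (GG_int 0 hs) (by
      exact integrableOn_exp_mul_complex_Ioi (a := -s) (by simpa using hs) 0)]
    refine setIntegral_congr_fun measurableSet_Ioi fun u _ => ?_
    have h2 : Chebyshev.psi (exp u) = ∑ k ∈ Finset.Icc 1 ⌊exp u⌋₊, ArithmeticFunction.vonMangoldt k := by
      simp [Chebyshev.psi]; rfl
    have h3 : (((exp u : ℝ):ℂ)) ^ (-(1 + s + 1)) = Complex.exp (-s * u) * Complex.exp (-u) * Complex.exp (-u) := by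
      rw [Complex.cpow_def_of_ne_zero (by simp), ← Complex.ofReal_log (exp_pos u).le, log_exp, ← Complex.exp_add,
        ← Complex.exp_add]; congr 1; ring
    have h4 : Complex.exp (u:ℂ) * Complex.exp (-u) = 1 := by rw [← Complex.exp_add]; simp
    simp only [abs_of_pos (exp_pos u), rr, ← Complex.ofReal_sum, ← h2, h3, Complex.real_smul]
    push_cast
    linear_combination (Chebyshev.psi (rexp u) : ℂ) * Complex.exp (-s * u) * Complex.exp (-u) * h4
  rw [e1, integral_exp_mul_complex_Ioi (by simpa using hs)] at key
  have e2 : (1 + s) - 1 = s := by ring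
  rw [e2] at key
  simp only [Complex.ofReal_zero, mul_zero, Complex.exp_zero] at key
  have e3 : GG 0 s = -(-s⁻¹ ^ 2 * riemannZeta₁ (1 + s) + s⁻¹ * deriv riemannZeta₁ (1 + s)) / (s⁻¹ * riemannZeta₁ (1 + s)) / (1+s) - 1 / s := by
    rw [key]; field_simp; ring
  rw [e3, FF]; field_simp; ring

lemma FF_iter (k : ℕ) : ∀ s : ℂ, 0 < s.re → iteratedDeriv k FF (1 + s) = (-1)^k * GG k s := by
  induction k with
  | zero => intro s hs; simpa using FF_eq hs
  | succ k ih =>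
    intro s hs
    rw [iteratedDeriv_succ]
    have h1 : iteratedDeriv k FF =ᶠ[𝓝 (1 + s)] fun z => (-1)^k * GG k (z - 1) := by
      filter_upwards [(isOpen_lt continuous_const Complex.continuous_re).mem_nhds
        (show (1 + s) ∈ {z : ℂ | (1:ℝ) < z.re} by simpa using hs)] with z hz
      have := ih (z - 1) (by simpa using hz)
      simpa using this
    rw [h1.deriv_eq]
    have h2 : HasDerivAt (fun z => (-1)^k * GG k (z - 1)) ((-1)^k * -GG (k+1) s) (1 + s) := by
      have h := GG_deriv k (s := (1 + s) - 1) (by simpa using hs)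
      have := (h.comp_sub_const (1+s) 1).const_mul ((-1:ℂ)^k)
      simpa using this
    rw [h2.deriv]; ring

lemma GG3_bd : ∃ C : ℝ, ∀ s : ℂ, 0 < s.re → s.re ≤ 1/2 → ‖GG 3 s‖ ≤ C := by
  obtain ⟨C, hC⟩ := FF_bd
  refine ⟨C, fun s h1 h2 => ?_⟩
  have := hC (1 + s) (by simpa using h1) (by simp; linarith)
  rw [FF_iter 3 s h1] at this
  simpa using this
end PNT3

section PNT4
open Set Filter Topology

lemma bump_ex : ∃ (g : ℝ → ℝ) (h : ℝ → ℂ) (M : ℝ), Continuous g ∧ (∀ x, 0 ≤ g x) ∧ (∀ x, g x ≤ M) ∧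
    (∀ x, g x ≠ 0 → 0 < x ∧ x < 1) ∧ Integrable g ∧ ∫ x, g x = 1 ∧ Integrable h ∧
    ∀ x, (g x : ℂ) = ∫ v, h v * Complex.exp (((2 * π * v * x : ℝ)) * Complex.I) := by
  let b : ContDiffBump (1/2:ℝ) := ⟨1/4, 1/2, by norm_num, by norm_num⟩
  let g := b.normed volume
  have hgc : ContDiff ℝ (⊤:ℕ∞) g := b.contDiff_normed
  have hgs : HasCompactSupport g := b.hasCompactSupport_normed
  have hcs : HasCompactSupport (fun x => (g x : ℂ)) := hgs.comp_left (g := fun y : ℝ => (y:ℂ)) rfl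
  have hcc : ContDiff ℝ (⊤:ℕ∞) (fun x => (g x : ℂ)) := Complex.ofRealCLM.contDiff.comp hgc
  let φ : SchwartzMap ℝ ℂ := hcs.toSchwartzMap hcc
  have hφ : ∀ x, φ x = g x := fun x => rfl
  obtain ⟨M, hM⟩ := hgs.exists_bound_of_continuous hgc.continuous
  refine ⟨g, FourierTransform.fourier (φ : ℝ → ℂ), M, hgc.continuous, fun x => b.nonneg_normed x,
    fun x => (le_abs_self _).trans (hM x), fun x hx => ?_, b.integrable_normed, b.integral_normed, ?_, ?_⟩
  · have : x ∈ Function.support g := hx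
    rw [b.support_normed_eq, Metric.mem_ball, Real.dist_eq, abs_lt] at this
    constructor <;> linarith [this.1, this.2]
  · rw [← SchwartzMap.fourier_coe]; exact SchwartzMap.integrable _
  · intro x
    have h1 := Continuous.fourierInv_fourier_eq (f := (φ : ℝ → ℂ)) φ.continuous φ.integrable
      (by rw [← SchwartzMap.fourier_coe]; exact SchwartzMap.integrable _)
    have h2 := congrFun h1 x
    rw [hφ, Real.fourierInv_eq'] at h2
    rw [← h2]
    refine integral_congr_ae (Eventually.of_forall fun v => ?_)
    simp only [smul_eq_mul]
    rw [mul_comm]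
    congr 3
    simp; ring

lemma smooth_bd : ∃ (g : ℝ → ℝ) (M K : ℝ), Continuous g ∧ (∀ x, 0 ≤ g x) ∧ (∀ x, g x ≤ M) ∧
    (∀ x, g x ≠ 0 → 0 < x ∧ x < 1) ∧ Integrable g ∧ ∫ x, g x = 1 ∧
    ∀ ε T w : ℝ, 0 < ε → ε ≤ 1/2 → 0 < w →
      |∫ u in Ioi (0:ℝ), rr u * (u ^ 3 * exp (-ε * u) * g ((u - T)/w))| ≤ K := by
  obtain ⟨g, h, M, hgc, hg0, hgM, hgs, hgi, hg1, hhi, hinv⟩ := bump_ex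
  obtain ⟨C, hC⟩ := GG3_bd
  refine ⟨g, M, (∫ v, ‖h v‖) * C, hgc, hg0, hgM, hgs, hgi, hg1, fun ε T w he he2 hw => ?_⟩
  let A : ℝ → ℂ := fun u => ((u:ℂ)^3 * rr u) * Complex.exp (-(ε:ℂ) * u)
  have hA : IntegrableOn A (Ioi 0) := GG_int 3 (by simpa using he)
  let e : ℝ → ℝ → ℂ := fun u v => Complex.exp (((2 * π * v * ((u - T)/w) : ℝ)) * Complex.I)
  have he1 : ∀ u v, ‖e u v‖ = 1 := fun u v => Complex.norm_exp_ofReal_mul_I _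
  have hint : Integrable (Function.uncurry fun u v => A u * (h v * e u v)) ((volume.restrict (Ioi (0:ℝ))).prod volume) := by
    have h1 := (hA.mul_prod hhi).bdd_mul (c := 1) (f := fun z : ℝ × ℝ => e z.1 z.2)
      (Continuous.aestronglyMeasurable (by simp only [e]; fun_prop)) (Eventually.of_forall fun z => (he1 _ _).le)
    refine h1.congr (Eventually.of_forall fun z => ?_)
    simp only [Function.uncurry]; ring
  have e1 : ((∫ u in Ioi (0:ℝ), rr u * (u ^ 3 * exp (-ε * u) * g ((u - T)/w)) : ℝ) : ℂ)
      = ∫ u in Ioi (0:ℝ), ∫ v, A u * (h v * e u v) := by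
    rw [← integral_complex_ofReal]
    refine setIntegral_congr_fun measurableSet_Ioi fun u _ => ?_
    simp only [integral_const_mul]
    rw [← hinv ((u-T)/w)]; simp only [A]; push_cast; ring
  have e2 : ∀ v, ∫ u in Ioi (0:ℝ), A u * (h v * e u v) =
      h v * Complex.exp (((-(2 * π * v * T / w) : ℝ)) * Complex.I) * GG 3 (ε - ((2 * π * v / w : ℝ) : ℂ) * Complex.I) := by
    intro v
    rw [GG, ← integral_const_mul]
    refine setIntegral_congr_fun measurableSet_Ioi fun u _ => ?_
    simp only [A, e]
    have : Complex.exp (-(ε:ℂ) * u) * Complex.exp (((2 * π * v * ((u - T)/w) : ℝ)) * Complex.I) =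
      Complex.exp (((-(2 * π * v * T / w) : ℝ)) * Complex.I) * Complex.exp (-(ε - ((2 * π * v / w : ℝ) : ℂ) * Complex.I) * u) := by
      rw [← Complex.exp_add, ← Complex.exp_add]; congr 1; push_cast; ring
    linear_combination ((u:ℂ)^3 * rr u) * h v * this
  rw [← norm_eq_abs, ← Complex.norm_real, e1, integral_integral_swap hint, ← integral_mul_const]
  refine norm_integral_le_of_norm_le (hhi.norm.mul_const C) (Eventually.of_forall fun v => ?_)
  rw [e2, norm_mul, norm_mul, Complex.norm_exp_ofReal_mul_I, mul_one]
  gcongr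
  exact hC _ (by simpa using he) (by simpa using he2)

lemma rr_mono {T u : ℝ} (h : T ≤ u) : exp (T - u) * (rr T + 1) ≤ rr u + 1 := by
  have h1 := Chebyshev.psi_mono (exp_le_exp.2 h)
  simp only [rr, sub_add_cancel, ← mul_assoc, ← exp_add]
  rw [show T - u + -T = -u by ring]
  gcongr

lemma rr_one : ∃ K : ℝ, ∀ T w : ℝ, 2 ≤ T → 0 < w → w ≤ 1 →
    rr T ≤ 8 * w + K / (T^3 * w) ∧ -rr (T + w) ≤ 16 * w + K / (T^3 * w) := by
  obtain ⟨g, M, K, hgc, hg0, hgM, hgs, hgi, hg1, hK⟩ := smooth_bd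
  refine ⟨K * exp 2, fun T w hT hw hw1 => ?_⟩
  have hT0 : 0 < T := by linarith
  have he : 0 < 1 / T := by positivity
  have he2 : 1 / T ≤ 1 / 2 := one_div_le_one_div_of_le two_pos hT
  have hb := hK (1/T) T w he he2 hw
  set W : ℝ → ℝ := fun u => u ^ 3 * exp (-(1/T) * u) * g ((u - T)/w) with hW
  have hWi : IntegrableOn W (Ioi 0) := by
    have h1 := (pexp_int 3 he).const_mul (1/7)
    have h2 : IntegrableOn (fun u : ℝ => g ((u-T)/w) * (1 / 7 * (7 * (u ^ 3 * rexp (-(1 / T) * u))))) (Ioi 0) :=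
      h1.bdd_mul (c := M) (Continuous.aestronglyMeasurable (by fun_prop))
      (Eventually.of_forall fun u => by rw [norm_eq_abs, abs_of_nonneg (hg0 _)]; exact hgM _)
    refine h2.congr_fun (fun u _ => ?_) measurableSet_Ioi
    simp only [hW]; ring
  have hrW : IntegrableOn (fun u => rr u * W u) (Ioi 0) :=
    hWi.bdd_mul (c := 7) rr_meas.aestronglyMeasurable (Eventually.of_forall fun u => rr_bd u)
  have hsup : ∀ u, W u ≠ 0 → T < u ∧ u < T + w := by
    intro u hu
    have := hgs _ (right_ne_zero_of_mul hu)
    rw [lt_div_iff₀ hw, div_lt_iff₀ hw] at this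
    constructor <;> linarith [this.1, this.2]
  have hW0 : ∀ u ∈ Ioi (0:ℝ), 0 ≤ W u := fun u (hu : 0 < u) =>
    mul_nonneg (by positivity) (hg0 _)
  have hgTi : Integrable (fun u => g ((u-T)/w)) := (hgi.comp_div hw.ne').comp_sub_right T
  have hgT : ∫ u in Ioi (0:ℝ), g ((u-T)/w) = w := by
    rw [setIntegral_eq_integral_of_forall_compl_eq_zero, integral_sub_right_eq_self (fun u => g (u/w)) T,
      Measure.integral_comp_div, hg1, abs_of_pos hw]; simp
    intro u hu
    by_contra h
    have := (hgs _ h).1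
    rw [lt_div_iff₀ hw] at this
    exact hu (by simp; linarith)
  have hWl : T^3 * w * exp (-2) ≤ ∫ u in Ioi (0:ℝ), W u := by
    have : T^3 * w * exp (-2) = ∫ u in Ioi (0:ℝ), (T^3 * exp (-2)) * g ((u-T)/w) := by
      rw [integral_const_mul, hgT]; ring
    rw [this]
    refine setIntegral_mono_on (hgTi.integrableOn.const_mul _) hWi measurableSet_Ioi fun u hu => ?_
    by_cases h : g ((u-T)/w) = 0
    · simp [hW, h]
    have h1 := hgs _ h
    rw [lt_div_iff₀ hw, div_lt_iff₀ hw] at h1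
    have h2 : exp (-2) ≤ exp (-(1/T)*u) := by
      apply exp_le_exp.2
      have : 1/T * u ≤ 1/T * (2*T) := by gcongr; linarith
      have h3 : 1/T*(2*T) = 2 := by field_simp
      linarith
    have h3 : T ^ 3 ≤ u ^ 3 := by gcongr; linarith
    have := hg0 ((u-T)/w)
    have : 0 ≤ u ^ 3 := pow_nonneg (le_of_lt hu) 3
    simp only [hW]; gcongr
  have hI : 0 < ∫ u in Ioi (0:ℝ), W u := lt_of_lt_of_le (by positivity) hWl
  rw [abs_le] at hb
  have fin : ∀ a : ℝ, a * (∫ u in Ioi (0:ℝ), W u) ≤ K → a ≤ K * exp 2 / (T^3 * w) := by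
    intro a ha
    have hK0 : 0 ≤ K := by linarith [hb.1, hb.2]
    rcases le_or_gt a 0 with h | h
    · exact h.trans (by positivity)
    rw [le_div_iff₀ (by positivity)]
    have h1 : a * (T^3 * w * exp (-2)) ≤ K := (by gcongr : _ ≤ _).trans ha
    have h2 : exp (-2:ℝ) * exp 2 = 1 := by rw [← exp_add]; simp
    calc a * (T^3 * w) = a * (T^3 * w * exp (-2)) * exp 2 := by linear_combination (-a * (T^3*w)) * h2
      _ ≤ K * exp 2 := by gcongr
  have b1 := abs_le.1 (rr_bd T)
  have b2 := abs_le.1 (rr_bd (T+w))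
  constructor
  · have := fin (rr T - 8 * w) (by
      rw [← integral_const_mul]
      refine le_trans (setIntegral_mono_on (hWi.const_mul _) hrW measurableSet_Ioi fun u hu => ?_) hb.2
      by_cases h : W u = 0
      · simp [h]
      have h1 := hsup u h
      have h2 := rr_mono h1.1.le
      have h3 := add_one_le_exp (T - u)
      have h4 : 0 ≤ rr T + 1 := by rw [rr]; simp; have := Chebyshev.psi_nonneg (exp T); positivity
      have := hW0 u hu
      gcongr
      nlinarith)
    linarith
  · have := fin (-rr (T+w) - 16 * w) (by
      rw [← integral_const_mul]
      refine le_trans (setIntegral_mono_on (hWi.const_mul _) hrW.neg measurableSet_Ioi fun u hu => ?_) (b := ∫ u in Ioi (0:ℝ), -(rr u * W u)) (by rw [integral_neg]; linarith [hb.1])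
      by_cases h : W u = 0
      · simp [h]
      have h1 := hsup u h
      have h2 := rr_mono h1.2.le
      have h3 := add_one_le_exp (u - (T+w))
      have h4 : 0 ≤ rr u + 1 := by rw [rr]; simp; have := Chebyshev.psi_nonneg (exp u); positivity
      have := hW0 u hu
      have b3 := abs_le.1 (rr_bd u)
      have : -rr (T+w) - 16 * w ≤ -rr u := by nlinarith
      simp only [← neg_mul]
      gcongr)
    linarith

/-- PNT with error `x / log x`. -/
lemma psi_pnt : ∃ C : ℝ, 0 < C ∧ ∀ x : ℝ, 2 ≤ x → |Chebyshev.psi x - x| ≤ C * x / log x := by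
  obtain ⟨K, hK⟩ := rr_one
  have key : ∀ T : ℝ, 3 ≤ T → |rr T| ≤ (16 + 8 * |K|) / T := by
    intro T hT
    have hT0 : 0 < T := by linarith
    have hw : 0 < 1 / T := by positivity
    have hw1 : 1 / T ≤ 1 := by rw [div_le_one hT0]; linarith
    have h1 := (hK T (1/T) (by linarith) hw hw1).1
    have h2 := (hK (T - 1/T) (1/T) (by linarith) hw hw1).2
    rw [sub_add_cancel] at h2
    have h4 : T/2 ≤ T - 1/T := by linarith
    have h3 : ∀ S : ℝ, T/2 ≤ S → K / (S^3 * (1/T)) ≤ 8 * |K| / T := by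
      intro S hS
      have hS0 : 0 < S := by linarith
      have : (T/2)^3 ≤ S^3 := by gcongr
      calc K / (S^3 * (1/T)) ≤ |K| / ((T/2)^3 * (1/T)) := by gcongr; exact le_abs_self K
        _ = 8 * |K| / T / T := by field_simp; ring
        _ ≤ 8 * |K| / T := by
          apply div_le_self (by positivity); linarith
    have := h3 T (by linarith)
    have := h3 _ h4
    rw [abs_le, add_div]
    have e1 : 8 * (1/T) = 8/T := by ring
    have e2 : 16 * (1/T) = 16/T := by ring
    have : 8/T ≤ 16/T := by gcongr; norm_num
    constructor <;> linarith
  refine ⟨max 21 (16 + 8*|K|), by positivity, fun x hx => ?_⟩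
  have hx0 : 0 < x := by linarith
  have hl : 0 < log x := log_pos (by linarith)
  have e : Chebyshev.psi x - x = x * rr (log x) := by
    rw [rr, exp_neg, exp_log hx0]; field_simp
  rw [e, abs_mul, abs_of_pos hx0, mul_comm _ x, mul_div_assoc]
  gcongr
  rcases le_total 3 (log x) with h | h
  · exact (key _ h).trans (by gcongr; exact le_max_right _ _)
  · refine (rr_bd _).trans ?_
    rw [le_div_iff₀ hl]
    have := le_max_left (21:ℝ) (16 + 8 * |K|)
    linarith
end PNT4

section PNT5
open Set Filter Topology

lemma log2_lb : (0.69:ℝ) < log 2 := by linarith [Real.log_two_gt_d9]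
lemma log2_ub : log 2 < (0.7:ℝ) := by linarith [Real.log_two_lt_d9]
lemma log_ge {x : ℝ} (hx : 2 ≤ x) : 0.69 < log x :=
  log2_lb.trans_le (log_le_log two_pos hx)

lemma theta_pnt : ∃ C : ℝ, 0 < C ∧ ∀ x : ℝ, 2 ≤ x → |Chebyshev.theta x - x| ≤ C * x / log x := by
  obtain ⟨C, hC, h⟩ := psi_pnt
  refine ⟨C + 32, by positivity, fun x hx => ?_⟩
  have h1 := h x hx
  have h2 := Chebyshev.psi_sub_theta_le (x := x) (by linarith)
  have h3 := Chebyshev.theta_le_psi x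
  have hx0 : 0 < x := by linarith
  have hl : 0 < log x := by linarith [log_ge hx]
  have h4 : 2 * √x * log x ≤ 32 * x / log x := by
    rw [le_div_iff₀ hl]
    have := Real.log_le_rpow_div hx0.le (show (0:ℝ) < 1/4 by norm_num)
    have h5 : log x * log x ≤ (x ^ (1/4:ℝ) / (1/4)) * (x ^ (1/4:ℝ) / (1/4)) := by gcongr
    have h6 : x ^ (1/4:ℝ) * x ^ (1/4:ℝ) = √x := by
      rw [← rpow_add hx0, Real.sqrt_eq_rpow]; norm_num
    have h7 : √x * √x = x := mul_self_sqrt hx0.le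
    have h8 : log x * log x ≤ 16 * √x := by nlinarith
    nlinarith [sqrt_nonneg x]
  rw [add_mul, add_div]
  rw [abs_le] at *
  constructor <;> linarith [h1.1, h1.2]

lemma pi_pnt : ∃ C : ℝ, 0 < C ∧ ∀ x : ℝ, 2 ≤ x →
    |(Nat.primeCounting ⌊x⌋₊ : ℝ) - x / log x| ≤ C * x / log x ^ 2 := by
  obtain ⟨C, hC, h⟩ := theta_pnt
  obtain ⟨K, hK⟩ := Chebyshev.primeCounting_sub_theta_div_log_isBigO.bound
  obtain ⟨X, hX⟩ := eventually_atTop.1 hK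
  have hm : ∀ x : ℝ, 2 ≤ x → |(Nat.primeCounting ⌊x⌋₊ : ℝ) - Chebyshev.theta x / log x| ≤
      (|K| + 8 * (log (max X 2)) ^ 2) * x / log x ^ 2 := by
    intro x hx
    have hl := log_ge hx
    rcases le_total X x with h1 | h1
    · have := hX x h1
      rw [norm_eq_abs, norm_eq_abs, abs_of_pos (show 0 < x / log x ^ 2 from div_pos (by linarith) (by positivity))] at this
      refine this.trans ?_
      rw [← mul_div_assoc]
      gcongr
      have := le_abs_self K
      nlinarith [sq_nonneg (log (max X 2))]
    · have h2 : log x ≤ log (max X 2) := log_le_log (by linarith) (h1.trans (le_max_left _ _))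
      have h3 : (Nat.primeCounting ⌊x⌋₊ : ℝ) ≤ x := by
        have : Nat.primeCounting ⌊x⌋₊ ≤ ⌊x⌋₊ := by
          rw [Nat.primeCounting, Nat.primeCounting', Nat.count_eq_card_filter_range]
          refine (Finset.card_le_card (t := Finset.Ioc 0 ⌊x⌋₊) fun p hp => ?_).trans (by simp)
          simp only [Finset.mem_filter, Finset.mem_range, Finset.mem_Ioc] at *
          exact ⟨hp.2.pos, by omega⟩
        exact (Nat.cast_le.2 this).trans (Nat.floor_le (by linarith))
      have h4 : Chebyshev.theta x / log x ≤ 3 * x := by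
        rw [div_le_iff₀ (by linarith)]
        have := Chebyshev.theta_le_log4_mul_x (x := x) (by linarith)
        have h5 : log 4 < 2 := by
          rw [show (4:ℝ) = 2 * 2 by norm_num, Real.log_mul (by norm_num) (by norm_num)]
          linarith [Real.log_two_lt_d9]
        nlinarith
      have h6 : 0 ≤ Chebyshev.theta x / log x := div_nonneg (Chebyshev.theta_nonneg x) (by linarith)
      have h7 : |(Nat.primeCounting ⌊x⌋₊ : ℝ) - Chebyshev.theta x / log x| ≤ 8 * x := by
        rw [abs_le]; constructor <;> linarith [(Nat.cast_nonneg (Nat.primeCounting ⌊x⌋₊) : (0:ℝ) ≤ _)]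
      refine h7.trans ?_
      rw [le_div_iff₀ (by positivity)]
      have h8 : log x ^ 2 ≤ log (max X 2) ^ 2 := by gcongr
      nlinarith [abs_nonneg K, mul_nonneg (abs_nonneg K) (by linarith : (0:ℝ) ≤ x)]
  refine ⟨C + (|K| + 8 * (log (max X 2)) ^ 2), by positivity, fun x hx => ?_⟩
  have hl := log_ge hx
  have h1 := hm x hx
  have h2 : |Chebyshev.theta x / log x - x / log x| ≤ C * x / log x ^ 2 := by
    rw [← sub_div, abs_div, abs_of_pos (show 0 < log x by linarith), div_le_iff₀ (by linarith)]
    refine (h x hx).trans (le_of_eq ?_); field_simp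
  calc _ = |((Nat.primeCounting ⌊x⌋₊ : ℝ) - Chebyshev.theta x / log x) + (Chebyshev.theta x / log x - x / log x)| := by ring_nf
    _ ≤ _ := (abs_add_le _ _).trans (by rw [add_mul, add_div]; linarith)

noncomputable def PS (x : ℝ) : ℝ := ∑ p ∈ primesUpTo x, 1 / (p:ℝ)

lemma primesUpTo_eq (x : ℝ) : primesUpTo x = (Finset.Icc 0 ⌊x⌋₊).filter Nat.Prime := by
  ext; simp [primesUpTo]

lemma hasDeriv_loglog {t : ℝ} (ht : 2 ≤ t) : HasDerivAt (fun t => log (log t)) (1 / (t * log t)) t := by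
  have := log_ge ht
  refine ((Real.hasDerivAt_log (by linarith)).log (by linarith)).congr_deriv ?_
  field_simp

lemma mertens_diff : ∃ C : ℝ, 0 < C ∧ ∀ x y : ℝ, 2 ≤ x → x ≤ y →
    |PS y - PS x - (log (log y) - log (log x))| ≤ C / log x := by
  obtain ⟨C, hC, h⟩ := theta_pnt
  refine ⟨7 * C, by positivity, fun x y hx hxy => ?_⟩
  let f : ℝ → ℝ := fun t => 1 / (t * log t)
  let f' : ℝ → ℝ := fun t => -(log t + 1) / (t * log t) ^ 2
  have hf : ∀ t, 2 ≤ t → HasDerivAt f (f' t) t := by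
    intro t ht
    have := log_ge ht
    have h1 := (hasDerivAt_id t).mul (Real.hasDerivAt_log (by linarith : t ≠ 0))
    have h2 := h1.inv (show id t * log t ≠ 0 from mul_ne_zero (by simp; linarith) (by linarith))
    have e : f = (id * log)⁻¹ := by ext; simp [f]
    rw [e]
    refine h2.congr_deriv ?_
    have : t * t⁻¹ = 1 := mul_inv_cancel₀ (by linarith)
    simp [f', this]
  have hsub : ∀ t ∈ uIcc x y, 2 ≤ t := fun t ht => by
    rw [uIcc_of_le hxy] at ht; linarith [ht.1]
  have hf'c : ContinuousOn f' (uIcc x y) := by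
    intro t ht
    have h1 := hsub t ht
    have h2 := log_ge h1
    have h3 : t ≠ 0 := by linarith
    have : (t * log t)^2 ≠ 0 := by positivity
    apply ContinuousAt.continuousWithinAt
    simp only [f']
    fun_prop (disch := assumption)
  let c : ℕ → ℝ := fun k => if k.Prime then log k else 0
  have hθ : ∀ t : ℝ, ∑ k ∈ Finset.Icc 0 ⌊t⌋₊, c k = Chebyshev.theta t := fun t => by
    rw [Chebyshev.theta_eq_sum_Icc, Finset.sum_filter]
  have e1 := sum_mul_eq_sub_sub_integral_mul c (f := f) (a := x) (b := y) (by linarith) hxy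
    (fun t ht => (hf t (by linarith [ht.1])).differentiableAt) (by
      rw [← uIcc_of_le hxy]
      exact (hf'c.integrableOn_compact isCompact_uIcc).congr_fun
        (fun t ht => (hf t (hsub t ht)).deriv.symm) measurableSet_uIcc)
  simp only [hθ] at e1
  have e2 : ∑ k ∈ Finset.Ioc ⌊x⌋₊ ⌊y⌋₊, f k * c k = PS y - PS x := by
    have hh : ∀ z : ℝ, PS z = ∑ k ∈ Finset.Ioc 0 ⌊z⌋₊, f k * c k := by
      intro z
      rw [PS, primesUpTo_eq, Finset.sum_filter, ← Finset.Ioc_insert_left (Nat.zero_le _), Finset.sum_insert (by simp)]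
      simp only [Nat.not_prime_zero, if_false, zero_add]
      refine Finset.sum_congr rfl fun k _ => ?_
      simp only [c, f]; split_ifs with hk
      · have := log_ge (show (2:ℝ) ≤ k by exact_mod_cast hk.two_le)
        field_simp
      · simp
    rw [hh, hh, eq_sub_iff_add_eq, add_comm, Finset.sum_Ioc_consecutive _ (Nat.zero_le _) (Nat.floor_mono hxy)]
  rw [e2, ← intervalIntegral.integral_of_le hxy] at e1
  have e3 : ∫ t in x..y, deriv f t * Chebyshev.theta t = ∫ t in x..y, f' t * Chebyshev.theta t :=
    intervalIntegral.integral_congr fun t ht => by simp only [(hf t (hsub t ht)).deriv]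
  rw [e3] at e1
  have i1 : IntervalIntegrable (fun t => f' t * Chebyshev.theta t) volume x y :=
    (Chebyshev.theta_mono.intervalIntegrable).continuousOn_mul hf'c
  have i2 : IntervalIntegrable (fun t => f' t * t) volume x y :=
    (hf'c.mul continuousOn_id).intervalIntegrable
  have hfc : ContinuousOn f (uIcc x y) := fun t ht => (hf t (hsub t ht)).continuousAt.continuousWithinAt
  have e4 : log (log y) - log (log x) = f y * y - f x * x - ∫ t in x..y, f' t * t := by
    have h1 := intervalIntegral.integral_eq_sub_of_hasDerivAt (f := fun t => log (log t)) (f' := f) (a := x) (b := y)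
      (fun t ht => hasDeriv_loglog (hsub t ht)) hfc.intervalIntegrable
    have h2 := intervalIntegral.integral_mul_deriv_eq_deriv_mul (u := f) (v := fun t => t) (u' := f') (v' := fun _ => 1) (a := x) (b := y)
      (fun t ht => hf t (hsub t ht)) (fun t _ => hasDerivAt_id t) hf'c.intervalIntegrable (by simp)
    simp only [mul_one] at h2
    rw [← h1, h2]
  have lx := log_ge hx
  have ly : log x ≤ log y := log_le_log (by linarith) hxy
  have e5 : |∫ t in x..y, f' t * (Chebyshev.theta t - t)| ≤ 3 * C / log x := by
    have hg : ∀ t ∈ uIcc x y, HasDerivAt (fun t => -(3 * C) / log t) (3 * C / (t * log t ^ 2)) t := by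
      intro t ht
      have := log_ge (hsub t ht)
      refine ((Real.hasDerivAt_log (by linarith [hsub t ht])).inv (by linarith)).const_mul (-(3*C)) |>.congr_deriv ?_
      field_simp
    have hgc : ContinuousOn (fun t => 3 * C / (t * log t ^ 2)) (uIcc x y) := by
      intro t ht
      have h1 := hsub t ht
      have h2 := log_ge h1
      have h3 : t ≠ 0 := by linarith
      have : t * log t^2 ≠ 0 := by positivity
      exact ContinuousAt.continuousWithinAt (by fun_prop (disch := assumption))
    have h1 := intervalIntegral.integral_eq_sub_of_hasDerivAt hg hgc.intervalIntegrable
    rw [← norm_eq_abs]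
    refine (intervalIntegral.norm_integral_le_of_norm_le hxy (g := fun t => 3 * C / (t * log t ^ 2)) (Eventually.of_forall fun t ht => ?_) hgc.intervalIntegrable).trans ?_
    · have ht2 : 2 ≤ t := by linarith [ht.1]
      have hl := log_ge ht2
      have := h t ht2
      rw [norm_mul, norm_eq_abs, norm_eq_abs]
      have h5 : |f' t| = (log t + 1) / (t * log t) ^ 2 := by
        simp only [f']; rw [abs_div, abs_neg, abs_of_pos (by linarith : 0 < log t + 1), abs_of_pos (by positivity)]
      rw [h5]
      calc (log t + 1) / (t * log t) ^ 2 * |Chebyshev.theta t - t| ≤ (3 * log t) / (t * log t) ^ 2 * (C * t / log t) := by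
            gcongr; linarith
        _ = _ := by field_simp
    · rw [h1]
      have : 0 ≤ 3 * C / log y := div_nonneg (by positivity) (by linarith)
      have e : -(3*C)/log y - -(3*C)/log x = 3 * C / log x - 3 * C / log y := by ring
      linarith
  have e6 : ∀ t, x ≤ t → |f t * (Chebyshev.theta t - t)| ≤ 2 * C / log x := by
    intro t hxt
    have ht2 : 2 ≤ t := by linarith
    have hl := log_ge ht2
    have l2 : log x ≤ log t := log_le_log (by linarith) hxt
    have := h t ht2
    simp only [f]
    rw [abs_mul, abs_of_pos (by positivity)]
    calc 1 / (t * log t) * |Chebyshev.theta t - t| ≤ 1 / (t * log t) * (C * t / log t) := by gcongr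
      _ = C / log t / log t := by field_simp
      _ ≤ C / log x / (1/2) := by gcongr; linarith
      _ = _ := by ring
  have e7 : PS y - PS x - (log (log y) - log (log x)) = f y * (Chebyshev.theta y - y) - f x * (Chebyshev.theta x - x) -
      ∫ t in x..y, f' t * (Chebyshev.theta t - t) := by
    simp only [mul_sub]
    rw [intervalIntegral.integral_sub i1 i2, e1, e4]; ring
  have a1 := abs_le.1 (e6 y hxy)
  have a2 := abs_le.1 (e6 x le_rfl)
  have a3 := abs_le.1 e5
  have e8 : 7 * C / log x = 2 * C / log x + 2 * C / log x + 3 * C / log x := by ring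
  rw [e7, e8, abs_le]; constructor <;> linarith [a1.1, a1.2, a2.1, a2.2, a3.1, a3.2]
end PNT5

section Abel
open Set Filter Topology

lemma mertens_P : ∃ C : ℝ, 0 < C ∧ ∀ (a b u : ℝ) (P : Finset ℕ), log 2 ≤ a → a ≤ u → u ≤ b →
    (∀ p ∈ P, p.Prime ∧ log p ≤ b) → (∀ p : ℕ, p.Prime → a < log p → log p < b → p ∈ P) →
    |∑ p ∈ P with u < log (p:ℕ), 1 / (p:ℝ) - (log b - log u)| ≤ C / u := by
  obtain ⟨C, hC, h⟩ := mertens_diff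
  refine ⟨C + 1, by positivity, fun a b u P ha hu hub h1 h2 => ?_⟩
  have h2u : 2 ≤ exp u := by rw [← exp_log two_pos]; exact exp_le_exp.2 (ha.trans hu)
  have hu0 : 0 < u := by linarith [log2_lb]
  have h3 := h (exp u) (exp b) h2u (exp_le_exp.2 hub)
  rw [log_exp, log_exp] at h3
  have hm : ∀ v : ℝ, ∀ p : ℕ, p ∈ primesUpTo (exp v) ↔ p.Prime ∧ log p ≤ v := by
    intro v p
    rw [primesUpTo, Finset.mem_filter, Finset.mem_range, Nat.lt_succ_iff, Nat.le_floor_iff (exp_pos _).le, and_comm]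
    refine and_congr_right fun hp => ?_
    rw [log_le_iff_le_exp (by exact_mod_cast hp.pos)]
  have e1 : PS (exp b) - PS (exp u) = ∑ p ∈ primesUpTo (exp b) with u < log (p:ℕ), 1 / (p:ℝ) := by
    rw [PS, PS, sub_eq_iff_eq_add, ← Finset.sum_filter_add_sum_filter_not (primesUpTo (exp b)) (fun p : ℕ => u < log (p:ℕ))]
    congr 1
    refine Finset.sum_congr ?_ fun _ _ => rfl
    ext p; simp only [Finset.mem_filter, hm, not_lt]
    constructor
    · rintro ⟨⟨h, _⟩, h'⟩; exact ⟨h, h'⟩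
    · rintro ⟨h, h'⟩; exact ⟨⟨h, h'.trans hub⟩, h'⟩
  set P1 := P.filter (fun p : ℕ => u < log (p:ℕ))
  set P2 := (primesUpTo (exp b)).filter (fun p : ℕ => u < log (p:ℕ))
  have hsub : P1 ⊆ P2 := by
    intro p hp
    simp only [P1, P2, Finset.mem_filter, hm] at *
    exact ⟨h1 p hp.1, hp.2⟩
  have e2 := Finset.sum_sdiff (f := fun p : ℕ => 1 / (p:ℝ)) hsub
  have h4 : ∑ p ∈ P2 \ P1, 1 / (p:ℝ) ≤ 1 / u := by
    have hs : P2 \ P1 ⊆ {⌊exp b⌋₊} := by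
      intro p hp
      simp only [P1, P2, Finset.mem_sdiff, Finset.mem_filter, hm, not_and, Finset.mem_singleton] at *
      obtain ⟨⟨⟨hp, hb⟩, hu'⟩, hn⟩ := hp
      have : ¬ (log p < b) := fun hlt => hn (h2 p hp (hu.trans_lt hu') hlt) hu'
      have : log p = b := le_antisymm hb (not_lt.1 this)
      rw [← this, exp_log (by exact_mod_cast hp.pos), Nat.floor_natCast]
    rcases Finset.subset_singleton_iff.1 hs with h0 | h0
    · rw [h0]; simp; exact hu0.le
    · have : ⌊exp b⌋₊ ∈ P2 \ P1 := by rw [h0]; simp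
      rw [h0, Finset.sum_singleton]
      simp only [P2, Finset.mem_sdiff, Finset.mem_filter] at this
      exact one_div_le_one_div_of_le hu0 (this.1.2.le.trans ((Real.log_le_sub_one_of_pos (by
        have := ((hm _ _).1 this.1.1).1.pos; exact_mod_cast this)).trans (by linarith)))
  have h5 : 0 ≤ ∑ p ∈ P2 \ P1, 1 / (p:ℝ) := Finset.sum_nonneg fun _ _ => by positivity
  rw [e1] at h3
  rw [add_div]
  rw [abs_le] at *
  constructor <;> linarith [h3.1, h3.2]

lemma abel : ∃ C : ℝ, 0 < C ∧ ∀ (a b : ℝ) (P : Finset ℕ) (g g' w : ℝ → ℝ) (S : Set ℝ), log 2 ≤ a → a ≤ b →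
    (∀ p ∈ P, p.Prime ∧ a ≤ log p ∧ log p ≤ b) → (∀ p : ℕ, p.Prime → a < log p → log p < b → p ∈ P) →
    S.Countable → ContinuousOn g (Icc a b) → (∀ u ∈ Ioo a b \ S, HasDerivAt g (g' u) u) →
    (∀ u ∈ Ioo a b \ S, |g' u| ≤ w u) → ContinuousOn w (Icc a b) →
    |∑ p ∈ P, g (log p) / p - ∫ σ in a..b, g σ / σ| ≤ C * (|g a| / a + ∫ u in a..b, w u / u) := by
  obtain ⟨C, hC, h⟩ := mertens_P
  refine ⟨C + 1, by positivity, fun a b P g g' w S ha hab h1 h2 hS hg hd hw hwc => ?_⟩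
  have ha0 : 0 < a := by linarith [log2_lb]
  have hae : ∀ᵐ u, u ∈ Ioc a b → u ∈ Ioo a b \ S := by
    have : (volume : Measure ℝ) (S ∪ {b}) = 0 := (hS.union (countable_singleton b)).measure_zero _
    filter_upwards [compl_mem_ae_iff.2 this] with u hu hab
    simp only [mem_compl_iff, mem_union, mem_singleton_iff, not_or] at hu
    exact ⟨⟨hab.1, lt_of_le_of_ne hab.2 hu.2⟩, hu.1⟩
  have hd' : ∀ u ∈ Ioo a b \ S, HasDerivAt g (deriv g u) u := fun u hu => (hd u hu).differentiableAt.hasDerivAt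
  have hw' : ∀ u ∈ Ioo a b \ S, ‖deriv g u‖ ≤ w u := fun u hu => by rw [(hd u hu).deriv]; exact hw u hu
  have hi : IntervalIntegrable (deriv g) volume a b := by
    refine IntervalIntegrable.mono_fun' (g := w) (hwc.intervalIntegrable_of_Icc hab) (measurable_deriv g).aestronglyMeasurable ?_
    rw [uIoc_of_le hab, Filter.EventuallyLE, ae_restrict_iff' measurableSet_Ioc]
    filter_upwards [hae] with u hu hu'
    exact hw' u (hu hu')
  let Δ : ℝ → ℝ := fun u => ∑ p ∈ P with u < log (p:ℕ), 1 / (p:ℝ)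
  have hind : ∀ p : ℕ, IntervalIntegrable ((Iio (log p)).indicator (deriv g)) volume a b := fun p => by
    rw [intervalIntegrable_iff] at *
    exact hi.indicator measurableSet_Iio
  have e1 : ∑ p ∈ P, g (log p) / p = g a * ∑ p ∈ P, 1 / (p:ℝ) + ∫ u in a..b, deriv g u * Δ u := by
    have : ∀ p ∈ P, g (log p) / p = g a * (1 / (p:ℝ)) + ∫ u in a..b, (Iio (log p)).indicator (deriv g) u * (1 / (p:ℝ)) := by
      intro p hp
      obtain ⟨_, hpa, hpb⟩ := h1 p hp
      have := integral_eq_of_hasDerivAt_off_countable_of_le g (deriv g) hpa hS (hg.mono (Icc_subset_Icc_right hpb))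
        (fun u hu => hd' u ⟨⟨hu.1.1, hu.1.2.trans_le hpb⟩, hu.2⟩) (hi.mono_set (by
          rw [uIcc_of_le hpa, uIcc_of_le hab]; exact Icc_subset_Icc_right hpb))
      rw [intervalIntegral.integral_mul_const]
      have e : ∫ u in a..b, (Iio (log p)).indicator (deriv g) u = ∫ u in a..log p, deriv g u := by
        rw [intervalIntegral.integral_of_le hab, intervalIntegral.integral_of_le hpa, setIntegral_indicator measurableSet_Iio,
          integral_Ioc_eq_integral_Ioo]
        congr 2; ext u; simp only [mem_inter_iff, mem_Ioc, mem_Iio, mem_Ioo]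
        constructor
        · rintro ⟨⟨h, _⟩, h'⟩; exact ⟨h, h'⟩
        · rintro ⟨h, h'⟩; exact ⟨⟨h, h'.le.trans hpb⟩, h'⟩
      rw [e, this]; ring
    rw [Finset.sum_congr rfl this, Finset.sum_add_distrib, ← Finset.mul_sum, ← intervalIntegral.integral_finsetSum
      (fun p _ => (hind p).mul_const _)]
    congr 1
    refine intervalIntegral.integral_congr fun u _ => ?_
    simp only [Δ]
    rw [Finset.sum_filter, Finset.mul_sum]
    refine Finset.sum_congr rfl fun p _ => ?_
    simp only [indicator, mem_Iio]; split_ifs <;> simp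
  have e2 : ∫ u in a..b, g u / u = g a * (log b - log a) + ∫ u in a..b, deriv g u * (log b - log u) := by
    have hlc : ContinuousOn (fun u => log b - log u) (Icc a b) := fun u hu =>
      (continuousAt_const.sub (continuousAt_log (by linarith [hu.1]))).continuousWithinAt
    have i1 : IntervalIntegrable (fun u => deriv g u * (log b - log u)) volume a b :=
      hi.mul_continuousOn (by rwa [uIcc_of_le hab])
    have i2 : IntervalIntegrable (fun u => g u / u) volume a b := by
      refine ContinuousOn.intervalIntegrable_of_Icc hab (hg.div continuousOn_id fun u hu => ?_)
      simp; linarith [hu.1]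
    have := integral_eq_of_hasDerivAt_off_countable_of_le (fun u => g u * (log b - log u))
      (fun u => deriv g u * (log b - log u) - g u / u) hab hS (hg.mul hlc) (fun u hu => by
        have hu0 : u ≠ 0 := by linarith [hu.1.1]
        refine ((hd' u hu).mul ((hasDerivAt_const u (log b)).sub (Real.hasDerivAt_log hu0))).congr_deriv ?_
        simp; ring) (i1.sub i2)
    rw [intervalIntegral.integral_sub i1 i2] at this
    simp at this; linarith
  have i3 : IntervalIntegrable (fun u => w u / u) volume a b := by
    refine ContinuousOn.intervalIntegrable_of_Icc hab (hwc.div continuousOn_id fun u hu => ?_)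
    simp; linarith [hu.1]
  have hΔi : IntervalIntegrable (fun u => deriv g u * Δ u) volume a b := by
    have : (fun u => deriv g u * Δ u) = fun u => ∑ p ∈ P, (Iio (log p)).indicator (deriv g) u * (1 / (p:ℝ)) := by
      ext u; simp only [Δ]
      rw [Finset.sum_filter, Finset.mul_sum]
      refine Finset.sum_congr rfl fun p _ => ?_
      simp only [indicator, mem_Iio]; split_ifs <;> simp
    rw [this]
    rw [show (fun u => ∑ p ∈ P, (Iio (log p)).indicator (deriv g) u * (1 / (p:ℝ))) =
      ∑ p ∈ P, (fun u => (Iio (log p)).indicator (deriv g) u * (1 / (p:ℝ))) by ext; simp [Finset.sum_apply]]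
    exact IntervalIntegrable.sum P fun p _ => (hind p).mul_const _
  have hli : IntervalIntegrable (fun u => deriv g u * (log b - log u)) volume a b :=
    hi.mul_continuousOn (by
      rw [uIcc_of_le hab]
      exact fun u hu => (continuousAt_const.sub (continuousAt_log (by linarith [hu.1]))).continuousWithinAt)
  have h5 : |∫ u in a..b, deriv g u * (Δ u - (log b - log u))| ≤ C * ∫ u in a..b, w u / u := by
    rw [← intervalIntegral.integral_const_mul, ← norm_eq_abs]
    refine intervalIntegral.norm_integral_le_of_norm_le hab ?_ (i3.const_mul C)
    filter_upwards [hae] with u hu hu'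
    have h6 := h a b u P ha hu'.1.le hu'.2 (fun p hp => ⟨(h1 p hp).1, (h1 p hp).2.2⟩) h2
    rw [norm_mul, norm_eq_abs (Δ u - _)]
    calc _ ≤ w u * (C / u) := mul_le_mul (hw' u (hu hu')) h6 (abs_nonneg _) ((norm_nonneg _).trans (hw' u (hu hu')))
      _ = _ := by ring
  have h6 : |∑ p ∈ P, 1 / (p:ℝ) - (log b - log a)| ≤ (C + 1) / a := by
    have h7 := h a b a P ha le_rfl hab (fun p hp => ⟨(h1 p hp).1, (h1 p hp).2.2⟩) h2
    have e3 := Finset.sum_filter_add_sum_filter_not P (fun p : ℕ => a < log (p:ℕ)) (fun p : ℕ => 1 / (p:ℝ))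
    have h8 : ∑ p ∈ P with ¬ a < log (p:ℕ), 1 / (p:ℝ) ≤ 1 / a := by
      have hs : (P.filter fun p : ℕ => ¬ a < log (p:ℕ)) ⊆ {⌊exp a⌋₊} := by
        intro p hp
        simp only [Finset.mem_filter, Finset.mem_singleton] at *
        have := h1 p hp.1
        have : log p = a := le_antisymm (not_lt.1 hp.2) this.2.1
        rw [← this, exp_log (by exact_mod_cast (h1 p hp.1).1.pos), Nat.floor_natCast]
      refine (Finset.sum_le_sum_of_subset_of_nonneg hs fun _ _ _ => by positivity).trans ?_
      rw [Finset.sum_singleton]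
      refine one_div_le_one_div_of_le ha0 ?_
      have := add_one_le_exp a
      linarith [Nat.lt_floor_add_one (exp a)]
    have h9 : 0 ≤ ∑ p ∈ P with ¬ a < log (p:ℕ), 1 / (p:ℝ) := Finset.sum_nonneg fun _ _ => by positivity
    rw [add_div]
    rw [abs_le] at *
    constructor <;> linarith [h7.1, h7.2]
  have e4 : ∑ p ∈ P, g (log p) / p - ∫ σ in a..b, g σ / σ =
      g a * (∑ p ∈ P, 1 / (p:ℝ) - (log b - log a)) + ∫ u in a..b, deriv g u * (Δ u - (log b - log u)) := by
    have := intervalIntegral.integral_sub hΔi hli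
    simp only [← mul_sub] at this
    rw [e1, e2, this]; ring
  rw [e4]
  have hwi : 0 ≤ ∫ u in a..b, w u / u := by
    refine intervalIntegral.integral_nonneg_of_ae_restrict hab ?_
    rw [Filter.EventuallyLE, ← Measure.restrict_congr_set Ioc_ae_eq_Icc, ae_restrict_iff' measurableSet_Ioc]
    filter_upwards [hae] with u hu hu'
    exact div_nonneg ((norm_nonneg _).trans (hw' u (hu hu'))) (by linarith [hu'.1])
  calc _ ≤ |g a| * ((C + 1) / a) + C * ∫ u in a..b, w u / u := (abs_add_le _ _).trans (by rw [abs_mul]; gcongr)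
    _ ≤ _ := by rw [mul_add]; refine add_le_add (le_of_eq (by ring)) (by gcongr; linarith)
end Abel

section Mert
open Set Filter Topology

noncomputable def PiM (M : ℕ) : ℝ := ∏ p ∈ (Finset.range M).filter Nat.Prime, (1 - 1 / (p:ℝ))

lemma PS_lim : ∃ m : ℝ, Tendsto (fun n : ℕ => PS n - log (log n)) atTop (𝓝 m) := by
  obtain ⟨C, hC, h⟩ := mertens_diff
  have hc : CauchySeq (fun n : ℕ => PS (n+2:ℕ) - log (log (n+2:ℕ))) := by
    refine cauchySeq_of_le_tendsto_0 (fun N : ℕ => 2 * C / log (N + 2:ℕ)) (fun n m N hn hm => ?_) ?_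
    · have h2 : (2:ℝ) ≤ (N+2:ℕ) := by push_cast; linarith [(Nat.cast_nonneg N : (0:ℝ) ≤ N)]
      have a1 := h (N+2:ℕ) (n+2:ℕ) h2 (by gcongr)
      have a2 := h (N+2:ℕ) (m+2:ℕ) h2 (by gcongr)
      rw [Real.dist_eq, mul_div_assoc]
      rw [abs_le] at *; constructor <;> linarith [a1.1, a1.2, a2.1, a2.2]
    · exact Tendsto.const_div_atTop (tendsto_log_atTop.comp (tendsto_natCast_atTop_atTop.comp (tendsto_add_atTop_nat 2))) _
  obtain ⟨m, hm⟩ := cauchySeq_tendsto_of_complete hc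
  exact ⟨m, (tendsto_add_atTop_iff_nat 2).1 hm⟩

lemma PS_lim' {m : ℝ} (hm : Tendsto (fun n : ℕ => PS n - log (log n)) atTop (𝓝 m)) :
    Tendsto (fun n : ℕ => PS (exp n) - log n) atTop (𝓝 m) := by
  obtain ⟨C, hC, h⟩ := mertens_diff
  have h1 : Tendsto (fun n : ℕ => ⌊exp n⌋₊) atTop atTop :=
    tendsto_nat_floor_atTop.comp (tendsto_exp_atTop.comp tendsto_natCast_atTop_atTop)
  have h2 := hm.comp h1
  have h3 : Tendsto (fun n : ℕ => log (log (exp n)) - log (log (⌊exp (n:ℝ)⌋₊))) atTop (𝓝 0) := by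
    have l1 : Tendsto (fun n : ℕ => log (⌊exp (n:ℝ)⌋₊)) atTop atTop :=
      tendsto_log_atTop.comp (tendsto_natCast_atTop_atTop.comp h1)
    have : Tendsto (fun n : ℕ => C / log (⌊exp (n:ℝ)⌋₊)) atTop (𝓝 0) := Tendsto.const_div_atTop l1 _
    refine squeeze_zero_norm' ?_ this
    filter_upwards [h1.eventually_ge_atTop 2] with n hn
    have := h (⌊exp (n:ℝ)⌋₊) (exp n) (by exact_mod_cast hn) (Nat.floor_le (exp_pos _).le)
    rwa [PS, PS, primesUpTo, primesUpTo, Nat.floor_natCast, sub_self, zero_sub, abs_neg] at this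
  have h4 := h2.sub h3
  rw [sub_zero] at h4
  refine h4.congr fun n => ?_
  simp only [Function.comp_apply, PS, primesUpTo, Nat.floor_natCast, log_exp]; ring

noncomputable def zq (y : ℝ) : ℝ := -log (1 - y) - y
lemma zq_bd {y : ℝ} (h0 : 0 ≤ y) (h1 : y ≤ 1/2) : |zq y| ≤ 2 * y ^ 2 := by
  have := Real.abs_log_sub_add_sum_range_le (x := y) (by rw [abs_of_nonneg h0]; linarith) 1
  simp at this
  rw [abs_of_nonneg h0] at this
  rw [zq, ← abs_neg, show -(-log (1 - y) - y) = y + log (1 - y) by ring]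
  refine this.trans ?_
  rw [div_le_iff₀ (by linarith)]; nlinarith [sq_nonneg y]

noncomputable def pind (F : ℕ → ℝ) : ℕ → ℝ := fun p => if p.Prime then F p else 0

lemma pind_sum (F : ℕ → ℝ) (n : ℕ) : ∑ p ∈ Finset.range n, pind F p = ∑ p ∈ (Finset.range n).filter Nat.Prime, F p := by
  rw [Finset.sum_filter]; rfl

lemma pr_le (p : ℕ) (hp : p.Prime) (e : ℝ) (he : 0 ≤ e) : (p:ℝ) ^ (-1 - e) ≤ 1 / p := by
  have : (1:ℝ) ≤ p := by exact_mod_cast hp.one_lt.le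
  rw [one_div, ← rpow_neg_one]
  exact rpow_le_rpow_of_exponent_le this (by linarith)

lemma sum_inv_sq : Summable (fun p : ℕ => 2 * (1 / (p:ℝ)) ^ 2) := by
  simpa [one_div] using (Real.summable_one_div_nat_pow (p := 2)).2 (by norm_num) |>.mul_left 2

lemma zq_pind_bd (e : ℝ) (he : 0 ≤ e) (p : ℕ) : ‖pind (fun p => zq ((p:ℝ) ^ (-1 - e))) p‖ ≤ 2 * (1 / (p:ℝ)) ^ 2 := by
  unfold pind; split_ifs with hp
  · have h2 : (2:ℝ) ≤ p := by exact_mod_cast hp.two_le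
    have h1 := pr_le p hp e he
    refine (zq_bd (by positivity) (h1.trans (one_div_le_one_div_of_le two_pos h2))).trans ?_
    gcongr
  · simp

lemma log_zeta (e : ℝ) (he : 0 < e) : Summable (pind fun p => (p:ℝ) ^ (-1 - e)) ∧
    log (∑' n : ℕ, 1 / (n:ℝ) ^ (1 + e)) = ∑' p, pind (fun p => (p:ℝ) ^ (-1 - e)) p + ∑' p, pind (fun p => zq ((p:ℝ) ^ (-1 - e))) p := by
  let φ : ℕ →*₀ ℝ :=
    { toFun := fun n => (n:ℝ) ^ (-1 - e)
      map_zero' := by simp [zero_rpow (show -1 - e ≠ 0 by linarith)]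
      map_one' := by simp
      map_mul' := fun m n => by push_cast; exact mul_rpow (by positivity) (by positivity) }
  have hφ : ∀ n, φ n = 1 / (n:ℝ) ^ (1 + e) := fun n => by
    show (n:ℝ) ^ (-1 - e) = _
    rw [one_div, ← rpow_neg (by positivity)]; ring_nf
  have hs : Summable φ := by
    exact (Real.summable_one_div_nat_rpow.2 (by linarith : 1 < 1 + e)).congr fun n => (hφ n).symm
  have hpos : 0 < ∑' n, φ n := by
    refine hs.tsum_pos (fun n => by rw [hφ]; positivity) 1 (by rw [hφ]; simp)
  have hp := EulerProduct.eulerProduct_completely_multiplicative_hasProd hs.norm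
  have h1 : HasSum (fun p : Nat.Primes => -log (1 - φ p)) (log (∑' n, φ n)) := by
    have := ((continuousAt_log hpos.ne').tendsto).comp hp
    refine this.congr fun s => ?_
    simp only [Function.comp_apply]
    rw [log_prod]
    · exact Finset.sum_congr rfl fun p _ => log_inv _
    · intro p _
      have : φ p ≤ 1 / (p:ℕ) := pr_le p p.2 e he.le
      have h2 : (2:ℝ) ≤ (p:ℕ) := by exact_mod_cast p.2.two_le
      have := one_div_le_one_div_of_le two_pos h2
      exact inv_ne_zero (by linarith)
  have h2 : HasSum (pind fun p => -log (1 - φ p)) (log (∑' n, φ n)) := by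
    have := (hasSum_subtype_iff_indicator (f := fun p : ℕ => -log (1 - φ p)) (s := {p | p.Prime})).1 h1
    convert this using 1
    ext p; simp [pind, indicator]
  have h3 : Summable (pind fun p => zq ((p:ℝ) ^ (-1 - e))) := sum_inv_sq.of_norm_bounded (zq_pind_bd e he.le)
  have h4 : Summable (pind fun p => (p:ℝ) ^ (-1 - e)) := by
    refine (h2.summable.sub h3).congr fun p => ?_
    unfold pind; split_ifs
    · show -log (1 - (p:ℝ) ^ (-1 - e)) - zq _ = _
      rw [zq]; ring
    · simp
  refine ⟨h4, ?_⟩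
  rw [← h4.tsum_add h3]
  simp_rw [← hφ]
  rw [← h2.tsum_eq]
  refine tsum_congr fun p => ?_
  unfold pind; split_ifs
  · show -log (1 - (p:ℝ) ^ (-1 - e)) = _ + zq _
    rw [zq]; ring
  · simp

lemma zq_lim : Tendsto (fun e : ℝ => ∑' p, pind (fun p => zq ((p:ℝ) ^ (-1 - e))) p) (𝓝[>] 0)
    (𝓝 (∑' p, pind (fun p => zq (1 / (p:ℝ))) p)) := by
  refine tendsto_tsum_of_dominated_convergence sum_inv_sq (fun p => ?_) ?_
  · unfold pind; split_ifs with hp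
    · have h2 : (2:ℝ) ≤ p := by exact_mod_cast hp.two_le
      have h3 : Tendsto (fun e : ℝ => (p:ℝ) ^ (-1 - e)) (𝓝[>] 0) (𝓝 (1 / p)) := by
        have : ContinuousAt (fun e : ℝ => (p:ℝ) ^ (-1 - e)) 0 := by
          have : (p:ℝ) ≠ 0 := by positivity
          fun_prop (disch := assumption)
        have := this.tendsto.mono_left (nhdsWithin_le_nhds (s := Ioi 0))
        simpa [rpow_neg_one] using this
      have h4 : ContinuousAt zq (1 / p) := by
        have : (1 - 1/(p:ℝ)) ≠ 0 := by
          have := one_div_le_one_div_of_le two_pos h2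
          linarith
        unfold zq
        fun_prop (disch := assumption)
      exact h4.tendsto.comp h3
    · exact tendsto_const_nhds
  · filter_upwards [self_mem_nhdsWithin] with e he p using zq_pind_bd e (le_of_lt he) p

lemma PS_step (x : ℝ) (N : ℕ) : ∑ p ∈ primesUpTo (exp N), 1 / (p:ℝ) * x ^ ⌈log p⌉₊ =
    ∑ n ∈ Finset.range (N + 1), (if n = 0 then 0 else PS (exp n) - PS (exp (n - 1))) * x ^ n := by
  have hm : ∀ v : ℝ, ∀ p : ℕ, p ∈ primesUpTo (exp v) ↔ p.Prime ∧ log p ≤ v := by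
    intro v p
    rw [primesUpTo, Finset.mem_filter, Finset.mem_range, Nat.lt_succ_iff, Nat.le_floor_iff (exp_pos _).le, and_comm]
    refine and_congr_right fun hp => ?_
    rw [log_le_iff_le_exp (by exact_mod_cast hp.pos)]
  induction N with
  | zero =>
    simp only [zero_add, Finset.range_one, Finset.sum_singleton, if_true, zero_mul]
    refine Finset.sum_eq_zero fun p hp => ?_
    have := (hm _ _).1 hp
    have h2 := log_ge (show (2:ℝ) ≤ p by exact_mod_cast this.1.two_le)
    norm_num at this; linarith
  | succ N ih =>
    rw [Finset.sum_range_succ, ← ih]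
    have hsub : primesUpTo (exp N) ⊆ primesUpTo (exp (N+1:ℕ)) := fun p hp => by
      rw [hm] at *; exact ⟨hp.1, hp.2.trans (by push_cast; linarith)⟩
    simp only [Nat.succ_ne_zero, if_false, Nat.cast_add, Nat.cast_one, add_sub_cancel_right] at *
    rw [PS, PS, ← Finset.sum_sdiff hsub, ← Finset.sum_sdiff hsub (f := fun p : ℕ => 1 / (p:ℝ)), add_sub_cancel_right, add_comm, Finset.sum_mul]
    congr 1
    refine Finset.sum_congr rfl fun p hp => ?_
    rw [Finset.mem_sdiff, hm, hm] at hp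
    have : ⌈log p⌉₊ = N + 1 := by
      rw [Nat.ceil_eq_iff (by simp)]
      push_cast
      exact ⟨by simpa using not_le.1 fun h => hp.2 ⟨hp.1.1, h⟩, hp.1.2⟩
    rw [this]

lemma mertens_gamma {m : ℝ} (hm : Tendsto (fun n : ℕ => PS n - log (log n)) atTop (𝓝 m)) :
    m + ∑' p, pind (fun p => zq (1 / (p:ℝ))) p = eulerMascheroniConstant := by
  set K := ∑' p, pind (fun p => zq (1 / (p:ℝ))) p
  have hm' := PS_lim' hm
  let b : ℕ → ℝ := fun n => if n = 0 then 0 else PS (exp n) - PS (exp (n - 1))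
  have hPS1 : PS (exp (0:ℕ)) = 0 := by
    have := PS_step 1 0
    simpa [PS] using this
  have hbs : ∀ N : ℕ, ∑ n ∈ Finset.range (N+1), b n = PS (exp N) := fun N => by
    have := PS_step 1 N
    simpa [PS, b] using this.symm
  have hab : Tendsto (fun N => ∑ n ∈ Finset.range N, (b n - (n:ℝ)⁻¹)) atTop (𝓝 (m - eulerMascheroniConstant)) := by
    rw [← tendsto_add_atTop_iff_nat 1]
    refine (hm'.sub Real.tendsto_harmonic_sub_log).congr fun N => ?_
    rw [Finset.sum_sub_distrib, hbs, Finset.sum_range_succ', harmonic]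
    push_cast; simp
  have hA := Real.tendsto_tsum_powerSeries_nhdsWithin_lt hab
  have hx : Tendsto (fun e : ℝ => exp (-e)) (𝓝[>] 0) (𝓝[<] 1) := by
    refine tendsto_nhdsWithin_iff.2 ⟨?_, ?_⟩
    · have : ContinuousAt (fun e : ℝ => exp (-e)) 0 := by fun_prop
      simpa using this.tendsto.mono_left (nhdsWithin_le_nhds (s := Ioi 0))
    · filter_upwards [self_mem_nhdsWithin] with e he
      simpa using he
  have hA' := hA.comp hx
  let U : ℝ → ℝ := fun e => ∑' p, pind (fun p => 1 / (p:ℝ) * exp (-e) ^ ⌈log p⌉₊) p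
  let Z : ℝ → ℝ := fun e => ∑' p, pind (fun p => (p:ℝ) ^ (-1 - e)) p
  have hcmp : ∀ e, 0 < e → ∀ p : ℕ, 0 ≤ pind (fun p => 1 / (p:ℝ) * exp (-e) ^ ⌈log p⌉₊) p ∧
      pind (fun p => 1 / (p:ℝ) * exp (-e) ^ ⌈log p⌉₊) p ≤ pind (fun p => (p:ℝ) ^ (-1 - e)) p ∧
      pind (fun p => (p:ℝ) ^ (-1 - e)) p ≤ exp e * pind (fun p => 1 / (p:ℝ) * exp (-e) ^ ⌈log p⌉₊) p := by
    intro e he p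
    unfold pind; split_ifs with hp
    · have hp0 : (0:ℝ) < p := by exact_mod_cast hp.pos
      have e1 : (p:ℝ) ^ (-1 - e) = 1 / p * exp (-e * log p) := by
        rw [sub_eq_add_neg, rpow_add hp0, rpow_neg_one, one_div, rpow_def_of_pos hp0]; ring_nf
      beta_reduce
      rw [e1, ← exp_nat_mul]
      have l0 : 0 ≤ log p := log_nonneg (by exact_mod_cast hp.one_lt.le)
      have c1 := Nat.le_ceil (log p)
      have c2 := (Nat.ceil_lt_add_one l0).le
      refine ⟨by positivity, mul_le_mul_of_nonneg_left (exp_le_exp.2 (by nlinarith)) (by positivity), ?_⟩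
      rw [show exp e * (1 / p * exp (⌈log p⌉₊ * -e)) = 1 / p * (exp e * exp (⌈log p⌉₊ * -e)) by ring, ← exp_add]
      exact mul_le_mul_of_nonneg_left (exp_le_exp.2 (by nlinarith)) (by positivity)
    · simp
  have hUs : ∀ e, 0 < e → Summable (pind (fun p => 1 / (p:ℝ) * exp (-e) ^ ⌈log p⌉₊)) := fun e he =>
    (log_zeta e he).1.of_nonneg_of_le (fun p => (hcmp e he p).1) fun p => (hcmp e he p).2.1
  have hUZ : ∀ e, 0 < e → U e ≤ Z e ∧ Z e ≤ exp e * U e := fun e he => by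
    refine ⟨(hUs e he).tsum_le_tsum (fun p => (hcmp e he p).2.1) (log_zeta e he).1, ?_⟩
    rw [← (hUs e he).tsum_mul_left]
    exact (log_zeta e he).1.tsum_le_tsum (fun p => (hcmp e he p).2.2) ((hUs e he).mul_left _)
  have hU : ∀ e, 0 < e → HasSum (fun n => b n * exp (-e) ^ n) (U e) := by
    intro e he
    have h0 : ∀ n, 0 ≤ b n * exp (-e) ^ n := fun n => by
      simp only [b]; split_ifs with h
      · simp
      · refine mul_nonneg (sub_nonneg.2 (Finset.sum_le_sum_of_subset_of_nonneg ?_ fun _ _ _ => by positivity)) (by positivity)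
        unfold primesUpTo
        exact Finset.filter_subset_filter _ (Finset.range_mono (by gcongr; linarith))
    rw [hasSum_iff_tendsto_nat_of_nonneg h0, ← tendsto_add_atTop_iff_nat 1]
    have h1 : Tendsto (fun n : ℕ => ⌊exp n⌋₊ + 1) atTop atTop :=
      (tendsto_add_atTop_nat 1).comp (tendsto_nat_floor_atTop.comp (tendsto_exp_atTop.comp tendsto_natCast_atTop_atTop))
    refine ((hUs e he).hasSum.tendsto_sum_nat.comp h1).congr fun N => ?_
    simp only [Function.comp_apply]
    rw [pind_sum]
    exact PS_step (exp (-e)) N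
  have hlog : ∀ e, 0 < e → HasSum (fun n : ℕ => (n:ℝ)⁻¹ * exp (-e) ^ n) (-log (1 - exp (-e))) := by
    intro e he
    have := Real.hasSum_pow_div_log_of_abs_lt_one (x := exp (-e)) (by rw [abs_of_pos (exp_pos _)]; simpa using he)
    rw [← hasSum_nat_add_iff' 1]
    simp only [Finset.range_one, Finset.sum_singleton, Nat.cast_zero, inv_zero, zero_mul, sub_zero]
    rw [show (fun n : ℕ => ((n + 1 : ℕ):ℝ)⁻¹ * exp (-e) ^ (n+1)) = fun n : ℕ => exp (-e) ^ (n+1) / ((n:ℝ)+1) from funext fun n => by push_cast; rw [div_eq_inv_mul]]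
    exact this
  have hUl : Tendsto (fun e => U e + log (1 - exp (-e))) (𝓝[>] 0) (𝓝 (m - eulerMascheroniConstant)) := by
    refine hA'.congr' ?_
    filter_upwards [self_mem_nhdsWithin] with e he
    simp only [Function.comp_apply, sub_mul]
    rw [((hU e he).sub (hlog e he)).tsum_eq]; ring
  have hratio : Tendsto (fun e : ℝ => (1 - exp (-e)) / e) (𝓝[>] 0) (𝓝 1) := by
    have h1 : HasDerivAt (fun e : ℝ => -exp (-e)) 1 0 := by
      have := ((hasDerivAt_id (0:ℝ)).neg.exp).neg
      simpa using! this
    have := hasDerivAt_iff_tendsto_slope.1 h1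
    have := this.mono_left (nhdsWithin_mono 0 (fun e (he : 0 < e) => (ne_of_gt he : e ≠ 0)))
    refine this.congr' ?_
    filter_upwards [self_mem_nhdsWithin] with e he
    rw [slope_def_field]; simp; ring
  have hzeta : Tendsto (fun e : ℝ => e * ∑' n : ℕ, 1 / (n:ℝ) ^ (1 + e)) (𝓝[>] 0) (𝓝 1) := by
    have h1 : Tendsto (fun e : ℝ => 1 + e) (𝓝[>] 0) (𝓝[>] 1) := by
      refine tendsto_nhdsWithin_iff.2 ⟨?_, ?_⟩
      · have : ContinuousAt (fun e : ℝ => 1 + e) 0 := by fun_prop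
        simpa using this.tendsto.mono_left (nhdsWithin_le_nhds (s := Ioi 0))
      · filter_upwards [self_mem_nhdsWithin] with e he
        simpa using he
    refine (tendsto_sub_mul_tsum_nat_rpow.comp h1).congr fun e => ?_
    simp
  have hl1 : Tendsto (fun e : ℝ => log e + log (∑' n : ℕ, 1 / (n:ℝ) ^ (1 + e))) (𝓝[>] 0) (𝓝 0) := by
    have := (continuousAt_log one_ne_zero).tendsto.comp hzeta
    rw [log_one] at this
    refine this.congr' ?_
    filter_upwards [self_mem_nhdsWithin, hzeta.eventually_ne one_ne_zero] with e he h1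
    have he : 0 < e := he
    exact log_mul he.ne' (right_ne_zero_of_mul h1)
  have hl2 : Tendsto (fun e : ℝ => log (1 - exp (-e)) - log e) (𝓝[>] 0) (𝓝 0) := by
    have := (continuousAt_log one_ne_zero).tendsto.comp hratio
    rw [log_one] at this
    refine this.congr' ?_
    filter_upwards [self_mem_nhdsWithin] with e he
    have he : 0 < e := he
    refine log_div ?_ he.ne'
    have : exp (-e) < 1 := by simpa using he
    linarith
  have hel : Tendsto (fun e : ℝ => (exp e - 1) * log e) (𝓝[>] 0) (𝓝 0) := by
    have h1 : Tendsto (fun e : ℝ => log e * e) (𝓝[>] 0) (𝓝 0) := by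
      simpa only [rpow_one] using tendsto_log_mul_rpow_nhdsGT_zero zero_lt_one
    have h2 : Tendsto (fun e : ℝ => exp e) (𝓝[>] 0) (𝓝 1) := by
      have : ContinuousAt (fun e : ℝ => exp e) 0 := by fun_prop
      simpa using this.tendsto.mono_left (nhdsWithin_le_nhds (s := Ioi 0))
    have h3 := (h2.mul hratio).mul h1
    simp only [mul_one, mul_zero] at h3
    refine h3.congr' ?_
    filter_upwards [self_mem_nhdsWithin] with e he
    have he : e ≠ 0 := ne_of_gt he
    have : exp e * (1 - exp (-e)) = exp e - 1 := by rw [mul_sub, ← exp_add]; simp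
    field_simp
    rw [this]; ring
  have hUl2 : Tendsto (fun e => U e + log e) (𝓝[>] 0) (𝓝 (m - eulerMascheroniConstant)) := by
    have := hUl.sub hl2
    rw [sub_zero] at this
    exact this.congr fun e => by ring
  have hex0 : Tendsto (fun e : ℝ => exp e - 1) (𝓝[>] 0) (𝓝 0) := by
    have : ContinuousAt (fun e : ℝ => exp e - 1) 0 := by fun_prop
    simpa using this.tendsto.mono_left (nhdsWithin_le_nhds (s := Ioi 0))
  have hZU : Tendsto (fun e => Z e - U e) (𝓝[>] 0) (𝓝 0) := by
    have h1 := (hex0.mul hUl2).sub hel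
    simp only [zero_mul, sub_zero] at h1
    refine squeeze_zero' ?_ ?_ h1
    · filter_upwards [self_mem_nhdsWithin] with e he; linarith [(hUZ e he).1]
    · filter_upwards [self_mem_nhdsWithin] with e he; linarith [(hUZ e he).2]
  have hfin := ((hl1.sub hUl2).sub hZU).sub zq_lim
  have h0 : Tendsto (fun _ : ℝ => (0:ℝ)) (𝓝[>] 0) (𝓝 (0 - (m - eulerMascheroniConstant) - 0 - K)) := by
    refine hfin.congr' ?_
    filter_upwards [self_mem_nhdsWithin] with e he
    rw [(log_zeta e he).2]; simp only [Z]; ring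
  have := tendsto_nhds_unique h0 tendsto_const_nhds
  linarith

lemma PiM_pos (M : ℕ) : 0 < PiM M := Finset.prod_pos fun p hp => by
  have : (2:ℝ) ≤ p := by exact_mod_cast (Finset.mem_filter.1 hp).2.two_le
  have := one_div_le_one_div_of_le two_pos this
  linarith

lemma PiM_lim : Tendsto (fun M : ℕ => log M * PiM M) atTop (𝓝 (exp (-eulerMascheroniConstant))) := by
  obtain ⟨m, hm⟩ := PS_lim
  rw [← mertens_gamma hm]
  have h3 : Summable (pind fun p => zq (1 / (p:ℝ))) := sum_inv_sq.of_norm_bounded fun p => by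
    have := zq_pind_bd 0 le_rfl p
    simpa [rpow_neg_one] using this
  have h4 := ((hm.add (h3.hasSum.tendsto_sum_nat.comp (tendsto_add_atTop_nat 1))).neg).rexp
  rw [← tendsto_add_atTop_iff_nat 1]
  have h5 : Tendsto (fun n : ℕ => log (n+1:ℕ) / log n) atTop (𝓝 1) := by
    have h6 : Tendsto (fun n : ℕ => 1 + log 2 / log n) atTop (𝓝 1) := by
      simpa using (Tendsto.const_div_atTop (tendsto_log_atTop.comp tendsto_natCast_atTop_atTop) (log 2)).const_add 1
    refine tendsto_of_tendsto_of_tendsto_of_le_of_le' tendsto_const_nhds h6 ?_ ?_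
    · filter_upwards [eventually_ge_atTop 2] with n hn
      have hn' : (2:ℝ) ≤ n := by exact_mod_cast hn
      have := log_ge hn'
      rw [le_div_iff₀ (by linarith), one_mul]
      exact log_le_log (by linarith) (by push_cast; linarith)
    · filter_upwards [eventually_ge_atTop 2] with n hn
      have hn' : (2:ℝ) ≤ n := by exact_mod_cast hn
      have := log_ge hn'
      rw [div_le_iff₀ (by linarith), add_mul, div_mul_cancel₀ _ (by linarith), one_mul, ← log_mul (by linarith) (by norm_num)]
      exact log_le_log (by positivity) (by push_cast; linarith)
  have h7 := h4.mul h5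
  rw [mul_one] at h7
  refine h7.congr' ?_
  filter_upwards [eventually_ge_atTop 2] with n hn
  have hn' : (2:ℝ) ≤ n := by exact_mod_cast hn
  have hl := log_ge hn'
  have h8 : PiM (n+1) = exp (-PS n - ∑ p ∈ Finset.range (n+1), pind (fun p => zq (1 / (p:ℝ))) p) := by
    rw [pind_sum, PS, primesUpTo, Nat.floor_natCast, PiM, ← Finset.sum_neg_distrib, ← Finset.sum_sub_distrib, exp_sum]
    refine Finset.prod_congr rfl fun p hp => ?_
    have : (2:ℝ) ≤ p := by exact_mod_cast (Finset.mem_filter.1 hp).2.two_le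
    have := one_div_le_one_div_of_le two_pos this
    rw [zq, show -(1 / (p:ℝ)) - (-log (1 - 1 / (p:ℝ)) - 1 / p) = log (1 - 1/(p:ℝ)) by ring, exp_log (by linarith)]
  rw [h8, Function.comp_apply, show -(PS n - log (log n) + ∑ i ∈ Finset.range (n + 1), pind (fun p => zq (1 / (p:ℝ))) i) =
    (-PS n - ∑ p ∈ Finset.range (n+1), pind (fun p => zq (1 / (p:ℝ))) p) + log (log n) by ring, exp_add, exp_log (by linarith)]
  have : log (n:ℝ) ≠ 0 := by linarith
  field_simp
end Mert

section Buch
open Set Filter Topology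

noncomputable def Yk : ℕ → ℝ → ℝ
  | 0 => fun _ => 1
  | k+1 => fun w => 1 + ∫ u in (1:ℝ)..(max (w-1) 1), Yk k u / max u 1
noncomputable def Yf (w : ℝ) : ℝ := Yk ⌈w⌉₊ w
noncomputable def om (u : ℝ) : ℝ := Yf u / max u 1

lemma m1 (u : ℝ) : 0 < max u 1 := lt_of_lt_of_le one_pos (le_max_right _ _)

lemma Yk_cont (k : ℕ) : Continuous (Yk k) := by
  induction k with
  | zero => exact continuous_const
  | succ k ih =>
    have h : Continuous fun u => Yk k u / max u 1 := ih.div (by fun_prop) fun u => (m1 u).ne'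
    exact continuous_const.add ((intervalIntegral.continuous_primitive (fun a b => h.intervalIntegrable a b) 1).comp
      (by fun_prop : Continuous fun w : ℝ => max (w-1) 1))

lemma Yk_stab (k : ℕ) : ∀ w : ℝ, w ≤ k + 2 → Yk (k+1) w = Yk k w := by
  induction k with
  | zero => intro w hw; simp only [Yk]; rw [max_eq_right (by norm_num at hw; linarith)]; simp
  | succ k ih =>
    intro w hw
    show 1 + ∫ u in (1:ℝ)..(max (w-1) 1), Yk (k+1) u / max u 1 = 1 + ∫ u in (1:ℝ)..(max (w-1) 1), Yk k u / max u 1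
    congr 1
    refine intervalIntegral.integral_congr fun u hu => ?_
    rw [uIcc_of_le (le_max_right _ _)] at hu
    have : u ≤ k + 2 := hu.2.trans (max_le (by push_cast at hw; linarith) (by linarith [(Nat.cast_nonneg k : (0:ℝ) ≤ k)]))
    simp only [ih u this]

lemma Yk_eq (k : ℕ) (w : ℝ) (h : w ≤ k) : Yk k w = Yf w := by
  have h0 : ⌈w⌉₊ ≤ k := Nat.ceil_le.2 h
  clear h
  induction k, h0 using Nat.le_induction with
  | base => rfl
  | succ n hn ih => rw [Yk_stab _ _ ((Nat.ceil_le.1 hn).trans (by linarith)), ih]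

lemma Yf_cont : Continuous Yf := continuous_iff_continuousAt.2 fun w => by
  obtain ⟨k, hk⟩ := exists_nat_gt w
  exact (Yk_cont k).continuousAt.congr (by filter_upwards [Iio_mem_nhds hk] with u hu using Yk_eq k u (le_of_lt hu))

lemma om_cont : Continuous om := Yf_cont.div (by fun_prop) fun u => (m1 u).ne'

lemma Yf_eq (w : ℝ) : Yf w = 1 + ∫ u in (1:ℝ)..(max (w-1) 1), om u := by
  obtain ⟨k, hk⟩ := exists_nat_gt (max w 1)
  rw [← Yk_eq (k+1) w (by push_cast; linarith [le_max_left w 1]), Yk]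
  beta_reduce
  congr 1
  refine intervalIntegral.integral_congr fun u hu => ?_
  rw [uIcc_of_le (le_max_right _ _)] at hu
  rw [om, Yk_eq]
  refine hu.2.trans (le_of_lt (lt_of_le_of_lt ?_ hk))
  exact max_le_max (by linarith) le_rfl

lemma Yf_one {w : ℝ} (h : w ≤ 2) : Yf w = 1 := by
  rw [Yf_eq, max_eq_right (by linarith)]; simp

lemma Yk_bd (k : ℕ) : ∀ w, 1 ≤ Yk k w ∧ Yk k w ≤ max w 1 := by
  induction k with
  | zero => intro w; simp [Yk]
  | succ k ih =>
    intro w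
    have h : Continuous fun u => Yk k u / max u 1 := (Yk_cont k).div (by fun_prop) fun u => (m1 u).ne'
    have h1 : ∫ u in (1:ℝ)..(max (w-1) 1), Yk k u / max u 1 ≤ ∫ u in (1:ℝ)..(max (w-1) 1), (1:ℝ) :=
      intervalIntegral.integral_mono_on (le_max_right _ _) (h.intervalIntegrable _ _) (by simp)
        fun u _ => (div_le_one (m1 u)).2 (ih u).2
    have h2 : 0 ≤ ∫ u in (1:ℝ)..(max (w-1) 1), Yk k u / max u 1 :=
      intervalIntegral.integral_nonneg (le_max_right _ _) fun u _ => div_nonneg (by linarith [(ih u).1]) (m1 u).le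
    rw [intervalIntegral.integral_const, smul_eq_mul, mul_one] at h1
    rw [Yk]
    refine ⟨by linarith, ?_⟩
    have : max (w-1) 1 ≤ max w 1 := max_le_max (by linarith) le_rfl
    linarith

lemma Yf_bd (w : ℝ) : 1 ≤ Yf w ∧ Yf w ≤ max w 1 := Yk_bd _ w
lemma om_pos (u : ℝ) : 0 < om u := div_pos (by linarith [(Yf_bd u).1]) (m1 u)
lemma om_le (u : ℝ) : om u ≤ 1 := (div_le_one (m1 u)).2 (Yf_bd u).2
lemma om_eq {u : ℝ} (h : 1 ≤ u) : om u = Yf u / u := by rw [om, max_eq_left h]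

lemma Yf_deriv {w : ℝ} (h : 2 < w) : HasDerivAt Yf (om (w-1)) w := by
  have h1 : HasDerivAt (fun w => 1 + ∫ u in (1:ℝ)..(w-1), om u) (om (w-1)) w := by
    have := (intervalIntegral.integral_hasDerivAt_right (om_cont.intervalIntegrable 1 (w-1))
      (om_cont.stronglyMeasurableAtFilter _ _) om_cont.continuousAt).comp w ((hasDerivAt_id w).sub_const 1)
    simpa [Function.comp_def] using this.const_add 1
  refine h1.congr_of_eventuallyEq ?_
  filter_upwards [Ioi_mem_nhds h] with u hu
  rw [Yf_eq, max_eq_left (by linarith [mem_Ioi.1 hu])]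

lemma Yf_deriv' {w : ℝ} (h : w < 2) : HasDerivAt Yf 0 w :=
  (hasDerivAt_const w (1:ℝ)).congr_of_eventuallyEq (by filter_upwards [Iio_mem_nhds h] with u hu using Yf_one (le_of_lt hu))

/-- derivative of om -/
noncomputable def od (u : ℝ) : ℝ := (if 2 < u then om (u-1) - om u else - om u) / u

lemma om_deriv {u : ℝ} (h1 : 1 < u) (h2 : u ≠ 2) : HasDerivAt om (od u) u := by
  have e : om =ᶠ[𝓝 u] fun w => Yf w / w := by
    filter_upwards [Ioi_mem_nhds h1] with w hw using om_eq (le_of_lt hw)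
  have u0 : u ≠ 0 := by linarith
  refine HasDerivAt.congr_of_eventuallyEq ?_ e
  rcases lt_or_gt_of_ne h2 with h | h
  · refine ((Yf_deriv' h).div (hasDerivAt_id u) u0).congr_deriv ?_
    rw [od, if_neg (by linarith), om_eq h1.le]; simp; field_simp
  · refine ((Yf_deriv h).div (hasDerivAt_id u) u0).congr_deriv ?_
    rw [od, if_pos h, om_eq h1.le]; simp; field_simp

lemma om_mvt {a b D : ℝ} (ha : 2 ≤ a) (hab : a ≤ b) (hD : ∀ u, a < u → u < b → |od u| ≤ D) : |om b - om a| ≤ D * (b - a) := by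
  rcases hab.eq_or_lt with rfl | hlt
  · simp
  obtain ⟨c, hc, h⟩ := exists_hasDerivAt_eq_slope om od hlt om_cont.continuousOn
    fun x hx => om_deriv (by linarith [hx.1]) (by linarith [hx.1])
  have := hD c hc.1 hc.2
  rw [h, abs_div, abs_of_pos (by linarith : 0 < b - a), div_le_iff₀ (by linarith)] at this
  exact this

lemma od_bd0 {u : ℝ} (h1 : 1 < u) : |od u| ≤ 1 / u := by
  rw [od, abs_div, abs_of_pos (by linarith : 0 < u)]
  gcongr
  have := om_pos u; have := om_le u; have := om_pos (u-1); have := om_le (u-1)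
  split_ifs <;> rw [abs_le] <;> constructor <;> linarith

lemma od_bd (k : ℕ) : ∃ C > 0, ∀ u, 1 < u → |od u| ≤ C / u ^ k := by
  induction k with
  | zero => exact ⟨1, one_pos, fun u hu => (od_bd0 hu).trans (by rw [pow_zero]; exact div_le_div_of_nonneg_left zero_le_one one_pos hu.le)⟩
  | succ k ih =>
    obtain ⟨C, hC, h⟩ := ih
    refine ⟨C * 2 ^ k + 3 ^ k, by positivity, fun u hu => ?_⟩
    have u0 : 0 < u := by linarith
    rcases le_or_gt u 3 with h3 | h3
    · refine (od_bd0 hu).trans ?_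
      rw [div_le_div_iff₀ u0 (by positivity), one_mul, pow_succ]
      gcongr
      refine (pow_le_pow_left₀ u0.le h3 k).trans (by linarith [show 0 < C * 2^k by positivity])
    · have := om_mvt (a := u-1) (b := u) (D := C * 2 ^ k / u ^ k) (by linarith) (by linarith) fun w h1 h2 => by
        have w0 : 0 < w := by linarith
        refine (h w (by linarith)).trans ?_
        rw [div_le_div_iff₀ (by positivity) (by positivity), mul_assoc, ← mul_pow]
        gcongr; linarith
      rw [od, if_pos (by linarith), abs_div, abs_of_pos u0, abs_sub_comm, pow_succ, ← div_div]
      gcongr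
      refine this.trans ?_
      rw [sub_sub_cancel, mul_one]
      gcongr; linarith [show (0:ℝ) < 3 ^ k by positivity]

lemma om_lim : ∃ A : ℝ, ∀ k : ℕ, ∃ C > 0, ∀ v, 1 ≤ v → |om v - A| ≤ C / v ^ k := by
  have key : ∀ k : ℕ, ∃ C > 0, ∀ v w, 2 ≤ v → v ≤ w → |om w - om v| ≤ C / v ^ k := by
    intro k
    obtain ⟨C, hC, h⟩ := od_bd (k+2)
    refine ⟨C, hC, fun v w hv hvw => ?_⟩
    have h1 : |(-1) * om w - (-1) * om v| ≤ C / v ^ (k) * (1/v - 1/w) := by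
      have hF : ∀ ε : ℝ, (ε = 1 ∨ ε = -1) → ε * (om w - om v) ≤ C / v ^ k * (1/v - 1/w) := by
        intro ε hε
        have : AntitoneOn (fun x => ε * om x + C / v ^ k * x⁻¹) (Icc v w) := by
          refine antitoneOn_of_hasDerivWithinAt_nonpos (convex_Icc _ _)
            (f' := fun x => ε * od x + C / v ^ k * (-(x^2)⁻¹)) ?_ ?_ ?_
          · refine (om_cont.continuousOn.const_smul ε).add (continuousOn_const.mul (continuousOn_inv₀.mono fun x hx => ?_))
            simp; linarith [hx.1]
          · intro x hx
            rw [interior_Icc] at hx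
            exact (((om_deriv (by linarith [hx.1]) (by linarith [hx.1])).const_mul ε).add
              ((hasDerivAt_inv (by linarith [hx.1])).const_mul _)).hasDerivWithinAt
          · intro x hx
            rw [interior_Icc] at hx
            have h2 := h x (by linarith [hx.1])
            have h3 : C / x ^ (k+2) ≤ C / v ^ k * (x^2)⁻¹ := by
              rw [pow_add, ← div_div, div_eq_mul_inv (C / x^k)]
              have : 0 < v := by linarith
              have := hx.1.le
              gcongr
            rw [abs_le] at h2
            rcases hε with rfl | rfl <;> nlinarith
        have := this (left_mem_Icc.2 hvw) (right_mem_Icc.2 hvw) hvw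
        simp only [one_div] at *; linarith
      rw [abs_le]; constructor <;> linarith [hF 1 (.inl rfl), hF (-1) (.inr rfl)]
    rw [← mul_sub, abs_mul, abs_neg, abs_one, one_mul] at h1
    refine h1.trans (mul_le_of_le_one_right (by positivity) ?_)
    have : 1 / v ≤ 1 := by rw [div_le_one (by linarith)]; linarith
    have : 0 < 1 / w := by have : 0 < w := by linarith
                           positivity
    linarith
  have hc : CauchySeq (fun n : ℕ => om (n + 2)) := by
    obtain ⟨C, hC, h⟩ := key 1
    refine cauchySeq_of_le_tendsto_0 (fun N : ℕ => 2 * C / (N+2:ℕ)) (fun n m N hn hm => ?_)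
      (Tendsto.const_div_atTop (tendsto_natCast_atTop_atTop.comp (tendsto_add_atTop_nat 2)) _)
    have hN : (0:ℝ) ≤ N := Nat.cast_nonneg N
    have a1 := h (N+2) (n+2) (by linarith) (by gcongr)
    have a2 := h (N+2) (m+2) (by linarith) (by gcongr)
    rw [Real.dist_eq, mul_div_assoc]
    push_cast
    rw [pow_one] at a1 a2
    rw [abs_le] at *; constructor <;> linarith [a1.1, a1.2, a2.1, a2.2]
  obtain ⟨A, hA⟩ := cauchySeq_tendsto_of_complete hc
  have hA2 : |A| ≤ 1 := by
    refine le_of_tendsto hA.abs (.of_forall fun n => ?_)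
    rw [abs_of_pos (om_pos _)]; exact om_le _
  refine ⟨A, fun k => ?_⟩
  obtain ⟨C, hC, h⟩ := key k
  refine ⟨C + 2 * 2 ^ k, by positivity, fun v hv => ?_⟩
  have v0 : 0 < v := by linarith
  rcases le_or_gt v 2 with h2 | h2
  · have : |om v - A| ≤ 2 := by
      have := om_pos v; have := om_le v
      rw [abs_le] at *; constructor <;> linarith
    refine this.trans ?_
    rw [le_div_iff₀ (by positivity)]
    have := pow_le_pow_left₀ v0.le h2 k
    nlinarith
  · have : |A - om v| ≤ C / v ^ k := by
      refine le_of_tendsto (hA.sub_const (om v)).abs ?_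
      filter_upwards [eventually_ge_atTop ⌈v⌉₊] with n hn
      exact h v _ h2.le (by linarith [Nat.ceil_le.1 hn])
    rw [abs_sub_comm]
    refine this.trans ?_
    gcongr; linarith [show (0:ℝ) < 2 * 2 ^ k by positivity]
end Buch

section Ph
open Set Filter Topology

def rough (M r : ℕ) : Prop := ∀ p, p.Prime → p ∣ r → M ≤ p
open Classical in
noncomputable def ws (j M : ℕ) (R : ℝ) : ℝ := ∑ r ∈ (Finset.Icc 1 ⌊R⌋₊).filter (rough M), (1 / (r:ℝ)) ^ j
def pri (M N : ℕ) : Finset ℕ := (Finset.Ico M N).filter Nat.Prime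

lemma ws_nonneg (j M : ℕ) (R : ℝ) : 0 ≤ ws j M R := Finset.sum_nonneg fun _ _ => by positivity
lemma ws_le (M : ℕ) {R : ℝ} (hR : 0 ≤ R) : ws 0 M R ≤ R := by
  classical
  simp only [ws, pow_zero, Finset.sum_const, nsmul_eq_mul, mul_one]
  refine le_trans ?_ (Nat.floor_le hR)
  exact_mod_cast (Finset.card_filter_le _ _).trans (by simp)

lemma ws_np (j : ℕ) {M : ℕ} (R : ℝ) (h : ¬ M.Prime) : ws j (M+1) R = ws j M R := by
  unfold ws
  congr 1; ext r; simp only [Finset.mem_filter, and_congr_right_iff]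
  exact fun _ => ⟨fun h p hp hd => (Nat.le_succ _).trans (h p hp hd), fun h' p hp hd =>
    (h' p hp hd).lt_of_ne fun e => h (e ▸ hp)⟩

lemma ws_pr (j : ℕ) {M : ℕ} (R : ℝ) (h : M.Prime) : ws j M R = ws j (M+1) R + (1/(M:ℝ))^j * ws j M (R/M) := by
  classical
  have hM : (0:ℝ) < M := by exact_mod_cast h.pos
  unfold ws
  rw [← Finset.sum_filter_not_add_sum_filter (s := (Finset.Icc 1 ⌊R⌋₊).filter (rough M)) (p := fun r => M ∣ r)]
  congr 1
  · refine Finset.sum_congr ?_ fun _ _ => rfl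
    ext r; simp only [Finset.mem_filter, and_assoc, and_congr_right_iff]
    exact fun _ => ⟨fun h' p hp hd => (h'.1 p hp hd).lt_of_ne fun e => h'.2 (e ▸ hd), fun h' =>
      ⟨fun p hp hd => (Nat.le_succ _).trans (h' p hp hd), fun hd => absurd (h' M h hd) (by simp)⟩⟩
  · rw [Finset.mul_sum]
    symm
    refine Finset.sum_nbij' (fun r => M * r) (fun r => r / M) ?_ ?_ ?_ ?_ ?_
    · intro r hr
      simp only [Finset.mem_filter, Finset.mem_Icc] at hr ⊢
      refine ⟨⟨⟨Nat.mul_pos h.pos hr.1.1, ?_⟩, fun p hp hd => ?_⟩, dvd_mul_right _ _⟩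
      · have := (Nat.le_floor_iff' (by omega)).1 hr.1.2
        refine Nat.le_floor ?_
        push_cast; rwa [le_div_iff₀ hM, mul_comm] at this
      · rcases (hp.dvd_mul).1 hd with h1 | h1
        · exact ((Nat.prime_dvd_prime_iff_eq hp h).1 h1).ge
        · exact hr.2 p hp h1
    · intro r hr
      simp only [Finset.mem_filter, Finset.mem_Icc] at hr ⊢
      obtain ⟨⟨⟨h1, h2⟩, h3⟩, k, rfl⟩ := hr
      rw [Nat.mul_div_cancel_left _ h.pos]
      have k0 : 0 < k := Nat.pos_of_mul_pos_left h1
      refine ⟨⟨k0, Nat.le_floor ?_⟩, fun p hp hd => h3 p hp (hd.mul_left _)⟩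
      have := (Nat.le_floor_iff' (by omega)).1 h2
      push_cast at this; rwa [le_div_iff₀ hM, mul_comm]
    · intro r _; exact Nat.mul_div_cancel_left _ h.pos
    · intro r hr; exact Nat.mul_div_cancel' (Finset.mem_filter.1 hr).2
    · intro r _; push_cast; rw [← mul_pow]; ring

lemma mem_pri {M N p : ℕ} : p ∈ pri M N ↔ M ≤ p ∧ p < N ∧ p.Prime := by
  simp [pri, Finset.mem_filter, and_assoc]

lemma pri_succ {M N : ℕ} (h : M ≤ N) (F : ℕ → ℝ) : ∑ p ∈ pri M (N+1), F p = ∑ p ∈ pri M N, F p + if N.Prime then F N else 0 := by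
  simp only [pri, Finset.sum_filter]
  rw [Finset.sum_Ico_succ_top h]

lemma ws_tel (j : ℕ) {M N : ℕ} (h : M ≤ N) (R : ℝ) : ws j M R = ws j N R + ∑ p ∈ pri M N, (1/(p:ℝ))^j * ws j p (R/p) := by
  induction N, h using Nat.le_induction with
  | base => simp [pri]
  | succ N hN ih =>
    rw [pri_succ hN, ih]
    split_ifs with hp
    · rw [ws_pr j R hp]; ring
    · rw [ws_np j R hp]; ring

lemma ws_one (j : ℕ) {N : ℕ} {R : ℝ} (h1 : 1 ≤ R) (h2 : R < N) : ws j N R = 1 := by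
  classical
  unfold ws
  rw [show (Finset.Icc 1 ⌊R⌋₊).filter (rough N) = {1} from ?_]
  · simp
  · ext r
    simp only [Finset.mem_filter, Finset.mem_Icc, Finset.mem_singleton]
    constructor
    · rintro ⟨⟨a, b⟩, c⟩
      by_contra hr
      have := c _ (Nat.minFac_prime hr) (Nat.minFac_dvd r)
      have h4 := Nat.minFac_le a
      have : (N:ℝ) ≤ R := (Nat.le_floor_iff (by linarith)).1 (this.trans (h4.trans b))
      linarith
    · rintro rfl
      exact ⟨⟨le_rfl, Nat.le_floor (by simpa using h1)⟩, fun p hp hd => absurd (Nat.dvd_one.1 hd) hp.one_lt.ne'⟩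

lemma ws_pi {N : ℕ} {R : ℝ} (hN : 0 < N) (h1 : (N:ℝ) ≤ R) (h2 : R < (N:ℝ)^2) : ws 0 N R = 1 + (pri N (⌊R⌋₊+1)).card := by
  have hN' : (1:ℝ) ≤ N := by exact_mod_cast hN
  rw [ws_tel 0 ((Nat.le_floor h1).trans (Nat.le_succ _)) R, ws_one 0 (by linarith) (by push_cast; exact Nat.lt_floor_add_one R),
    Finset.sum_congr rfl (g := fun _ => (1:ℝ)) fun p hp => ?_]
  · simp
  · obtain ⟨a, b, c⟩ := mem_pri.1 hp
    have hp0 : (0:ℝ) < p := by exact_mod_cast c.pos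
    have hb : (p:ℝ) ≤ R := (Nat.le_floor_iff (by linarith)).1 (Nat.lt_succ_iff.1 b)
    have ha : (N:ℝ) ≤ p := by exact_mod_cast a
    rw [pow_zero, one_mul, ws_one 0 (by rwa [le_div_iff₀ hp0, one_mul])]
    rw [div_lt_iff₀ hp0]; nlinarith

lemma logM {M : ℕ} (h : 2 ≤ M) : 0.69 < log M := log_ge (by exact_mod_cast h)

lemma Adirect : ∃ C > 0, ∀ (M : ℕ) (R : ℝ), 2 ≤ M → (M:ℝ) ≤ R → R < (M:ℝ)^2 →
    |ws 0 M R - R / log R + M / log M| ≤ C * R / log M ^ 2 := by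
  obtain ⟨C, hC, h⟩ := pi_pnt
  refine ⟨8 + 2 * C, by positivity, fun M R hM h1 h2 => ?_⟩
  have hM' : (2:ℝ) ≤ M := by exact_mod_cast hM
  have ls := logM hM
  have lt : log M ≤ log R := log_le_log (by linarith) h1
  have c1 := h R (by linarith)
  have c2 := h M hM'
  rw [Nat.floor_natCast] at c2
  have hcard : ((pri M (⌊R⌋₊+1)).card : ℝ) + Nat.primeCounting M = Nat.primeCounting ⌊R⌋₊ + if M.Prime then 1 else 0 := by
    have hle : M ≤ ⌊R⌋₊ := Nat.le_floor h1
    have e : ∀ n, (Nat.primeCounting n : ℝ) = ∑ p ∈ Finset.Ico 0 (n+1), if p.Prime then 1 else 0 := fun n => by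
      rw [Nat.primeCounting, Nat.primeCounting', Nat.count_eq_card_filter_range, Finset.range_eq_Ico, Finset.card_filter]; push_cast; rfl
    rw [e, e, pri, Finset.card_filter, ← Finset.sum_Ico_consecutive _ (Nat.zero_le M) (hle.trans (Nat.le_succ _) : M ≤ ⌊R⌋₊+1),
      Finset.sum_Ico_succ_top (Nat.zero_le M)]
    push_cast; ring
  rw [ws_pi (by omega) h1 h2]
  have hq : (0:ℝ) ≤ (if M.Prime then 1 else 0) ∧ (if M.Prime then (1:ℝ) else 0) ≤ 1 := by split_ifs <;> norm_num
  have e1 : C * R / log R ^ 2 ≤ C * R / log M ^ 2 := by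
    have : 0 < C * R := mul_pos hC (by linarith)
    gcongr
  have e2 : C * M / log M ^ 2 ≤ C * R / log M ^ 2 := by gcongr
  have e3 : 2 ≤ 8 * R / log M ^ 2 := by
    rw [le_div_iff₀ (by positivity)]
    have := Real.add_one_le_exp (log M / 2)
    have h3 : exp (log M / 2) ^ 2 = M := by rw [← exp_nat_mul]; push_cast; rw [mul_div_cancel₀ _ two_ne_zero, exp_log (by linarith)]
    nlinarith
  rw [show (8 + 2 * C) * R / log M ^ 2 = 8 * R / log M ^ 2 + 2 * (C * R / log M ^ 2) by ring]
  rw [abs_le] at *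
  constructor <;> linarith [c1.1, c1.2, c2.1, c2.2]

lemma int_inv (k : ℕ) (c : ℝ) {a b : ℝ} (ha : 0 < a) (hab : a ≤ b) : ∫ u in a..b, c / u ^ (k+2) = c / (k+1) * (1/a^(k+1) - 1/b^(k+1)) := by
  have : ∀ u ∈ uIcc a b, HasDerivAt (fun u : ℝ => -(c / (k+1)) * (u ^ (k+1))⁻¹) (c / u ^ (k+2)) u := by
    intro u hu
    rw [uIcc_of_le hab] at hu
    have u0 : u ≠ 0 := by linarith [hu.1]
    refine (((hasDerivAt_pow (k+1) u).inv (pow_ne_zero _ u0)).const_mul _).congr_deriv ?_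
    have : (k:ℝ) + 1 ≠ 0 := by positivity
    push_cast
    field_simp; ring
  rw [intervalIntegral.integral_eq_sub_of_hasDerivAt this]
  · simp only [one_div]; ring
  · refine ContinuousOn.intervalIntegrable fun u hu => ContinuousAt.continuousWithinAt ?_
    rw [uIcc_of_le hab] at hu
    have u0 : u ^ (k+2) ≠ 0 := pow_ne_zero _ (by linarith [hu.1])
    fun_prop (disch := assumption)
lemma int_inv_le (k : ℕ) {c : ℝ} (hc : 0 ≤ c) {a b : ℝ} (ha : 0 < a) (hab : a ≤ b) : ∫ u in a..b, c / u ^ (k+2) ≤ c / (k+1) / a ^ (k+1) := by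
  rw [int_inv k c ha hab, div_eq_mul_one_div (c / (k+1)) (a^(k+1))]
  have : 0 < b := by linarith
  refine mul_le_mul_of_nonneg_left ?_ (by positivity)
  linarith [show 0 < 1 / b ^ (k+1) by positivity]
lemma cont_inv (k : ℕ) (c : ℝ) {a b : ℝ} (ha : 0 < a) : ContinuousOn (fun u : ℝ => c / u ^ k) (Icc a b) := fun u hu => by
  have u0 : u ^ k ≠ 0 := pow_ne_zero _ (by linarith [hu.1])
  exact ContinuousAt.continuousWithinAt (by fun_prop (disch := assumption))

lemma priP {M N : ℕ} (hM : 2 ≤ M) : (∀ p ∈ pri M N, p.Prime ∧ log M ≤ log p ∧ log p ≤ log N) ∧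
    ∀ p : ℕ, p.Prime → log M < log p → log p < log N → p ∈ pri M N := by
  have hM' : (0:ℝ) < M := by positivity
  refine ⟨fun p hp => ?_, fun p hp h1 h2 => ?_⟩
  · obtain ⟨a, b, c⟩ := mem_pri.1 hp
    have hp0 : (0:ℝ) < p := by exact_mod_cast c.pos
    exact ⟨c, log_le_log hM' (by exact_mod_cast a), log_le_log hp0 (by exact_mod_cast b.le)⟩
  · have hp0 : (0:ℝ) < p := by exact_mod_cast hp.pos
    have hN0 : (0:ℝ) < N := by
      rcases Nat.eq_zero_or_pos N with rfl | h
      · simp at h2; have := logM hM; linarith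
      · exact_mod_cast h
    exact mem_pri.2 ⟨by exact_mod_cast ((log_lt_log_iff hM' hp0).1 h1).le, by exact_mod_cast (log_lt_log_iff hp0 hN0).1 h2, hp⟩

lemma log2_le {M : ℕ} (hM : 2 ≤ M) : log 2 ≤ log M := log_le_log two_pos (by exact_mod_cast hM)

lemma abel2 (k : ℕ) : ∃ C > 0, ∀ (a b c : ℝ) (P : Finset ℕ) (g g' : ℝ → ℝ) (S : Set ℝ), log 2 ≤ a → a ≤ b →
    (∀ p ∈ P, p.Prime ∧ a ≤ log p ∧ log p ≤ b) → (∀ p : ℕ, p.Prime → a < log p → log p < b → p ∈ P) → S.Countable →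
    ContinuousOn g (Icc a b) → (∀ u ∈ Ioo a b \ S, HasDerivAt g (g' u) u) → (∀ u ∈ Ioo a b \ S, |g' u| ≤ c / u ^ (k+1)) →
    |g a| ≤ c / a ^ k → |∑ p ∈ P, g (log p) / p - ∫ σ in a..b, g σ / σ| ≤ C * c / a ^ (k+1) := by
  obtain ⟨C, hC, h⟩ := abel
  refine ⟨C * 2, by positivity, fun a b c P g g' S h2 hab h3 h4 h5 h6 h7 h8 h9 => ?_⟩
  have a0 : 0 < a := by linarith [log2_lb]
  have c0 : 0 ≤ c := by
    have := (abs_nonneg _).trans h9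
    rwa [le_div_iff₀ (by positivity), zero_mul] at this
  refine (h a b P g g' _ S h2 hab h3 h4 h5 h6 h7 h8 (cont_inv (k+1) c a0)).trans ?_
  rw [mul_assoc, mul_div_assoc]
  refine mul_le_mul_of_nonneg_left ?_ hC.le
  have i := int_inv_le k c0 a0 hab
  have e1 : |g a| / a ≤ c / a ^ (k+1) := by rw [pow_succ, ← div_div]; gcongr
  have e2 : c / (k+1) / a ^ (k+1) ≤ c / a ^ (k+1) := by
    gcongr; exact div_le_self c0 (by linarith [(Nat.cast_nonneg k : (0:ℝ) ≤ k)])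
  simp only [div_div, ← pow_succ] at *
  rw [mul_div_assoc]; linarith

lemma sumA1 : ∃ C > 0, ∀ M N : ℕ, 2 ≤ M → M ≤ N → ∑ p ∈ pri M N, 1 / log p ^ 2 / p ≤ 1 / (2 * log M ^ 2) + C / log M ^ 3 := by
  obtain ⟨C, hC, h⟩ := abel2 2
  refine ⟨C * 2, by positivity, fun M N hM hN => ?_⟩
  have ls := logM hM
  have lN : log M ≤ log N := log_le_log (by positivity) (by exact_mod_cast hN)
  have l0 : 0 < log M := by linarith
  have := h (log M) (log N) 2 (pri M N) (fun u => 1 / u ^ 2) (fun u => -(2 / u ^ 3)) ∅ (log2_le hM) lN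
    (priP hM).1 (priP hM).2 countable_empty (cont_inv 2 1 l0) (fun u hu => by
      have u0 : u ≠ 0 := by linarith [hu.1.1]
      simp only [one_div]
      refine ((hasDerivAt_pow 2 u).inv (pow_ne_zero _ u0)).congr_deriv ?_
      simp; field_simp) (fun u hu => by
      have u0 : 0 < u := by linarith [hu.1.1]
      rw [abs_neg, abs_of_pos (by positivity)]) (by rw [abs_of_pos (by positivity)]; gcongr; norm_num)
  have i1 := int_inv_le 1 zero_le_one l0 lN
  have e : ∫ σ in log M..log N, 1 / σ ^ 2 / σ = ∫ u in log M..log N, 1 / u ^ (1+2) := by simp only [div_div, ← pow_succ]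
  have t := (abs_le.1 this).2
  beta_reduce at t
  rw [e] at t
  have e2 : (1:ℝ) / ((1:ℕ)+1) / log M ^ (1+1) = 1 / (2 * log M ^ 2) := by push_cast; rw [div_div]; norm_num
  linarith

lemma sumA2 : ∃ C > 0, ∀ (N : ℕ) (R : ℝ), 2 ≤ N → 4 ≤ R → (N:ℝ) - 1 ≤ √R → ∑ p ∈ pri 2 N, (p:ℝ) / log p ≤ C * R / log R ^ 2 := by
  obtain ⟨C, hC, h⟩ := pi_pnt
  refine ⟨12 + 24 * C, by positivity, fun N R hN hR hNR => ?_⟩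
  set z := √R
  have hz2 : z ^ 2 = R := Real.sq_sqrt (by linarith)
  have hz : 2 ≤ z := by nlinarith [Real.sqrt_nonneg R]
  have lz := log_ge hz
  have lR : log R = 2 * log z := by rw [← hz2, log_pow]; norm_num
  have hp : ∀ p ∈ pri 2 N, (p:ℝ) / log p ≤ 3 * z / log z := by
    intro p hp
    obtain ⟨a, b, c⟩ := mem_pri.1 hp
    have h2 : (2:ℝ) ≤ p := by exact_mod_cast a
    have pz : (p:ℝ) ≤ z := by
      have : (p:ℝ) + 1 ≤ N := by exact_mod_cast b
      linarith
    have lp := log_ge h2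
    rw [div_le_div_iff₀ (by linarith) (by linarith)]
    have h3 : log z ≤ log p + z / p := by
      have := log_le_sub_one_of_pos (show 0 < z / p by positivity)
      rw [log_div (by positivity) (by positivity)] at this; linarith
    have h4 : p * log z ≤ p * log p + z := by
      refine (mul_le_mul_of_nonneg_left h3 (by positivity)).trans (le_of_eq ?_)
      field_simp
    nlinarith
  have hc : ((pri 2 N).card : ℝ) ≤ z / log z + C * z / log z ^ 2 := by
    have h1 := (abs_le.1 (h z hz)).2
    have : (pri 2 N).card ≤ Nat.primeCounting ⌊z⌋₊ := by
      rw [Nat.primeCounting, Nat.primeCounting', Nat.count_eq_card_filter_range]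
      refine Finset.card_le_card fun p hp => ?_
      obtain ⟨a, b, c⟩ := mem_pri.1 hp
      rw [Finset.mem_filter, Finset.mem_range, Nat.lt_succ_iff]
      have : (p:ℝ) + 1 ≤ N := by exact_mod_cast b
      exact ⟨Nat.le_floor (by linarith), c⟩
    have : ((pri 2 N).card : ℝ) ≤ Nat.primeCounting ⌊z⌋₊ := by exact_mod_cast this
    linarith
  refine (Finset.sum_le_card_nsmul _ _ _ hp).trans ?_
  rw [nsmul_eq_mul, lR, ← hz2]
  have h5 : C * z / log z ^ 2 ≤ 2 * C * z / log z := by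
    rw [div_le_div_iff₀ (by positivity) (by positivity)]
    have : 0 ≤ C * z * log z * (2 * log z - 1) := mul_nonneg (by positivity) (by linarith)
    nlinarith
  refine (mul_le_mul_of_nonneg_right (hc.trans (add_le_add le_rfl h5)) (by positivity)).trans (le_of_eq ?_)
  field_simp; ring
end Ph

section Qa
open Set Filter Topology

lemma gder {t σ κ : ℝ} (h0 : 0 < σ) (h1 : 2 * σ < t) (h2 : σ ≠ t / 3) :
    HasDerivAt (fun σ => (om (t/σ-1) - κ)/σ) (od (t/σ-1) * (-(t/σ^2))/σ - (om (t/σ-1) - κ)/σ^2) σ := by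
  have e1 : 1 < t/σ-1 := by rw [lt_sub_iff_add_lt, lt_div_iff₀ h0]; linarith
  have e2 : t/σ-1 ≠ 2 := fun h => h2 (by rw [sub_eq_iff_eq_add, div_eq_iff h0.ne'] at h; linarith)
  have d : HasDerivAt (fun σ : ℝ => t/σ-1) (-(t/σ^2)) σ := by
    refine (((hasDerivAt_inv h0.ne').const_mul t).sub_const 1).congr_deriv ?_
    rw [mul_neg, div_eq_mul_inv]
  refine ((((om_deriv e1 e2).comp σ d).sub_const κ).div (hasDerivAt_id σ) h0.ne').congr_deriv ?_
  simp; field_simp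

lemma gcont {t κ a b : ℝ} (ha : 0 < a) : ContinuousOn (fun σ => (om (t/σ-1) - κ)/σ) (Icc a b) := fun σ hσ => by
  have : σ ≠ 0 := by linarith [hσ.1]
  exact (((om_cont.continuousAt.comp ((continuousAt_const.div continuousAt_id this).sub continuousAt_const)).sub continuousAt_const).div continuousAt_id this).continuousWithinAt

lemma gint {t κ a b : ℝ} (ha : 0 < a) (hab : a ≤ b) (hb : 2 * b ≤ t) :
    ∫ σ in a..b, (om (t/σ-1) - κ)/σ/σ = (om (t/a) - κ)/a - (om (t/b) - κ)/b := by
  have t0 : 0 < t := by linarith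
  have hd : ∀ σ ∈ Ioo a b, HasDerivAt (fun σ : ℝ => -(1/t * Yf (t/σ) - κ/σ)) ((om (t/σ-1) - κ)/σ/σ) σ := by
    intro σ hσ
    have s0 : σ ≠ 0 := by linarith [hσ.1]
    have e1 : 2 < t/σ := by rw [lt_div_iff₀ (by linarith [hσ.1])]; linarith [hσ.2]
    have d : ∀ t : ℝ, HasDerivAt (fun σ : ℝ => t/σ) (-(t/σ^2)) σ := fun t => by
      refine ((hasDerivAt_inv s0).const_mul t).congr_deriv ?_
      rw [mul_neg, div_eq_mul_inv]
    refine (((((Yf_deriv e1).comp σ (d t)).const_mul (1/t)).sub (d κ)).neg).congr_deriv ?_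
    field_simp; ring
  have hc : ContinuousOn (fun σ : ℝ => -(1/t * Yf (t/σ) - κ/σ)) (Icc a b) := fun σ hσ => by
    have : σ ≠ 0 := by linarith [hσ.1]
    exact ((continuousAt_const.mul (Yf_cont.continuousAt.comp (continuousAt_const.div continuousAt_id this))).sub (continuousAt_const.div continuousAt_id this)).neg.continuousWithinAt
  rw [intervalIntegral.integral_eq_sub_of_hasDerivAt_of_le hab hc hd]
  · have b0 : 0 < b := by linarith
    have : 1 ≤ t / a := by rw [le_div_iff₀ ha]; linarith
    have : 1 ≤ t / b := by rw [le_div_iff₀ b0]; linarith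
    rw [om_eq ‹1 ≤ t/a›, om_eq ‹1 ≤ t/b›]; field_simp; ring
  · rw [intervalIntegrable_iff_integrableOn_Icc_of_le hab]
    refine ContinuousOn.integrableOn_Icc ((gcont ha).div continuousOn_id fun σ hσ => ?_)
    simp; linarith [hσ.1]

set_option maxHeartbeats 1000000 in
lemma AStep : ∃ C > 0, ∀ (K : ℝ) (M : ℕ) (R : ℝ), 0 ≤ K → 2 ≤ M → (M:ℝ)^2 ≤ R →
    (∀ p : ℕ, M ≤ p → (p:ℝ)^2 ≤ R → |ws 0 p (R/p) - (R/p) * om (log (R/p) / log p) / log p + p / log p| ≤ K * (R/p) / log p ^ 2) →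
    |ws 0 M R - R * om (log R / log M) / log M + M / log M| ≤ (K * (1/2 + C / log M) + C) * R / log M ^ 2 := by
  obtain ⟨C1, hC1, h1⟩ := Adirect
  obtain ⟨C2, hC2, h2⟩ := abel2 1
  obtain ⟨C3, hC3, h3⟩ := sumA1
  obtain ⟨C4, hC4, h4⟩ := sumA2
  refine ⟨C1 + 3 * C2 + C3 + C4 + 3, by positivity, fun K M R hK hM hR ih => ?_⟩
  have hM' : (2:ℝ) ≤ M := by exact_mod_cast hM
  have hR4 : 4 ≤ R := by nlinarith only [hM', hR]
  have ls := logM hM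
  set s := log M
  set t := log R
  have s0 : 0 < s := by linarith
  have hst : 2 * s ≤ t := by
    have := log_le_log (by positivity) hR
    rwa [log_pow] at this
  have t0 : 0 < t := by linarith
  set N := Nat.sqrt ⌊R⌋₊ + 1
  have hN1 : ((N:ℝ) - 1)^2 ≤ R := by
    have : ((Nat.sqrt ⌊R⌋₊ ^ 2 : ℕ):ℝ) ≤ ⌊R⌋₊ := by exact_mod_cast Nat.sqrt_le' _
    push_cast [N] at *; rw [add_sub_cancel_right]; exact this.trans (Nat.floor_le (by linarith))
  have hN2 : R < (N:ℝ)^2 := by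
    have : ⌊R⌋₊ + 1 ≤ N^2 := Nat.succ_le_of_lt (Nat.lt_succ_sqrt' _)
    exact (Nat.lt_floor_add_one R).trans_le (by exact_mod_cast this)
  have hz := Real.sq_sqrt (show 0 ≤ R by linarith)
  have hz0 := Real.sqrt_nonneg R
  have hz2 : 2 ≤ √R := by nlinarith only [hz, hz0, hR4]
  have hNz : (N:ℝ) - 1 ≤ √R := Real.le_sqrt_of_sq_le hN1
  have hMz : M ≤ √R := Real.le_sqrt_of_sq_le hR
  have hMN : M ≤ N := by
    have : (M:ℝ) < N := lt_of_pow_lt_pow_left₀ 2 (by positivity) (hR.trans_lt hN2)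
    exact_mod_cast this.le
  have hszle : s ≤ √R := (log_le_self (by linarith)).trans hMz
  have lN : t < 2 * log N := by
    have := log_lt_log (by linarith) hN2
    rwa [log_pow] at this
  have a1 := h1 N R (hM.trans hMN) (by nlinarith only [hNz, hz, hz2]) hN2
  have hNlog : N / log N ≤ 2 * R / s ^ 2 := by
    have : (N:ℝ) / log N ≤ 2 * √R / s := div_le_div₀ (by positivity) (by linarith) s0 (by linarith)
    refine this.trans ?_
    rw [div_le_div_iff₀ s0 (by positivity)]
    have : √R * s * s ≤ √R * √R * s := by nlinarith only [mul_le_mul_of_nonneg_left hszle (mul_nonneg hz0 s0.le)]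
    rw [show √R * √R = R by rw [← sq, hz]] at this; linarith only [this]
  have hN0 : 0 ≤ N / log N := div_nonneg (by positivity) (by linarith)
  have hMs : M / s ≤ R / s ^ 2 := by
    rw [div_le_div_iff₀ s0 (by positivity)]
    have : M * s ≤ √R * √R := mul_le_mul hMz hszle s0.le hz0
    nlinarith only [this, hz, s0]
  have hM0 : 0 ≤ M / s := by positivity
  have a1' : C1 * R / log N ^ 2 ≤ C1 * R / s ^ 2 := by
    have : 0 < C1 * R := by positivity
    have : s ≤ log N := by linarith
    gcongr
  have mem : ∀ p ∈ pri M N, (p:ℝ)^2 ≤ R ∧ 2 ≤ p ∧ p.Prime ∧ s ≤ log p ∧ log p ≤ t/2 := fun p hp => by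
    obtain ⟨a, b, c⟩ := mem_pri.1 hp
    have hp0 : (0:ℝ) < p := by exact_mod_cast c.pos
    have b' : (p:ℝ) ≤ N - 1 := by
      have : (p:ℝ) + 1 ≤ N := by exact_mod_cast b
      linarith
    have h5 : (p:ℝ)^2 ≤ R := (pow_le_pow_left₀ hp0.le b' 2).trans hN1
    have h6 := log_le_log (by positivity) h5
    rw [log_pow] at h6
    push_cast at h6
    exact ⟨h5, hM.trans a, c, log_le_log (by linarith) (by exact_mod_cast a), by linarith⟩
  have a2 := h2 s (t/2) 3 (pri M N) (fun σ => (om (t/σ-1) - 0)/σ) _ {t/3} (log2_le hM) (by linarith)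
    (fun p hp => (mem p hp).2.2) (fun p hp h1 h2 => (priP hM).2 p hp h1 (by linarith)) (countable_singleton _) (gcont s0)
    (fun u hu => gder (by linarith [hu.1.1]) (by linarith [hu.1.2]) (by simpa using hu.2)) (fun u hu => by
      have u0 : 0 < u := by linarith [hu.1.1]
      have ut : 2 * u < t := by linarith [hu.1.2]
      have e : 2 < t / u := by rw [lt_div_iff₀ u0]; linarith
      have o := od_bd0 (u := t/u-1) (by linarith)
      have o1 := om_pos (t/u-1); have o2 := om_le (t/u-1)
      have x1 : |od (t/u-1) * (-(t/u^2))/u| ≤ 2 / u^2 := by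
        rw [abs_div, abs_mul, abs_neg, abs_of_pos u0, abs_of_pos (by positivity : 0 < t/u^2)]
        have : |od (t/u-1)| ≤ 2 * u / t := o.trans (by
          rw [div_le_div_iff₀ (by linarith) (by linarith), show 2 * u * (t/u-1) = 2 * t - 2 * u by field_simp]; linarith)
        refine (div_le_div_of_nonneg_right (mul_le_mul_of_nonneg_right this (by positivity)) u0.le).trans (le_of_eq ?_)
        field_simp
      have x2 : |(om (t/u-1) - 0)/u^2| ≤ 1 / u^2 := by
        rw [sub_zero, abs_of_pos (by positivity)]; gcongr
      refine (abs_sub _ _).trans ((add_le_add x1 x2).trans (le_of_eq (by ring)))) (by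
      have o1 := om_pos (t/s-1); have o2 := om_le (t/s-1)
      rw [sub_zero, abs_of_pos (by positivity), pow_one]; gcongr; linarith)
  rw [gint s0 (by linarith) (by linarith), show t / (t/2) = 2 by field_simp, om_eq one_le_two, Yf_one le_rfl] at a2
  have e2 : ((1:ℝ)/2 - 0)/(t/2) = 1/t := by ring
  rw [e2, sub_zero] at a2
  have a3 : |∑ p ∈ pri M N, ws 0 p (R/p) - R * ∑ p ∈ pri M N, (om (t / log p - 1) - 0) / log p / p| ≤
      ∑ p ∈ pri M N, (p / log p + K * R * (1 / log p ^ 2 / p)) := by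
    rw [Finset.mul_sum, ← Finset.sum_sub_distrib]
    refine (Finset.abs_sum_le_sum_abs _ _).trans (Finset.sum_le_sum fun p hp => ?_)
    obtain ⟨b1, b2, b3, b4, b5⟩ := mem p hp
    have i := ih p (mem_pri.1 hp).1 b1
    have hp0 : (0:ℝ) < p := by exact_mod_cast b3.pos
    have lp : 0 < log p := by linarith
    rw [log_div (by linarith) hp0.ne', sub_div, div_self lp.ne'] at i
    have q : 0 ≤ p / log p := by positivity
    rw [show R * ((om (t / log p - 1) - 0) / log p / p) = (R/p) * om (t / log p - 1) / log p by ring,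
      show K * R * (1 / log p ^ 2 / p) = K * (R/p) / log p ^ 2 by ring]
    rw [abs_le] at i ⊢; constructor <;> linarith [i.1, i.2]
  rw [Finset.sum_add_distrib, ← Finset.mul_sum] at a3
  have a4 := h3 M N hM hMN
  have a5 : ∑ p ∈ pri M N, (p:ℝ) / log p ≤ C4 * R / s ^ 2 := by
    refine (Finset.sum_le_sum_of_subset_of_nonneg (fun p hp => ?_) fun p hp _ => ?_).trans
      ((h4 N R (hM.trans hMN) hR4 hNz).trans (by gcongr; linarith))
    · have := mem_pri.1 hp; exact mem_pri.2 ⟨hM.trans this.1, this.2⟩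
    · have := (mem_pri.1 hp).1
      have := logM this
      positivity
  have a6 := mul_le_mul_of_nonneg_left a4 (show 0 ≤ K * R by positivity)
  rw [ws_tel 0 hMN R]
  simp only [pow_zero, one_mul]
  have a7 : R * |∑ p ∈ pri M N, (om (t / log p - 1) - 0) / log p / p - (om (t / s) / s - 1/t)| ≤ R * (C2 * 3 / s^(1+1)) :=
    mul_le_mul_of_nonneg_left a2 (by linarith)
  rw [← abs_of_pos (show 0 < R by linarith), ← abs_mul, abs_of_pos (show 0 < R by linarith), mul_sub, mul_sub] at a7
  have fin : (K * (1/2 + (C1 + 3 * C2 + C3 + C4 + 3) / s) + (C1 + 3 * C2 + C3 + C4 + 3)) * R / s ^ 2 =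
    C1 * R / s^2 + 2 * R/s^2 + R/s^2 + C4 * R / s^2 + K * R * (1 / (2 * s^2) + C3 / s^3) + R * (C2 * 3 / s^(1+1)) + C3 * R/s^2
      + K * R * ((C1 + 3 * C2 + C4 + 3) / s^3) := by field_simp; ring
  rw [fin]
  have p1 : 0 ≤ C3 * R/s^2 := by positivity
  have p2 : 0 ≤ K * R * ((C1 + 3 * C2 + C4 + 3) / s^3) := by positivity
  rw [show R * (om (t/s)/s) = R * om (t/s) / s by ring, show R * (1/t) = R / t by ring] at a7
  rw [abs_le] at *
  constructor <;> linarith [a1.1, a1.2, a3.1, a3.2, a7.1, a7.2]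

theorem phiA : ∃ K > 0, ∀ (M : ℕ) (R : ℝ), 2 ≤ M → (M:ℝ) ≤ R →
    |ws 0 M R - R * om (log R / log M) / log M + M / log M| ≤ K * R / log M ^ 2 := by
  obtain ⟨C1, hC1, h1⟩ := Adirect
  obtain ⟨C, hC, h⟩ := AStep
  set K := C1 + 4 * C + 4 * (4 * C)^2
  have hK : 0 < K := by positivity
  refine ⟨K, hK, ?_⟩
  suffices H : ∀ (n : ℕ) (M : ℕ) (R : ℝ), 2 ≤ M → (M:ℝ) ≤ R → R ≤ 2 ^ n →
      |ws 0 M R - R * om (log R / log M) / log M + M / log M| ≤ K * R / log M ^ 2 by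
    intro M R hM hR
    obtain ⟨n, hn⟩ := pow_unbounded_of_one_lt R (one_lt_two)
    exact H n M R hM hR hn.le
  intro n
  induction n with
  | zero => intro M R hM hR h2; norm_num at h2; have : (2:ℝ) ≤ M := by exact_mod_cast hM
            linarith
  | succ n ih =>
    intro M R hM hR h2
    have hM' : (2:ℝ) ≤ M := by exact_mod_cast hM
    have ls := logM hM
    have s0 : 0 < log M := by linarith
    have R0 : 0 < R := by linarith
    have tt : log M ≤ log R := log_le_log (by linarith) hR
    rcases lt_or_ge (log M) (4 * C) with hs | hs
    · have b1 := ws_nonneg 0 M R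
      have b2 := ws_le M R0.le
      have o1 := om_pos (log R / log M); have o2 := om_le (log R / log M)
      have b3 : R * om (log R / log M) / log M ≤ 2 * R := by
        rw [div_le_iff₀ s0]; nlinarith only [R0, ls, o1, o2]
      have b4 : 0 < R * om (log R / log M) / log M := by positivity
      have b5 : M / log M ≤ 2 * R := by rw [div_le_iff₀ s0]; nlinarith only [R0, ls, hR]
      have b6 : 0 < M / log M := by positivity
      have : 4 * R ≤ K * R / log M ^ 2 := by
        rw [le_div_iff₀ (by positivity)]
        have : 4 * log M ^ 2 ≤ K := by
          have : log M ^ 2 ≤ (4 * C)^2 := by gcongr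
          simp only [K]; linarith
        nlinarith only [this, R0]
      rw [abs_le]; constructor <;> linarith
    rcases lt_or_ge R ((M:ℝ)^2) with h3 | h3
    · have := h1 M R hM hR h3
      have e : om (log R / log M) = log M / log R := by
        have l2 := log_lt_log R0 h3
        rw [log_pow] at l2; push_cast at l2
        rw [om_eq (by rwa [le_div_iff₀ s0, one_mul]), Yf_one (by rw [div_le_iff₀ s0]; exact l2.le), one_div, inv_div]
      rw [e, show R * (log M / log R) / log M = R / log R by field_simp]
      refine this.trans ?_
      gcongr
      simp only [K]; linarith [show 0 ≤ 4 * C + 4 * (4 * C)^2 by positivity]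
    · refine (h K M R hK.le hM h3 fun p hp hpR => ?_).trans ?_
      · have hp2 : (2:ℝ) ≤ p := by exact_mod_cast hM.trans hp
        have hp0 : (0:ℝ) < p := by linarith
        refine ih p (R/p) (hM.trans hp) ?_ ?_
        · rw [le_div_iff₀ hp0]; nlinarith only [hpR]
        · rw [div_le_iff₀ hp0]
          rw [pow_succ] at h2
          exact h2.trans (by gcongr)
      · gcongr
        have : C / log M ≤ 1/4 := by rw [div_le_iff₀ s0]; linarith
        have : 4 * C ≤ K := by simp only [K]; linarith [show 0 ≤ C1 + 4 * (4 * C)^2 by positivity]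
        nlinarith
end Qa

section Qb
open Set Filter Topology

noncomputable def LM (M : ℕ) : ℝ := ∑ p ∈ (Finset.range M).filter Nat.Prime, log p / ((p:ℝ) - 1)
noncomputable def XX (M : ℕ) (R : ℝ) : ℝ := ws 0 M R / R - PiM M
noncomputable def DD (M : ℕ) (R : ℝ) : ℝ := ws 1 M R - PiM M * (log R + eulerMascheroniConstant + LM M)

lemma PiM_succ (M : ℕ) : PiM (M+1) = PiM M * (if M.Prime then 1 - 1/(M:ℝ) else 1) := by
  unfold PiM; rw [Finset.range_add_one, Finset.filter_insert]
  split_ifs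
  · rw [Finset.prod_insert (by simp), mul_comm]
  · rw [mul_one]
lemma LM_succ (M : ℕ) : LM (M+1) = LM M + (if M.Prime then log M / ((M:ℝ)-1) else 0) := by
  unfold LM; rw [Finset.range_add_one, Finset.filter_insert]
  split_ifs
  · rw [Finset.sum_insert (by simp), add_comm]
  · rw [add_zero]

lemma rec_bd {X : ℕ → ℝ → ℝ} {c : ℝ} (hc : 0 ≤ c) (h1 : ∀ M R, ¬ M.Prime → X (M+1) R = X M R)
    (h2 : ∀ M R, M.Prime → 0 < R → X (M+1) R = X M R - 1/(M:ℝ) * X M (R/M)) (h0 : ∀ R, 0 < R → |X 0 R| ≤ c/R) (M : ℕ) :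
    ∀ R, 0 < R → |X M R| ≤ 2^M * c / R := by
  induction M with
  | zero => simpa using h0
  | succ M ih =>
    intro R hR
    have := ih R hR
    have e : 2^(M+1) * c / R = 2^M * c/R + 2^M * c/R := by ring
    have p : 0 ≤ 2^M * c / R := by positivity
    by_cases hM : M.Prime
    · have M0 : (0:ℝ) < M := by exact_mod_cast hM.pos
      have i2 := ih (R/M) (by positivity)
      rw [h2 M R hM hR, e]
      have : |1/(M:ℝ) * X M (R/M)| ≤ 2^M*c/R := by
        rw [abs_mul, abs_of_pos (by positivity)]
        refine (mul_le_mul_of_nonneg_left i2 (by positivity)).trans (le_of_eq ?_)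
        field_simp
      exact (abs_sub _ _).trans (by linarith)
    · rw [h1 M R hM]; linarith

lemma XX_np (M : ℕ) (R : ℝ) (h : ¬ M.Prime) : XX (M+1) R = XX M R := by
  rw [XX, XX, ws_np 0 R h, PiM_succ, if_neg h, mul_one]
lemma XX_pr (M : ℕ) (R : ℝ) (h : M.Prime) (hR : 0 < R) : XX (M+1) R = XX M R - 1/(M:ℝ) * XX M (R/M) := by
  have M0 : (0:ℝ) < M := by exact_mod_cast h.pos
  rw [XX, XX, XX, ws_pr 0 R h, PiM_succ, if_pos h, pow_zero]
  field_simp; ring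
lemma DD_np (M : ℕ) (R : ℝ) (h : ¬ M.Prime) : DD (M+1) R = DD M R := by
  rw [DD, DD, ws_np 1 R h, PiM_succ, LM_succ, if_neg h, if_neg h, mul_one, add_zero]
lemma DD_pr (M : ℕ) (R : ℝ) (h : M.Prime) (hR : 0 < R) : DD (M+1) R = DD M R - 1/(M:ℝ) * DD M (R/M) := by
  have M1 : (1:ℝ) < M := by exact_mod_cast h.one_lt
  have : (M:ℝ) - 1 ≠ 0 := by linarith
  rw [DD, DD, DD, ws_pr 1 R h, PiM_succ, LM_succ, if_pos h, if_pos h, pow_one, log_div hR.ne' (by positivity)]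
  field_simp; ring

lemma rough0 (r : ℕ) : rough 0 r := fun _ _ _ => Nat.zero_le _
lemma XX_bd (M : ℕ) {R : ℝ} (hR : 0 < R) : |XX M R| ≤ 2^M / R := by
  have := rec_bd zero_le_one XX_np XX_pr (fun R hR => by
    simp only [XX, ws, rough0, PiM, pow_zero]
    rw [Finset.filter_true]
    have a := Nat.floor_le hR.le; have b := Nat.lt_floor_add_one R
    simp
    rw [show (⌊R⌋₊:ℝ)/R - 1 = (⌊R⌋₊ - R)/R by field_simp, abs_div, abs_of_pos hR, ← one_div]
    gcongr
    rw [abs_le]; constructor <;> linarith) M R hR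
  rwa [mul_one] at this

lemma harm (R : ℝ) (hR : 0 < R) : |ws 1 0 R - (log R + eulerMascheroniConstant)| ≤ 2/R := by
  have e : ws 1 0 R = harmonic ⌊R⌋₊ := by
    simp only [ws, rough0, harmonic_eq_sum_Icc]; simp
  rw [e]
  have g1 := one_half_lt_eulerMascheroniConstant
  have g2 := eulerMascheroniConstant_lt_two_thirds
  rcases lt_or_ge R 1 with h | h
  · rw [Nat.floor_eq_zero.2 h, harmonic_zero]
    have l1 := log_le_sub_one_of_pos hR
    have l2 := one_sub_inv_le_log_of_pos hR
    have e2 : 2/R = R⁻¹ + R⁻¹ := by ring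
    have : 1 ≤ R⁻¹ := (one_le_inv₀ hR).2 h.le
    push_cast
    rw [e2, abs_le]; constructor <;> linarith
  · set n := ⌊R⌋₊
    have n1 : 1 ≤ n := Nat.le_floor (by simpa using h)
    have n0 : (1:ℝ) ≤ n := by exact_mod_cast n1
    have a := Nat.floor_le hR.le; have b := Nat.lt_floor_add_one R
    have e1 := eulerMascheroniSeq_lt_eulerMascheroniConstant n
    have e2 := eulerMascheroniConstant_lt_eulerMascheroniSeq' n
    rw [eulerMascheroniSeq] at e1
    rw [eulerMascheroniSeq', if_neg (by omega)] at e2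
    have f1 : log (n+1) - log R ≤ 1/R := by
      rw [← log_div (by positivity) hR.ne']
      refine (log_le_sub_one_of_pos (by positivity)).trans ?_
      rw [div_sub_one hR.ne']; gcongr; linarith
    have f2 : log R - log n ≤ 2/R := by
      rw [← log_div hR.ne' (by positivity)]
      refine (log_le_sub_one_of_pos (by positivity)).trans ?_
      rw [div_sub_one (by positivity), div_le_div_iff₀ (by positivity) hR]; nlinarith
    have : 1/R ≤ 2/R := by gcongr; norm_num
    rw [abs_le]; constructor <;> linarith
lemma DD_bd (M : ℕ) {R : ℝ} (hR : 0 < R) : |DD M R| ≤ 2^M * 2 / R := by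
  refine rec_bd zero_le_two DD_np DD_pr (fun R hR => ?_) M R hR
  have : DD 0 R = ws 1 0 R - (log R + eulerMascheroniConstant) := by simp [DD, PiM, LM]
  rw [this]; exact harm R hR

lemma XX_tel {M : ℕ} (h : 2 ≤ M) {R : ℝ} (hR : 0 < R) : XX M R = XX 2 R - ∑ p ∈ pri 2 M, 1/(p:ℝ) * XX p (R/p) := by
  induction M, h using Nat.le_induction with
  | base => simp [pri]
  | succ n hn ih =>
    rw [pri_succ hn]
    by_cases h : n.Prime
    · rw [XX_pr n R h hR, ih, if_pos h]; ring
    · rw [XX_np n R h, ih, if_neg h]; ring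

noncomputable def al : ℝ := exp (-eulerMascheroniConstant)
lemma al_pos : 0 < al := exp_pos _
lemma omPi : (∀ k : ℕ, ∃ C > 0, ∀ v, 1 ≤ v → |om v - al| ≤ C / v ^ k) ∧ ∃ C > 0, ∀ M : ℕ, 2 ≤ M → |PiM M - al / log M| ≤ C / log M ^ 2 := by
  obtain ⟨A, hA⟩ := om_lim
  obtain ⟨K, hK, h⟩ := phiA
  have key : ∀ M : ℕ, 2 ≤ M → |PiM M - A / log M| ≤ K / log M ^ 2 := by
    intro M hM
    have s0 : 0 < log M := by linarith [logM hM]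
    obtain ⟨C, hC, hc⟩ := hA 1
    have lim1 : Tendsto (fun R : ℝ => |PiM M - A / log M| - 2^M/R - C / log R - M/log M / R) atTop (𝓝 (|PiM M - A / log M| - 0 - 0 - 0)) := by
      refine ((tendsto_const_nhds.sub ?_).sub ?_).sub ?_
      · exact tendsto_const_nhds.div_atTop tendsto_id
      · exact tendsto_const_nhds.div_atTop tendsto_log_atTop
      · exact tendsto_const_nhds.div_atTop tendsto_id
    rw [sub_zero, sub_zero, sub_zero] at lim1
    refine le_of_tendsto lim1 ?_
    filter_upwards [eventually_ge_atTop (M:ℝ)] with R hR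
    have M2 : (2:ℝ) ≤ M := by exact_mod_cast hM
    have R0 : 0 < R := by linarith
    have st : log M ≤ log R := log_le_log (by linarith) hR
    have a1 := h M R hM hR
    have a2 := XX_bd M R0
    have a3 := hc (log R / log M) (by rwa [le_div_iff₀ s0, one_mul])
    have a4 : |(om (log R / log M) - A) / log M| ≤ C / log R := by
      rw [abs_div, abs_of_pos s0, div_le_iff₀ s0]
      refine a3.trans (le_of_eq ?_); field_simp
    have a5 : |ws 0 M R / R - om (log R / log M) / log M + M/log M/R| ≤ K / log M ^ 2 := by
      rw [← mul_le_mul_iff_right₀ R0]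
      refine le_trans (le_of_eq ?_) (a1.trans (le_of_eq (by ring)))
      rw [← abs_of_pos R0, ← abs_mul, abs_of_pos R0]
      exact congrArg _ (by field_simp)
    rw [XX] at a2
    have a6 : 0 ≤ M/log M/R := by positivity
    rw [sub_div] at a4
    have : |PiM M - A / log M| ≤ 2^M/R + C / log R + M/log M/R + K/log M^2 := by
      rw [abs_le] at *; constructor <;> linarith [a2.1, a2.2, a4.1, a4.2, a5.1, a5.2]
    linarith
  have : A = al := by
    refine tendsto_nhds_unique (f := fun M : ℕ => log M * PiM M) (l := atTop) ?_ PiM_lim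
    have lt : Tendsto (fun M : ℕ => log (M:ℝ)) atTop atTop := tendsto_log_atTop.comp tendsto_natCast_atTop_atTop
    rw [tendsto_iff_norm_sub_tendsto_zero]
    refine squeeze_zero' (.of_forall fun _ => norm_nonneg _) ?_ (tendsto_const_nhds.div_atTop lt : Tendsto (fun M : ℕ => K / log M) atTop (𝓝 0))
    filter_upwards [eventually_ge_atTop 2] with M hM
    have s0 : 0 < log M := by linarith [logM hM]
    have := mul_le_mul_of_nonneg_left (key M hM) s0.le
    rw [norm_eq_abs]
    refine le_trans (le_of_eq ?_) (this.trans (le_of_eq (by field_simp)))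
    rw [← abs_of_pos s0, ← abs_mul, abs_of_pos s0]
    exact congrArg _ (by field_simp)
  exact ⟨fun k => this ▸ hA k, K, hK, this ▸ key⟩
end Qb

section Qc
open Set Filter Topology

lemma sumB : ∃ C > 0, ∀ M : ℕ, 2 ≤ M → ∑ p ∈ pri 2 M, log p ^ 2 / p ≤ log M ^ 2 / 2 + C * log M := by
  obtain ⟨C, hC, h⟩ := abel
  refine ⟨3 * C, by positivity, fun M hM => ?_⟩
  have l2 := log2_lb
  have hs := log2_le hM
  have P := priP (N := M) le_rfl
  push_cast at P
  have := h (log 2) (log M) (pri 2 M) (fun σ => σ^2) (fun σ => 2*σ) (fun σ => 2*σ) ∅ le_rfl hs P.1 P.2 countable_empty (by fun_prop)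
    (fun u _ => by simpa using hasDerivAt_pow 2 u) (fun u hu => by rw [abs_of_pos]; linarith [hu.1.1]) (by fun_prop)
  have e1 : ∫ σ in log 2..log M, σ^2/σ = (log M^2 - log 2^2)/2 := by
    rw [← integral_id]
    refine intervalIntegral.integral_congr fun u hu => ?_
    rw [uIcc_of_le hs] at hu
    have : u ≠ 0 := by linarith [hu.1]
    show u^2/u = u
    field_simp
  have e2 : ∫ u in log 2..log M, 2*u/u ≤ 2 * log M := by
    have : ∀ u ∈ uIoc (log 2) (log M), ‖2*u/u‖ ≤ 2 := fun u hu => by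
      rw [uIoc_of_le hs] at hu
      have : u ≠ 0 := by linarith [hu.1]
      rw [mul_div_cancel_right₀ _ this]; norm_num
    have := intervalIntegral.norm_integral_le_of_norm_le_const this
    rw [abs_of_nonneg (by linarith)] at this
    exact (le_abs_self _).trans (this.trans (by linarith))
  rw [e1, abs_of_pos (by positivity : 0 < log 2^2), show log 2^2/log 2 = log 2 by field_simp] at this
  have := mul_le_mul_of_nonneg_left (show log 2 + ∫ u in log 2..log M, 2*u/u ≤ 3 * log M by linarith) hC.le
  have := (abs_le.1 ‹|_ - _| ≤ _›).2
  linarith [sq_nonneg (log 2)]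

lemma quart {t : ℝ} (ht : 0 < t) : 1 / exp t ≤ 24 / t^4 := by
  have := pow_div_factorial_le_exp t ht.le 4
  rw [div_le_div_iff₀ (exp_pos t) (by positivity)]
  norm_num [Nat.factorial] at this; linarith

lemma upStep : ∃ C > 0, ∀ (K : ℝ) (M : ℕ) (R : ℝ), 0 ≤ K → 2 ≤ M → 0 < R → 8 * log M ≤ log R →
    (∀ p : ℕ, p < M → 2 ≤ p → 2 * log p ≤ log (R/p) → |XX p (R/p) - (om (log (R/p) / log p) - al)/log p| ≤ K * log p^2/log (R/p)^4) →
    |XX M R - (om (log R / log M) - al)/log M| ≤ (K * (0.86 + C/log M) + C) * log M^2/log R^4 := by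
  obtain ⟨Ca, hCa, hA⟩ := abel
  obtain ⟨Cb, hCb, hB⟩ := sumB
  obtain ⟨C4, hC4, h4⟩ := omPi.1 4
  obtain ⟨C5, hC5, h5⟩ := od_bd 5
  set C6 := 32 * C5 + 16 * C4
  refine ⟨2 * Cb + Ca * (2 * C6) + C4 + 300, by positivity, fun K M R hK hM hR ht ih => ?_⟩
  have hs := logM hM
  have hs2 := log2_le hM
  have l2 := log2_lb; have l2' := log2_ub
  have eR : exp (log R) = R := exp_log hR
  set s := log M
  set t := log R
  have t0 : 0 < t := by linarith
  have s0 : 0 < s := by linarith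
  have P := priP (N := M) le_rfl
  push_cast at P
  have ub : ∀ σ, log 2 ≤ σ → σ ≤ s → 7 ≤ t/σ-1 ∧ t/(2*σ) ≤ t/σ-1 := fun σ h1 h2 => by
    have s0 : 0 < σ := by linarith
    have : 8 ≤ t/σ := by rw [le_div_iff₀ s0]; linarith
    have : t/(2*σ) = t/σ/2 := by field_simp
    constructor <;> linarith
  have omb : ∀ σ, log 2 ≤ σ → σ ≤ s → |om (t/σ-1) - al| ≤ 16 * C4 * σ^4/t^4 := fun σ h1 h2 => by
    obtain ⟨x, y⟩ := ub σ h1 h2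
    have s0 : 0 < σ := by linarith
    refine (h4 _ (by linarith)).trans ?_
    refine (div_le_div_of_nonneg_left hC4.le (by positivity) (pow_le_pow_left₀ (by positivity) y 4)).trans (le_of_eq ?_)
    field_simp; norm_num
  have odb : ∀ σ, log 2 ≤ σ → σ ≤ s → |od (t/σ-1)| ≤ 32 * C5 * σ^5/t^5 := fun σ h1 h2 => by
    obtain ⟨x, y⟩ := ub σ h1 h2
    have s0 : 0 < σ := by linarith
    refine (h5 _ (by linarith)).trans ?_
    refine (div_le_div_of_nonneg_left hC5.le (by positivity) (pow_le_pow_left₀ (by positivity) y 5)).trans (le_of_eq ?_)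
    field_simp; norm_num
  have a := hA (log 2) s (pri 2 M) (fun σ => (om (t/σ-1) - al)/σ) _ (fun u => C6 * u^2/t^4) {t/3} le_rfl hs2 P.1 P.2 (countable_singleton _)
    (gcont (by linarith)) (fun u hu => gder (by linarith [hu.1.1]) (by linarith [hu.1.2]) (by simpa using hu.2)) (fun u hu => by
      have u0 : 0 < u := by linarith [hu.1.1]
      refine (abs_sub _ _).trans ?_
      rw [abs_div, abs_mul, abs_neg, abs_of_pos u0, abs_of_pos (by positivity : 0 < t/u^2), abs_div, abs_of_pos (by positivity : 0 < u^2)]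
      have x := div_le_div_of_nonneg_right (mul_le_mul_of_nonneg_right (odb u hu.1.1.le hu.1.2.le) (by positivity : 0 ≤ t/u^2)) u0.le
      have y := div_le_div_of_nonneg_right (omb u hu.1.1.le hu.1.2.le) (by positivity : 0 ≤ u^2)
      refine (add_le_add x y).trans (le_of_eq ?_)
      simp only [C6]; field_simp) ((continuous_const.mul (continuous_pow 2)).div_const _).continuousOn
  rw [gint (by linarith) hs2 (by linarith)] at a
  have i1 : ∫ u in log 2..s, C6 * u^2/t^4/u ≤ C6 * s^2/t^4 := by
    have : ∀ u ∈ uIoc (log 2) s, ‖C6 * u^2/t^4/u‖ ≤ C6 * s/t^4 := fun u hu => by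
      rw [uIoc_of_le hs2] at hu
      have u0 : 0 < u := by linarith [hu.1]
      have : C6 * u^2/t^4/u = C6 * u/t^4 := by field_simp
      rw [this, norm_of_nonneg (by positivity)]
      gcongr; exact hu.2
    have := intervalIntegral.norm_integral_le_of_norm_le_const this
    refine (le_abs_self _).trans (this.trans ?_)
    rw [abs_of_nonneg (by linarith)]
    have : C6 * s/t^4 * (s - log 2) ≤ C6 * s/t^4 * s := by gcongr; linarith
    exact this.trans (le_of_eq (by ring))
  have i2 : |(om (t/log 2-1) - al)/log 2|/log 2 ≤ C6 * s^2/t^4 := by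
    rw [abs_div, abs_of_pos (by linarith : 0 < log 2)]
    have := div_le_div_of_nonneg_right (div_le_div_of_nonneg_right (omb _ le_rfl hs2) (by linarith : 0 ≤ log 2)) (by linarith : 0 ≤ log 2)
    refine this.trans ?_
    rw [show 16 * C4 * log 2^4/t^4/log 2/log 2 = 16 * C4 * log 2^2/t^4 by field_simp]
    gcongr
    simp only [C6]; linarith
  have i3 : |(om (t/log 2) - al)/log 2| ≤ C4 * s^2/t^4 := by
    rw [abs_div, abs_of_pos (by linarith : 0 < log 2)]
    have := div_le_div_of_nonneg_right (h4 (t/log 2) (by rw [le_div_iff₀ (by linarith)]; linarith)) (by linarith : 0 ≤ log 2)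
    refine this.trans ?_
    rw [show C4 / (t/log 2)^4/log 2 = C4 * log 2^3/t^4 by field_simp]
    gcongr
    nlinarith only [sq_nonneg (log 2), hs2, l2, l2', s0]
  have i4 : |XX 2 R| ≤ 300 * s^2/t^4 := by
    refine (XX_bd 2 hR).trans ?_
    have := quart t0
    rw [eR] at this
    calc (2:ℝ)^2/R = 4 * (1/R) := by ring
      _ ≤ 4 * (24/t^4) := by gcongr
      _ = 96/t^4 := by ring
      _ ≤ _ := by gcongr; nlinarith only [hs]
  have i5 : |∑ p ∈ pri 2 M, 1/(p:ℝ) * XX p (R/p) - ∑ p ∈ pri 2 M, (om (t/log p-1) - al)/log p/p| ≤ K * (1.72/t^4) * (s^2/2 + Cb * s) := by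
    rw [← Finset.sum_sub_distrib]
    refine (Finset.abs_sum_le_sum_abs _ _).trans (le_trans (Finset.sum_le_sum (g := fun p : ℕ => K * (1.72/t^4) * (log p^2/p)) fun p hp => ?_) ?_)
    · obtain ⟨b1, b2, b3⟩ := mem_pri.1 hp
      have p0 : (0:ℝ) < p := by exact_mod_cast b3.pos
      have lp := logM b1
      have lps : log p ≤ s := log_le_log p0 (by exact_mod_cast b2.le)
      have e : log (R/p) = t - log p := log_div hR.ne' p0.ne'
      have i := ih p b2 b1 (by rw [e]; linarith)
      rw [e, show (t - log p)/log p = t/log p - 1 by rw [sub_div, div_self (by linarith)]] at i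
      rw [show 1/(p:ℝ) * XX p (R/p) - (om (t/log p-1) - al)/log p/p = (XX p (R/p) - (om (t/log p-1) - al)/log p)/p by ring, abs_div, abs_of_pos p0,
        show K * (1.72/t^4) * (log p^2/p) = K * log p^2 * (1.72/t^4) / p by ring]
      gcongr
      refine i.trans ?_
      rw [div_eq_mul_one_div]
      refine mul_le_mul_of_nonneg_left ?_ (by positivity)
      have : (7/8*t)^4 ≤ (t-log p)^4 := pow_le_pow_left₀ (by positivity) (by linarith) 4
      have t4 : 0 < t^4 := by positivity
      rw [div_le_div_iff₀ (pow_pos (by linarith) 4) (by positivity)]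
      linarith only [this, t4]
    · rw [← Finset.mul_sum]; gcongr; exact hB M hM
  have a' := mul_le_mul_of_nonneg_left (add_le_add i2 i1) hCa.le
  have a'' := a.trans a'
  rw [XX_tel hM hR]
  have fin : (K * (0.86 + (2 * Cb + Ca * (2 * C6) + C4 + 300)/s) + (2 * Cb + Ca * (2 * C6) + C4 + 300)) * s^2/t^4 =
    K * (1.72/t^4) * (s^2/2 + Cb * s) + Ca * (C6 * s^2/t^4 + C6 * s^2/t^4) + C4 * s^2/t^4 + 300 * s^2/t^4
     + (K * ((0.28 * Cb + Ca * (2 * C6) + C4 + 300)/s) + 2 * Cb) * s^2/t^4 := by field_simp; ring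
  rw [fin]
  have : 0 ≤ (K * ((0.28 * Cb + Ca * (2 * C6) + C4 + 300)/s) + 2 * Cb) * s^2/t^4 := by positivity
  rw [abs_le] at *
  constructor <;> linarith [i3.1, i3.2, i4.1, i4.2, i5.1, i5.2, a''.1, a''.2]

lemma upX : ∃ K > 0, ∀ (M : ℕ) (R : ℝ), 2 ≤ M → 0 < R → 2 * log M ≤ log R →
    |XX M R - (om (log R / log M) - al)/log M| ≤ K * log M^2/log R^4 := by
  obtain ⟨C, hC, h⟩ := upStep
  obtain ⟨C4, hC4, h4⟩ := omPi.1 4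
  obtain ⟨K1, hK1, h1⟩ := omPi.2
  obtain ⟨K0, hK0, h0⟩ := phiA
  set Z : ℝ := 2^(⌈exp (25 * C)⌉₊)
  set K := 20 * C + 4096 * (K0 + K1 + 1) + 60 * Z + C4 * (25 * C)
  refine ⟨K, by positivity, fun M => ?_⟩
  induction M using Nat.strong_induction_on with
  | _ M ih =>
  intro R hM hR ht
  have hs := logM hM
  have hM2 : (2:ℝ) ≤ M := by exact_mod_cast hM
  have eR : exp (log R) = R := exp_log hR
  have eM : exp (log M) = M := exp_log (by linarith)
  have hK : 0 < K := by positivity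
  have hZ : 0 < Z := by positivity
  have Kd : 20 * C ≤ K ∧ 4096 * (K0+K1+1) ≤ K ∧ 60 * Z + C4 * (25 * C) ≤ K := by
    have : 0 < C4 * (25 * C) := by positivity
    refine ⟨?_, ?_, ?_⟩ <;> simp only [K] <;> linarith
  have s0 : 0 < log M := by linarith
  have t0 : 0 < log R := by linarith
  rcases lt_or_ge (log R) (8 * log M) with h8 | h8
  · have MR : (M:ℝ)^2 ≤ R := by
      rw [← eM, ← eR, ← exp_nat_mul]; exact exp_le_exp.2 (by push_cast; exact ht)
    have a1 := h0 M R hM (by nlinarith only [MR, hM2])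
    have a2 := h1 M hM
    have a3 : M/log M/R ≤ 1/log M^2 := by
      rw [div_div, div_le_div_iff₀ (by positivity) (by positivity)]
      have : log M ≤ M := log_le_self (by linarith)
      have := mul_le_mul_of_nonneg_left MR s0.le
      have : (M:ℝ) * log M * log M ≤ M * log M * M := by gcongr
      nlinarith
    have a4 : 0 ≤ M/log M/R := by positivity
    have a5 : |ws 0 M R / R - om (log R / log M) / log M + M/log M/R| ≤ K0 / log M ^ 2 := by
      rw [← mul_le_mul_iff_right₀ hR]
      refine le_trans (le_of_eq ?_) (a1.trans (le_of_eq (by ring)))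
      rw [← abs_of_pos hR, ← abs_mul, abs_of_pos hR]
      exact congrArg _ (by field_simp)
    have : (K0+K1+1)/log M^2 ≤ K * log M^2/log R^4 := by
      rw [div_le_div_iff₀ (by positivity) (by positivity)]
      have : log R^4 ≤ (8*log M)^4 := pow_le_pow_left₀ t0.le h8.le 4
      have := mul_le_mul_of_nonneg_left this (by positivity : 0 ≤ K0+K1+1)
      have := mul_le_mul_of_nonneg_right Kd.2.1 (by positivity : 0 ≤ log M^4)
      linarith only [this, ‹_ * log R^4 ≤ _›]
    refine le_trans ?_ this
    rw [XX, sub_div, add_div, add_div]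
    rw [abs_le] at *; constructor <;> linarith [a2.1, a2.2, a5.1, a5.2]
  rcases lt_or_ge (log M) (25 * C) with hsm | hsm
  · have x1 := XX_bd M hR
    have x2 : (2:ℝ)^M ≤ Z := by
      refine pow_le_pow_right₀ one_le_two ?_
      have : (M:ℝ) ≤ ⌈exp (25 * C)⌉₊ := by
        rw [← eM]; exact (exp_le_exp.2 hsm.le).trans (Nat.le_ceil _)
      exact_mod_cast this
    have x3 := quart t0
    rw [eR] at x3
    have x4 : |XX M R| ≤ (60 * Z) * log M^2/log R^4 := by
      calc |XX M R| ≤ 2^M/R := x1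
        _ = 2^M * (1/R) := by ring
        _ ≤ Z * (24/log R^4) := by gcongr
        _ = 24 * Z/log R^4 := by ring
        _ ≤ _ := div_le_div_of_nonneg_right (by nlinarith only [hZ, show (0.4:ℝ) ≤ log M^2 by nlinarith only [hs]]) (by positivity)
    have x5 : |(om (log R / log M) - al)/log M| ≤ (C4 * (25 * C)) * log M^2/log R^4 := by
      rw [abs_div, abs_of_pos s0, div_le_iff₀ s0]
      refine (h4 _ (by rw [le_div_iff₀ s0]; linarith)).trans ?_
      rw [show C4/(log R/log M)^4 = C4 * log M * log M^2/log R^4 * log M by field_simp]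
      gcongr
    refine (abs_sub _ _).trans ((add_le_add x4 x5).trans ?_)
    rw [← add_div, ← add_mul]; gcongr; exact Kd.2.2
  · refine (h K M R hK.le hM hR h8 fun p h1 h2 h3 => ?_).trans ?_
    · have p0 : (0:ℝ) < p := by exact_mod_cast (by omega : 0 < p)
      exact ih p h1 (R/p) h2 (by positivity) h3
    · gcongr
      have : C/log M ≤ 0.04 := by rw [div_le_iff₀ s0]; linarith
      nlinarith only [Kd.1, this, hK]
end Qc

section Qd
open Set Filter Topology

noncomputable def et (u : ℝ) : ℝ := Yf (u+1) - al * (u+1)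

lemma XX_all : ∃ K > 0, ∀ (M : ℕ) (R : ℝ), 2 ≤ M → M ≤ R →
    |XX M R - (om (log R / log M) - al)/log M| ≤ K * log M^2/log R^4 + M/log M/R := by
  obtain ⟨K, hK, h⟩ := upX
  obtain ⟨K1, hK1, h1⟩ := omPi.2
  obtain ⟨K0, hK0, h0⟩ := phiA
  refine ⟨K + 16 * (K0 + K1), by positivity, fun M R hM hR => ?_⟩
  have hs := logM hM
  have M2 : (2:ℝ) ≤ M := by exact_mod_cast hM
  have R0 : 0 < R := by linarith
  have s0 : 0 < log M := by linarith
  have st : log M ≤ log R := log_le_log (by linarith) hR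
  have t0 : 0 < log R := by linarith
  have p : 0 ≤ M/log M/R := by positivity
  rcases le_or_gt (2 * log M) (log R) with h2 | h2
  · refine (h M R hM R0 h2).trans ?_
    have : K * log M^2/log R^4 ≤ (K + 16 * (K0 + K1)) * log M^2/log R^4 := by gcongr; linarith
    linarith
  · have a1 := h0 M R hM hR
    have a2 := h1 M hM
    have a5 : |ws 0 M R / R - om (log R / log M) / log M + M/log M/R| ≤ K0 / log M ^ 2 := by
      rw [← mul_le_mul_iff_right₀ R0]
      refine le_trans (le_of_eq ?_) (a1.trans (le_of_eq (by ring)))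
      rw [← abs_of_pos R0, ← abs_mul, abs_of_pos R0]
      exact congrArg _ (by field_simp)
    have : (K0+K1)/log M^2 ≤ (K + 16 * (K0 + K1)) * log M^2/log R^4 := by
      rw [div_le_div_iff₀ (by positivity) (by positivity)]
      have : log R^4 ≤ (2*log M)^4 := pow_le_pow_left₀ t0.le h2.le 4
      have := mul_le_mul_of_nonneg_left this (by positivity : 0 ≤ K0+K1)
      have : 0 < K * log M^4 := by positivity
      linarith only [this, ‹_ * log R^4 ≤ _›]
    rw [add_div] at this
    rw [XX, sub_div]
    rw [abs_le] at *; constructor <;> linarith [a2.1, a2.2, a5.1, a5.2]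

lemma ws_abel (M : ℕ) {R S : ℝ} (hR : 1 ≤ R) (hRS : R ≤ S) :
    ws 1 M S - ws 1 M R = ws 0 M S/S - ws 0 M R/R + ∫ y in R..S, ws 0 M y/y^2 := by
  classical
  have w : ∀ (j : ℕ) (F : ℕ → ℝ) (N : ℕ), (∀ k, F k = (1/(k:ℝ))^j) → ∑ r ∈ (Finset.Icc 1 N).filter (rough M), (1 / (r:ℝ)) ^ j = ∑ k ∈ Finset.Ioc 0 N, F k * (if 1 ≤ k ∧ rough M k then 1 else 0) := by
    intro j F N hF
    rw [Finset.sum_filter]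
    refine Finset.sum_congr (by ext; simp; omega) fun k hk => ?_
    rw [hF]
    have : 1 ≤ k := (Finset.mem_Ioc.1 hk).1
    by_cases h : rough M k <;> simp [h, this]
  have w0 : ∀ y : ℝ, ∑ k ∈ Finset.Icc 0 ⌊y⌋₊, (if 1 ≤ k ∧ rough M k then (1:ℝ) else 0) = ws 0 M y := by
    intro y
    rw [ws, w 0 (fun _ => 1) _ (by simp), ← Finset.insert_Icc_add_one_left_eq_Icc (Nat.zero_le _), Finset.sum_insert (by simp)]
    simp [← Finset.Icc_add_one_left_eq_Ioc]
  have d : ∀ y ∈ Icc R S, HasDerivAt (fun y : ℝ => 1/y) (-(1/y^2)) y := fun y hy => by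
    simpa using hasDerivAt_inv (show y ≠ 0 by linarith [hy.1])
  have := sum_mul_eq_sub_sub_integral_mul (f := fun y : ℝ => 1/y) (fun k => if 1 ≤ k ∧ rough M k then (1:ℝ) else 0) (by linarith : 0 ≤ R) hRS
    (fun y hy => (d y hy).differentiableAt) (by
      refine ContinuousOn.integrableOn_Icc (ContinuousOn.congr (f := fun y => -(1/y^2)) (fun y hy => ?_) fun y hy => (d y hy).deriv)
      have : y ≠ 0 := by linarith [hy.1]
      exact ContinuousAt.continuousWithinAt (by fun_prop (disch := positivity)))
  simp only [w0] at this
  have s1 : ws 1 M S - ws 1 M R = ∑ k ∈ Finset.Ioc ⌊R⌋₊ ⌊S⌋₊, 1/(k:ℝ) * (if 1 ≤ k ∧ rough M k then (1:ℝ) else 0) := by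
    rw [ws, ws, w 1 (fun k => 1/(k:ℝ)) _ (by simp), w 1 (fun k => 1/(k:ℝ)) _ (by simp), sub_eq_iff_eq_add']
    exact (Finset.sum_Ioc_consecutive _ (Nat.zero_le _) (Nat.floor_mono hRS)).symm
  rw [s1, this, ← intervalIntegral.integral_of_le hRS, sub_eq_add_neg _ (∫ _ in _.._, _), ← intervalIntegral.integral_neg]
  congr 1
  · ring
  · refine intervalIntegral.integral_congr fun y hy => ?_
    rw [uIcc_of_le hRS] at hy
    simp only [(d y hy).deriv]; ring

lemma et_bd : ∃ C > 0, ∀ u, 0 ≤ u → |et u| ≤ C/(u+1)^3 := by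
  obtain ⟨C, hC, h⟩ := omPi.1 4
  refine ⟨C, hC, fun u hu => ?_⟩
  have := h (u+1) (by linarith)
  have e : et u = (u+1) * (om (u+1) - al) := by
    rw [et, om_eq (by linarith)]; field_simp
  rw [e, abs_mul, abs_of_pos (by linarith)]
  refine (mul_le_mul_of_nonneg_left this (by linarith)).trans (le_of_eq ?_)
  field_simp

lemma DD_up : ∃ K > 0, ∀ (M : ℕ) (R : ℝ), 2 ≤ M → M ≤ R → |DD M R - et (log R/log M)| ≤ K * log M^2/log R^3 := by
  obtain ⟨K, hK, h⟩ := XX_all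
  obtain ⟨C4, hC4, h4⟩ := omPi.1 3
  obtain ⟨Ce, hCe, hce⟩ := et_bd
  refine ⟨C4 + 3 * K + 120, by positivity, fun M R hM hR => ?_⟩
  have hs := logM hM
  have M2 : (2:ℝ) ≤ M := by exact_mod_cast hM
  have R0 : 0 < R := by linarith
  have s0 : 0 < log M := by linarith
  have st : log M ≤ log R := log_le_log (by linarith) hR
  have t0 : 0 < log R := by linarith
  have main : ∀ S, R ≤ S → |DD M R - XX M R - et (log R/log M)| ≤ K * log M^2/log R^3 + M/log M/R + (2^M*2/S + 2^M/S + Ce/(log S/log M+1)^3) := by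
    intro S hRS
    have S0 : 0 < S := by linarith
    have lRS : log R ≤ log S := log_le_log R0 hRS
    have ab := ws_abel M (by linarith) hRS
    have pos : ∀ y ∈ Icc R S, 0 < y ∧ 0 < log y ∧ log M ≤ log y := fun y hy => by
      have := log_le_log R0 hy.1
      exact ⟨by linarith [hy.1], by linarith, by linarith⟩
    have e1 : ∫ y in R..S, (PiM M / y + (om (log y/log M) - al)/log M/y) = (PiM M * log S + et (log S/log M)) - (PiM M * log R + et (log R/log M)) := by
      refine intervalIntegral.integral_eq_sub_of_hasDerivAt_of_le (f := fun y => PiM M * log y + et (log y/log M)) hRS ?_ ?_ ?_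
      · have : Continuous et := by unfold et; exact (Yf_cont.comp (by fun_prop)).sub (by fun_prop)
        have l : ContinuousOn log (Icc R S) := continuousOn_log.mono fun y hy => (pos y hy).1.ne'
        exact (continuousOn_const.mul l).add (this.comp_continuousOn (l.div_const _))
      · intro y hy
        obtain ⟨y0, ly, -⟩ := pos y ⟨hy.1.le, hy.2.le⟩
        have hl := hasDerivAt_log y0.ne'
        have lt : log M < log y := log_lt_log (by linarith) (by linarith [hy.1])
        have hu : 1 < log y/log M := by rwa [lt_div_iff₀ s0, one_mul]
        have h1 := (hl.div_const (log M)).add_const 1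
        have h2 := HasDerivAt.comp y (Yf_deriv (w := log y/log M+1) (by linarith)) h1
        have := (hl.const_mul (PiM M)).add (h2.sub (h1.const_mul al))
        refine this.congr_deriv ?_
        rw [add_sub_cancel_right]; field_simp
      · refine ContinuousOn.intervalIntegrable_of_Icc hRS fun y hy => ContinuousAt.continuousWithinAt ?_
        obtain ⟨y0, ly, -⟩ := pos y hy
        have : ContinuousAt (fun y => om (log y/log M)) y := om_cont.continuousAt.comp (by fun_prop (disch := positivity))
        fun_prop (disch := positivity)
    have I1 : IntervalIntegrable (fun y => PiM M / y + (om (log y/log M) - al)/log M/y) volume R S := by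
      refine ContinuousOn.intervalIntegrable_of_Icc hRS fun y hy => ContinuousAt.continuousWithinAt ?_
      obtain ⟨y0, ly, -⟩ := pos y hy
      have : ContinuousAt (fun y => om (log y/log M)) y := om_cont.continuousAt.comp (by fun_prop (disch := positivity))
      fun_prop (disch := positivity)
    have I2 : IntervalIntegrable (fun y => ws 0 M y/y^2) volume R S := by
      have m : Monotone (ws 0 M) := fun a b hab => by
        classical
        unfold ws; exact Finset.sum_le_sum_of_subset_of_nonneg (Finset.filter_subset_filter _ (Finset.Icc_subset_Icc_right (Nat.floor_mono hab))) (fun _ _ _ => by positivity)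
      simp only [div_eq_mul_inv]
      refine m.intervalIntegrable.mul_continuousOn fun y hy => ContinuousAt.continuousWithinAt ?_
      rw [uIcc_of_le hRS] at hy
      obtain ⟨y0, -⟩ := pos y hy
      fun_prop (disch := positivity)
    have c3 : ∀ y ∈ Icc R S, ContinuousAt (fun y => K * log M^2/log y^4/y + M/log M/y^2) y := fun y hy => by
      obtain ⟨y0, ly, -⟩ := pos y hy
      fun_prop (disch := positivity)
    have I3 : IntervalIntegrable (fun y => K * log M^2/log y^4/y + M/log M/y^2) volume R S :=
      ContinuousOn.intervalIntegrable_of_Icc hRS fun y hy => (c3 y hy).continuousWithinAt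
    have d3 : ∀ y ∈ Icc R S, HasDerivAt (fun y => - (K * log M^2/3/log y^3) - M/log M/y) (K * log M^2/log y^4/y + M/log M/y^2) y := fun y hy => by
      obtain ⟨y0, ly, -⟩ := pos y hy
      have l := ((hasDerivAt_const y (K * log M^2/3)).div ((hasDerivAt_log y0.ne').pow 3) (pow_pos ly 3).ne').neg.sub ((hasDerivAt_const y (M/log M)).div (hasDerivAt_id y) y0.ne')
      refine l.congr_deriv ?_
      simp; field_simp; ring
    have e3 : ∫ y in R..S, (K * log M^2/log y^4/y + M/log M/y^2) ≤ K * log M^2/log R^3 + M/log M/R := by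
      rw [intervalIntegral.integral_eq_sub_of_hasDerivAt (fun y hy => d3 y (by rwa [uIcc_of_le hRS] at hy)) I3]
      have lS : 0 < log S := by linarith
      have : 0 ≤ K * log M^2/3/log S^3 := by positivity
      have : 0 ≤ M/log M/S := by positivity
      have : K * log M^2/3/log R^3 ≤ K * log M^2/log R^3 := by gcongr; have : 0 < K * log M^2 := by positivity
                                                               linarith
      linarith
    have e4 := intervalIntegral.norm_integral_le_of_norm_le (f := fun y => ws 0 M y/y^2 - (PiM M / y + (om (log y/log M) - al)/log M/y)) hRS
      (.of_forall fun y hy => ?_) I3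
    · rw [intervalIntegral.integral_sub I2 I1, e1, norm_eq_abs] at e4
      have b1 := DD_bd M S0
      have b2 := XX_bd M S0
      have b3 := hce (log S/log M) (div_nonneg (by linarith) s0.le)
      have key : DD M R - XX M R - et (log R/log M) = DD M S - XX M S - et (log S/log M) - ((∫ y in R..S, ws 0 M y/y^2) - ((PiM M * log S + et (log S/log M)) - (PiM M * log R + et (log R/log M)))) := by
        simp only [DD, XX]; linear_combination -ab
      rw [key]
      have := e4.trans e3
      rw [abs_le] at *; constructor <;> linarith [b1.1, b1.2, b2.1, b2.2, b3.1, b3.2, this.1, this.2]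
    · have hy' : y ∈ Icc R S := ⟨hy.1.le, hy.2⟩
      obtain ⟨y0, ly, -⟩ := pos y hy'
      have := h M y hM (hR.trans hy.1.le)
      rw [norm_eq_abs, show ws 0 M y/y^2 - (PiM M / y + (om (log y/log M) - al)/log M/y) = (XX M y - (om (log y / log M) - al)/log M)/y by
        rw [XX]; field_simp; ring, abs_div, abs_of_pos y0, div_le_iff₀ y0]
      refine this.trans (le_of_eq ?_)
      field_simp
  have lim : |DD M R - XX M R - et (log R/log M)| ≤ K * log M^2/log R^3 + M/log M/R + (0 + 0 + 0) := by
    refine ge_of_tendsto (x := atTop) (f := fun S : ℝ => K * log M^2/log R^3 + M/log M/R + (2^M*2/S + 2^M/S + Ce/(log S/log M+1)^3)) ?_ ?_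
    · refine tendsto_const_nhds.add (((tendsto_const_nhds.div_atTop tendsto_id).add (tendsto_const_nhds.div_atTop tendsto_id)).add (tendsto_const_nhds.div_atTop ?_))
      exact (tendsto_pow_atTop (by norm_num)).comp ((tendsto_log_atTop.atTop_div_const s0).atTop_add tendsto_const_nhds)
    · filter_upwards [eventually_ge_atTop R] with S hS using main S hS
  have x := h M R hM hR
  have y1 : |(om (log R / log M) - al)/log M| ≤ C4 * log M^2/log R^3 := by
    rw [abs_div, abs_of_pos s0, div_le_iff₀ s0]
    refine (h4 _ (by rwa [le_div_iff₀ s0, one_mul])).trans (le_of_eq ?_)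
    field_simp
  have y2 : K * log M^2/log R^4 ≤ 2 * (K * log M^2/log R^3) := by
    rw [show K * log M^2/log R^4 = (K * log M^2/log R^3)/log R by field_simp, div_le_iff₀ t0]
    have : 0 < K * log M^2/log R^3 := by positivity
    nlinarith
  have y3 : M/log M/R ≤ 60 * log M^2/log R^3 := by
    rw [div_div, div_le_div_iff₀ (by positivity) (by positivity)]
    have eR : R = M * exp (log R - log M) := by rw [exp_sub, exp_log R0, exp_log (by linarith)]; field_simp
    set d := log R - log M
    have d0 : 0 ≤ d := by simp only [d]; linarith
    have f := pow_div_factorial_le_exp (d+1) (by linarith) 3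
    rw [exp_add] at f
    norm_num [Nat.factorial] at f
    have e1 := exp_one_lt_d9
    have ed := exp_pos d
    have g : log R ≤ 1.5 * log M * (d+1) := by
      have : log R = log M + d := by simp only [d]; ring
      rw [this]; nlinarith only [d0, hs, s0]
    have g3 := pow_le_pow_left₀ t0.le g 3
    have : (d+1)^3 ≤ 17 * exp d := by nlinarith only [f, e1, ed]
    have : log R^3 ≤ 60 * log M^3 * exp d := by
      refine g3.trans ?_
      have : 0 < log M^3 := by positivity
      nlinarith only [mul_le_mul_of_nonneg_left ‹(d+1)^3 ≤ _› this.le, mul_pos this ed]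
    calc (M:ℝ) * log R^3 ≤ M * (60 * log M^3 * exp d) := by gcongr
      _ = 60 * log M^2 * (log M * (M * exp d)) := by ring
      _ = _ := by rw [← eR]
  have fin : (C4 + 3 * K + 120) * log M^2/log R^3 = C4 * log M^2/log R^3 + 3 * (K * log M^2/log R^3) + 2 * (60 * log M^2/log R^3) := by ring
  rw [fin]
  rw [abs_le] at *; constructor <;> linarith [x.1, x.2, y1.1, y1.2, lim.1, lim.2]

lemma PiM_lb : ∃ c > 0, ∀ M : ℕ, 2 ≤ M → c / log M ≤ PiM M := by
  obtain ⟨K1, hK1, h1⟩ := omPi.2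
  have ap := al_pos
  have anti : Antitone PiM := antitone_nat_of_succ_le fun n => by
    rw [PiM_succ]
    have := PiM_pos n
    split_ifs with h
    · have : 0 ≤ 1/(n:ℝ) := by positivity
      nlinarith
    · linarith
  set s1 := 2 * K1 / al
  have q := PiM_pos ⌈exp s1⌉₊
  refine ⟨min (al/2) (0.69 * PiM ⌈exp s1⌉₊), lt_min (by positivity) (by positivity), fun M hM => ?_⟩
  have hs := logM hM
  have s0 : 0 < log M := by linarith
  rw [div_le_iff₀ s0]
  rcases lt_or_ge (log M) s1 with h | h
  · refine (min_le_right _ _).trans ?_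
    have : M ≤ ⌈exp s1⌉₊ := by
      have : (M:ℝ) ≤ ⌈exp s1⌉₊ := le_trans (by rw [← exp_log (by exact_mod_cast (by omega : 0 < M) : (0:ℝ) < M)]; exact exp_le_exp.2 h.le) (Nat.le_ceil _)
      exact_mod_cast this
    have := anti this
    nlinarith
  · refine (min_le_left _ _).trans ?_
    have := (abs_le.1 (h1 M hM)).1
    have k : K1/log M^2 ≤ al/2/log M := by
      rw [div_le_div_iff₀ (by positivity) s0]
      have : 2 * K1 ≤ log M * al := (div_le_iff₀ ap).1 h
      nlinarith
    have : al/2/log M ≤ PiM M := by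
      have e : al/log M = al/2/log M + al/2/log M := by ring
      linarith
    rwa [div_le_iff₀ s0] at this

lemma LM_bd : ∃ C > 0, ∀ M : ℕ, 2 ≤ M → |LM M - log M| ≤ C := by
  obtain ⟨K1, hK1, h1⟩ := omPi.2
  obtain ⟨c, hc, h2⟩ := PiM_lb
  obtain ⟨K, hK, h3⟩ := DD_up
  refine ⟨(2 * K1 + K + 1)/c + 1, by positivity, fun M hM => ?_⟩
  have hs := logM hM
  have s0 : 0 < log M := by linarith
  have M2 : (2:ℝ) ≤ M := by exact_mod_cast hM
  have d := h3 M M hM le_rfl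
  have w : |ws 1 M M - 1| ≤ 1/log M := by
    have e : 1/(M:ℝ) ≤ 1/log M := one_div_le_one_div_of_le s0 (log_le_self (by linarith))
    have o := ws_one 1 (N := M+1) (R := M) (by linarith) (by push_cast; linarith)
    by_cases h : M.Prime
    · rw [ws_pr 1 _ h, o, div_self (by linarith), ws_one 1 le_rfl (by linarith)]
      rw [abs_of_nonneg (by simp)]; simpa using e
    · rw [← ws_np 1 _ h, o, sub_self, abs_zero]; positivity
  have e1 : et 1 = 1 - 2 * al := by rw [et, Yf_one (by norm_num)]; ring
  rw [div_self s0.ne', e1, DD, show K * log M^2/log M^3 = K/log M by field_simp] at d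
  have a := h1 M hM
  have a' : |PiM M * log M - al| ≤ K1/log M := by
    rw [show PiM M * log M - al = (PiM M - al/log M) * log M by field_simp, abs_mul, abs_of_pos s0]
    refine (mul_le_mul_of_nonneg_right a s0.le).trans (le_of_eq (by field_simp))
  have f : PiM M * |LM M + eulerMascheroniConstant - log M| ≤ (2 * K1 + K + 1)/log M := by
    rw [← abs_of_pos (PiM_pos M), ← abs_mul, add_div, add_div, mul_div_assoc]
    rw [abs_le] at *; constructor <;> linarith [w.1, w.2, a'.1, a'.2, d.1, d.2]
  have g1 := one_half_lt_eulerMascheroniConstant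
  have g2 := eulerMascheroniConstant_lt_two_thirds
  have g : |LM M + eulerMascheroniConstant - log M| ≤ (2 * K1 + K + 1)/c := by
    rw [le_div_iff₀ hc]
    have := (mul_le_mul_of_nonneg_right (h2 M hM) (abs_nonneg _)).trans f
    rw [div_mul_eq_mul_div] at this
    have := (div_le_div_iff_of_pos_right s0).1 this
    linarith
  rw [abs_le] at *; constructor <;> linarith [g.1, g.2]

theorem DD_all : ∃ K > 0, ∀ (M : ℕ) (R : ℝ), 2 ≤ M → 1 ≤ R → |DD M R - et (log R/log M)| ≤ K * log M^2/(log M + log R)^3 := by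
  obtain ⟨K1, hK1, h1⟩ := omPi.2
  obtain ⟨C, hC, h2⟩ := LM_bd
  obtain ⟨K, hK, h3⟩ := DD_up
  refine ⟨8 * (K + 2 * K1 + (al + 2 * K1) * (C+1)), by have := al_pos; positivity, fun M R hM hR => ?_⟩
  have ap := al_pos
  have hs := logM hM
  have s0 : 0 < log M := by linarith
  have M2 : (2:ℝ) ≤ M := by exact_mod_cast hM
  have t0 : 0 ≤ log R := log_nonneg hR
  rcases lt_or_ge R M with h | h
  · have ts : log R ≤ log M := log_le_log (by linarith) h.le
    rw [DD, ws_one 1 hR h, et, Yf_one (by have := (div_le_one s0).2 ts; linarith)]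
    have a := h1 M hM
    have b := h2 M hM
    have g1 := one_half_lt_eulerMascheroniConstant
    have g2 := eulerMascheroniConstant_lt_two_thirds
    have e : 1 - PiM M * (log R + eulerMascheroniConstant + LM M) - (1 - al * (log R/log M+1)) = -((PiM M - al/log M) * (log R + log M) + PiM M * (eulerMascheroniConstant + (LM M - log M))) := by
      field_simp; ring
    have x1 : |(PiM M - al/log M) * (log R + log M)| ≤ 2 * K1/log M := by
      rw [abs_mul, abs_of_pos (by linarith : 0 < log R + log M)]
      refine (mul_le_mul a (show log R + log M ≤ 2 * log M by linarith) (by linarith) (by positivity)).trans (le_of_eq (by field_simp))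
    have x2 : |PiM M * (eulerMascheroniConstant + (LM M - log M))| ≤ (al + 2 * K1) * (C+1)/log M := by
      rw [abs_mul, abs_of_pos (PiM_pos M)]
      have y1 : PiM M ≤ (al + 2 * K1)/log M := by
        have := (abs_le.1 a).2
        have : K1/log M^2 ≤ 2*K1/log M := by rw [div_le_div_iff₀ (by positivity) s0]; nlinarith [mul_pos hK1 s0]
        rw [add_div]; linarith
      have y2 : |eulerMascheroniConstant + (LM M - log M)| ≤ C+1 := by
        rw [abs_le] at *; constructor <;> linarith [b.1, b.2]
      refine (mul_le_mul y1 y2 (abs_nonneg _) (by positivity)).trans (le_of_eq (by ring))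
    rw [e, abs_neg]
    refine (abs_add_le _ _).trans ((add_le_add x1 x2).trans ?_)
    rw [← add_div, div_le_div_iff₀ s0 (by positivity)]
    have : (log M + log R)^3 ≤ (2 * log M)^3 := pow_le_pow_left₀ (by linarith) (by linarith) 3
    set Z := (al + 2 * K1) * (C+1)
    have Z0 : 0 < Z := by positivity
    have := mul_le_mul_of_nonneg_left this (by positivity : 0 ≤ 2 * K1 + Z)
    linarith [mul_pos hK (pow_pos s0 3)]
  · refine (h3 M R hM h).trans ?_
    have st : log M ≤ log R := log_le_log (by linarith) h
    have t0 : 0 < log R := by linarith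
    rw [div_le_div_iff₀ (by positivity) (by positivity)]
    have : (log M + log R)^3 ≤ (2 * log R)^3 := pow_le_pow_left₀ (by linarith) (by linarith) 3
    have q := mul_le_mul_of_nonneg_left this (by positivity : 0 ≤ K * log M^2)
    have : 0 ≤ 8 * (2 * K1 + (al + 2 * K1) * (C+1)) * log M^2 * log R^3 := by positivity
    linarith only [this, q]
end Qd

section Q3
open Set Filter Topology

structure EP (F E : ℝ → ℝ) : Prop where
  mono : ∀ a b, 0 ≤ a → a ≤ b → F a ≤ F b
  lb : ∀ a, 0 ≤ a → 0.69 ≤ F a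
  anti : ∀ a b, 0 < a → a ≤ b → E b ≤ E a
  lim : Tendsto E atTop (𝓝 0)
  diff : ∀ a, 0 < a → F a/(2*a) ≤ E a - E (2*a)
  dil : ∀ a l, 0 < a → 1 ≤ l → E (a/l) ≤ l * E a

lemma EP.nn {F E : ℝ → ℝ} (h : EP F E) {a : ℝ} (ha : 0 < a) : 0 ≤ E a :=
  le_of_tendsto h.lim (eventually_atTop.2 ⟨a, fun b hb => h.anti a b ha hb⟩)
lemma EP.Fle {F E : ℝ → ℝ} (h : EP F E) {a : ℝ} (ha : 0 < a) : F a ≤ 2*a*E a := by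
  have h1 := h.diff a ha
  have h2 := h.nn (a := 2*a) (by positivity)
  rw [div_le_iff₀ (by positivity)] at h1
  nlinarith
lemma EP.ge {F E : ℝ → ℝ} (h : EP F E) {a : ℝ} (ha : 0 < a) : 0.3/a ≤ E a := by
  have := h.Fle ha
  have := h.lb a ha.le
  rw [div_le_iff₀ ha]; nlinarith

lemma intF {f : ℝ → ℝ} (hfl : ∃ A : ℝ, ∀ x : ℝ, 16 ≤ x → f x ≤ A * lfun x) (hf : Monotone f) (h1 : 2 ≤ f 1) {T : ℝ} (hT : 0 < T) :
    IntegrableOn (fun s => log (f (exp s))/s^2) (Ioi T) := by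
  obtain ⟨A, hA⟩ := hfl
  have hms : AEStronglyMeasurable (fun s => log (f (exp s))/s^2) volume :=
    ((measurable_log.comp (hf.measurable.comp measurable_exp)).div (by fun_prop)).aestronglyMeasurable
  have f2 : ∀ s, 0 ≤ s → 2 ≤ f (exp s) := fun s hs => h1.trans (hf (one_le_exp hs))
  have F0 : ∀ s, 0 ≤ s → 0 ≤ log (f (exp s)) := fun s hs => log_nonneg (by linarith [f2 s hs])
  set S := max T (exp (exp 1)) with hS
  have hTS : T ≤ S := le_max_left _ _
  have e1 : (2.7:ℝ) < exp 1 := by linarith [exp_one_gt_d9]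
  have e2 : (3.7:ℝ) < exp (exp 1) := by linarith [add_one_le_exp (exp 1)]
  have hSe : ∀ s, S ≤ s → exp (exp 1) ≤ s := fun s hs => (le_max_right _ _).trans hs
  have l1 : ∀ s, S ≤ s → exp 1 ≤ log s := fun s hs => by
    rw [le_log_iff_exp_le (by linarith [hSe s hs])]; exact hSe s hs
  have l2 : ∀ s, S ≤ s → 1 ≤ log (log s) := fun s hs => by
    rw [le_log_iff_exp_le (by linarith [l1 s hs])]; exact l1 s hs
  rw [← Ioc_union_Ioi_eq_Ioi hTS]
  refine IntegrableOn.union ?_ ?_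
  · refine Measure.integrableOn_of_bounded (M := log (f (exp S))/T^2) (by simp) hms ?_
    refine (ae_restrict_iff' measurableSet_Ioc).2 (Eventually.of_forall fun s hs => ?_)
    have hs0 : 0 ≤ s := by linarith [hs.1]
    rw [norm_of_nonneg (div_nonneg (F0 s hs0) (by positivity))]
    exact div_le_div₀ (F0 S (by linarith)) (log_le_log (by linarith [f2 s hs0]) (hf (exp_le_exp.2 hs.2))) (by positivity) (by gcongr; exact hs.1.le)
  · have hd : ∀ s, S ≤ s → HasDerivAt (fun s => -(1/2) * (1 / log (log s)^2)) (1/(s * log s * log (log s)^3)) s := fun s hs => by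
      have a1 := hSe s hs
      have a2 := l1 s hs
      have a3 := l2 s hs
      have hs0 : s ≠ 0 := by linarith
      have hl0 : log s ≠ 0 := by linarith
      have hll0 : log (log s) ≠ 0 := by linarith
      have := ((((hasDerivAt_log hs0).log hl0).pow 2).inv (pow_ne_zero 2 hll0)).const_mul (-(1/2:ℝ))
      refine (this.congr_of_eventuallyEq (Eventually.of_forall fun y => by simp)).congr_deriv ?_
      simp; field_simp
    have hi : IntegrableOn (fun s => 1/(s * log s * log (log s)^3)) (Ioi S) := by
      refine integrableOn_Ioi_deriv_of_nonneg (hd S le_rfl).continuousAt.continuousWithinAt (fun s hs => hd s (le_of_lt hs)) (fun s hs => ?_) (l := 0) ?_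
      · have a1 := hSe s (le_of_lt hs)
        have a2 := l1 s (le_of_lt hs)
        have a3 := l2 s (le_of_lt hs)
        have : 0 < s := by linarith
        have : 0 < log s := by linarith
        positivity
      · have := ((tendsto_pow_atTop (two_ne_zero)).comp (tendsto_log_atTop.comp tendsto_log_atTop)).inv_tendsto_atTop.const_mul (-(1/2:ℝ))
        refine (by simpa using this : Tendsto _ _ _).congr fun s => ?_
        simp
    have hi2 : IntegrableOn (fun s : ℝ => |log A| * s^(-2:ℝ)) (Ioi S) :=
      (integrableOn_Ioi_rpow_of_lt (by norm_num) (by linarith)).const_mul _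
    refine (hi2.add hi).mono' hms.restrict ?_
    refine (ae_restrict_iff' measurableSet_Ioi).2 (Eventually.of_forall fun s hs => ?_)
    have hs' : S ≤ s := le_of_lt hs
    have a1 := hSe s hs'
    have a2 := l1 s hs'
    have a3 := l2 s hs'
    have hs0 : 0 < s := by linarith
    have p2 : 0 < log s := by linarith
    rw [norm_of_nonneg (div_nonneg (F0 s hs0.le) (by positivity))]
    have h16 : 16 ≤ exp s := by
      have : exp 3 ≤ exp s := exp_le_exp.2 (by linarith)
      have e3 : exp 3 = exp 1 ^ 3 := by rw [← exp_nat_mul]; norm_num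
      nlinarith [sq_nonneg (exp 1 - 2.7), mul_pos (show 0 < exp 1 - 2.7 by linarith) (show 0 < exp 1 - 2.7 by linarith)]
    have hb := hA _ h16
    have hA0 : 0 < A := by
      by_contra hn
      have : A * lfun (exp s) ≤ 0 := mul_nonpos_of_nonpos_of_nonneg (by linarith) (exp_pos _).le
      linarith [f2 s hs0.le]
    have hlb : log (f (exp s)) ≤ log A + s/(log s * log (log s)^3) := by
      have := log_le_log (by linarith [f2 s hs0.le]) hb
      rwa [lfun, log_mul hA0.ne' (exp_pos _).ne', log_exp, log_exp] at this
    have : |log A| * s^(-2:ℝ) + 1/(s * log s * log (log s)^3) = (|log A| + s/(log s * log (log s)^3))/s^2 := by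
      rw [rpow_neg hs0.le, show (2:ℝ) = ((2:ℕ):ℝ) by norm_num, rpow_natCast]; field_simp
    simp only [Pi.add_apply, this]
    gcongr
    linarith [le_abs_self (log A)]

lemma EPf {f : ℝ → ℝ} (hfl : ∃ A : ℝ, ∀ x : ℝ, 16 ≤ x → f x ≤ A * lfun x) (hf : Monotone f) (h1 : 2 ≤ f 1) :
    EP (fun s => log (f (exp s))) (fun T => Efun f (exp T)) := by
  have f2 : ∀ s, 0 ≤ s → 2 ≤ f (exp s) := fun s hs => h1.trans (hf (one_le_exp hs))
  have F0 : ∀ s, 0 ≤ s → 0 ≤ log (f (exp s)) := fun s hs => log_nonneg (by linarith [f2 s hs])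
  have Fm : ∀ a b, 0 ≤ a → a ≤ b → log (f (exp a)) ≤ log (f (exp b)) := fun a b ha hab => log_le_log (by linarith [f2 a ha]) (hf (exp_le_exp.2 hab))
  have hI : ∀ T, 0 < T → IntegrableOn (fun s => log (f (exp s))/s^2) (Ioi T) := fun T hT => intF hfl hf h1 hT
  have hE : ∀ T, Efun f (exp T) = ∫ s in Ioi T, log (f (exp s))/s^2 := fun T => by
    have himg : exp '' Ioi T = Ioi (exp T) := by
      ext y; constructor
      · rintro ⟨s, hs, rfl⟩; exact exp_lt_exp.2 hs
      · intro hy; exact ⟨log y, (lt_log_iff_exp_lt ((exp_pos _).trans hy)).2 hy, exp_log ((exp_pos _).trans hy)⟩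
    rw [Efun, ← himg, integral_image_eq_integral_abs_deriv_smul measurableSet_Ioi (fun s _ => (hasDerivAt_exp s).hasDerivWithinAt) exp_injective.injOn]
    refine setIntegral_congr_fun measurableSet_Ioi fun s _ => ?_
    simp only [log_exp, abs_exp, smul_eq_mul]
    have := (exp_pos s).ne'
    by_cases hs : s = 0
    · simp [hs]
    field_simp
  have hnn : ∀ s, 0 ≤ s → 0 ≤ log (f (exp s))/s^2 := fun s hs => div_nonneg (F0 s hs) (by positivity)
  have hsub : ∀ a b, 0 < a → a ≤ b → Efun f (exp a) - Efun f (exp b) = ∫ s in a..b, log (f (exp s))/s^2 := fun a b ha hab => by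
    rw [hE, hE, ← intervalIntegral.integral_interval_add_Ioi (hI a ha) (hI b (ha.trans_le hab))]; ring
  have hii : ∀ a b, 0 < a → a ≤ b → IntervalIntegrable (fun s => log (f (exp s))/s^2) volume a b := fun a b ha hab =>
    (intervalIntegrable_iff_integrableOn_Ioc_of_le hab).2 ((hI a ha).mono_set Ioc_subset_Ioi_self)
  refine ⟨Fm, fun a ha => ?_, fun a b ha hab => ?_, ?_, fun a ha => ?_, fun a l ha hl => ?_⟩
  · exact (log_ge (f2 a ha)).le
  · have := hsub a b ha hab
    have h2 : 0 ≤ ∫ s in a..b, log (f (exp s))/s^2 := intervalIntegral.integral_nonneg hab fun s hs => hnn s (by linarith [hs.1])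
    linarith
  · have h3 : Tendsto (fun b => ∫ s in (1:ℝ)..b, log (f (exp s))/s^2) atTop (𝓝 (∫ s in Ioi 1, log (f (exp s))/s^2)) :=
      intervalIntegral_tendsto_integral_Ioi 1 (hI 1 one_pos) tendsto_id
    have h4 := h3.const_sub (∫ s in Ioi (1:ℝ), log (f (exp s))/s^2)
    rw [sub_self] at h4
    refine h4.congr' (eventually_atTop.2 ⟨1, fun b hb => ?_⟩)
    rw [← hsub 1 b one_pos hb, ← hE 1]; ring
  · rw [hsub a (2*a) ha (by linarith)]
    have h5 : ∫ s in a..(2*a), log (f (exp a)) / s^(0+2) ≤ ∫ s in a..(2*a), log (f (exp s))/s^2 := by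
      refine intervalIntegral.integral_mono_on (by linarith) ((cont_inv _ _ ha).intervalIntegrable_of_Icc (by linarith)) (hii a _ ha (by linarith)) fun s hs => ?_
      have := Fm a s ha.le hs.1
      have : 0 < s := by linarith [hs.1]
      simp only [zero_add]; gcongr
    rw [int_inv 0 _ ha (by linarith)] at h5
    refine le_trans (le_of_eq ?_) h5
    field_simp; norm_num; ring
  · simp only [hE]
    have hl0 : 0 < l := by linarith
    have := integral_comp_mul_left_Ioi (fun s => log (f (exp s))/s^2) a (inv_pos.2 hl0)
    rw [inv_inv, smul_eq_mul, show l⁻¹ * a = a/l by field_simp] at this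
    have h6 : ∫ s in Ioi (a/l), log (f (exp s))/s^2 = l⁻¹ * ∫ s in Ioi a, log (f (exp (l⁻¹*s)))/(l⁻¹*s)^2 := by
      rw [this]; field_simp
    rw [h6, ← integral_const_mul, ← integral_const_mul]
    have hg : IntegrableOn (fun s => l * (log (f (exp s))/s^2)) (Ioi a) := (hI a ha).const_mul _
    refine integral_mono_of_nonneg ?_ hg ?_
    · refine (ae_restrict_iff' measurableSet_Ioi).2 (Eventually.of_forall fun s hs => ?_)
      have : 0 < s := ha.trans hs
      have := F0 (l⁻¹*s) (by positivity)
      simp only [Pi.zero_apply]; positivity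
    · refine (ae_restrict_iff' measurableSet_Ioi).2 (Eventually.of_forall fun s hs => ?_)
      have hs0 : 0 < s := ha.trans hs
      have h7 : l⁻¹ * s ≤ s := by
        have : l⁻¹ ≤ 1 := inv_le_one_of_one_le₀ hl
        nlinarith
      have := Fm (l⁻¹*s) s (by positivity) h7
      calc l⁻¹ * (log (f (exp (l⁻¹*s)))/(l⁻¹*s)^2) = l * (log (f (exp (l⁻¹*s)))/s^2) := by field_simp
        _ ≤ _ := mul_le_mul_of_nonneg_left (div_le_div_of_nonneg_right this (by positivity)) hl0.le
end Q3

section Q3b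
open Set Filter Topology

def pre (m y : ℕ) : ℕ := ∏ q ∈ m.primeFactors.filter (· < y), q ^ m.factorization q
noncomputable def Mf (θ : ℕ → ℝ) (n : ℕ) : ℕ := ⌊θ n⌋₊ + 1

lemma pre_dvd {m y p : ℕ} (hp : p.Prime) (h : p ∣ pre m y) : p ∣ m ∧ p < y := by
  obtain ⟨q, hq, hd⟩ := (hp.prime.dvd_finsetProd_iff _).1 h
  rw [Finset.mem_filter] at hq
  have hqp := Nat.prime_of_mem_primeFactors hq.1
  rw [(Nat.prime_dvd_prime_iff_eq hp hqp).1 (hp.dvd_of_dvd_pow hd)]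
  exact ⟨Nat.dvd_of_mem_primeFactors hq.1, hq.2⟩
lemma pre_co {m : ℕ} (hm : 0 < m) (y : ℕ) : ∃ r, pre m y * r = m ∧ rough y r := by
  refine ⟨∏ q ∈ m.primeFactors.filter (¬ · < y), q ^ m.factorization q, ?_, fun p hp h => ?_⟩
  · rw [pre, Finset.prod_filter_mul_prod_filter_not]; exact Nat.prod_factorization_pow_eq_self hm.ne'
  · obtain ⟨q, hq, hd⟩ := (hp.prime.dvd_finsetProd_iff _).1 h
    rw [Finset.mem_filter] at hq
    rw [(Nat.prime_dvd_prime_iff_eq hp (Nat.prime_of_mem_primeFactors hq.1)).1 (hp.dvd_of_dvd_pow hd)]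
    exact not_lt.1 hq.2
lemma pre_mul {n r y z : ℕ} (hn : 0 < n) (hr : 0 < r) (h : rough y r) (hz : z ≤ y) : pre (n*r) z = pre n z := by
  refine Finset.prod_congr ?_ fun q hq => ?_
  · ext q
    simp only [Finset.mem_filter, Nat.mem_primeFactors]
    constructor
    · rintro ⟨⟨a, b, c⟩, d⟩
      refine ⟨⟨a, (a.dvd_mul.1 b).resolve_right fun hh => ?_, hn.ne'⟩, d⟩
      have := h q a hh; omega
    · rintro ⟨⟨a, b, c⟩, d⟩
      exact ⟨⟨a, b.mul_right _, by positivity⟩, d⟩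
  · rw [Finset.mem_filter, Nat.mem_primeFactors] at hq
    rw [Nat.factorization_mul hn.ne' hr.ne', Finsupp.add_apply, Nat.factorization_eq_zero_of_not_dvd (n := r) (fun hh => by have := h q hq.1.1 hh; omega), add_zero]
lemma pre_self {n y : ℕ} (hn : 0 < n) (h : ∀ p, p.Prime → p ∣ n → p < y) : pre n y = n := by
  rw [pre, Finset.filter_true_of_mem fun q hq => h q (Nat.prime_of_mem_primeFactors hq) (Nat.dvd_of_mem_primeFactors hq)]
  exact Nat.prod_factorization_pow_eq_self hn.ne'
lemma pre_eq {m y z : ℕ} (hyz : y ≤ z) (h : ∀ p, p.Prime → p ∣ m → p < z → p < y) : pre m z = pre m y := by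
  refine Finset.prod_congr ?_ fun _ _ => rfl
  refine Finset.filter_congr fun q hq => ⟨fun hh => h q (Nat.prime_of_mem_primeFactors hq) (Nat.dvd_of_mem_primeFactors hq) hh, fun hh => by omega⟩
lemma pre_pos (m y : ℕ) : 0 < pre m y := Finset.prod_pos fun q hq => pow_pos (Nat.prime_of_mem_primeFactors (Finset.mem_filter.1 hq).1).pos _

lemma lt_Mf {θ : ℕ → ℝ} (h0 : ∀ n : ℕ, 1 ≤ n → (max 2 n : ℕ) ≤ θ n) {n p : ℕ} (hn : 1 ≤ n) : p < Mf θ n ↔ (p:ℝ) ≤ θ n := by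
  rw [Mf, Nat.lt_succ_iff, Nat.le_floor_iff ((Nat.cast_nonneg _).trans (h0 n hn))]
lemma Mf_ge {θ : ℕ → ℝ} (h0 : ∀ n : ℕ, 1 ≤ n → (max 2 n : ℕ) ≤ θ n) {n : ℕ} (hn : 1 ≤ n) : n < Mf θ n ∧ 3 ≤ Mf θ n := by
  have := (lt_Mf h0 hn (p := max 2 n)).2 (h0 n hn)
  exact ⟨by omega, by omega⟩

lemma B_lt {θ : ℕ → ℝ} (h0 : ∀ n : ℕ, 1 ≤ n → (max 2 n : ℕ) ≤ θ n) {n : ℕ} (hn : n ∈ Bset θ) (p : ℕ) (hp : p ∣ n) : p < Mf θ n :=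
  (Nat.le_of_dvd hn.1 hp).trans_lt (Mf_ge h0 hn.1).1

lemma fac_ex {θ : ℕ → ℝ} (h0 : ∀ n : ℕ, 1 ≤ n → (max 2 n : ℕ) ≤ θ n) {m : ℕ} (hm : 0 < m) :
    ∃ n r, n ∈ Bset θ ∧ rough (Mf θ n) r ∧ n * r = m := by
  classical
  by_cases hB : m ∈ Bset θ
  · exact ⟨m, 1, hB, fun p hp h => absurd (Nat.dvd_one.1 h) hp.ne_one, by simp⟩
  have hex : ∃ p : ℕ, p.Prime ∧ p ∣ m ∧ ¬ (p:ℝ) ≤ θ (pre m p) := by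
    by_contra hn; push Not at hn
    exact hB ⟨hm, fun p hp hd => hn p hp hd⟩
  obtain ⟨hp, hd, hl⟩ := Nat.find_spec hex
  set p := Nat.find hex
  have hmin : ∀ q, q < p → q.Prime → q ∣ m → (q:ℝ) ≤ θ (pre m q) := fun q hq h1 h2 => by
    by_contra h3; exact Nat.find_min hex hq ⟨h1, h2, h3⟩
  obtain ⟨r, h1, h2⟩ := pre_co hm p
  have hr : 0 < r := Nat.pos_of_ne_zero fun h => by simp [h] at h1; omega
  refine ⟨pre m p, r, ⟨pre_pos _ _, fun q hq hqd => ?_⟩, fun q hq hqd => ?_, h1⟩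
  · have := pre_dvd hq hqd
    have h3 := hmin q this.2 hq this.1
    have h4 := pre_mul (pre_pos m p) hr h2 this.2.le
    rw [h1] at h4
    rw [h4] at h3; exact h3
  · refine le_trans ?_ (h2 q hq hqd)
    by_contra h; exact hl ((lt_Mf h0 (pre_pos _ _)).1 (not_le.1 h))

lemma fac_un {θ : ℕ → ℝ} (h0 : ∀ n : ℕ, 1 ≤ n → (max 2 n : ℕ) ≤ θ n) {n r n' r' : ℕ} (h1 : n ∈ Bset θ) (h1' : n' ∈ Bset θ)
    (h2 : rough (Mf θ n) r) (h2' : rough (Mf θ n') r') (hr : 0 < r) (hr' : 0 < r') (h : n*r = n'*r') : n = n' := by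
  wlog hM : Mf θ n ≤ Mf θ n' generalizing n r n' r'
  · exact (this h1' h1 h2' h2 hr' hr h.symm (by omega)).symm
  have e1 : pre (n*r) (Mf θ n) = n := (pre_mul h1.1 hr h2 le_rfl).trans (pre_self h1.1 fun p _ hp => B_lt h0 h1 p hp)
  have e2 : pre (n*r) (Mf θ n') = n' := by
    rw [h]; exact (pre_mul h1'.1 hr' h2' le_rfl).trans (pre_self h1'.1 fun p _ hp => B_lt h0 h1' p hp)
  classical
  by_cases hex : ∃ q : ℕ, q.Prime ∧ q ∣ n*r ∧ Mf θ n ≤ q ∧ q < Mf θ n'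
  · obtain ⟨hp, hd, hl, hl'⟩ := Nat.find_spec hex
    set q := Nat.find hex
    have e3 : pre (n*r) q = n := by
      refine (pre_eq hl fun p hp hd hpq => ?_).trans e1
      by_contra hc; exact Nat.find_min hex hpq ⟨hp, hd, not_lt.1 hc, hpq.trans hl'⟩
    have h5 : q ∣ n' := by
      rw [h] at hd
      exact (hp.dvd_mul.1 hd).resolve_right fun hh => by have := h2' q hp hh; omega
    have h6 := h1'.2 q hp h5
    have h7 : pre (n*r) q = pre n' q := by rw [h]; exact pre_mul h1'.1 hr' h2' hl'.le
    rw [e3] at h7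
    change (q:ℝ) ≤ θ (pre n' q) at h6
    rw [← h7] at h6
    have := (lt_Mf h0 h1.1).2 h6
    omega
  · push Not at hex
    rw [← e1, ← e2]
    refine (pre_eq hM fun p hp hd hpq => ?_).symm
    by_contra hc; have := hex p hp hd (not_lt.1 hc); omega

open Classical in
lemma fac_sum {θ : ℕ → ℝ} (h0 : ∀ n : ℕ, 1 ≤ n → (max 2 n : ℕ) ≤ θ n) (j : ℕ) (P : ℕ → Prop)
    (hP : ∀ n r, 0 < n → 0 < r → rough (Mf θ n) r → (P (n*r) ↔ P n)) (x : ℝ) :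
    ∑ m ∈ (Finset.Icc 1 ⌊x⌋₊).filter P, (1/(m:ℝ))^j =
    ∑ n ∈ (Finset.Icc 1 ⌊x⌋₊).filter (fun n => n ∈ Bset θ ∧ P n), (1/(n:ℝ))^j * ws j (Mf θ n) (x/n) := by
  simp only [ws, Finset.mul_sum]
  rw [Finset.sum_sigma']
  symm
  refine Finset.sum_bij (fun a _ => a.1 * a.2) ?_ ?_ ?_ ?_
  · rintro ⟨n, r⟩ h
    simp only [Finset.mem_sigma, Finset.mem_filter, Finset.mem_Icc, Nat.floor_div_natCast] at h ⊢
    obtain ⟨⟨⟨a, b⟩, c, d⟩, ⟨e, g⟩, i⟩ := h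
    exact ⟨⟨Nat.mul_pos a e, by rw [mul_comm]; exact (Nat.le_div_iff_mul_le a).1 g⟩, (hP n r a e i).2 d⟩
  · rintro ⟨n, r⟩ h ⟨n', r'⟩ h' hh
    simp only [Finset.mem_sigma, Finset.mem_filter, Finset.mem_Icc] at h h' hh
    have := fac_un h0 h.1.2.1 h'.1.2.1 h.2.2 h'.2.2 h.2.1.1 h'.2.1.1 hh
    subst this
    have := Nat.eq_of_mul_eq_mul_left h.1.1.1 hh
    subst this; rfl
  · intro m hm
    simp only [Finset.mem_filter, Finset.mem_Icc] at hm
    obtain ⟨n, r, h1, h2, rfl⟩ := fac_ex h0 hm.1.1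
    have hr : 0 < r := Nat.pos_of_ne_zero fun h => by simp [h] at hm
    refine ⟨⟨n, r⟩, ?_, rfl⟩
    simp only [Finset.mem_sigma, Finset.mem_filter, Finset.mem_Icc, Nat.floor_div_natCast]
    exact ⟨⟨⟨h1.1, (Nat.le_mul_of_pos_right n hr).trans hm.1.2⟩, h1, (hP n r h1.1 hr h2).1 hm.2⟩, ⟨hr, (Nat.le_div_iff_mul_le h1.1).2 (by rw [mul_comm]; exact hm.1.2)⟩, h2⟩
  · rintro ⟨n, r⟩ h
    push_cast; rw [← mul_pow]; congr 1; rw [div_mul_div_comm, one_mul]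
end Q3b

section Q3c
open Set Filter Topology

lemma et_lip : ∃ C > 0, ∀ m a b, 0 ≤ m → m ≤ a → m ≤ b → |et b - et a| ≤ C/(m+1)^3 * |b-a| := by
  obtain ⟨C0, hC0, h0⟩ := omPi.1 3
  set C := 8*C0 + 8*al with hC
  have hal := al_pos
  refine ⟨2*C, by positivity, ?_⟩
  have key : ∀ m a b, 0 ≤ m → m ≤ a → a ≤ b → |et b - et a| ≤ 2*C/(m+1)^3 * (b-a) := by
    have c1 : ∀ m a b, 0 ≤ m → m ≤ a → a ≤ b → 1 ≤ a → |et b - et a| ≤ C/(m+1)^3 * (b-a) := fun m a b hm ha hab h1 => by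
      have e : et b - et a = ∫ u in a..b, (om u - al) := by
        rw [intervalIntegral.integral_sub (om_cont.intervalIntegrable _ _) (by simp), et, et, Yf_eq (b+1), Yf_eq (a+1)]
        have := intervalIntegral.integral_interval_sub_left (a := 1) (om_cont.intervalIntegrable (μ := volume) 1 b) (om_cont.intervalIntegrable 1 a)
        rw [← this]
        simp [max_eq_left h1, max_eq_left (h1.trans hab)]; ring
      rw [e, ← abs_of_nonneg (sub_nonneg.2 hab), ← norm_eq_abs]
      refine intervalIntegral.norm_integral_le_of_norm_le_const fun u hu => ?_
      rw [uIoc_of_le hab] at hu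
      refine (h0 u (by linarith [hu.1])).trans ?_
      rw [div_le_div_iff₀ (pow_pos (by linarith [hu.1]) 3) (by positivity)]
      have : (m+1)^3 ≤ (2*u)^3 := by gcongr; linarith [hu.1]
      nlinarith [show 0 ≤ al * u^3 from mul_nonneg hal.le (pow_nonneg (by linarith [hu.1]) 3)]
    have c2 : ∀ m a b, 0 ≤ m → m ≤ a → a ≤ b → b ≤ 1 → |et b - et a| ≤ C/(m+1)^3 * (b-a) := fun m a b hm ha hab h1 => by
      rw [et, et, Yf_one (by linarith), Yf_one (by linarith), show 1 - al*(b+1) - (1-al*(a+1)) = -(al*(b-a)) by ring, abs_neg, abs_of_nonneg (mul_nonneg hal.le (by linarith))]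
      refine mul_le_mul_of_nonneg_right ?_ (by linarith)
      rw [le_div_iff₀ (by positivity)]
      have : (m+1)^3 ≤ 2^3 := by gcongr; linarith
      nlinarith
    intro m a b hm ha hab
    have hk : 0 ≤ C/(m+1)^3 := by positivity
    rw [mul_div_assoc]
    rcases le_total 1 a with h | h
    · have := c1 m a b hm ha hab h
      nlinarith [mul_nonneg hk (sub_nonneg.2 hab)]
    rcases le_total b 1 with h' | h'
    · have := c2 m a b hm ha hab h'
      nlinarith [mul_nonneg hk (sub_nonneg.2 hab)]
    have := c2 m a 1 hm ha h le_rfl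
    have h2 := c1 m 1 b hm (by linarith) h' le_rfl
    have := abs_sub_le (et b) (et 1) (et a)
    nlinarith [mul_nonneg hk (sub_nonneg.2 h), mul_nonneg hk (sub_nonneg.2 h')]
  intro m a b hm ha hb
  rcases le_total a b with h | h
  · rw [abs_of_nonneg (sub_nonneg.2 h)]; exact key m a b hm ha h
  · rw [abs_sub_comm, abs_sub_comm b, abs_of_nonneg (sub_nonneg.2 h)]; exact key m b a hm hb h

lemma per_n (K : ℝ) (hK : 0 ≤ K) : ∃ C > 0, ∀ (M : ℕ) (F s T : ℝ), 2 ≤ M → 0.69 ≤ F → F ≤ K*s → log 2 ≤ s → s ≤ T → s/2 ≤ log M → |log M - s| ≤ 2*F →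
    |DD M (exp (T-s)) - PiM M * (al⁻¹ * (T * (om (T/s) - al)))| ≤ C * (PiM M * (F * (s/T)^2)) := by
  obtain ⟨K1, hK1, h1⟩ := DD_all
  obtain ⟨Ce, hCe, h2⟩ := et_lip
  obtain ⟨Ct, hCt, h3⟩ := et_bd
  obtain ⟨c, hc, h4⟩ := PiM_lb
  obtain ⟨Cp, hCp, h5⟩ := omPi.2
  have hal := al_pos
  set κ := 2*K+1 with hκ
  have hκ1 : 1 ≤ κ := by linarith
  refine ⟨16*K1*κ^3/c + 32*Ce*κ^4/c + (2+2*Cp/c)*Ct/al, by positivity, fun M F s T hM hF hFK hs hsT hL hLs => ?_⟩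
  have hs0 : 0 < s := by linarith [log2_lb]
  have hT0 : 0 < T := by linarith
  have hL0 : 0 < log M := by linarith
  have hLκ : log M ≤ κ*s := by have := (abs_le.1 hLs).2; rw [hκ]; linarith
  have hP := PiM_pos M
  have h1P : 1 ≤ PiM M * (κ*s/c) := by
    have h6 := h4 M hM
    rw [div_le_iff₀ hL0] at h6
    rw [← mul_div_assoc, le_div_iff₀ hc, one_mul]
    exact h6.trans (mul_le_mul_of_nonneg_left hLκ hP.le)
  have hL1 : 1/log M ≤ PiM M/c := by
    rw [le_div_iff₀ hc, div_mul_eq_mul_div, one_mul]; exact h4 M hM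
  set t := T - s with ht
  have ht0 : 0 ≤ t := by linarith
  set z := s/T with hz
  have hz0 : 0 < z := by positivity
  have hz1 : z ≤ 1 := (div_le_one hT0).2 hsT
  have hsz : s = z*T := by rw [hz]; field_simp
  -- e1
  have e1 : |DD M (exp t) - et (t/log M)| ≤ 16*K1*κ^3/c * (PiM M * (F*z^2)) := by
    have := h1 M (exp t) hM (one_le_exp ht0)
    rw [log_exp] at this
    have hb : K1 * log M^2/(log M+t)^3 ≤ K1*(κ*s)^2/(T/2)^3 := by
      gcongr; linarith
    refine this.trans (hb.trans ?_)
    calc K1*(κ*s)^2/(T/2)^3 ≤ K1*(κ*s)^2/(T/2)^3 * (PiM M * (κ*s/c)) := le_mul_of_one_le_right (by positivity) h1P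
      _ = 8*K1*κ^3/c*(PiM M * (z*z^2)) := by rw [hz]; field_simp; ring
      _ ≤ 8*K1*κ^3/c*(PiM M * (2*F*z^2)) := by gcongr; linarith
      _ = _ := by ring
  have e2 : |et (t/log M) - et (t/s)| ≤ 32*Ce*κ^4/c * (PiM M * (F*z^2)) := by
    have hm1 : 1/(2*κ*z) - 1 ≤ t/log M ∧ 1/(2*κ*z) - 1 ≤ t/s := by
      have g1 : t/s + 1 = 1/z := by rw [hz, ht]; field_simp; ring
      have g2 : 1/(2*κ*z) ≤ 1/z := one_div_le_one_div_of_le hz0 (by nlinarith)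
      have g3 : t/log M + 1 = (t + log M)/log M := by field_simp
      have g4 : 1/(2*κ*z) ≤ (t+log M)/log M := by
        rw [div_le_div_iff₀ (by positivity) hL0, one_mul]
        calc log M ≤ κ*s := hLκ
          _ = (T/2)*(2*κ*z) := by rw [hsz]; ring
          _ ≤ _ := by gcongr; linarith
      constructor <;> linarith
    set m := max 0 (1/(2*κ*z) - 1) with hm
    have hm0 : 0 ≤ m := le_max_left _ _
    have := h2 m (t/s) (t/log M) hm0 (max_le (by positivity) hm1.2) (max_le (by positivity) hm1.1)
    refine this.trans ?_
    have g5 : |t/log M - t/s| ≤ T*(2*F)/(s/2*s) := by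
      rw [show t/log M - t/s = t*(s-log M)/(log M*s) by field_simp, abs_div, abs_mul, abs_of_nonneg ht0, abs_of_pos (a := log M*s) (by positivity), abs_sub_comm]
      gcongr; linarith
    have g6 : Ce/(m+1)^3 ≤ Ce/(1/(2*κ*z))^3 := by
      gcongr; linarith [le_max_right 0 (1/(2*κ*z) - 1)]
    calc Ce/(m+1)^3 * |t/log M - t/s| ≤ Ce/(1/(2*κ*z))^3 * (T*(2*F)/(s/2*s)) := by gcongr
      _ ≤ Ce/(1/(2*κ*z))^3 * (T*(2*F)/(s/2*s)) * (PiM M * (κ*s/c)) := le_mul_of_one_le_right (by positivity) h1P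
      _ = _ := by rw [hz]; field_simp; ring
  have e3 : |et (t/s) - PiM M * (al⁻¹ * (T * (om (T/s) - al)))| ≤ (2+2*Cp/c)*Ct/al * (PiM M * (F*z^2)) := by
    have hTs : 1 ≤ T/s := (one_le_div hs0).2 hsT
    have q1 : t/s = T/s - 1 := by rw [ht]; field_simp
    have q2 : T * (om (T/s) - al) = s * et (t/s) := by
      rw [q1, et, om_eq hTs, sub_add_cancel]; field_simp
    rw [q2, show et (t/s) - PiM M * (al⁻¹ * (s * et (t/s))) = (al - s*PiM M)/al * et (t/s) by field_simp, abs_mul, abs_div, abs_of_pos hal]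
    have q3 : |et (t/s)| ≤ Ct*z^2 := by
      refine (h3 _ (by positivity)).trans ?_
      rw [q1, sub_add_cancel, show Ct/(T/s)^3 = Ct*(z^2*z) by rw [hz]; field_simp]
      gcongr; exact mul_le_of_le_one_right (by positivity) hz1
    have q4 : |al - s*PiM M| ≤ (2+2*Cp/c)*(PiM M*F) := by
      have r1 := h5 M hM
      have r2 : |PiM M * log M - al| ≤ Cp/log M := by
        rw [show PiM M * log M - al = (PiM M - al/log M)*log M by field_simp, abs_mul, abs_of_pos hL0]
        calc _ ≤ Cp/log M^2*log M := by gcongr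
          _ = _ := by field_simp
      have r3 : Cp/log M ≤ Cp*(PiM M/c) := by rw [← mul_one_div]; gcongr
      have r4 : |PiM M * (log M - s)| ≤ PiM M*(2*F) := by rw [abs_mul, abs_of_pos hP]; gcongr
      have r5 := abs_sub_le al (PiM M*log M) (s*PiM M)
      rw [abs_sub_comm al (PiM M*log M), show PiM M*log M - s*PiM M = PiM M * (log M - s) by ring] at r5
      have r6 : Cp*(PiM M/c) ≤ Cp*(PiM M/c)*(2*F) := le_mul_of_one_le_right (by positivity) (by linarith)
      calc _ ≤ _ := r5
        _ ≤ Cp*(PiM M/c)*(2*F) + PiM M*(2*F) := by linarith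
        _ = _ := by ring
    calc _ ≤ (2+2*Cp/c)*(PiM M*F)/al * (Ct*z^2) := by gcongr
      _ = _ := by ring
  have := abs_sub_le (DD M (exp t)) (et (t/log M)) (PiM M * (al⁻¹ * (T * (om (T/s) - al))))
  have := abs_sub_le (et (t/log M)) (et (t/s)) (PiM M * (al⁻¹ * (T * (om (T/s) - al))))
  rw [add_mul, add_mul]; linarith
end Q3c

section Q3d
open Set Filter Topology

noncomputable def sm (g : ℕ → ℝ) (T : ℝ) : ℝ := ∑ n ∈ Finset.Icc 1 ⌊exp T/2⌋₊, g n
noncomputable def sn (n : ℕ) : ℝ := log (2*n)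
open Classical in
noncomputable def aS (M : ℕ → ℕ) (S : Set ℕ) (n : ℕ) : ℝ := if n ∈ S then PiM (M n)/n else 0

lemma mem_sm {n : ℕ} {T : ℝ} : n ∈ Finset.Icc 1 ⌊exp T/2⌋₊ ↔ 1 ≤ n ∧ sn n ≤ T := by
  rw [Finset.mem_Icc, and_congr_right_iff]
  intro h
  have h' : (0:ℝ) < n := by exact_mod_cast h
  rw [Nat.le_floor_iff (by positivity), sn, log_le_iff_le_exp (by positivity), le_div_iff₀ two_pos, mul_comm]
lemma sn_ge {n : ℕ} (h : 1 ≤ n) : log 2 ≤ sn n := by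
  have : (1:ℝ) ≤ n := by exact_mod_cast h
  exact log_le_log two_pos (by linarith)
lemma sm_add (g h : ℕ → ℝ) (T : ℝ) : sm (fun n => g n + h n) T = sm g T + sm h T := Finset.sum_add_distrib
lemma sm_mul (c : ℝ) (g : ℕ → ℝ) (T : ℝ) : sm (fun n => c * g n) T = c * sm g T := (Finset.mul_sum _ _ _).symm
lemma sm_le {g h : ℕ → ℝ} {T : ℝ} (H : ∀ n, 1 ≤ n → sn n ≤ T → g n ≤ h n) : sm g T ≤ sm h T :=
  Finset.sum_le_sum fun n hn => H n (mem_sm.1 hn).1 (mem_sm.1 hn).2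
lemma sm_sub {T T' : ℝ} (h : T ≤ T') : Finset.Icc 1 ⌊exp T/2⌋₊ ⊆ Finset.Icc 1 ⌊exp T'/2⌋₊ := fun n hn => by
  rw [mem_sm] at hn ⊢; exact ⟨hn.1, hn.2.trans h⟩
lemma sm_mono {g : ℕ → ℝ} (H : ∀ n, 0 ≤ g n) {T T' : ℝ} (h : T ≤ T') : sm g T ≤ sm g T' :=
  Finset.sum_le_sum_of_subset_of_nonneg (sm_sub h) fun n _ _ => H n
lemma aS_nn (M : ℕ → ℕ) (S : Set ℕ) (n : ℕ) : 0 ≤ aS M S n := by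
  unfold aS; split_ifs
  · exact div_nonneg (PiM_pos _).le (Nat.cast_nonneg _)
  · rfl

structure KP (F E : ℝ → ℝ) (M : ℕ → ℕ) (S : Set ℕ) (w κ : ℝ) : Prop where
  ep : EP F E
  three : ∀ n, 1 ≤ n → 3 ≤ M n
  lt : ∀ n, 1 ≤ n → n < M n
  up : ∀ n, 1 ≤ n → log (M n) ≤ sn n + F (sn n)
  key : ∃ C > 0, ∀ x : ℝ, 1 ≤ x → |∑ n ∈ Finset.Icc 1 ⌊x⌋₊, S.indicator (fun n => 1/(n:ℝ) * ws 1 (M n) (x/n)) n - (w * (log x + eulerMascheroniConstant) + κ)| ≤ C/x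

noncomputable def QS (M : ℕ → ℕ) (S : Set ℕ) (κ T : ℝ) : ℝ := sm (fun n => aS M S n * (LM (M n) - log n)) T - κ
noncomputable def ZS (F : ℝ → ℝ) (M : ℕ → ℕ) (S : Set ℕ) (T : ℝ) : ℝ := sm (fun n => aS M S n * (F (sn n) * (sn n/T)^2)) T

variable {F E : ℝ → ℝ} {M : ℕ → ℕ} {S : Set ℕ} {w κ : ℝ}

lemma KP.logs (h : KP F E M S w κ) {n : ℕ} (hn : 1 ≤ n) : sn n/2 ≤ log (M n) ∧ |log (M n) - sn n| ≤ 2*F (sn n) ∧ sn n = log 2 + log n := by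
  have hn0 : (1:ℝ) ≤ n := by exact_mod_cast hn
  have hM : (n:ℝ)+1 ≤ M n := by exact_mod_cast h.lt n hn
  have h3 : sn n = log 2 + log n := log_mul (by norm_num) (by positivity)
  have h4 := h.up n hn
  have h5 := h.ep.lb (sn n) (by linarith [sn_ge hn, log2_lb])
  have h6 : log n ≤ log (M n) := log_le_log (by positivity) (by linarith)
  refine ⟨?_, ?_, h3⟩
  · have : log (2*n) ≤ log ((M n:ℝ)^2) := log_le_log (by positivity) (by nlinarith)
    rw [log_pow] at this; push_cast at this; rw [sn]; linarith
  · rw [abs_le]; constructor <;> linarith [log2_ub]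

lemma KP.FK (h : KP F E M S w κ) : ∃ K, 0 ≤ K ∧ ∀ s, log 2 ≤ s → F s ≤ K*s := by
  have h2 := log2_lb
  refine ⟨2*E (log 2), by linarith [h.ep.nn (a := log 2) (by linarith)], fun s hs => (h.ep.Fle (by linarith)).trans ?_⟩
  have := h.ep.anti _ _ (by linarith) hs
  nlinarith

lemma KP.star (h : KP F E M S w κ) : ∃ C > 0, ∀ T, log 2 ≤ T →
    |sm (fun n => aS M S n * om (T/sn n)) T - al*w + al*QS M S κ T/T| ≤ C*(|w - sm (aS M S) T| + ZS F M S T + 1/T^2)/T := by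
  obtain ⟨K, hK, hFK⟩ := h.FK
  obtain ⟨C1, hC1, h1⟩ := per_n K hK
  obtain ⟨C2, hC2, h2⟩ := h.key
  have hal := al_pos
  set δ := eulerMascheroniConstant - log 2 with hδ
  refine ⟨al*(C1+4*C2+|δ|), by positivity, fun T hT => ?_⟩
  have hT0 : 0 < T := by linarith [log2_lb]
  set x := exp T/2 with hx
  have hx1 : 1 ≤ x := by
    rw [hx, le_div_iff₀ two_pos, one_mul, ← exp_log (two_pos : (0:ℝ)<2)]; exact exp_le_exp.2 hT
  have hlx : log x = T - log 2 := by rw [hx, log_div (exp_pos _).ne' two_ne_zero, log_exp]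
  have hx2 : C2/x ≤ 4*C2*(1/T^2) := by
    have := quadratic_le_exp_of_nonneg hT0.le
    rw [show 4*C2*(1/T^2) = C2/(T^2/4) by field_simp]
    gcongr; rw [hx]; linarith
  have key := h2 x hx1
  set A := sm (fun n => aS M S n * om (T/sn n)) T with hA
  set N := sm (aS M S) T with hN
  set Q := QS M S κ T with hQ
  set Z := ZS F M S T with hZ
  have e1 : |∑ n ∈ Finset.Icc 1 ⌊x⌋₊, S.indicator (fun n => 1/(n:ℝ) * ws 1 (M n) (x/n)) n - (al⁻¹*T*(A - al*N) + N*(T+δ) + (Q+κ))| ≤ C1*Z := by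
    rw [hA, hN, hQ, QS, hZ, ZS]
    simp only [sm]
    rw [sub_add_cancel, ← hx]
    simp only [Finset.mul_sum, Finset.sum_mul, ← Finset.sum_sub_distrib, ← Finset.sum_add_distrib]
    refine (Finset.abs_sum_le_sum_abs _ _).trans (Finset.sum_le_sum fun n hn => ?_)
    rw [mem_sm] at hn
    obtain ⟨l1, l2, l3⟩ := h.logs hn.1
    have hn0 : (0:ℝ) < n := by exact_mod_cast hn.1
    unfold aS
    by_cases hS : n ∈ S
    · rw [indicator_of_mem hS, if_pos hS]
      have hh := h1 (M n) (F (sn n)) (sn n) T (by linarith [h.three n hn.1]) (h.ep.lb _ (by linarith [sn_ge hn.1, log2_lb])) (hFK _ (sn_ge hn.1)) (sn_ge hn.1) hn.2 l1 l2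
      have hxn : x/n = exp (T - sn n) := by
        rw [exp_sub, sn, exp_log (by positivity), hx]; field_simp
      have hD : ws 1 (M n) (x/n) = DD (M n) (exp (T-sn n)) + PiM (M n) * (T - sn n + eulerMascheroniConstant + LM (M n)) := by
        rw [hxn, DD, log_exp]; ring
      rw [hD, show 1/(n:ℝ) * (DD (M n) (exp (T-sn n)) + PiM (M n) * (T - sn n + eulerMascheroniConstant + LM (M n))) - (al⁻¹*T*(PiM (M n)/n * om (T/sn n) - al * (PiM (M n)/n)) + PiM (M n)/n*(T+δ) + PiM (M n)/n * (LM (M n) - log n)) = (DD (M n) (exp (T-sn n)) - PiM (M n) * (al⁻¹ * (T * (om (T/sn n) - al))))/n by rw [l3, hδ]; ring, abs_div, abs_of_pos hn0, div_le_iff₀ hn0]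
      refine hh.trans (le_of_eq ?_)
      field_simp
    · rw [indicator_of_notMem hS, if_neg hS]; simp
  rw [hlx] at key
  have e2 : |al⁻¹*T*(A-al*w+al*Q/T) - (w-N)*δ| ≤ C1*Z + 4*C2*(1/T^2) := by
    rw [abs_le] at e1 key ⊢
    have : al⁻¹*T*(A-al*w+al*Q/T) - (w-N)*δ = (al⁻¹*T*(A - al*N) + N*(T+δ) + (Q+κ)) - (w * (T - log 2 + eulerMascheroniConstant) + κ) := by
      rw [hδ]; field_simp; ring
    rw [this]
    constructor <;> linarith [e1.1, e1.2, key.1, key.2]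
  have hZ0 : 0 ≤ Z := by
    rw [hZ, ZS, sm]
    refine Finset.sum_nonneg fun n hn => ?_
    have := h.ep.lb (sn n) (by linarith [sn_ge (mem_sm.1 hn).1, log2_lb])
    have := aS_nn M S n
    positivity
  have e3 : |al⁻¹*T*(A-al*w+al*Q/T)| ≤ (C1+4*C2+|δ|)*(|w-N| + Z + 1/T^2) := by
    have := abs_sub_abs_le_abs_sub (al⁻¹*T*(A-al*w+al*Q/T)) ((w-N)*δ)
    rw [abs_mul (w-N)] at this
    have p1 : 0 ≤ 1/T^2 := by positivity
    have p2 := abs_nonneg (w-N)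
    have p3 := abs_nonneg δ
    generalize 1/T^2 = y at *
    nlinarith [mul_nonneg hC1.le p1, mul_nonneg hC1.le p2, mul_nonneg hC2.le hZ0, mul_nonneg hC2.le p2, mul_nonneg p3 hZ0, mul_nonneg p3 p1]
  rw [abs_mul, abs_of_pos (by positivity : 0 < al⁻¹*T)] at e3
  rw [le_div_iff₀ hT0]
  calc _ = al*(al⁻¹*T*|A-al*w+al*Q/T|) := by field_simp
    _ ≤ al*((C1+4*C2+|δ|)*(|w-N| + Z + 1/T^2)) := by gcongr
    _ = _ := by ring

lemma KP.Nle (h : KP F E M S w κ) (T : ℝ) : sm (aS M S) T ≤ w := by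
  obtain ⟨C2, hC2, h2⟩ := h.key
  by_contra hc
  set N := sm (aS M S) T with hN
  set G := ⌊exp T/2⌋₊ with hG
  set D := ∑ n ∈ Finset.Icc 1 G, (aS M S n * |eulerMascheroniConstant + LM (M n) - log n| + 2^(M n) * 2) with hD
  set Y := (D + |w*eulerMascheroniConstant + κ| + C2)/(N - w) with hY
  have hb : ∀ x : ℝ, 1 ≤ x → (G:ℝ) ≤ x → (N-w)*log x ≤ D + |w*eulerMascheroniConstant + κ| + C2 := fun x hx hGx => by
    have k1 := (abs_le.1 (h2 x hx)).2
    have hx' : C2/x ≤ C2 := div_le_self hC2.le hx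
    have k2 : N*log x - D ≤ ∑ n ∈ Finset.Icc 1 ⌊x⌋₊, S.indicator (fun n => 1/(n:ℝ) * ws 1 (M n) (x/n)) n := by
      refine le_trans ?_ (Finset.sum_le_sum_of_subset_of_nonneg (Finset.Icc_subset_Icc_right (Nat.le_floor hGx)) fun n _ _ => indicator_nonneg (fun n _ => mul_nonneg (by positivity) (ws_nonneg _ _ _)) n)
      rw [hN, sm, hD, Finset.sum_mul, ← Finset.sum_sub_distrib]
      refine Finset.sum_le_sum fun n hn => ?_
      have hn0 : (0:ℝ) < n := by exact_mod_cast (Finset.mem_Icc.1 hn).1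
      have hn1 : (1:ℝ) ≤ n := by exact_mod_cast (Finset.mem_Icc.1 hn).1
      have hx0 : 0 < x := by linarith
      unfold aS
      by_cases hS : n ∈ S
      · rw [indicator_of_mem hS, if_pos hS]
        have hd := (abs_le.1 (DD_bd (M n) (R := x/n) (by positivity))).1
        have hws : ws 1 (M n) (x/n) = DD (M n) (x/n) + PiM (M n) * (log x + (eulerMascheroniConstant + LM (M n) - log n)) := by
          rw [DD, log_div hx0.ne' hn0.ne']; ring
        have h7 := neg_abs_le (eulerMascheroniConstant + LM (M n) - log n)
        have hPn := div_nonneg (PiM_pos (M n)).le hn0.le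
        have h8 : 1/(n:ℝ)*(2^(M n)*2/(x/n)) ≤ 2^(M n)*2 := by
          rw [show 1/(n:ℝ)*(2^(M n)*2/(x/n)) = 2^(M n)*2/x by field_simp]
          exact div_le_self (by positivity) hx
        have h9 := mul_le_mul_of_nonneg_left hd (by positivity : 0 ≤ 1/(n:ℝ))
        rw [hws]
        have h10 := mul_le_mul_of_nonneg_left h7 hPn
        have : 1/(n:ℝ) * (DD (M n) (x/n) + PiM (M n) * (log x + (eulerMascheroniConstant + LM (M n) - log n))) = 1/(n:ℝ) * DD (M n) (x/n) + PiM (M n)/n * log x + PiM (M n)/n * (eulerMascheroniConstant + LM (M n) - log n) := by ring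
        rw [this]; linarith
      · rw [indicator_of_notMem hS, if_neg hS]
        have : (0:ℝ) ≤ 2^(M n)*2 := by positivity
        linarith
    linarith [le_abs_self (w*eulerMascheroniConstant + κ)]
  have hNw : 0 < N - w := by linarith
  have := hb (exp (|Y|+1+G)) (one_le_exp (by positivity)) (by linarith [add_one_le_exp (|Y|+1+G), abs_nonneg Y])
  rw [log_exp, mul_comm, ← le_div_iff₀ hNw] at this
  have hG0 : (0:ℝ) ≤ G := Nat.cast_nonneg _
  linarith [le_abs_self Y]
end Q3d

section Q4
open Set Filter Topology

noncomputable def kk (l : ℝ) : ℝ := om (l/2) - om (l-1)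

lemma log_cmp (g g' : ℝ → ℝ) (h1 : g 1 = 0) (hd : ∀ x, 1 ≤ x → HasDerivAt g (g' x) x) : 
    ((∀ x, 1 ≤ x → g' x ≤ 1/x) → ∀ x, 1 ≤ x → g x ≤ log x) ∧ ((∀ x, 1 ≤ x → 1/x ≤ g' x) → ∀ x, 1 ≤ x → log x ≤ g x) := by
  have hl : ∀ x, 1 ≤ x → HasDerivAt log (1/x) x := fun x hx => by simpa using hasDerivAt_log (by linarith : x ≠ 0)
  constructor
  · intro h x hx
    have : MonotoneOn (fun y => log y - g y) (Ici 1) := monotoneOn_of_hasDerivWithinAt_nonneg (convex_Ici 1) (fun y hy => ((hl y hy).sub (hd y hy)).continuousAt.continuousWithinAt) (fun y hy => ((hl y (interior_subset hy)).sub (hd y (interior_subset hy))).hasDerivWithinAt) (fun y hy => sub_nonneg.2 (h y (interior_subset hy)))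
    have := this (mem_Ici.2 le_rfl) hx hx
    simp [h1] at this; exact this
  · intro h x hx
    have : MonotoneOn (fun y => g y - log y) (Ici 1) := monotoneOn_of_hasDerivWithinAt_nonneg (convex_Ici 1) (fun y hy => ((hd y hy).sub (hl y hy)).continuousAt.continuousWithinAt) (fun y hy => ((hd y (interior_subset hy)).sub (hl y (interior_subset hy))).hasDerivWithinAt) (fun y hy => sub_nonneg.2 (h y (interior_subset hy)))
    have := this (mem_Ici.2 le_rfl) hx hx
    simp [h1] at this; exact this

lemma log_lo {x : ℝ} (hx : 1 ≤ x) : 3*(x^2-1)/(x^2+4*x+1) ≤ log x := by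
  refine (log_cmp (fun x => 3*(x^2-1)/(x^2+4*x+1)) (fun x => (3*(2*x)*(x^2+4*x+1) - 3*(x^2-1)*(2*x+4))/(x^2+4*x+1)^2) (by norm_num) fun x hx => ?_).1 (fun x hx => ?_) x hx
  · have h1 : HasDerivAt (fun x : ℝ => 3*(x^2-1)) (3*(2*x)) x := by simpa using ((hasDerivAt_pow 2 x).sub_const 1).const_mul 3
    have h2 : HasDerivAt (fun x : ℝ => x^2+4*x+1) (2*x+4) x := by simpa using ((hasDerivAt_pow 2 x).add ((hasDerivAt_id x).const_mul 4)).add_const 1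
    exact h1.div h2 (by positivity)
  · rw [div_le_div_iff₀ (by positivity) (by linarith)]; nlinarith [sq_nonneg ((x-1)^2)]
lemma log_lo1 {x : ℝ} (hx : 1 ≤ x) : 2*(x-1)/(x+1) ≤ log x := by
  refine le_trans ?_ (log_lo hx)
  rw [div_le_div_iff₀ (by positivity) (by positivity)]; nlinarith [mul_nonneg (sub_nonneg.2 hx) (sq_nonneg (x-1))]
lemma log_up {x : ℝ} (hx : 1 ≤ x) : log x ≤ (x^2+4*x-5)/(4*x+2) := by
  refine (log_cmp (fun x => (x^2+4*x-5)/(4*x+2)) (fun x => ((2*x+4)*(4*x+2) - (x^2+4*x-5)*4)/(4*x+2)^2) (by norm_num) fun x hx => ?_).2 (fun x hx => ?_) x hx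
  · have h1 : HasDerivAt (fun x : ℝ => x^2+4*x-5) (2*x+4) x := by simpa using ((hasDerivAt_pow 2 x).add ((hasDerivAt_id x).const_mul 4)).sub_const 5
    have h2 : HasDerivAt (fun x : ℝ => 4*x+2) 4 x := by simpa using ((hasDerivAt_id x).const_mul 4).add_const 2
    exact h1.div h2 (by positivity)
  · rw [div_le_div_iff₀ (by linarith) (by positivity)]; nlinarith [mul_nonneg (sub_nonneg.2 hx) (sq_nonneg (x-1))]

lemma Yf_sub {a b : ℝ} (ha : 2 ≤ a) (hab : a ≤ b) : Yf b = Yf a + ∫ u in (a-1)..(b-1), om u := by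
  rw [Yf_eq b, Yf_eq a, max_eq_left (by linarith), max_eq_left (by linarith), add_assoc, intervalIntegral.integral_add_adjacent_intervals (om_cont.intervalIntegrable _ _) (om_cont.intervalIntegrable _ _)]
lemma om12 {u : ℝ} (h1 : 1 ≤ u) (h2 : u ≤ 2) : om u = 1/u := by rw [om_eq h1, Yf_one h2]
lemma Yf23 {u : ℝ} (h1 : 2 ≤ u) (h2 : u ≤ 3) : Yf u = 1 + log (u-1) := by
  rw [Yf_sub le_rfl h1, Yf_one le_rfl]
  congr 1
  rw [intervalIntegral.integral_congr (g := fun u => 1/u), integral_one_div_of_pos (by norm_num) (by linarith)]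
  · norm_num
  · intro y hy
    rw [uIcc_of_le (by linarith)] at hy
    exact om12 (by linarith [hy.1]) (by linarith [hy.2])
lemma om23 {u : ℝ} (h1 : 2 ≤ u) (h2 : u ≤ 3) : om u = (1 + log (u-1))/u := by rw [om_eq (by linarith), Yf23 h1 h2]

lemma om23_up {u : ℝ} (h1 : 2 ≤ u) (h2 : u ≤ 3) : om u ≤ 0.5673 := by
  rw [om23 h1 h2, div_le_iff₀ (by linarith)]
  have a1 : log (u-1) ≤ log 1.763 + ((u-1)/1.763 - 1) := by
    have := log_le_sub_one_of_pos (show 0 < (u-1)/1.763 by apply div_pos <;> linarith)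
    rw [log_div (by linarith) (by norm_num)] at this; linarith
  have a2 : log 1.763 = log 2 - log (2/1.763) := by rw [log_div (by norm_num) (by norm_num)]; ring
  have a3 := log_lo (x := 2/1.763) (by norm_num)
  have a4 := log_two_lt_d9
  norm_num at a1 a2 a3 a4 ⊢; linarith
lemma om34 {u : ℝ} (h1 : 3 ≤ u) (h2 : u ≤ 4) : |om u - 0.56265| ≤ 0.00465 := by
  have hu : 0 < u := by linarith
  have Y3 : Yf 3 = 1 + log 2 := by rw [Yf23 (by norm_num) le_rfl]; norm_num
  have e := Yf_sub (a := 3) (by norm_num) h1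
  have up : ∫ v in (3-1:ℝ)..(u-1), om v ≤ 0.5673*(u-3) := by
    have := intervalIntegral.integral_mono_on (by linarith : (3-1:ℝ) ≤ u-1) (om_cont.intervalIntegrable _ _) (intervalIntegrable_const (c := (0.5673:ℝ)) (μ := volume)) (fun v hv => om23_up (by linarith [hv.1]) (by linarith [hv.2]))
    rw [intervalIntegral.integral_const, smul_eq_mul] at this; linarith
  have lo : 3*log ((u-1)/2) + 4/(u-1) - 2 ≤ ∫ v in (3-1:ℝ)..(u-1), om v := by
    have hc : ∀ v ∈ uIcc (3-1:ℝ) (u-1), HasDerivAt (fun v => 3*log v + 4/v) (3/v - 4/v^2) v := fun v hv => by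
      rw [uIcc_of_le (by linarith)] at hv
      have hv0 : v ≠ 0 := by linarith [hv.1]
      refine (((hasDerivAt_log hv0).const_mul 3).add ((hasDerivAt_inv hv0).const_mul 4)).congr_deriv ?_
      field_simp; ring
    have hi : IntervalIntegrable (fun v : ℝ => 3/v - 4/v^2) volume (3-1) (u-1) := by
      refine ContinuousOn.intervalIntegrable fun v hv => ?_
      rw [uIcc_of_le (by linarith)] at hv
      have hv0 : v ≠ 0 := by linarith [hv.1]
      exact ((continuousAt_const.div continuousAt_id hv0).sub (continuousAt_const.div (continuousAt_id.pow 2) (pow_ne_zero 2 hv0))).continuousWithinAt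
    have := intervalIntegral.integral_mono_on (by linarith : (3-1:ℝ) ≤ u-1) hi (om_cont.intervalIntegrable _ _) (fun v hv => by
      have hv1 : 2 ≤ v := by linarith [hv.1]
      rw [om23 hv1 (by linarith [hv.2]), show 3/v - 4/v^2 = (3 - 4/v)/v by field_simp]
      gcongr
      have := log_lo1 (x := v-1) (by linarith)
      have hv0 : v ≠ 0 := by linarith
      rw [show 2*(v-1-1)/(v-1+1) = 2 - 4/v by rw [sub_add_cancel]; field_simp; ring] at this; linarith)
    rw [intervalIntegral.integral_eq_sub_of_hasDerivAt hc hi] at this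
    rw [log_div (by linarith) (by norm_num)]
    norm_num at this ⊢; linarith
  have l2 := log_two_gt_d9
  have l3 := log_lo (x := (u-1)/2) (by linarith)
  set t := (u-1)/2 with ht
  have hut : u = 2*t+1 := by rw [ht]; ring
  have ht1 : 1 ≤ t := by linarith
  have ht2 : t ≤ 1.5 := by linarith
  rw [om_eq (by linarith), abs_le]
  constructor
  · have : 0.558*(2*t+1) ≤ 1.6931471803 + 9*(t^2-1)/(t^2+4*t+1) + 2/t - 2 := by
      have q : 0 < t*(t^2+4*t+1) := by positivity
      rw [← sub_nonneg, show 1.6931471803 + 9*(t^2-1)/(t^2+4*t+1) + 2/t - 2 - 0.558*(2*t+1) = ((9*(t^2-1)*t + 2*(t^2+4*t+1)) + (-0.3068528197- 0.558*(2*t+1))*(t*(t^2+4*t+1)))/(t*(t^2+4*t+1)) by field_simp; ring]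
      refine div_nonneg ?_ q.le
      nlinarith [mul_nonneg (sub_nonneg.2 ht1) (sub_nonneg.2 ht2), mul_nonneg (mul_nonneg (sub_nonneg.2 ht1) (sub_nonneg.2 ht2)) (sub_nonneg.2 ht1), mul_nonneg (mul_nonneg (sub_nonneg.2 ht1) (sub_nonneg.2 ht2)) (sub_nonneg.2 ht2), mul_nonneg (sub_nonneg.2 ht1) (sq_nonneg (t-1.25)), sq_nonneg ((t-1)*(t-1.3)), sq_nonneg (t-1.25)]
    have h4 : 4/(u-1) = 2/t := by rw [ht]; field_simp; norm_num
    have : 0.558*u ≤ Yf u := by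
      rw [e, Y3]; rw [h4] at lo
      rw [show 9*(t^2-1)/(t^2+4*t+1) = 3*(3*(t^2-1)/(t^2+4*t+1)) by ring] at this
      rw [← hut] at this; linarith
    have := (le_div_iff₀ hu).2 this
    linarith
  · have h3 := om23_up (u := 3) (by norm_num) le_rfl
    rw [om_eq (by norm_num), div_le_iff₀ (by norm_num)] at h3
    have : Yf u ≤ 0.5673*u := by rw [e]; linarith
    have := (div_le_iff₀ hu).2 this
    linarith

lemma om3 {u : ℝ} (h1 : 3 ≤ u) : |om u - 0.56265| ≤ 0.00465 := by
  have : ∀ n : ℕ, ∀ u : ℝ, 3 ≤ u → u ≤ 4+n → |om u - 0.56265| ≤ 0.00465 := by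
    intro n
    induction n with
    | zero => intro u h1 h2; exact om34 h1 (by simpa using h2)
    | succ n ih =>
      intro u h1 h2
      push_cast at h2
      have hn : (0:ℝ) ≤ n := Nat.cast_nonneg n
      rcases le_total u (4+n) with h | h
      · exact ih u h1 h
      have e := Yf_sub (a := 4+n) (by linarith) h
      have i1 : |∫ v in (4+n-1:ℝ)..(u-1), (om v - 0.56265)| ≤ 0.00465*|u-1-(4+n-1)| := by
        rw [← norm_eq_abs]
        refine intervalIntegral.norm_integral_le_of_norm_le_const fun v hv => ?_
        rw [uIoc_of_le (by linarith)] at hv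
        exact ih v (by linarith [hv.1]) (by linarith [hv.2])
      rw [intervalIntegral.integral_sub (om_cont.intervalIntegrable _ _) (by simp), intervalIntegral.integral_const, smul_eq_mul, abs_of_nonneg (a := u-1-_) (by linarith)] at i1
      have i2 := ih (4+n) (by linarith) le_rfl
      rw [om_eq (by linarith), div_sub' (by linarith), abs_div, abs_of_pos (a := (4:ℝ)+n) (by linarith), div_le_iff₀ (by linarith)] at i2
      rw [om_eq (by linarith), div_sub' (by linarith), abs_div, abs_of_pos (a := u) (by linarith), div_le_iff₀ (by linarith), e]
      rw [abs_le] at *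
      constructor <;> linarith [i1.1, i1.2, i2.1, i2.2]
  obtain ⟨n, hn⟩ := exists_nat_ge u
  exact this n u h1 (by linarith)

lemma od_exp {u : ℝ} (h : 4 ≤ u) : |od u| ≤ 0.002325*exp (-(1.5*(u-5))) := by
  have hod : ∀ u c, 4 ≤ u → |om u - om (u-1)| ≤ c → |od u| ≤ c/u := fun u c hu hc => by
    rw [od, if_pos (by linarith), abs_div, abs_of_pos (a := u) (by linarith), abs_sub_comm]; gcongr
  have P : ∀ j : ℕ, ∀ u, 4 + (j:ℝ) ≤ u → |od u| ≤ 0.002325*(1/5)^j := by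
    intro j
    induction j with
    | zero =>
      intro u hu
      have hu' : 4 ≤ u := by simpa using hu
      have h1 := om3 (u := u) (by linarith)
      have h2 := om3 (u := u-1) (by linarith)
      refine (hod u 0.0093 hu' ?_).trans ?_
      · rw [abs_le] at *; constructor <;> linarith [h1.1, h1.2, h2.1, h2.2]
      · rw [div_le_iff₀ (by linarith)]; linarith
    | succ j ih =>
      intro u hu
      push_cast at hu
      have hj : (0:ℝ) ≤ j := Nat.cast_nonneg j
      have h1 := om_mvt (a := u-1) (b := u) (D := 0.002325*(1/5)^j) (by linarith) (by linarith) (by intros v hv; first | exact ih v (by linarith [hv.1]) | (intros; exact ih v (by linarith)))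
      rw [sub_sub_cancel, mul_one] at h1
      refine (hod u _ (by linarith) h1).trans ?_
      rw [pow_succ, ← mul_assoc, mul_one_div]
      gcongr; linarith
  have h0 : 0 ≤ u - 4 := by linarith
  have hf := Nat.floor_le h0
  have hf2 := Nat.lt_floor_add_one (u-4)
  refine (P ⌊u-4⌋₊ u (by linarith)).trans ?_
  refine mul_le_mul_of_nonneg_left ?_ (by norm_num)
  have e5 : (1/5:ℝ) ≤ exp (-1.5) := by
    rw [exp_neg, one_div]
    refine inv_anti₀ (exp_pos _) ?_
    have : exp 1.5 ^ 2 = exp 1 ^ 3 := by rw [← exp_nat_mul, ← exp_nat_mul]; norm_num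
    have h1 : exp 1 ^ 3 ≤ 2.72^3 := by gcongr; linarith [exp_one_lt_d9]
    nlinarith [exp_pos 1.5]
  calc (1/5:ℝ)^⌊u-4⌋₊ ≤ exp (-1.5)^⌊u-4⌋₊ := by gcongr
    _ = exp (⌊u-4⌋₊*(-1.5)) := (exp_nat_mul _ _).symm
    _ ≤ _ := exp_le_exp.2 (by linarith)

lemma om_osc {a b : ℝ} (ha : 4 ≤ a) (hab : a ≤ b) : |om b - om a| ≤ 0.00155*exp (-(1.5*(a-5))) := by
  have hB : ∀ x : ℝ, HasDerivAt (fun x => 0.00155*(exp (-(1.5*(a-5))) - exp (-(1.5*(x-5))))) (0.002325*exp (-(1.5*(x-5)))) x := fun x => by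
    have h1 : HasDerivAt (fun x : ℝ => -(1.5*(x-5))) (-1.5) x := by
      simpa using (((hasDerivAt_id x).sub_const 5).const_mul 1.5).fun_neg
    refine ((h1.exp.const_sub _).const_mul 0.00155).congr_deriv ?_
    ring
  have := image_norm_le_of_norm_deriv_right_le_deriv_boundary (f := fun x => om x - om a) (f' := od) (a := a) (b := b) (om_cont.sub continuous_const).continuousOn (fun x hx => ((om_deriv (by linarith [hx.1]) (by linarith [hx.1])).sub_const _).hasDerivWithinAt) (by simp) hB (fun x hx => od_exp (by linarith [hx.1])) ⟨hab, le_rfl⟩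
  rw [norm_eq_abs] at this
  refine this.trans ?_
  have := exp_pos (-(1.5*(b-5)))
  linarith

lemma kk_cont : Continuous kk := (om_cont.comp (continuous_id.div_const 2)).sub (om_cont.comp (continuous_id.sub continuous_const))
lemma lkk_int (a b : ℝ) : IntervalIntegrable (fun l => l*|kk l|) volume a b := (continuous_id.mul kk_cont.abs).intervalIntegrable _ _

lemma pc {a b : ℝ} (G g : ℝ → ℝ) (hab : a ≤ b) (hd : ∀ x ∈ Icc a b, HasDerivAt G (g x) x) (hc : ContinuousOn g (Icc a b))
    (hb : ∀ x ∈ Icc a b, x*|kk x| ≤ g x) : ∫ l in a..b, l*|kk l| ≤ G b - G a := by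
  have hi : IntervalIntegrable g volume a b := hc.intervalIntegrable_of_Icc hab
  rw [← intervalIntegral.integral_eq_sub_of_hasDerivAt (by rwa [uIcc_of_le hab]) hi]
  exact intervalIntegral.integral_mono_on hab (lkk_int a b) hi hb
end Q4

section Q4b
open Set Filter Topology

lemma qlem : ∃ q : ℝ, 0 < q ∧ q < 1 ∧ ∀ U, 2 ≤ U → ∫ l in (2:ℝ)..U, l*|kk l| ≤ q := by
  have l2 := log_two_gt_d9
  have p1 : ∫ l in (2:ℝ)..3, l*|kk l| ≤ 0.31 := by
    refine (pc (fun l => l - log (l-1)) (fun l => 1 - 1/(l-1)) (by norm_num) (fun x hx => ?_) (fun x hx => ?_) (fun x hx => ?_)).trans ?_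
    · have := ((hasDerivAt_id x).sub_const 1).log (by simp; linarith [hx.1])
      exact (hasDerivAt_id x).sub this
    · have : x - 1 ≠ 0 := by linarith [hx.1]
      exact (continuousAt_const.sub (continuousAt_const.div (continuousAt_id.sub continuousAt_const) this)).continuousWithinAt
    · obtain ⟨h1, h2⟩ := hx
      have hx1 : 0 < x-1 := by linarith
      rw [kk, om12 (by linarith) (by linarith), om12 (u := x-1) (by linarith) (by linarith), show 1/(x/2) - 1/(x-1) = (x-2)/(x*(x-1)) by field_simp; ring, abs_of_nonneg (div_nonneg (by linarith) (by positivity))]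
      apply le_of_eq; field_simp; ring
    · norm_num; linarith
  have hq : ∀ x, 3 ≤ x → x ≤ 4 → ∀ c, (x-1)*(2-c) ≤ x*(1+3*(x-3)/(x-1)-(x-3)/(x-1)) → x*((x-2)^2+8*(x-2)-3)/(4*(x-2)+2) ≤ (x-1)*(2+c) → x*|kk x| ≤ c := fun x h1 h2 c hu hl => by
    have hx1 : 0 < x-1 := by linarith
    have hx0 : 0 < x := by linarith
    rw [← abs_of_pos hx0, ← abs_mul, abs_of_pos hx0, kk, om12 (by linarith) (by linarith), om23 (u := x-1) (by linarith) (by linarith), show x*(1/(x/2) - (1+log (x-1-1))/(x-1)) = 2 - x*(1+log (x-2))/(x-1) by rw [sub_sub x]; norm_num; field_simp]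
    have a1 := log_lo1 (x := x-2) (by linarith)
    have a2 := log_up (x := x-2) (by linarith)
    rw [show x-2+1 = x-1 by ring, show 2*(x-2-1)/(x-1) = 3*(x-3)/(x-1)-(x-3)/(x-1) by ring] at a1
    rw [abs_le]
    constructor
    · have : x*(1+log (x-2)) ≤ (2+c)*(x-1) := by
        refine le_trans ?_ ((mul_comm (x-1) _) ▸ hl)
        rw [mul_div_assoc]
        refine mul_le_mul_of_nonneg_left ?_ hx0.le
        have : ((x-2)^2+8*(x-2)-3)/(4*(x-2)+2) = 1 + ((x-2)^2+4*(x-2)-5)/(4*(x-2)+2) := by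
          have : 4*(x-2)+2 ≠ 0 := by linarith
          rw [one_add_div this]; congr 1; ring
        linarith
      have := (div_le_iff₀ hx1).2 this
      linarith
    · have : (2-c)*(x-1) ≤ x*(1+log (x-2)) := by
        rw [mul_comm]; refine hu.trans (mul_le_mul_of_nonneg_left ?_ hx0.le); linarith
      have := (le_div_iff₀ hx1).2 this
      linarith
  have p2 : ∫ l in (3:ℝ)..3.5, l*|kk l| ≤ 0.13 := by
    refine (pc (fun l => -4*(l-1)⁻¹ + log (l-1) - l) (fun l => 4/(l-1)^2 + 1/(l-1) - 1) (by norm_num) (fun x hx => ?_) (fun x hx => ?_) (fun x hx => ?_)).trans ?_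
    · have h0 : x - 1 ≠ 0 := by linarith [hx.1]
      have h1 := ((hasDerivAt_id x).sub_const 1).log h0
      have h2 := (((hasDerivAt_id x).sub_const 1).inv h0).const_mul (-4)
      refine ((h2.add h1).sub (hasDerivAt_id x)).congr_deriv ?_
      simp only [id]; field_simp
    · have : x - 1 ≠ 0 := by linarith [hx.1]
      exact (((continuousAt_const.div ((continuousAt_id.sub continuousAt_const).pow 2) (pow_ne_zero 2 this)).add (continuousAt_const.div (continuousAt_id.sub continuousAt_const) this)).sub continuousAt_const).continuousWithinAt
    · obtain ⟨h1, h2⟩ := hx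
      have hx1 : 0 < x-1 := by linarith
      refine hq x h1 (by linarith) _ (le_of_eq ?_) ?_
      · field_simp; ring
      · have g0 : 0 ≤ 4/(x-1)^2 + 1/(x-1) - 1 := by
          rw [show 4/(x-1)^2 + 1/(x-1) - 1 = (4+(x-1)-(x-1)^2)/(x-1)^2 by field_simp]
          exact div_nonneg (by nlinarith) (by positivity)
        rw [div_le_iff₀ (by linarith)]
        have : x*((x-2)^2+8*(x-2)-3) ≤ (x-1)*2*(4*(x-2)+2) := by nlinarith [mul_nonneg (sub_nonneg.2 h1) (sub_nonneg.2 h2), mul_nonneg (mul_nonneg (sub_nonneg.2 h1) (sub_nonneg.2 h2)) (sub_nonneg.2 h1)]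
        refine this.trans ?_
        have : 0 < 4*(x-2)+2 := by linarith
        gcongr; linarith
    · have : log 2.5 - log 2 = log 1.25 := by rw [← log_div (by norm_num) (by norm_num)]; norm_num
      have := log_up (x := 1.25) (by norm_num)
      norm_num at *; linarith
  have p3 : ∫ l in (3.5:ℝ)..4, l*|kk l| ≤ 0.08 := by
    refine (pc (fun l => 0.04*l + 0.23*(l-3.5)^2) (fun l => 0.04 + 0.46*(l-3.5)) (by norm_num) (fun x hx => ?_) (by fun_prop) (fun x hx => ?_)).trans (by norm_num)
    · refine (((hasDerivAt_id x).const_mul 0.04).add ((((hasDerivAt_id x).sub_const 3.5).pow 2).const_mul 0.23)).congr_deriv ?_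
      simp only [id]; push_cast; ring
    · obtain ⟨h1, h2⟩ := hx
      have hx1 : 0 < x-1 := by linarith
      have q := mul_nonneg (sub_nonneg.2 h1) (sub_nonneg.2 h2)
      refine hq x (by linarith) h2 _ ?_ ?_
      · rw [show x*(1+3*(x-3)/(x-1)-(x-3)/(x-1)) = x*(3*x-7)/(x-1) by field_simp; ring, le_div_iff₀ hx1]
        nlinarith [mul_nonneg q (sub_nonneg.2 h1)]
      · rw [div_le_iff₀ (by linarith)]
        nlinarith [mul_nonneg q (sub_nonneg.2 h1)]
  have p4 : ∫ l in (4:ℝ)..6, l*|kk l| ≤ 0.22 := by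
    refine (pc (fun l => 4*(0.136*(l/2-2)-0.175*(l/2-2)^2+0.28/3*(l/2-2)^3)) (fun l => 2*(0.136-0.35*(l/2-2)+0.28*(l/2-2)^2)) (by norm_num) (fun x hx => ?_) (by fun_prop) (fun x hx => ?_)).trans (by norm_num)
    · have h := ((hasDerivAt_id x).div_const 2).sub_const 2
      refine ((((h.const_mul 0.136).sub ((h.pow 2).const_mul 0.175)).add ((h.pow 3).const_mul (0.28/3))).const_mul 4).congr_deriv ?_
      simp only [id]; push_cast; ring
    · obtain ⟨h1, h2⟩ := hx
      have hx0 : 0 < x := by linarith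
      have o := om3 (u := x-1) (by linarith)
      have a1 := log_lo1 (x := x/2-1) (by linarith)
      have a2 : om (x/2) ≤ 0.5673 := om23_up (by linarith) (by linarith)
      have e := om23 (u := x/2) (by linarith) (by linarith)
      have e2 : x*om (x/2) = 2*(1+log (x/2-1)) := by rw [e]; field_simp
      rw [← abs_of_pos hx0, ← abs_mul, abs_of_pos hx0, kk, abs_le]
      rw [abs_le] at o
      obtain ⟨z, rfl⟩ : ∃ z, x = 2*z+4 := ⟨x/2-2, by ring⟩
      rw [show (2*z+4)/2-1-1 = z by ring, show (2*z+4)/2-1+1 = z+2 by ring, div_le_iff₀ (by linarith)] at a1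
      rw [show (2*z+4)/2-2 = z by ring]
      constructor
      · have o2 : (2*z+4)*om (2*z+4-1) ≤ (2*z+4)*0.5673 := by gcongr; linarith [o.2]
        have a3 : 2*z/(z+2) ≤ log ((2*z+4)/2-1) := (div_le_iff₀ (by linarith)).2 a1
        have a4 : 0.5673*(z+2) - (0.136-0.35*z+0.28*z^2) ≤ 1 + 2*z/(z+2) := by
          rw [show 1+2*z/(z+2) = (3*z+2)/(z+2) by field_simp [show z+2 ≠ 0 by linarith]; ring, le_div_iff₀ (by linarith)]
          nlinarith [mul_nonneg (show 0 ≤ z by linarith) (sq_nonneg (z-0.4)), mul_nonneg (show 0 ≤ z by linarith) (show 0 ≤ 1-z by linarith), mul_nonneg (mul_nonneg (show 0 ≤ z by linarith) (show 0 ≤ 1-z by linarith)) (show 0 ≤ z by linarith), sq_nonneg (z-0.4)]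
        rw [mul_sub, e2]; linarith
      · have o2 : (2*z+4)*(om ((2*z+4)/2) - om (2*z+4-1)) ≤ (2*z+4)*0.0093 := by gcongr; linarith [o.1]
        refine o2.trans ?_
        nlinarith [sq_nonneg (z-0.64)]
  have p5 : ∫ l in (6:ℝ)..8, l*|kk l| ≤ 0.1302 := by
    refine (pc (fun l => 0.00465*l^2) (fun l => 0.0093*l) (by norm_num) (fun x hx => ?_) (by fun_prop) (fun x hx => ?_)).trans (by norm_num)
    · refine ((hasDerivAt_pow 2 x).const_mul 0.00465).congr_deriv ?_
      push_cast; ring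
    · have o1 := om3 (u := x-1) (by linarith [hx.1])
      have o2 := om3 (u := x/2) (by linarith [hx.1])
      rw [mul_comm]
      refine mul_le_mul_of_nonneg_right ?_ (by linarith [hx.1])
      rw [kk, abs_le]; rw [abs_le] at o1 o2
      constructor <;> linarith [o1.1, o1.2, o2.1, o2.2]
  have p6 : ∀ U, 8 ≤ U → ∫ l in (8:ℝ)..U, l*|kk l| ≤ 0.09 := fun U hU => by
    have hd : ∀ x : ℝ, HasDerivAt (fun l => -0.00155*((l/0.75+1/0.5625)*exp (-(1.5*(l/2-5))))) (x*(0.00155*exp (-(1.5*(x/2-5))))) x := fun x => by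
      have h1 : HasDerivAt (fun l : ℝ => -(1.5*(l/2-5))) (-(1.5*(1/2))) x := (((((hasDerivAt_id x).div_const 2).sub_const 5).const_mul 1.5).fun_neg)
      refine (((((hasDerivAt_id x).div_const 0.75).add_const (1/0.5625)).mul h1.exp).const_mul (-0.00155)).congr_deriv ?_
      simp only [id]; ring
    refine (pc _ _ hU (fun x _ => hd x) (by fun_prop) (fun x hx => ?_)).trans ?_
    · refine mul_le_mul_of_nonneg_left ?_ (by linarith [hx.1])
      rw [kk, abs_sub_comm]
      exact om_osc (by linarith [hx.1]) (by linarith [hx.1])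
    · have h1 : 0 ≤ (U/0.75+1/0.5625)*exp (-(1.5*(U/2-5))) := by positivity
      have h2 : exp (-(1.5*(8/2-5))) ≤ 4.5 := by
        have : exp (-(1.5*(8/2-5))) ^ 2 = exp 1 ^ 3 := by rw [← exp_nat_mul, ← exp_nat_mul]; norm_num
        have h1 : exp 1 ^ 3 ≤ 2.7183^3 := by gcongr; linarith [exp_one_lt_d9]
        nlinarith [exp_pos (-(1.5*(8/2-5)))]
      norm_num at *; linarith
  refine ⟨0.97, by norm_num, by norm_num, fun U hU => ?_⟩
  set V := max U 8 with hV
  have m : ∫ l in (2:ℝ)..U, l*|kk l| ≤ ∫ l in (2:ℝ)..V, l*|kk l| := by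
    refine intervalIntegral.integral_mono_interval le_rfl hU (le_max_left _ _) ?_ (lkk_int _ _)
    refine (ae_restrict_iff' measurableSet_Ioc).2 (Eventually.of_forall fun x hx => ?_)
    have : 0 ≤ x := by linarith [hx.1]
    simp only [Pi.zero_apply]; positivity
  have p6 := p6 V (le_max_right _ _)
  have ad := fun a b c => intervalIntegral.integral_add_adjacent_intervals (lkk_int a b) (lkk_int b c)
  have := ad 2 3 3.5
  have := ad 2 3.5 4
  have := ad 2 4 6
  have := ad 2 6 8
  have := ad 2 8 V
  linarith
end Q4b

section Q5
open Set Filter Topology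

lemma stj (ψ : ℕ → ℝ → ℝ) {T c d : ℝ} (hc : 0 < c) (hcd : c ≤ d) (hT : 0 < T)
    (hi : ∀ n, 1 ≤ n → sn n ≤ T/c → IntervalIntegrable (ψ n) volume c d) :
    IntervalIntegrable (fun l => sm (fun n => ψ n l) (T/l)) volume c d ∧
    ∫ l in c..d, sm (fun n => ψ n l) (T/l) = sm (fun n => ∫ l in c..min d (T/sn n), ψ n l) (T/c) := by
  have e : EqOn (fun l => sm (fun n => ψ n l) (T/l)) (fun l => ∑ n ∈ Finset.Icc 1 ⌊exp (T/c)/2⌋₊, (Iic (T/sn n)).indicator (ψ n) l) (Ioc c d) := by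
    intro l hl
    have hl0 : 0 < l := hc.trans hl.1
    simp only [indicator_apply, mem_Iic]
    rw [← Finset.sum_filter, sm]
    refine Finset.sum_congr (Finset.ext fun n => ?_) fun _ _ => rfl
    rw [Finset.mem_filter, mem_sm, mem_sm]
    have : 1 ≤ n → (l ≤ T/sn n ↔ sn n ≤ T/l) := fun h => by
      have : 0 < sn n := by linarith [sn_ge h, log2_lb]
      rw [le_div_iff₀ this, le_div_iff₀ hl0, mul_comm]
    have h2 : T/l ≤ T/c := by gcongr; exact hl.1.le
    constructor
    · exact fun h => ⟨⟨h.1, h.2.trans h2⟩, (this h.1).2 h.2⟩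
    · exact fun h => ⟨h.1.1, (this h.1.1).1 h.2⟩
  have hI : ∀ n ∈ Finset.Icc 1 ⌊exp (T/c)/2⌋₊, IntegrableOn ((Iic (T/sn n)).indicator (ψ n)) (Ioc c d) volume := fun n hn => by
    rw [mem_sm] at hn
    exact ((intervalIntegrable_iff_integrableOn_Ioc_of_le hcd).1 (hi n hn.1 hn.2)).integrable.indicator measurableSet_Iic
  constructor
  · rw [intervalIntegrable_iff_integrableOn_Ioc_of_le hcd, integrableOn_congr_fun e measurableSet_Ioc]
    exact integrable_finsetSum _ hI
  · rw [intervalIntegral.integral_of_le hcd, setIntegral_congr_fun measurableSet_Ioc e, integral_finsetSum _ hI]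
    refine Finset.sum_congr rfl fun n hn => ?_
    rw [mem_sm] at hn
    beta_reduce
    have : 0 < sn n := by linarith [sn_ge hn.1, log2_lb]
    have h3 : c ≤ T/sn n := by rw [le_div_iff₀ this, mul_comm]; exact (le_div_iff₀ hc).1 hn.2
    rw [setIntegral_indicator measurableSet_Iic, Ioc_inter_Iic, intervalIntegral.integral_of_le (le_min hcd h3)]

noncomputable def jj (w : ℝ) : ℝ := om w/max w 1
noncomputable def JJ (u : ℝ) : ℝ := ∫ w in (1:ℝ)..u, jj w
lemma jj_cont : Continuous jj := om_cont.div (continuous_id.max continuous_const) fun x => by positivity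
lemma JJ_deriv (u : ℝ) : HasDerivAt JJ (jj u) u :=
  intervalIntegral.integral_hasDerivAt_right (jj_cont.intervalIntegrable _ _) (jj_cont.stronglyMeasurableAtFilter _ _) jj_cont.continuousAt
lemma JJ_sub (a b : ℝ) : JJ b - JJ a = ∫ w in a..b, jj w :=
  intervalIntegral.integral_interval_sub_left (jj_cont.intervalIntegrable _ _) (jj_cont.intervalIntegrable _ _)

lemma V0 {u : ℝ} (h1 : 1 ≤ u) (h2 : u ≤ 2) : om u + JJ u = 1 := by
  have : JJ u = ∫ w in (1:ℝ)..u, 1/w^(0+2) := intervalIntegral.integral_congr fun w hw => by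
    rw [uIcc_of_le h1] at hw
    simp only [jj]
    rw [om12 hw.1 (hw.2.trans h2), max_eq_left hw.1]; have := hw.1; field_simp
  rw [this, int_inv 0 1 one_pos h1, om12 h1 h2]; norm_num

lemma klint {a b : ℝ} (ha : 0 < a) (hb : a ≤ b) : IntervalIntegrable (fun l => kk l/l) volume a b :=
  ContinuousOn.intervalIntegrable_of_Icc hb (kk_cont.continuousOn.div continuousOn_id fun x hx => by have := hx.1; simp; linarith)

lemma V1 {u : ℝ} (h : 2 ≤ u) : om u + JJ u - JJ (u/2) = 1 - ∫ l in (2:ℝ)..u, kk l/l := by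
  have hJ : Continuous JJ := continuous_iff_continuousAt.2 fun x => (JJ_deriv x).continuousAt
  have := intervalIntegral.integral_eq_sub_of_hasDerivAt_of_le (f := fun x => om x + JJ x - JJ (x/2)) (f' := fun l => -(kk l/l)) h
    (((om_cont.add hJ).sub (hJ.comp (continuous_id.div_const 2))).continuousOn) (fun x hx => ?_) (klint two_pos h).neg
  · rw [intervalIntegral.integral_neg] at this
    have e := V0 one_le_two le_rfl
    have : JJ 1 = 0 := intervalIntegral.integral_same
    norm_num at *; linarith
  · have hx := hx.1
    have h1 := (JJ_deriv (x/2)).comp x ((hasDerivAt_id x).div_const 2)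
    refine (((om_deriv (by linarith) hx.ne').add (JJ_deriv x)).sub h1).congr_deriv ?_
    rw [od, if_pos hx, jj, jj, max_eq_left (by linarith), max_eq_left (by linarith), kk]
    field_simp; ring

lemma V2 : ∃ C > 0, ∀ u, 2 ≤ u → |om u + JJ u - JJ (u/2) - al*(1+log 2)| ≤ C/u^2 := by
  obtain ⟨C, hC, h⟩ := omPi.1 2
  refine ⟨5*C, by positivity, fun u hu => ?_⟩
  have h1 := h u (by linarith)
  have hi : IntervalIntegrable (fun w : ℝ => al/w) volume (u/2) u := ContinuousOn.intervalIntegrable_of_Icc (by linarith) (continuousOn_const.div continuousOn_id fun x hx => by have := hx.1; simp; linarith)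
  have h2 : |∫ w in (u/2)..u, (jj w - al/w)| ≤ C/(u/2)^2/(u/2)*|u-u/2| := by
    rw [← norm_eq_abs]
    refine intervalIntegral.norm_integral_le_of_norm_le_const fun w hw => ?_
    rw [uIoc_of_le (by linarith)] at hw
    have hw1 : 1 < w := by linarith [hw.1]
    rw [jj, max_eq_left hw1.le, ← sub_div, norm_eq_abs, abs_div, abs_of_pos (a := w) (by linarith)]
    refine div_le_div₀ (by positivity) ((h w hw1.le).trans ?_) (by linarith) hw.1.le
    gcongr; exact hw.1.le
  rw [intervalIntegral.integral_sub (jj_cont.intervalIntegrable _ _) hi, ← JJ_sub] at h2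
  have h3 : ∫ w in (u/2)..u, al/w = al*log 2 := by
    simp_rw [div_eq_mul_inv]
    rw [intervalIntegral.integral_const_mul, integral_inv_of_pos (by linarith) (by linarith)]; congr 2; field_simp
  rw [h3, show u - u/2 = u/2 by ring, abs_of_pos (a := u/2) (by linarith), div_mul_cancel₀ _ (by linarith), show C/(u/2)^2 = 4*(C/u^2) by field_simp; norm_num] at h2
  rw [show 5*C/u^2 = C/u^2 + 4*(C/u^2) by ring, show om u + JJ u - JJ (u/2) - al*(1+log 2) = (om u - al) + (JJ u - JJ (u/2) - al*log 2) by ring]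
  exact (abs_add_le _ _).trans (add_le_add h1 h2)

lemma intkk : ∃ C > 0, ∀ U, 2 ≤ U → |(∫ l in (2:ℝ)..U, kk l) - (2*al-1)| ≤ C/U := by
  obtain ⟨C, hC, h⟩ := omPi.1 2
  refine ⟨8*C, by positivity, fun U hU => ?_⟩
  have e1 : ∫ l in (2:ℝ)..U, om (l/2) = 2*∫ l in (1:ℝ)..U/2, om l := by
    rw [intervalIntegral.integral_comp_div (fun x => om x) two_ne_zero]; norm_num
  have e2 : ∫ l in (2:ℝ)..U, om (l-1) = ∫ l in (1:ℝ)..U-1, om l := by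
    rw [intervalIntegral.integral_comp_sub_right (fun x => om x)]; norm_num
  have c1 : Continuous fun l => om (l/2) := om_cont.comp (continuous_id.div_const 2)
  have c2 : Continuous fun l => om (l-1) := om_cont.comp (continuous_id.sub continuous_const)
  have e3 : ∫ l in (2:ℝ)..U, kk l = 2*Yf (U/2+1) - Yf U - 1 := by
    simp only [kk]
    rw [intervalIntegral.integral_sub (c1.intervalIntegrable _ _) (c2.intervalIntegrable _ _), e1, e2, Yf_eq, Yf_eq U, max_eq_left (by linarith), max_eq_left (by linarith), add_sub_cancel_right]; ring
  have y : ∀ v, 1 ≤ v → |Yf v - al*v| ≤ C/v := fun v hv => by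
    have := h v hv
    rw [om_eq hv, div_sub' (by linarith), abs_div, abs_of_pos (a := v) (by linarith), div_le_iff₀ (by linarith)] at this
    rw [mul_comm al]; refine this.trans (le_of_eq ?_); field_simp
  have y1 := y (U/2+1) (by linarith)
  have y2 := y U (by linarith)
  have y3 : C/(U/2+1) ≤ 2*(C/U) := by rw [show 2*(C/U) = C/(U/2) by field_simp]; gcongr; linarith
  have y4 : 0 < C/U := by positivity
  rw [e3, mul_div_assoc]
  rw [abs_le] at *
  constructor <;> linarith [y1.1, y1.2, y2.1, y2.2]

variable {F E : ℝ → ℝ} {M : ℕ → ℕ} {S : Set ℕ} {w κ : ℝ}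

lemma KP.inv (h : KP F E M S w κ) : ∃ C > 0, ∀ T q D, 2*log 2 ≤ T → 
    (∀ t, T/2 ≤ t → t ≤ T → |sm (fun n => aS M S n * om (t/sn n)) t - al*w + al*q/t| ≤ D/t) →
    IntervalIntegrable (fun l => kk l*(T/l*(w - sm (aS M S) (T/l)))) volume 2 (T/log 2) ∧
    |T*(w - sm (aS M S) T) - (∫ l in (2:ℝ)..T/log 2, kk l*(T/l*(w - sm (aS M S) (T/l)))) - 2*al*q| ≤ 2*D + C/T := by
  obtain ⟨C, hC, hV⟩ := V2
  have l2 := log2_lb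
  have hw : 0 ≤ w := (Finset.sum_nonneg fun n _ => aS_nn M S n).trans (h.Nle 0)
  refine ⟨w*C+1, by positivity, fun T q D hT hρ => ?_⟩
  have hT0 : 0 < T := by linarith
  set U := T/log 2 with hU
  have hU2 : 2 ≤ U := by rw [hU, le_div_iff₀ (by linarith)]; exact hT
  set a := aS M S with ha
  have hsn : ∀ n, 1 ≤ n → 0 < sn n := fun n hn => by linarith [sn_ge hn]
  have i1 : IntervalIntegrable (fun l : ℝ => al*w/l - al*q/T) volume 1 2 := ContinuousOn.intervalIntegrable_of_Icc (by linarith) ((continuousOn_const.div continuousOn_id fun x hx => by have := hx.1; simp; linarith).sub continuousOn_const)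
  have com : ∀ n, ContinuousOn (fun l => om (T/(l*sn n))/l) {l | 0 < l ∧ 1 ≤ n} := fun n => by
    refine ContinuousOn.div (om_cont.comp_continuousOn (continuousOn_const.div (continuousOn_id.mul continuousOn_const) fun x hx => ?_)) continuousOn_id fun x hx => ?_
    · exact mul_ne_zero hx.1.ne' (hsn n hx.2).ne'
    · exact hx.1.ne'
  obtain ⟨i2, e2⟩ := stj (fun n l => a n*(om (T/(l*sn n))/l)) (T := T) one_pos one_le_two hT0 (fun n hn _ => ContinuousOn.intervalIntegrable_of_Icc (by linarith) (continuousOn_const.mul ((com n).mono fun x hx => ⟨by linarith [hx.1], hn⟩)))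
  rw [div_one] at e2
  have e2' : sm (fun n => ∫ l in (1:ℝ)..min 2 (T/sn n), a n*(om (T/(l*sn n))/l)) T = sm (fun n => a n*(JJ (T/sn n) - JJ (max (T/sn n/2) 1))) T := by
    refine Finset.sum_congr rfl fun n hn => ?_
    rw [mem_sm] at hn
    beta_reduce
    have hs := hsn n hn.1
    have hu : 1 ≤ T/sn n := (one_le_div hs).2 hn.2
    set u := T/sn n with hu'
    rw [intervalIntegral.integral_const_mul]
    congr 1
    have h12 : 1 ≤ min 2 u := le_min one_le_two hu
    rw [intervalIntegral.integral_eq_sub_of_hasDerivAt (f := fun l => -JJ (u/l))]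
    · have : u/min 2 u = max (u/2) 1 := by
        rcases le_total u 2 with h | h
        · rw [min_eq_right h, div_self (by linarith), max_eq_right (by linarith)]
        · rw [min_eq_left h, max_eq_left (by linarith)]
      rw [this, div_one]; ring
    · intro l hl
      rw [uIcc_of_le h12] at hl
      have l0 : 0 < l := by linarith [hl.1]
      have lu : l ≤ u := hl.2.trans (min_le_right _ _)
      have d1 := (hasDerivAt_const l u).div (hasDerivAt_id l) l0.ne'
      refine ((JJ_deriv (u/l)).comp l d1).neg.congr_deriv ?_
      rw [jj, max_eq_left ((one_le_div l0).2 lu), show T/(l*sn n) = u/l by rw [hu']; field_simp]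
      simp only [id]; field_simp; ring
    · exact ContinuousOn.intervalIntegrable_of_Icc h12 ((com n).mono fun x hx => ⟨by linarith [hx.1], hn.1⟩)
  rw [e2'] at e2
  have b1 : |∫ l in (1:ℝ)..2, (sm (fun n => a n*(om (T/(l*sn n))/l)) (T/l) - (al*w/l - al*q/T))| ≤ D/T*|2-1| := by
    rw [← norm_eq_abs]
    refine intervalIntegral.norm_integral_le_of_norm_le_const fun l hl => ?_
    rw [uIoc_of_le (by norm_num)] at hl
    have l0 : 0 < l := by linarith [hl.1]
    have := hρ (T/l) (by gcongr; exact hl.2) (div_le_self hT0.le hl.1.le)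
    have e : sm (fun n => a n*(om (T/(l*sn n))/l)) (T/l) = (1/l)*sm (fun n => a n*om (T/l/sn n)) (T/l) := by
      rw [← sm_mul]; congr 1; ext n; rw [div_div]; ring
    rw [e, norm_eq_abs, show ∀ z, 1/l*z - (al*w/l - al*q/T) = (1/l)*(z - al*w + al*q/(T/l)) from fun z => by field_simp; ring, abs_mul, abs_of_pos (a := 1/l) (by positivity)]
    refine (mul_le_mul_of_nonneg_left this (by positivity)).trans (le_of_eq ?_)
    field_simp
  have e3 : ∫ l in (1:ℝ)..2, (al*w/l - al*q/T) = al*w*log 2 - al*q/T := by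
    have hi : IntervalIntegrable (fun w' : ℝ => al*w/w') volume 1 2 := ContinuousOn.intervalIntegrable_of_Icc (by linarith) (continuousOn_const.div continuousOn_id fun x hx => by have := hx.1; simp; linarith)
    rw [intervalIntegral.integral_sub hi (by simp)]
    simp_rw [div_eq_mul_inv (al*w)]
    rw [intervalIntegral.integral_const_mul, integral_inv_of_pos (by linarith) (by linarith)]; norm_num
  rw [intervalIntegral.integral_sub i2 i1, e2, e3] at b1
  obtain ⟨i4, e4⟩ := stj (fun n l => kk l/l*a n) (T := T) two_pos hU2 hT0 (fun n _ _ => (klint two_pos hU2).mul_const _)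
  simp_rw [sm_mul] at i4 e4
  -- combine
  have e5 : sm (fun n => a n*om (T/sn n)) T + sm (fun n => a n*(JJ (T/sn n) - JJ (max (T/sn n/2) 1))) T = sm a T - ∫ l in (2:ℝ)..U, kk l/l*sm a (T/l) := by
    rw [e4, ← sm_add, eq_sub_iff_add_eq]
    have : sm (fun n => ∫ l in (2:ℝ)..min U (T/sn n), kk l/l*a n) (T/2) = sm (fun n => if sn n ≤ T/2 then ∫ l in (2:ℝ)..min U (T/sn n), kk l/l*a n else 0) T := by
      unfold sm
      rw [← Finset.sum_filter]
      refine Finset.sum_congr (Finset.ext fun n => ?_) fun _ _ => rfl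
      rw [Finset.mem_filter, mem_sm, mem_sm]
      exact ⟨fun h => ⟨⟨h.1, by linarith [h.2]⟩, h.2⟩, fun h => ⟨h.1.1, h.2⟩⟩
    rw [this, ← sm_add]
    refine Finset.sum_congr rfl fun n hn => ?_
    rw [mem_sm] at hn
    beta_reduce
    have hs := hsn n hn.1
    have hu : 1 ≤ T/sn n := (one_le_div hs).2 hn.2
    split_ifs with hh
    · have u2 : 2 ≤ T/sn n := by rw [le_div_iff₀ hs]; linarith
      have uU : T/sn n ≤ U := by rw [hU]; gcongr; exact sn_ge hn.1
      have := V1 u2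
      rw [min_eq_right uU, max_eq_left (by linarith), intervalIntegral.integral_mul_const]
      linear_combination a n*this
    · have u2 : T/sn n ≤ 2 := by rw [div_le_iff₀ hs]; linarith
      have := V0 hu u2
      have j1 : JJ 1 = 0 := intervalIntegral.integral_same
      rw [max_eq_right (by linarith), j1]
      linear_combination a n*this
  have ek := klint (a := 2) two_pos hU2
  have ef : (fun l => kk l*(T/l*(w - sm a (T/l)))) = fun l => T*(kk l/l*w - kk l/l*sm a (T/l)) := by ext l; ring
  rw [ef]
  refine ⟨((ek.mul_const _).sub i4).const_mul _, ?_⟩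
  rw [intervalIntegral.integral_const_mul, intervalIntegral.integral_sub (ek.mul_const _) i4, intervalIntegral.integral_mul_const]
  have v := hV U hU2
  rw [V1 hU2] at v
  have b2 := hρ T (by linarith) le_rfl
  have b3 : w*(C/U^2) ≤ w*C/T^2 := by
    rw [mul_div_assoc]; gcongr
    rw [hU, le_div_iff₀ (by linarith)]; nlinarith [log2_ub]
  have b4 := mul_le_mul_of_nonneg_left v hw
  rw [← abs_of_nonneg hw, ← abs_mul, abs_of_nonneg hw] at b4
  set ik := ∫ l in (2:ℝ)..U, kk l/l
  set iN := ∫ l in (2:ℝ)..U, kk l/l*sm a (T/l)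
  have fin : T*(w - sm a T) - T*(ik*w - iN) - 2*al*q = T*(w*(1 - ik - al*(1+log 2)) - (sm (fun n => a n*om (T/sn n)) T - al*w + al*q/T) - (sm (fun n => a n*(JJ (T/sn n) - JJ (max (T/sn n/2) 1))) T - (al*w*log 2 - al*q/T))) := by
    rw [show sm (fun n => a n*(JJ (T/sn n) - JJ (max (T/sn n/2) 1))) T = sm a T - iN - sm (fun n => a n*om (T/sn n)) T by linarith]; field_simp; ring
  rw [fin, abs_mul, abs_of_pos hT0]
  have : 2*D + (w*C+1)/T = T*(w*C/T^2 + D/T + D/T*|2-1|) + 1/T := by norm_num; field_simp; ring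
  rw [this]
  have : 0 < 1/T := by positivity
  refine le_trans (mul_le_mul_of_nonneg_left ?_ hT0.le) (le_add_of_nonneg_right this.le)
  exact (abs_sub _ _).trans (add_le_add ((abs_sub _ _).trans (add_le_add (b4.trans b3) b2)) b1)
end Q5

section Q5b
open Set Filter Topology

lemma contr {I : Set ℝ} {h : ℝ → ℝ} {r C K0 : ℝ} (hr0 : 0 ≤ r) (hr : r < 1) (hC : 0 ≤ C) (hK : 0 ≤ K0) (h0 : ∀ t ∈ I, h t ≤ K0)
    (st : ∀ K, 0 ≤ K → (∀ t ∈ I, h t ≤ K) → ∀ t ∈ I, h t ≤ r*K + C) : ∀ t ∈ I, h t ≤ C/(1-r) := by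
  have hr1 : 0 < 1-r := by linarith
  have : ∀ n : ℕ, ∀ t ∈ I, h t ≤ r^n*K0 + C/(1-r) := by
    intro n
    induction n with
    | zero => intro t ht; have := h0 t ht; have : 0 ≤ C/(1-r) := by positivity
              simp; linarith
    | succ n ih =>
      intro t ht
      refine (st _ (by positivity) ih t ht).trans (le_of_eq ?_)
      field_simp; ring
  intro t ht
  have l : Tendsto (fun n : ℕ => r^n*K0 + C/(1-r)) atTop (𝓝 (0*K0 + C/(1-r))) := ((tendsto_pow_atTop_nhds_zero_of_lt_one hr0 hr).mul_const _).add_const _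
  have := ge_of_tendsto' l fun n => this n t ht
  simpa using this

variable {F E : ℝ → ℝ} {M : ℕ → ℕ} {S : Set ℕ} {w κ : ℝ}

noncomputable def mb (M : ℕ → ℕ) (S : Set ℕ) (w T : ℝ) : ℝ := w - sm (aS M S) T
noncomputable def WS (F : ℝ → ℝ) (M : ℕ → ℕ) (S : Set ℕ) (T : ℝ) : ℝ := sm (fun n => aS M S n * F (sn n)) T

lemma KP.mb_nn (h : KP F E M S w κ) (T : ℝ) : 0 ≤ mb M S w T := sub_nonneg.2 (h.Nle T)

lemma sm_diff (g : ℕ → ℝ) {T T' : ℝ} (h : T ≤ T') : sm g T' - sm g T = ∑ n ∈ Finset.Icc 1 ⌊exp T'/2⌋₊ \ Finset.Icc 1 ⌊exp T/2⌋₊, g n := by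
  rw [sm, sm, ← Finset.sum_sdiff (sm_sub h)]; ring

lemma sm_diff_le {g k : ℕ → ℝ} {T T' : ℝ} (h : T ≤ T') (H : ∀ n, 1 ≤ n → T < sn n → sn n ≤ T' → g n ≤ k n) : sm g T' - sm g T ≤ sm k T' - sm k T := by
  rw [sm_diff _ h, sm_diff _ h]
  refine Finset.sum_le_sum fun n hn => ?_
  rw [Finset.mem_sdiff, mem_sm, mem_sm] at hn
  exact H n hn.1.1 (lt_of_not_ge fun h => hn.2 ⟨hn.1.1, h⟩) hn.1.2

/-- block bound -/
lemma KP.block (h : KP F E M S w κ) {g : ℕ → ℝ} {a b c : ℝ} (hab : a ≤ b) (hc : 0 ≤ c) (hg : ∀ n, 1 ≤ n → a < sn n → sn n ≤ b → g n ≤ c) :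
    sm (fun n => aS M S n * g n) b - sm (fun n => aS M S n * g n) a ≤ c * mb M S w a := by
  have := sm_diff_le hab (g := fun n => aS M S n * g n) (k := fun n => c * aS M S n) (fun n h1 h2 h3 => by
    rw [mul_comm]; exact mul_le_mul_of_nonneg_right (hg n h1 h2 h3) (aS_nn M S n))
  rw [sm_mul, sm_mul, ← mul_sub] at this
  refine this.trans (mul_le_mul_of_nonneg_left ?_ hc)
  rw [mb]; linarith [h.Nle b]

lemma KP.wnn (h : KP F E M S w κ) : 0 ≤ w := (Finset.sum_nonneg fun n _ => aS_nn M S n).trans (h.Nle 0)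

lemma KP.Wtail (h : KP F E M S w κ) {t0 T H : ℝ} (h0 : 0 < t0) (hH : ∀ t, t0 ≤ t → t ≤ T → t*mb M S w t ≤ H) (hT : t0 ≤ T) :
    WS F M S T - WS F M S t0 ≤ 4*H*E t0 := by
  have ep := h.ep
  have st : ∀ a b, t0 ≤ a → a ≤ b → b ≤ 2*a → b ≤ T → WS F M S b - WS F M S a ≤ 4*H*(E b - E (2*b)) := fun a b ha hab hb hbT => by
    have a0 : 0 < a := by linarith
    have F0 := ep.lb b (by linarith)
    refine (h.block hab (c := F b) (by linarith) fun n h1 h2 h3 => ep.mono _ _ (by linarith) h3).trans ?_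
    have h1 := hH a ha (by linarith)
    have h2 := ep.diff b (by linarith)
    have h3 : F b/(4*a) ≤ F b/(2*b) := div_le_div_of_nonneg_left (by linarith) (by linarith) (by linarith)
    have hm := h.mb_nn a
    have hH0 : 0 ≤ H := le_trans (by positivity) h1
    calc F b*mb M S w a = 4*(a*mb M S w a)*(F b/(4*a)) := by field_simp
      _ ≤ 4*H*(F b/(4*a)) := by gcongr
      _ ≤ _ := by gcongr; exact h3.trans h2
  have hH0 : 0 ≤ H := le_trans (mul_nonneg h0.le (h.mb_nn _)) (hH t0 le_rfl hT)
  have P : ∀ k : ℕ, ∀ T', t0 ≤ T' → T' ≤ T → T' ≤ 2^k*t0 → WS F M S T' - WS F M S t0 ≤ 4*H*(E t0 - E (2*T')) := by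
    intro k
    induction k with
    | zero =>
      intro T' h1 h2 h3
      refine (st t0 T' le_rfl h1 (by linarith) h2).trans ?_
      gcongr; exact ep.anti _ _ h0 h1
    | succ k ih =>
      intro T' h1 h2 h3
      rcases le_total T' (2*t0) with h4 | h4
      · refine (st t0 T' le_rfl h1 h4 h2).trans ?_
        gcongr; exact ep.anti _ _ h0 h1
      · have := ih (T'/2) (by linarith) (by linarith) (by rw [pow_succ] at h3; linarith)
        have h5 := st (T'/2) T' (by linarith) (by linarith) (by linarith) h2
        rw [mul_div_cancel₀ _ (two_ne_zero)] at this
        linarith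
  obtain ⟨k, hk⟩ := pow_unbounded_of_one_lt (T/t0) (one_lt_two (α := ℝ))
  refine (P k T hT le_rfl ((div_le_iff₀ h0).1 hk.le)).trans ?_
  gcongr
  linarith [ep.nn (a := 2*T) (by linarith)]

lemma KP.LMF (h : KP F E M S w κ) : ∃ C > 0, ∀ n, 1 ≤ n → |LM (M n) - log n| ≤ C*F (sn n) := by
  obtain ⟨C, hC, hL⟩ := LM_bd
  refine ⟨2*C+4, by positivity, fun n hn => ?_⟩
  have h1 := hL (M n) (by linarith [h.three n hn])
  obtain ⟨-, h2, h3⟩ := h.logs hn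
  have h4 := h.ep.lb (sn n) (by linarith [sn_ge hn, log2_lb])
  have l2 := log2_ub
  have l3 := log2_lb
  rw [abs_le] at *
  have := mul_le_mul_of_nonneg_left h4 hC.le
  constructor <;> linarith [h1.1, h1.2, h2.1, h2.2]

lemma kbd {q : ℝ} (hq : ∀ U, 2 ≤ U → ∫ l in (2:ℝ)..U, l*|kk l| ≤ q) {U K : ℝ} {g : ℝ → ℝ} (hU : 2 ≤ U) (hK : 0 ≤ K) (hg : ∀ l, 2 < l → l ≤ U → |g l| ≤ K*l) :
    |∫ l in (2:ℝ)..U, kk l*g l| ≤ q*K := by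
  have : |∫ l in (2:ℝ)..U, kk l*g l| ≤ ∫ l in (2:ℝ)..U, K*(l*|kk l|) := by
    rw [← norm_eq_abs]
    refine intervalIntegral.norm_integral_le_of_norm_le hU (Eventually.of_forall fun l hl => ?_) ((lkk_int _ _).const_mul _)
    rw [norm_mul, norm_eq_abs, norm_eq_abs]
    have := mul_le_mul_of_nonneg_left (hg l hl.1 hl.2) (abs_nonneg (kk l))
    linarith
  rw [intervalIntegral.integral_const_mul] at this
  nlinarith [hq U hU]

lemma KP.Hbd (h : KP F E M S w κ) : ∃ H > 0, ∀ T, log 2 ≤ T → T*mb M S w T ≤ H := by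
  obtain ⟨q, q0, q1, hq⟩ := qlem
  obtain ⟨C1, hC1, hst⟩ := h.star
  obtain ⟨C2, hC2, hin⟩ := h.inv
  obtain ⟨C3, hC3, hL⟩ := h.LMF
  have ep := h.ep
  have l2 := log2_lb
  have hw := h.wnn
  have ha := al_pos
  have snp : ∀ n, 1 ≤ n → 0 < sn n := fun n hn => by linarith [sn_ge hn]
  have wn : ∀ n, 0 ≤ aS M S n*F (sn n) := fun n => by
    rcases Nat.eq_zero_or_pos n with rfl | hn
    · have : aS M S 0 = 0 := by rw [aS]; split_ifs <;> simp
      rw [this, zero_mul]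
    · exact mul_nonneg (aS_nn M S n) (by linarith [ep.lb _ (snp n hn).le])
  have Wnn : ∀ T, 0 ≤ WS F M S T := fun T => by rw [WS, sm]; exact Finset.sum_nonneg fun n _ => wn n
  -- D bound
  set C4 := al*C3 + C1 with hC4
  set C5 := al*|κ| + C1*(w+3) with hC5
  have dB : ∀ T, 2*log 2 ≤ T → ∀ t, T/2 ≤ t → t ≤ T → |sm (fun n => aS M S n * om (t/sn n)) t - al*w + al*0/t| ≤ (C4*WS F M S T + C5)/t := fun T hT t h1 h2 => by
    have t0 : log 2 ≤ t := by linarith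
    have tp : 0 < t := by linarith
    have s := hst t t0
    have WT : WS F M S t ≤ WS F M S T := sm_mono wn h2
    have z : ZS F M S t ≤ WS F M S t := sm_le fun n hn hs => by
      have := snp n hn
      refine mul_le_mul_of_nonneg_left ?_ (aS_nn M S n)
      have : (sn n/t)^2 ≤ 1 := pow_le_one₀ (by positivity) ((div_le_one tp).2 hs)
      exact mul_le_of_le_one_right (by linarith [ep.lb _ (snp n hn).le]) this
    have Qb : |QS M S κ t| ≤ C3*WS F M S t + |κ| := by
      refine (abs_sub _ _).trans ?_
      gcongr
      rw [WS, ← sm_mul]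
      refine (Finset.abs_sum_le_sum_abs _ _).trans (sm_le fun n hn _ => ?_)
      rw [abs_mul, abs_of_nonneg (aS_nn M S n)]
      have := mul_le_mul_of_nonneg_left (hL n hn) (aS_nn M S n)
      linarith
    have m1 : |w - sm (aS M S) t| ≤ w := by
      rw [abs_of_nonneg (sub_nonneg.2 (h.Nle t))]; linarith [show 0 ≤ sm (aS M S) t from Finset.sum_nonneg fun n _ => aS_nn M S n]
    have t2 : 1/t^2 ≤ 3 := by rw [div_le_iff₀ (by positivity)]; nlinarith only [show (0.69:ℝ) ≤ t by linarith]
    have : |sm (fun n => aS M S n * om (t/sn n)) t - al*w + al*0/t| ≤ C1*(|w - sm (aS M S) t| + ZS F M S t + 1/t^2)/t + al*|QS M S κ t|/t := by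
      rw [show al*|QS M S κ t|/t = |al*QS M S κ t/t| by rw [abs_div, abs_mul, abs_of_pos ha, abs_of_pos tp]]
      refine le_trans (le_of_eq ?_) ((abs_sub _ _).trans (add_le_add s le_rfl))
      congr 1; ring
    refine this.trans ?_
    rw [← add_div]
    refine div_le_div_of_nonneg_right ?_ tp.le
    have e1 : C1*(|w - sm (aS M S) t| + ZS F M S t + 1/t^2) ≤ C1*(w + WS F M S T + 3) := by gcongr; linarith
    have e2 : al*|QS M S κ t| ≤ al*(C3*WS F M S T + |κ|) := by gcongr; exact Qb.trans (by gcongr)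
    rw [hC4, hC5]; linarith
  have C40 : 0 < C4 := by positivity
  obtain ⟨t1, ht1⟩ := (ep.lim.eventually (gt_mem_nhds (show (0:ℝ) < 1/(32*C4) by positivity))).exists_forall_of_atTop
  set t0 := max t1 (2*log 2) with ht0
  have t02 : 2*log 2 ≤ t0 := le_max_right _ _
  have Et0 := ht1 t0 (le_max_left _ _)
  rw [lt_div_iff₀ (by positivity)] at Et0
  set C6 := t0*w + 2*(C4*WS F M S t0 + C5) + C2*2 with hC6
  have hC50 : 0 ≤ C5 := by positivity
  have hC60 : 0 ≤ C6 := by have := Wnn t0; positivity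
  have hm : ∀ T, mb M S w T ≤ w := fun T => by rw [mb]; linarith [show 0 ≤ sm (aS M S) T from Finset.sum_nonneg fun n _ => aS_nn M S n]
  refine ⟨C6/(1-3/4)+1, by positivity, fun T hT => ?_⟩
  refine (contr (I := Icc (log 2) T) (h := fun t => t*mb M S w t) (r := 3/4) (K0 := T*w) (by norm_num) (by norm_num) hC60 (mul_nonneg (by linarith) hw) (fun t ht => ?_) (fun K hK hb t ht => ?_) T ⟨hT, le_rfl⟩).trans (by linarith)
  · exact mul_le_mul ht.2 (hm t) (h.mb_nn t) (by linarith)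
  · have tp : 0 < t := by linarith [ht.1]
    have hWt0 := Wnn t0
    rcases le_total t t0 with h1 | h1
    · have : t*mb M S w t ≤ t0*w := mul_le_mul h1 (hm t) (h.mb_nn t) (by linarith)
      have : 0 ≤ 2*(C4*WS F M S t0 + C5) + C2*2 := by positivity
      linarith
    · obtain ⟨-, iv⟩ := hin t 0 _ (by linarith) (dB t (by linarith))
      have hU : 2 ≤ t/log 2 := by rw [le_div_iff₀ (by linarith)]; linarith
      have kb := kbd hq hU (K := K/2) (g := fun l => t/l*(w - sm (aS M S) (t/l))) (by positivity) (fun l hl hlU => by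
        have hp : 0 < t/l := by positivity
        have : t/l ∈ Icc (log 2) T := ⟨by rw [le_div_iff₀ (by linarith)]; rw [le_div_iff₀ (by linarith)] at hlU; linarith, (div_le_self tp.le (by linarith)).trans ht.2⟩
        rw [abs_of_nonneg (mul_nonneg hp.le (sub_nonneg.2 (h.Nle _)))]
        refine (hb _ this).trans ?_
        have := mul_le_mul_of_nonneg_left hl.le hK
        linarith)
      have wt := h.Wtail (t0 := t0) (T := t) (H := K) (by linarith) (fun s h2 h3 => hb s ⟨by linarith, h3.trans ht.2⟩) h1
      have w2 : C4*(WS F M S t) ≤ C4*WS F M S t0 + K/8 := by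
        have := mul_le_mul_of_nonneg_left wt C40.le
        have := mul_le_mul_of_nonneg_left Et0.le hK
        linarith
      have c2 : C2/t ≤ C2*2 := by
        rw [div_le_iff₀ tp]; linarith [mul_nonneg hC2.le (show 0 ≤ 2*t-1 by linarith)]
      have := (abs_le.1 iv).2
      have := (abs_le.1 kb).2
      have : 0 ≤ t0*w := mul_nonneg (by linarith) hw
      have : q*(K/2) ≤ K/2 := mul_le_of_le_one_left (by positivity) q1.le
      simp only [mb]; rw [hC6]; linarith
end Q5b

section Q5c
open Set Filter Topology

variable {F E : ℝ → ℝ} {M : ℕ → ℕ} {S : Set ℕ} {w κ : ℝ}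

lemma aS0 (M : ℕ → ℕ) (S : Set ℕ) : aS M S 0 = 0 := by rw [aS]; split_ifs <;> simp

lemma al_lt : al < 1 := by
  rw [al, exp_lt_one_iff]; linarith [one_half_lt_eulerMascheroniConstant]

lemma sm_range {g : ℕ → ℝ} (hg : g 0 = 0) (T : ℝ) : sm g T = ∑ n ∈ Finset.range (⌊exp T/2⌋₊+1), g n := by
  rw [sm, Finset.sum_range_succ', hg, add_zero, Finset.range_eq_Ico, Finset.sum_Ico_add' (fun k => g k), zero_add]; rfl

lemma sm_tend {g : ℕ → ℝ} (hg : g 0 = 0) (hs : Summable g) : Tendsto (sm g) atTop (𝓝 (∑' n, g n)) := by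
  have : sm g = (fun N : ℕ => ∑ n ∈ Finset.range N, g n) ∘ fun T => ⌊exp T/2⌋₊+1 := by ext T; exact sm_range hg T
  rw [this]
  refine hs.hasSum.tendsto_sum_nat.comp ((tendsto_add_atTop_nat 1).comp (tendsto_nat_floor_atTop.comp (tendsto_exp_atTop.atTop_div_const two_pos)))

lemma sm_summable {g : ℕ → ℝ} (hg : g 0 = 0) (hn : ∀ n, 0 ≤ g n) {c : ℝ} (hb : ∀ T, log 2 ≤ T → sm g T ≤ c) : Summable g := by
  refine summable_of_sum_range_le hn (c := c) fun N => ?_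
  have hN : (0:ℝ) < N+1 := by positivity
  refine le_trans ?_ (hb (log (2*(N+1))) (log_le_log two_pos (by linarith [Nat.cast_nonneg (α := ℝ) N])))
  rw [sm_range hg, exp_log (by positivity), mul_div_cancel_left₀ _ two_ne_zero]
  refine Finset.sum_le_sum_of_subset_of_nonneg (Finset.range_mono ?_) fun n _ _ => hn n
  have : ⌊(N:ℝ)+1⌋₊ = N+1 := by exact_mod_cast Nat.floor_natCast (R := ℝ) (N+1)
  omega

lemma KP.Fnn (h : KP F E M S w κ) (n : ℕ) : 0 ≤ aS M S n*F (sn n) := by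
  rcases Nat.eq_zero_or_pos n with rfl | hn
  · rw [aS0, zero_mul]
  · exact mul_nonneg (aS_nn M S n) (by linarith [h.ep.lb _ (show 0 ≤ sn n by linarith [sn_ge hn, log2_lb])])

lemma KP.asq (h : KP F E M S w κ) : ∃ K > 0, ∀ T, log 2 ≤ T → sm (fun n => aS M S n*sn n^2) T ≤ K*T := by
  obtain ⟨H, hH, hb⟩ := h.Hbd
  have l2 := log2_lb
  have hw := h.wnn
  refine ⟨4*H+2*w, by positivity, ?_⟩
  have P : ∀ k : ℕ, ∀ T, log 2 ≤ T → T ≤ 2^k*log 2 → sm (fun n => aS M S n*sn n^2) T ≤ (4*H+2*w)*T := by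
    have base : ∀ T, log 2 ≤ T → T ≤ 2*log 2 → sm (fun n => aS M S n*sn n^2) T ≤ (4*H+2*w)*T := fun T h1 h2 => by
      have : sm (fun n => aS M S n*sn n^2) T ≤ sm (fun n => T^2*aS M S n) T := sm_le fun n hn hs => by
        rw [mul_comm]
        exact mul_le_mul_of_nonneg_right (pow_le_pow_left₀ (by linarith [sn_ge hn]) hs 2) (aS_nn M S n)
      rw [sm_mul] at this
      have e1 := mul_le_mul_of_nonneg_left (h.Nle T) (sq_nonneg T)
      have e2 : T^2*w ≤ 2*T*w := mul_le_mul_of_nonneg_right (by nlinarith only [h1, h2, l2, log2_ub]) hw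
      have : 0 ≤ H*T := by have : 0 < T := by linarith
                           positivity
      linarith
    intro k
    induction k with
    | zero => intro T h1 h2; exact base T h1 (by linarith)
    | succ k ih =>
      intro T h1 h2
      rcases le_total T (2*log 2) with h3 | h3
      · exact base T h1 h3
      · have i := ih (T/2) (by linarith) (by rw [pow_succ] at h2; linarith)
        have b := h.block (g := fun n => sn n^2) (a := T/2) (b := T) (by linarith) (sq_nonneg T) (fun n h1 h4 h5 => pow_le_pow_left₀ (by linarith [sn_ge h1]) h5 2)
        have := mul_le_mul_of_nonneg_left (hb (T/2) (by linarith)) (show 0 ≤ 2*T by linarith)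
        have : 0 ≤ w*T := mul_nonneg hw (by linarith)
        linarith
  intro T hT
  obtain ⟨k, hk⟩ := pow_unbounded_of_one_lt (T/log 2) (one_lt_two (α := ℝ))
  exact P k T hT ((div_le_iff₀ (by linarith)).1 hk.le)

lemma KP.sumF (h : KP F E M S w κ) : Summable (fun n => aS M S n*F (sn n)) := by
  obtain ⟨H, hH, hb⟩ := h.Hbd
  refine sm_summable (by rw [aS0, zero_mul]) h.Fnn (c := WS F M S (log 2) + 4*H*E (log 2)) fun T hT => ?_
  have := h.Wtail (t0 := log 2) (T := T) (H := H) (by linarith [log2_lb]) (fun t h1 _ => hb t h1) hT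
  rw [WS] at this; linarith

lemma KP.sumG (h : KP F E M S w κ) : Summable (fun n => aS M S n*(LM (M n) - log n)) := by
  obtain ⟨C3, hC3, hL⟩ := h.LMF
  refine Summable.of_norm_bounded (h.sumF.mul_left C3) fun n => ?_
  rcases Nat.eq_zero_or_pos n with rfl | hn
  · simp [aS0]
  rw [norm_mul, norm_eq_abs, norm_eq_abs, abs_of_nonneg (aS_nn M S n)]
  have := mul_le_mul_of_nonneg_left (hL n hn) (aS_nn M S n)
  linarith

lemma KP.Qtail (h : KP F E M S w κ) : ∃ C > 0, ∀ T, log 2 ≤ T → |∑' n, aS M S n*(LM (M n) - log n) - κ - QS M S κ T| ≤ C*E T := by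
  obtain ⟨H, hH, hb⟩ := h.Hbd
  obtain ⟨C3, hC3, hL⟩ := h.LMF
  refine ⟨C3*(4*H), by positivity, fun T hT => ?_⟩
  have hT0 : 0 < T := by linarith [log2_lb]
  rw [QS, sub_sub_sub_cancel_right]
  refine le_of_tendsto ((sm_tend (by simp [aS0]) h.sumG).sub_const _).abs (eventually_atTop.2 ⟨T, fun T' hT' => ?_⟩)
  have := h.Wtail (t0 := T) (T := T') (H := H) hT0 (fun t h1 _ => hb t (by linarith)) hT'
  refine le_trans ?_ ((mul_le_mul_of_nonneg_left this hC3.le).trans (le_of_eq (by ring)))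
  rw [WS, WS, mul_sub, ← sm_mul, ← sm_mul, sm_diff _ hT', sm_diff _ hT']
  refine (Finset.abs_sum_le_sum_abs _ _).trans (Finset.sum_le_sum fun n hn => ?_)
  rw [Finset.mem_sdiff, mem_sm] at hn
  rw [abs_mul, abs_of_nonneg (aS_nn M S n)]
  have := mul_le_mul_of_nonneg_left (hL n hn.1.1) (aS_nn M S n)
  linarith

noncomputable def cS (M : ℕ → ℕ) (S : Set ℕ) (κ : ℝ) : ℝ := al*(∑' n, aS M S n*(LM (M n) - log n) - κ)/(1-al)

lemma KP.asym (h : KP F E M S w κ) : ∃ C > 0, ∀ T, log 2 ≤ T → |T*mb M S w T - cS M S κ| ≤ C*E T := by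
  obtain ⟨q, q0, q1, hq⟩ := qlem
  obtain ⟨C1, hC1, hst⟩ := h.star
  obtain ⟨C2, hC2, hin⟩ := h.inv
  obtain ⟨C3, hC3, hQ⟩ := h.Qtail
  obtain ⟨C4, hC4, hk⟩ := intkk
  obtain ⟨H, hH, hb⟩ := h.Hbd
  obtain ⟨K, hK, hs⟩ := h.asq
  have ep := h.ep
  have l2 := log2_lb
  have ha := al_pos
  have ha1 := al_lt
  set Qi := ∑' n, aS M S n*(LM (M n) - log n) - κ with hQi
  set c := cS M S κ with hc
  have cQ : c*(1-al) = al*Qi := by rw [hc, cS]; exact div_mul_cancel₀ _ (by linarith)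
  have snp : ∀ n, 1 ≤ n → 0 < sn n := fun n hn => by linarith [sn_ge hn]
  have i1 : ∀ t, 0 < t → 1/t ≤ 4*E t := fun t ht => by
    have := ep.ge ht
    rw [div_le_iff₀ ht] at this ⊢; linarith
  set C5 := al*C3 + C1*(4*H + 2*K + 8) with hC5
  have hC50 : 0 < C5 := by positivity
  have dB : ∀ T, 2*log 2 ≤ T → ∀ t, T/2 ≤ t → t ≤ T → |sm (fun n => aS M S n * om (t/sn n)) t - al*w + al*Qi/t| ≤ (C5*(2*E T))/t := fun T hT t h1 h2 => by
    have t0 : log 2 ≤ t := by linarith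
    have tp : 0 < t := by linarith
    have s := hst t t0
    have Enn := ep.nn tp
    have z : ZS F M S t ≤ 2*K*E t := by
      have z1 : ZS F M S t ≤ sm (fun n => F t/t^2*(aS M S n*sn n^2)) t := sm_le fun n hn hs => by
        have := ep.mono _ _ (snp n hn).le hs
        rw [div_pow, show F t/t^2*(aS M S n*sn n^2) = aS M S n*(F t*(sn n^2/t^2)) by ring]
        exact mul_le_mul_of_nonneg_left (mul_le_mul_of_nonneg_right this (by positivity)) (aS_nn M S n)
      rw [sm_mul] at z1
      have f1 := ep.lb t tp.le
      have f2 := ep.Fle tp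
      calc _ ≤ F t/t^2*(K*t) := z1.trans (mul_le_mul_of_nonneg_left (hs t t0) (div_nonneg (by linarith) (by positivity)))
        _ = K*(F t/t) := by field_simp
        _ ≤ K*(2*E t) := mul_le_mul_of_nonneg_left ((div_le_iff₀ tp).2 (by linarith)) hK.le
        _ = _ := by ring
    have m1 : |w - sm (aS M S) t| ≤ 4*H*E t := by
      rw [abs_of_nonneg (sub_nonneg.2 (h.Nle t))]
      have : w - sm (aS M S) t ≤ H*(1/t) := by rw [mul_one_div, le_div_iff₀ tp, mul_comm]; exact hb t t0
      linarith [mul_le_mul_of_nonneg_left (i1 t tp) hH.le]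
    have t2 : 1/t^2 ≤ 8*E t := by
      have : 1/t^2 = 1/t*(1/t) := by field_simp
      have h3 : 1/t ≤ 2 := by rw [div_le_iff₀ tp]; linarith
      rw [this]; linarith [mul_le_mul_of_nonneg_left h3 (show 0 ≤ 1/t by positivity), i1 t tp]
    have : |sm (fun n => aS M S n * om (t/sn n)) t - al*w + al*Qi/t| ≤ C1*(|w - sm (aS M S) t| + ZS F M S t + 1/t^2)/t + al*|Qi - QS M S κ t|/t := by
      rw [show al*|Qi - QS M S κ t|/t = |al*(Qi - QS M S κ t)/t| by rw [abs_div, abs_mul, abs_of_pos ha, abs_of_pos tp]]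
      refine le_trans (le_of_eq ?_) ((abs_add_le _ _).trans (add_le_add s le_rfl))
      congr 1; ring
    refine this.trans ?_
    rw [← add_div]
    refine div_le_div_of_nonneg_right ?_ tp.le
    have e1 : C1*(|w - sm (aS M S) t| + ZS F M S t + 1/t^2) ≤ C1*(4*H*E t + 2*K*E t + 8*E t) := by gcongr
    have e2 : al*|Qi - QS M S κ t| ≤ al*(C3*E t) := by gcongr; exact hQ t t0
    have e3 : E t ≤ 2*E T := (ep.anti _ _ (by linarith) h1).trans (ep.dil T 2 (by linarith) one_le_two)
    have e4 := mul_le_mul_of_nonneg_left e3 hC50.le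
    rw [hC5] at e4 ⊢; linarith
  set C6 := 4*(2*H+2*|c|) + 4*C5 + 4*C2 + 4*(|c| * C4) with hC6
  have hC60 : 0 ≤ C6 := by positivity
  refine ⟨C6/(1-q)+1, by have : 0 < 1-q := by linarith
                         positivity, fun T hT => ?_⟩
  have T0 : 0 < T := by linarith
  have Ep : ∀ t, 0 < t → 0 < E t := fun t ht => lt_of_lt_of_le (by positivity) (ep.ge ht)
  have ab : ∀ t, log 2 ≤ t → |t*mb M S w t - c| ≤ H + |c| := fun t ht => by
    have h1 : 0 ≤ t*mb M S w t := mul_nonneg (by linarith) (h.mb_nn t)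
    refine (abs_sub _ _).trans (add_le_add ?_ le_rfl)
    rw [abs_of_nonneg h1]; exact hb t ht
  have := contr (I := Icc (log 2) T) (h := fun t => |t*mb M S w t - c|/E t) (r := q) (K0 := (H+|c|)/E T) q0.le q1 hC60 (div_nonneg (by positivity) (Ep T T0).le) (fun t ht => ?_) (fun K' hK' hbK t ht => ?_) T ⟨hT, le_rfl⟩
  · rw [div_le_iff₀ (Ep T T0)] at this
    linarith [Ep T T0]
  · exact div_le_div₀ (by positivity) (ab t ht.1) (Ep T T0) (ep.anti _ _ (by linarith [ht.1]) ht.2)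
  · have tp : 0 < t := by linarith [ht.1]
    have et := Ep t tp
    rw [div_le_iff₀ et]
    rcases le_total t (2*log 2) with h1 | h1
    · refine (ab t ht.1).trans ?_
      have : 1 ≤ 8*E t := by
        have := i1 t tp
        rw [div_le_iff₀ tp] at this
        have := mul_le_mul_of_nonneg_left (show t ≤ 2 by linarith [log2_ub]) et.le
        linarith
      have := mul_le_mul_of_nonneg_left this (show 0 ≤ H + |c| by positivity)
      have : 0 ≤ (q*K' + (4*C5 + 4*C2 + 4*(|c| * C4)))*E t := by positivity
      rw [hC6]; linarith
    · obtain ⟨ii, iv⟩ := hin t Qi _ h1 (dB t h1)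
      have hU : 2 ≤ t/log 2 := by rw [le_div_iff₀ (by linarith)]; linarith
      have kb := kbd hq hU (K := K'*E t) (g := fun l => t/l*(w - sm (aS M S) (t/l)) - c) (by positivity) (fun l hl hlU => by
        have hp : 0 < t/l := by positivity
        have : t/l ∈ Icc (log 2) T := ⟨by rw [le_div_iff₀ (by linarith)]; rw [le_div_iff₀ (by linarith)] at hlU; linarith, (div_le_self tp.le (by linarith)).trans ht.2⟩
        have := hbK _ this
        rw [div_le_iff₀ (Ep _ hp)] at this
        refine this.trans ?_
        rw [mul_assoc]; refine mul_le_mul_of_nonneg_left ?_ hK'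
        rw [mul_comm]; exact ep.dil t l tp (by linarith))
      simp_rw [mul_sub (kk _)] at kb
      rw [intervalIntegral.integral_sub ii ((kk_cont.intervalIntegrable _ _).mul_const _), intervalIntegral.integral_mul_const] at kb
      have k2 := mul_le_mul_of_nonneg_left (hk _ hU) (abs_nonneg c)
      rw [← abs_mul] at k2
      have k3 : |c| * (C4/(t/log 2)) ≤ |c| * C4*(4*E t) := by
        rw [mul_assoc]
        refine mul_le_mul_of_nonneg_left ?_ (abs_nonneg c)
        refine le_trans ?_ (mul_le_mul_of_nonneg_left (i1 t tp) hC4.le)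
        rw [mul_one_div]
        exact div_le_div_of_nonneg_left hC4.le tp (by rw [le_div_iff₀ (by linarith)]; exact mul_le_of_le_one_right tp.le (by linarith [log2_ub]))
      have k4 := mul_le_mul_of_nonneg_left (i1 t tp) hC2.le
      rw [mul_one_div] at k4
      have n0 : 0 ≤ (4*(2*H+2*|c|))*E t := by positivity
      simp only [mb]
      rw [abs_le] at iv kb k2 ⊢
      rw [hC6]
      constructor
      · linarith [iv.1, kb.1, k2.1]
      · linarith [iv.2, kb.2, k2.2]
end Q5c

section Q6
open Set Filter Topology

lemma om_et {u : ℝ} (h : 1 ≤ u) : om u = al + et (u-1)/u := by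
  rw [om_eq h, et]; have : u ≠ 0 := by linarith
  field_simp; ring_nf

lemma ws_up (M : ℕ) (R : ℝ) : ws 0 M R/R = PiM M + XX M R := by rw [XX]; ring

lemma sieve : ∃ C > 0, ∀ (M : ℕ) (R : ℝ), 2 ≤ M → M ≤ R → ws 0 M R/R ≤ C*PiM M := by
  obtain ⟨K, hK, h1⟩ := XX_all
  obtain ⟨c, hc, h4⟩ := PiM_lb
  have hal := al_pos
  refine ⟨1+(1+K/0.69+1)/c, by positivity, fun M R hM hR => ?_⟩
  have hM2 : (2:ℝ) ≤ M := by exact_mod_cast hM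
  have l := log_ge hM2
  have lR : log M ≤ log R := log_le_log (by linarith) hR
  have lR0 : 0 < log R := by linarith
  have b := (abs_le.1 (h1 M R hM hR)).2
  have e1 : (om (log R/log M)-al)/log M ≤ 1/log M := by
    gcongr; linarith [om_le (log R/log M)]
  have e2 : K*log M^2/log R^4 ≤ K/0.69*(1/log M) := by
    rw [div_mul_div_comm, mul_one, div_le_div_iff₀ (by positivity) (by positivity)]
    have : log M^4 ≤ log R^4 := pow_le_pow_left₀ (by linarith) lR 4
    have : log M^3*0.69 ≤ log M^3*log M := mul_le_mul_of_nonneg_left l.le (by positivity)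
    nlinarith only [this, hK, pow_le_pow_left₀ (by linarith) lR 4]
  have e3 : M/log M/R ≤ 1/log M := by
    rw [div_div, div_le_div_iff₀ (mul_pos (by linarith) (by linarith)) (by linarith)]; nlinarith only [l, hR]
  have h6 := h4 M hM
  have h7 : 1/log M ≤ PiM M/c := by
    rw [le_div_iff₀ hc, div_mul_eq_mul_div, one_mul]; exact h6
  rw [ws_up]
  have : (1+K/0.69+1)*(1/log M) ≤ (1+K/0.69+1)*(PiM M/c) := mul_le_mul_of_nonneg_left h7 (by positivity)
  have e : (1+(1+K/0.69+1)/c)*PiM M = PiM M + (1+K/0.69+1)*(PiM M/c) := by ring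
  rw [e]; linarith

set_option maxHeartbeats 400000 in
lemma per_c (K : ℝ) (hK : 0 ≤ K) : ∃ C > 0, ∀ (M : ℕ) (F s T : ℝ), 2 ≤ M → 0.69 ≤ F → F ≤ K*s → log 2 ≤ s → s ≤ T/2 → s/2 ≤ log M → |log M - s| ≤ 2*F → log M ≤ T-s →
    |ws 0 M (exp (T-s))/exp (T-s) - al⁻¹*PiM M*om (T/s-1)| ≤ C * (PiM M * (F*s^2/T^3 + M/exp (T-s))) := by
  obtain ⟨K1, hK1, h1⟩ := XX_all
  obtain ⟨Ce, hCe, h2⟩ := et_lip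
  obtain ⟨Ct, hCt, h3⟩ := et_bd
  obtain ⟨c, hc, h4⟩ := PiM_lb
  obtain ⟨Cp, hCp, h5⟩ := omPi.2
  have hal := al_pos
  set κ := 2*K+1 with hκ
  have hκ1 : 1 ≤ κ := by linarith
  clear_value κ
  have hκ0 : 0 < κ := by linarith
  refine ⟨32*K1*κ^3/c + 32*Ce*κ^4/c + 16*Ct*(2+2*Cp/c)/al + 1/c, by positivity, fun M F s T hM hF hFK hs hsT hL hLs hm => ?_⟩
  have hs0 : 0 < s := by linarith [log2_lb]
  have hT0 : 0 < T := by linarith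
  have hL0 : 0 < log M := by linarith
  have hLκ : log M ≤ κ*s := by have := (abs_le.1 hLs).2; rw [hκ]; linarith
  have hP := PiM_pos M
  have h6 := h4 M hM
  have h1P : 1 ≤ PiM M * (κ*s/c) := by
    have h6 := h6
    rw [div_le_iff₀ hL0] at h6
    rw [← mul_div_assoc, le_div_iff₀ hc, one_mul]
    exact h6.trans (mul_le_mul_of_nonneg_left hLκ hP.le)
  have hL1 : 1/log M ≤ PiM M/c := by
    rw [le_div_iff₀ hc, div_mul_eq_mul_div, one_mul]; exact h6
  set t := T - s with ht
  set m := log M with hmdef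
  clear_value t m
  have ht0 : 0 < t := by linarith
  have htT : T/2 ≤ t := by linarith
  have hMR : (M:ℝ) ≤ exp t := by
    rw [← exp_log (show (0:ℝ) < M by positivity), ← hmdef]; exact exp_le_exp.2 hm
  set Y := F*s^2/T^3 with hY
  have hY0 : 0 ≤ Y := by have : 0 ≤ F := by linarith
                         positivity
  have it : 1/t ≤ 2/T := by rw [div_le_div_iff₀ ht0 hT0]; linarith
  -- A
  have A : |XX M (exp t) - et (t/m-1)/t| ≤ 32*K1*κ^3/c*(PiM M*Y) + 1/c*(PiM M*(M/exp t)) := by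
    have b := h1 M (exp t) hM hMR
    rw [log_exp, ← hmdef, om_et ((one_le_div hL0).2 hm), show (al+et (t/m-1)/(t/m)-al)/m = et (t/m-1)/t by field_simp; ring] at b
    refine b.trans (add_le_add ?_ ?_)
    · have a1 : K1*m^2/t^4 ≤ K1*(κ*s)^2*(2/T)^4 := by
        rw [show K1*m^2/t^4 = K1*m^2*(1/t)^4 by ring]; gcongr
      have a2 : K1*(κ*s)^2*(2/T)^4 = 16*K1*κ^2*(s^2/T^3)*(1/T) := by field_simp; ring
      have a3 : 1/T ≤ 2*F*(PiM M*κ/c) := by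
        have : 1/T ≤ 1/s := by gcongr; linarith
        have h8 : 1/s ≤ PiM M*κ/c := by rw [div_le_iff₀ hs0]; refine h1P.trans (le_of_eq (by ring))
        have : 0 ≤ PiM M*κ/c := by positivity
        nlinarith only [this, h8, hF, ‹1/T ≤ 1/s›]
      calc _ ≤ 16*K1*κ^2*(s^2/T^3)*(2*F*(PiM M*κ/c)) := by
            rw [a2] at a1; exact a1.trans (mul_le_mul_of_nonneg_left a3 (by positivity))
        _ = _ := by rw [hY]; ring
    · rw [div_eq_mul_one_div (M:ℝ) m, mul_div_right_comm, mul_comm]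
      calc 1/m*(M/exp t) ≤ PiM M/c*(M/exp t) := mul_le_mul_of_nonneg_right hL1 (by positivity)
        _ = _ := by ring
  have B : |et (t/m-1)/t - et (t/s-1)/t| ≤ 32*Ce*κ^4/c*(PiM M*Y) := by
    have z0 : 0 ≤ min (t/m-1) (t/s-1) := le_min (by linarith [(one_le_div hL0).2 hm]) (by linarith [(one_le_div hs0).2 (show s ≤ t by linarith)])
    have b := h2 _ (t/s-1) (t/m-1) z0 (min_le_right _ _) (min_le_left _ _)
    have z1 : t/(κ*s) ≤ min (t/m-1) (t/s-1) + 1 := by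
      rw [← min_add_add_right, sub_add_cancel, sub_add_cancel]
      refine le_min (by gcongr) ?_
      exact div_le_div_of_nonneg_left ht0.le hs0 (le_mul_of_one_le_left hs0.le hκ1)
    have b2 : |t/m-1-(t/s-1)| ≤ t*(4*F/s^2) := by
      rw [show t/m-1-(t/s-1) = -(t*(m-s)/(m*s)) by field_simp; ring, abs_neg, abs_div, abs_mul, abs_of_pos ht0, abs_of_pos (mul_pos hL0 hs0), mul_div_assoc]
      refine mul_le_mul_of_nonneg_left ?_ ht0.le
      rw [div_le_div_iff₀ (by positivity) (by positivity)]
      have : s^2 ≤ 2*(m*s) := by nlinarith only [hL, hs0]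
      nlinarith only [this, hLs, abs_nonneg (m-s), mul_pos hL0 hs0]
    rw [← sub_div, abs_div, abs_of_pos ht0, div_le_iff₀ ht0]
    have b3 : Ce/(min (t/m-1) (t/s-1) + 1)^3 ≤ Ce*(κ*s)^3*(2/T)^2*(1/t) := by
      calc _ ≤ Ce/(t/(κ*s))^3 := by gcongr
        _ = Ce*(κ*s)^3*(1/t)^2*(1/t) := by rw [div_pow, div_div_eq_mul_div]; ring
        _ ≤ _ := by gcongr
    have b4 : (1:ℝ)/T ≤ 2/T := by gcongr; norm_num
    calc _ ≤ Ce*(κ*s)^3*(2/T)^2*(1/t)*(t*(4*F/s^2)) := b.trans (mul_le_mul b3 b2 (abs_nonneg _) (by positivity))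
      _ = 16*Ce*κ^3*(F*s/T^2)*1 := by field_simp; ring
      _ ≤ 16*Ce*κ^3*(F*s/T^2)*(PiM M*(κ*s/c)*(2*(t/T))) := by
          refine mul_le_mul_of_nonneg_left ?_ (by have : 0 ≤ F := by linarith
                                                  positivity)
          have : 1 ≤ 2*(t/T) := by rw [← mul_div_assoc, one_le_div hT0]; linarith
          exact one_le_mul_of_one_le_of_one_le h1P this
      _ = _ := by rw [hY]; field_simp; ring
  have Cc : |et (t/s-1)/t - al⁻¹*PiM M*s*(et (t/s-1)/t)| ≤ 16*Ct*(2+2*Cp/c)/al*(PiM M*Y) := by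
    have us : 1 ≤ t/s := (one_le_div hs0).2 (by linarith)
    have b := h3 (t/s-1) (by linarith)
    rw [sub_add_cancel] at b
    have d1 : |PiM M*m - al| ≤ PiM M*Cp/c := by
      have := h5 M hM
      rw [← hmdef] at this
      rw [show PiM M*m - al = (PiM M - al/m)*m by field_simp, abs_mul, abs_of_pos hL0]
      calc _ ≤ Cp/m^2*m := mul_le_mul_of_nonneg_right this hL0.le
        _ = Cp*(1/m) := by field_simp
        _ ≤ Cp*(PiM M/c) := by gcongr
        _ = _ := by ring
    have d2 : |PiM M*s-al| ≤ PiM M*(F*(2+2*Cp/c)) := by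
      have e : |PiM M*(m-s)| ≤ PiM M*(2*F) := by rw [abs_mul, abs_of_pos hP]; gcongr
      have e2 : |PiM M*s-al| ≤ |PiM M*m - al| + |PiM M*(m-s)| := by
        rw [show PiM M*s-al = (PiM M*m - al)-(PiM M*(m-s)) by ring]; exact abs_sub _ _
      have e3 : PiM M*Cp/c*1 ≤ PiM M*Cp/c*(2*F) := mul_le_mul_of_nonneg_left (by linarith) (by positivity)
      have : PiM M*(F*(2+2*Cp/c)) = PiM M*Cp/c*(2*F)+PiM M*(2*F) := by ring
      linarith
    rw [show et (t/s-1)/t - al⁻¹*PiM M*s*(et (t/s-1)/t) = -(et (t/s-1)*(1/t)*(al⁻¹*(PiM M*s-al))) by field_simp; ring, abs_neg, abs_mul, abs_mul, abs_mul, abs_of_pos (inv_pos.2 hal), abs_of_pos (one_div_pos.2 ht0)]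
    calc _ ≤ Ct/(t/s)^3*(1/t)*(al⁻¹*(PiM M*(F*(2+2*Cp/c)))) := by gcongr
      _ = Ct*s^3*(1/t)^4*(al⁻¹*(PiM M*(F*(2+2*Cp/c)))) := by field_simp
      _ ≤ Ct*s^3*(2/T)^4*(al⁻¹*(PiM M*(F*(2+2*Cp/c)))) := by gcongr
      _ = 16*Ct*(2+2*Cp/c)/al*(PiM M*Y)*(s/T) := by rw [hY]; field_simp; ring
      _ ≤ _ := mul_le_of_le_one_right (by positivity) ((div_le_one hT0).2 (by linarith))
  have e : ws 0 M (exp t)/exp t - al⁻¹*PiM M*om (T/s-1) = (XX M (exp t) - et (t/m-1)/t) + (et (t/m-1)/t - et (t/s-1)/t) + (et (t/s-1)/t - al⁻¹*PiM M*s*(et (t/s-1)/t)) := by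
    rw [ws_up, show T/s-1 = t/s by rw [ht]; field_simp, om_et ((one_le_div hs0).2 (show s ≤ t by linarith))]
    field_simp; ring
  rw [e]
  have q0 : 0 ≤ PiM M*(M/exp t) := by positivity
  have q1 : 0 ≤ (32*K1*κ^3/c + 32*Ce*κ^4/c + 16*Ct*(2+2*Cp/c)/al)*(PiM M*(M/exp t)) := by positivity
  have q2 : 0 ≤ 1/c*(PiM M*Y) := by positivity
  refine (abs_add_three _ _ _).trans ?_
  have : (32*K1*κ^3/c + 32*Ce*κ^4/c + 16*Ct*(2+2*Cp/c)/al + 1/c)*(PiM M*(Y+M/exp t)) = 32*K1*κ^3/c*(PiM M*Y) + 1/c*(PiM M*(M/exp t)) + 32*Ce*κ^4/c*(PiM M*Y) + 16*Ct*(2+2*Cp/c)/al*(PiM M*Y) + (32*K1*κ^3/c + 32*Ce*κ^4/c + 16*Ct*(2+2*Cp/c)/al)*(PiM M*(M/exp t)) + 1/c*(PiM M*Y) := by ring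
  rw [this]; linarith only [A, B, Cc, q1, q2]
end Q6

section Q6b
open Set Filter Topology

variable {F E : ℝ → ℝ} {M : ℕ → ℕ} {S : Set ℕ} {w κ : ℝ}

lemma sm_ite (g : ℕ → ℝ) {t T : ℝ} (h : t ≤ T) : sm (fun n => if sn n ≤ t then g n else 0) T = sm g t := by
  rw [sm, sm, ← Finset.sum_filter]
  refine Finset.sum_congr ?_ fun _ _ => rfl
  ext n; rw [Finset.mem_filter, mem_sm, mem_sm]; constructor
  · rintro ⟨⟨a, b⟩, c⟩; exact ⟨a, c⟩
  · rintro ⟨a, b⟩; exact ⟨⟨a, b.trans h⟩, b⟩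

lemma EP.sq (h : EP F E) {T : ℝ} (hT : 0 < T) : 1/T^2 ≤ 4*(E T/T) := by
  have := h.ge hT
  rw [div_le_iff₀ hT] at this
  rw [← mul_div_assoc, div_le_div_iff₀ (by positivity) hT]
  nlinarith only [this, hT]

lemma EP.F2 (h : EP F E) {T : ℝ} (hT : 0 < T) : F T/T^2 ≤ 2*(E T/T) := by
  have := h.Fle hT
  rw [← mul_div_assoc, div_le_div_iff₀ (by positivity) hT]
  nlinarith only [this, hT]

lemma KP.win (h : KP F E M S w κ) : ∃ C > 0, ∀ T t d, 0 < T → T/8 ≤ t → log 2 ≤ t → 0 ≤ d →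
    sm (aS M S) (t+d) - sm (aS M S) t ≤ C*(d/T^2 + E T/T) := by
  obtain ⟨C, hC, hb⟩ := h.asym
  refine ⟨64*|cS M S κ| + 128*C, by positivity, fun T t d hT h1 h2 hd => ?_⟩
  have l2 := log2_lb
  have ht0 : 0 < t := by linarith
  have b1 := (abs_le.1 (hb t h2)).2
  have b2 := (abs_le.1 (hb (t+d) (by linarith))).1
  have E1 : E t ≤ 8*E T := (h.ep.anti (T/8) t (by linarith) h1).trans (h.ep.dil T 8 hT (by norm_num))
  have E2 := h.ep.anti t (t+d) ht0 (by linarith)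
  have E0 := h.ep.nn hT
  have e : sm (aS M S) (t+d) - sm (aS M S) t = mb M S w t - mb M S w (t+d) := by rw [mb, mb]; ring
  rw [e]
  set c := cS M S κ
  have m1 : mb M S w t ≤ (c + 8*C*E T)/t := by rw [le_div_iff₀ ht0]; nlinarith only [b1, E1, hC]
  have m2 : (c - 8*C*E T)/(t+d) ≤ mb M S w (t+d) := by rw [div_le_iff₀ (by linarith)]; nlinarith only [b2, E1, E2, hC]
  have m3 : (c + 8*C*E T)/t - (c - 8*C*E T)/(t+d) = c*(d/(t*(t+d))) + 8*C*E T*(1/t+1/(t+d)) := by field_simp; ring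
  have m4 : c*(d/(t*(t+d))) ≤ |c| * (64*(d/T^2)) := by
    refine mul_le_mul (le_abs_self _) ?_ (by positivity) (abs_nonneg _)
    rw [← mul_div_assoc, div_le_div_iff₀ (by positivity) (by positivity)]
    have : T^2 ≤ 64*(t*(t+d)) := by nlinarith only [h1, hd, ht0, hT]
    nlinarith only [this, hd]
  have m5 : 1/t ≤ 8/T := by rw [div_le_div_iff₀ ht0 hT]; linarith
  have m6 : 1/(t+d) ≤ 8/T := by rw [div_le_div_iff₀ (by linarith) hT]; linarith
  have m7 : 8*C*E T*(1/t+1/(t+d)) ≤ 8*C*E T*(16/T) := mul_le_mul_of_nonneg_left (by linarith [show (16:ℝ)/T = 8/T+8/T by ring]) (by positivity)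
  have m8 : 0 ≤ |c| * (E T/T) := by positivity
  have m9 : 0 ≤ C*(d/T^2) := by positivity
  have : (64*|c| + 128*C)*(d/T^2+E T/T) = |c| * (64*(d/T^2)) + 8*C*E T*(16/T) + 64*(|c| * (E T/T)) + 128*(C*(d/T^2)) := by ring
  rw [this]; linarith

lemma KP.err2 (h : KP F E M S w κ) : ∃ C > 0, ∀ T, 8 ≤ T → F T ≤ T/2 →
    sm (fun n => aS M S n * exp (2*(sn n - (T-F T)/2))) ((T-F T)/2) ≤ C*(E T/T) := by
  obtain ⟨C, hC, hb⟩ := h.win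
  have hw := h.wnn
  refine ⟨256*exp 2*w+10*C, by positivity, fun T h8 hF => ?_⟩
  have hT : 0 < T := by linarith
  have l2 := log2_ub
  set δ := C*(1/T^2+E T/T) with hδ
  have E0 := h.ep.nn hT
  have δ0 : 0 ≤ δ := by positivity
  have e2 : exp (-2) ≤ 1/2 := by
    rw [exp_neg, inv_eq_one_div]; gcongr; linarith [add_one_le_exp (2:ℝ)]
  have P : ∀ k : ℕ, ∀ τ, T/8 ≤ τ - k → sm (fun n => aS M S n*exp (2*sn n)) τ ≤ exp (2*(τ-k))*w + 2*δ*exp (2*τ) := by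
    intro k
    induction k with
    | zero => intro τ hτ
              have : sm (fun n => aS M S n*exp (2*sn n)) τ ≤ sm (fun n => exp (2*τ)*aS M S n) τ := sm_le fun n hn hs => by
                rw [mul_comm]; exact mul_le_mul_of_nonneg_right (exp_le_exp.2 (by linarith)) (aS_nn M S n)
              rw [sm_mul] at this
              have e1 := mul_le_mul_of_nonneg_left (h.Nle τ) (exp_pos (2*τ)).le
              have : 0 ≤ 2*δ*exp (2*τ) := by positivity
              simp only [Nat.cast_zero, sub_zero]; linarith
    | succ k ih =>
      intro τ hτ
      push_cast at hτ ⊢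
      have i := ih (τ-1) (by linarith)
      have k0 : (0:ℝ) ≤ k := Nat.cast_nonneg k
      have b := hb T (τ-1) 1 hT (by linarith) (by linarith) zero_le_one
      rw [sub_add_cancel] at b
      have d1 := sm_diff_le (show τ-1 ≤ τ by linarith) (g := fun n => aS M S n*exp (2*sn n)) (k := fun n => exp (2*τ)*aS M S n) (fun n h1 h2 h3 => by
        rw [mul_comm]; exact mul_le_mul_of_nonneg_right (exp_le_exp.2 (by linarith)) (aS_nn M S n))
      rw [sm_mul, sm_mul, ← mul_sub] at d1
      have ee : exp (2*(τ-1)) = exp (2*τ)*exp (-2) := by rw [← exp_add]; ring_nf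
      have := mul_le_mul_of_nonneg_left e2 (show 0 ≤ 2*δ*exp (2*τ) by positivity)
      have b' := mul_le_mul_of_nonneg_right b (exp_pos (2*τ)).le
      rw [ee] at i
      rw [show τ-(k+1) = τ-1-k by ring]
      linarith
  set τ := (T-F T)/2 with hτ
  have p := P ⌊τ-T/8⌋₊ τ (by linarith [Nat.floor_le (show 0 ≤ τ-T/8 by linarith)])
  have p2 := Nat.lt_floor_add_one (τ-T/8)
  have e0 : sm (fun n => aS M S n*exp (2*(sn n-τ))) τ = exp (-(2*τ))*sm (fun n => aS M S n*exp (2*sn n)) τ := by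
    rw [← sm_mul]; congr 1; ext n; rw [show 2*(sn n-τ) = -(2*τ)+2*sn n by ring, exp_add]; ring
  have e1 : exp (2*(τ-⌊τ-T/8⌋₊)) ≤ exp (2*τ)*(exp 2*exp (-(T/4))) := by
    rw [← exp_add, ← exp_add]; exact exp_le_exp.2 (by linarith)
  have e3 : exp (-(T/4)) ≤ 32*(1/T^2) := by
    rw [exp_neg, inv_eq_one_div, ← mul_div_assoc, div_le_div_iff₀ (exp_pos _) (by positivity)]
    nlinarith only [quadratic_le_exp_of_nonneg (show 0 ≤ T/4 by linarith), hT]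
  have e4 := h.ep.sq hT
  have e5 := mul_le_mul_of_nonneg_left p (exp_pos (-(2*τ))).le
  have e6 : exp (-(2*τ))*exp (2*τ) = 1 := by rw [← exp_add]; simp
  have e7 := mul_le_mul_of_nonneg_right e1 hw
  have e8 := mul_le_mul_of_nonneg_left e7 (exp_pos (-(2*τ))).le
  have e9 := mul_le_mul_of_nonneg_left (e3.trans (mul_le_mul_of_nonneg_left e4 (by norm_num : (0:ℝ) ≤ 32))) (show 0 ≤ exp 2*w by positivity)
  have e10 := mul_le_mul_of_nonneg_left e4 hC.le
  have z : exp (-(2*τ))*(exp (2*τ)*(exp 2*exp (-(T/4)))*w) = exp 2*w*exp (-(T/4)) := by linear_combination exp 2*exp (-(T/4))*w*e6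
  have z2 : exp (-(2*τ))*(exp (2*(τ-⌊τ-T/8⌋₊))*w+2*δ*exp (2*τ)) = exp (-(2*τ))*(exp (2*(τ-⌊τ-T/8⌋₊))*w) + 2*δ := by linear_combination 2*δ*e6
  rw [z2] at e5; rw [z] at e8; rw [e0]
  have : 0 ≤ exp 2*w*(E T/T) := by positivity
  rw [hδ] at e5
  linarith
end Q6b

section Q6c
open Set Filter Topology

variable {F E : ℝ → ℝ} {M : ℕ → ℕ} {S : Set ℕ} {w κ : ℝ}

lemma od_int {a b : ℝ} (ha : 1 ≤ a) (hab : a ≤ b) : IntervalIntegrable od volume a b := by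
  rw [intervalIntegrable_iff_integrableOn_Ioc_of_le hab]
  have hm : Measurable od := by
    unfold od
    have := om_cont.measurable
    exact (Measurable.ite measurableSet_Ioi ((this.comp (measurable_id.sub_const 1)).sub this) this.neg).div measurable_id
  refine Measure.integrableOn_of_bounded (M := 1) (by simp) hm.aestronglyMeasurable ?_
  refine (ae_restrict_iff' measurableSet_Ioc).2 (Eventually.of_forall fun u hu => ?_)
  have : 1 < u := by linarith [hu.1]
  exact (od_bd0 this).trans ((div_le_one (by linarith)).2 this.le)

lemma od_ftc {b : ℝ} (hb : 1 ≤ b) : ∫ u in (1:ℝ)..b, od u = om b - 1 := by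
  rw [integral_eq_of_hasDerivAt_off_countable_of_le om od hb (countable_singleton 2) om_cont.continuousOn
    (fun x hx => om_deriv hx.1.1 hx.2) (od_int le_rfl hb), om12 le_rfl one_le_two, div_one]

lemma od_ftc2 {b : ℝ} (hb : 1 ≤ b) : ∫ u in (1:ℝ)..b, (u+1)*od u = (b+1)*om b - Yf (b+1) - 1 := by
  rw [integral_eq_of_hasDerivAt_off_countable_of_le (fun u => (u+1)*om u - Yf (u+1)) (fun u => (u+1)*od u) hb (countable_singleton 2)
    (by have := om_cont; have := Yf_cont; fun_prop)
    (fun x hx => by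
      have h1 := ((hasDerivAt_id x).add_const 1).mul (om_deriv hx.1.1 hx.2)
      have h2 := (Yf_deriv (show 2 < x+1 by linarith [hx.1.1])).comp x ((hasDerivAt_id x).add_const 1)
      refine (h1.sub h2).congr_deriv ?_
      simp)
    ((od_int le_rfl hb).continuousOn_mul (by fun_prop)), om12 le_rfl one_le_two, Yf_one (show (1:ℝ)+1 ≤ 2 by norm_num)]
  norm_num

lemma od_ftc3 : ∃ C > 0, ∀ b, 1 ≤ b → |(∫ u in (1:ℝ)..b, (u+1)*od u) + 1| ≤ C/(b+1) ∧ |om b - al| ≤ C/(b+1)^2 := by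
  obtain ⟨C0, hC0, h0⟩ := omPi.1 2
  obtain ⟨C1, hC1, h1⟩ := et_bd
  refine ⟨4*C0+C1, by positivity, fun b hb => ?_⟩
  have B : |om b - al| ≤ 4*C0/(b+1)^2 := (h0 b hb).trans (by
    rw [div_le_div_iff₀ (by positivity) (by positivity)]
    have : (b+1)^2 ≤ (2*b)^2 := pow_le_pow_left₀ (by linarith) (by linarith) 2
    nlinarith only [this, hC0])
  refine ⟨?_, B.trans (by gcongr; linarith)⟩
  rw [od_ftc2 hb, show (b+1)*om b - Yf (b+1) - 1 + 1 = (b+1)*(om b - al) - et b by rw [et]; ring]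
  have e2 := h1 b (by linarith)
  have e3 : C1/(b+1)^3 ≤ C1/(b+1) := by gcongr; exact le_self_pow₀ (by linarith) (by norm_num)
  refine (abs_sub _ _).trans ?_
  rw [abs_mul, abs_of_pos (show 0 < b+1 by linarith)]
  have e4 := mul_le_mul_of_nonneg_left B (show 0 ≤ b+1 by linarith)
  rw [show (b+1)*(4*C0/(b+1)^2) = 4*C0/(b+1) by field_simp] at e4
  rw [add_div]; linarith

lemma KP.mainS (h : KP F E M S w κ) : ∃ C > 0, ∀ T, 4 ≤ T →
    |sm (fun n => aS M S n*om (T/sn n-1)) (T/2) - (w*al - cS M S κ/T)| ≤ C*(E T/T) := by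
  obtain ⟨C, hC, hb⟩ := h.asym
  obtain ⟨C0, hC0, h0⟩ := od_ftc3
  obtain ⟨D, hD, hd⟩ := od_bd 4
  have hw := h.wnn
  have l1 := log2_lb
  have l2 := log2_ub
  refine ⟨4*C0*w+4*C+4*C0*|cS M S κ| + 16*D*C, by positivity, fun T hT4 => ?_⟩
  have hT : 0 < T := by linarith
  have E0 := h.ep.nn hT
  set c := cS M S κ
  obtain ⟨U, hU⟩ : ∃ U, U = T/log 2 := ⟨_, rfl⟩
  have UT : T ≤ U := by rw [hU, le_div_iff₀ (by linarith)]; nlinarith only [l2, hT]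
  have shift : ∀ g : ℝ → ℝ, ∀ b, ∫ l in (2:ℝ)..b, g (l-1) = ∫ u in (1:ℝ)..(b-1), g u := fun g b => by
    rw [intervalIntegral.integral_comp_sub_right]; norm_num
  have oi : ∀ b, 2 ≤ b → IntervalIntegrable (fun l => od (l-1)) volume 2 b := fun b hb => by
    have := (od_int le_rfl (show 1 ≤ b-1 by linarith)).comp_sub_right 1
    norm_num at this; exact this
  obtain ⟨i1, i2⟩ := stj (fun n l => aS M S n*od (l-1)) two_pos (show 2 ≤ U by linarith) hT (fun n _ _ => (oi U (by linarith)).const_mul _)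
  have e1 : ∀ l, sm (fun n => aS M S n*od (l-1)) (T/l) = od (l-1)*w - od (l-1)*mb M S w (T/l) := fun l => by
    rw [show (fun n => aS M S n*od (l-1)) = fun n => od (l-1)*aS M S n by ext; ring, sm_mul, mb]; ring
  simp only [e1] at i1 i2
  have i3 : IntervalIntegrable (fun l => od (l-1)*w) volume 2 U := (oi U (by linarith)).mul_const _
  have i4 : IntervalIntegrable (fun l => od (l-1)*mb M S w (T/l)) volume 2 U := by
    refine (i3.sub i1).congr fun l _ => ?_
    simp
  have i5 : IntervalIntegrable (fun l => (c/T)*(l*od (l-1))) volume 2 U := ((oi U (by linarith)).continuousOn_mul (by fun_prop)).const_mul _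
  rw [intervalIntegral.integral_sub i3 i4, intervalIntegral.integral_mul_const, shift, od_ftc (by linarith)] at i2
  have e2 : sm (fun n => ∫ l in (2:ℝ)..min U (T/sn n), aS M S n*od (l-1)) (T/2) = sm (fun n => aS M S n*om (T/sn n-1)) (T/2) - sm (aS M S) (T/2) := by
    rw [eq_sub_iff_add_eq, ← sm_add]
    refine Finset.sum_congr rfl fun n hn => ?_
    beta_reduce
    obtain ⟨n1, n2⟩ := mem_sm.1 hn
    have s0 := sn_ge n1
    have : T/sn n ≤ U := by rw [hU]; gcongr
    have h2 : 2 ≤ T/sn n := by rw [le_div_iff₀ (by linarith)]; linarith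
    rw [min_eq_right this, intervalIntegral.integral_const_mul, shift, od_ftc (by linarith)]; ring
  have e3 : |(∫ l in (2:ℝ)..U, od (l-1)*mb M S w (T/l)) - ∫ l in (2:ℝ)..U, (c/T)*(l*od (l-1))| ≤ 16*D*C*(E T/T) := by
    rw [← intervalIntegral.integral_sub i4 i5, ← norm_eq_abs]
    refine (intervalIntegral.norm_integral_le_of_norm_le (g := fun l => 16*D*C*(E T/T)/l^(0+2)) (by linarith) (Eventually.of_forall fun l hl => ?_) ((cont_inv (0+2) _ two_pos).intervalIntegrable_of_Icc (by linarith))).trans ?_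
    · have l0 : 2 < l := hl.1
      have lT : log 2 ≤ T/l := by
        have := hl.2
        rw [hU, le_div_iff₀ (by linarith)] at this; rw [le_div_iff₀ (by linarith)]; linarith
      have a1 := hb (T/l) lT
      have a2 := h.ep.dil T l hT (by linarith)
      have a3 : |mb M S w (T/l) - c*l/T| ≤ C*l^2*(E T/T) := by
        rw [show mb M S w (T/l) - c*l/T = (l/T)*(T/l*mb M S w (T/l) - c) by field_simp, abs_mul, abs_of_pos (by positivity)]
        calc _ ≤ l/T*(C*(l*E T)) := by gcongr; exact a1.trans (by gcongr)
          _ = _ := by ring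
      have a4 : |od (l-1)| ≤ 16*D/l^4 := (hd (l-1) (by linarith)).trans (by
        rw [div_le_div_iff₀ (pow_pos (by linarith) 4) (by positivity)]
        have : l^4 ≤ (2*(l-1))^4 := pow_le_pow_left₀ (by linarith) (by linarith) 4
        nlinarith only [this, hD])
      rw [norm_eq_abs, show od (l-1)*mb M S w (T/l) - (c/T)*(l*od (l-1)) = od (l-1)*(mb M S w (T/l) - c*l/T) by ring, abs_mul]
      calc _ ≤ 16*D/l^4*(C*l^2*(E T/T)) := mul_le_mul a4 a3 (abs_nonneg _) (by positivity)
        _ = _ := by field_simp; norm_num; ring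
    · refine (int_inv_le 0 (by positivity) two_pos (by linarith)).trans ?_
      norm_num
      have : 0 ≤ 16*D*C*(E T/T) := by positivity
      linarith
  obtain ⟨g1, g2⟩ := h0 (U-1) (by linarith)
  rw [sub_add_cancel] at g1 g2
  have e4 : ∫ l in (2:ℝ)..U, (c/T)*(l*od (l-1)) = (c/T)*∫ u in (1:ℝ)..(U-1), (u+1)*od u := by
    rw [intervalIntegral.integral_const_mul, ← shift]; simp
  rw [e4] at e3
  set V := ∫ u in (1:ℝ)..(U-1), (u+1)*od u
  have sq := h.ep.sq hT
  have g3 : |om (U-1)-al| ≤ 4*C0*(E T/T) := g2.trans (by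
    calc C0/U^2 ≤ C0*(1/T^2) := by rw [mul_one_div]; gcongr
      _ ≤ _ := by nlinarith only [sq, hC0])
  have g4 : |c/T*(V+1)| ≤ |c| * (4*C0*(E T/T)) := by
    rw [abs_mul, abs_div, abs_of_pos hT]
    calc _ ≤ |c| /T*(C0/T) := by gcongr; exact g1.trans (by gcongr)
      _ = |c| *(C0*(1/T^2)) := by ring
      _ ≤ _ := by refine mul_le_mul_of_nonneg_left ?_ (abs_nonneg c); nlinarith only [sq, hC0]
  have g5 : |mb M S w (T/2) - 2*c/T| ≤ 4*C*(E T/T) := by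
    have := hb (T/2) (by linarith)
    rw [show mb M S w (T/2) - 2*c/T = 2/T*(T/2*mb M S w (T/2) - c) by field_simp, abs_mul, abs_of_pos (by positivity)]
    have a2 := h.ep.dil T 2 hT (by norm_num)
    calc _ ≤ 2/T*(C*(2*E T)) := by gcongr; exact this.trans (by gcongr)
      _ = _ := by ring
  have key : sm (fun n => aS M S n*om (T/sn n-1)) (T/2) - (w*al - c/T) = w*(om (U-1)-al) - (mb M S w (T/2) - 2*c/T) - c/T*(V+1) - ((∫ l in (2:ℝ)..U, od (l-1)*mb M S w (T/l)) - c/T*V) := by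
    rw [e2] at i2
    rw [mb] ; linear_combination -i2
  rw [key]
  have g6 : |w*(om (U-1)-al)| ≤ w*(4*C0*(E T/T)) := by rw [abs_mul, abs_of_nonneg hw]; gcongr
  refine (abs_sub _ _).trans ?_
  have r1 := abs_sub (w*(om (U-1)-al) - (mb M S w (T/2) - 2*c/T)) (c/T*(V+1))
  have r2 := abs_sub (w*(om (U-1)-al)) (mb M S w (T/2) - 2*c/T)
  linarith
end Q6c

section Q6d
open Set Filter Topology

variable {F E : ℝ → ℝ} {M : ℕ → ℕ} {S : Set ℕ} {w κ : ℝ}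

lemma KP.term (h : KP F E M S w κ) : ∃ C > 0, ∀ T, 8 ≤ T → F T ≤ T/2 → ∀ n, 1 ≤ n → sn n ≤ T →
    |ws 0 (M n) (exp (T-sn n))/exp (T-sn n) - 1/exp (T-sn n) - (if sn n ≤ T/2 then al⁻¹*PiM (M n)*om (T/sn n-1) else 0)| ≤
    C*(PiM (M n)*((if sn n ≤ T/2 then F (sn n)*sn n^2/T^3 else 0) + (if sn n ≤ (T-F T)/2 then exp (2*(sn n-(T-F T)/2)) else 0) +
      ((if sn n ≤ T/2+log 2 then 1 else 0) - (if sn n ≤ (T-F T)/2 then 1 else 0)))) := by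
  obtain ⟨K, hK, hFK⟩ := h.FK
  obtain ⟨C1, hC1, h1⟩ := per_c K hK
  obtain ⟨C2, hC2, h2⟩ := sieve
  obtain ⟨c, hc, h3⟩ := PiM_lb
  have hal := al_pos
  have l1 := log2_lb
  refine ⟨C1+C2+1/c+al⁻¹, by positivity, fun T h8 hFT n hn hs => ?_⟩
  have M3 := h.three n hn
  have Mn := h.lt n hn
  have up := h.up n hn
  have s0 := sn_ge hn
  obtain ⟨lg1, lg2, lg3⟩ := h.logs hn
  have Fm := h.ep.mono (sn n) T (by linarith) hs
  have F0 := h.ep.lb (sn n) (by linarith)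
  have FT0 := h.ep.lb T (by linarith)
  have hF := hFK (sn n) s0
  have hP := PiM_pos (M n)
  have lgn : log n < log (M n) := log_lt_log (by exact_mod_cast hn) (by exact_mod_cast Mn)
  have M0 : (3:ℝ) ≤ M n := by exact_mod_cast M3
  have h3n := h3 (M n) (by omega)
  have ml : M n = exp (log (M n)) := (exp_log (by linarith)).symm
  have lM : log (M n) ≤ M n := (log_le_sub_one_of_pos (by linarith)).trans (by linarith)
  set s := sn n
  set m := log (M n)
  set P := PiM (M n)
  have R0 := exp_pos (T-s)
  have c1 : 1 ≤ 1/c*P*M n := by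
    rw [div_le_iff₀ (by linarith)] at h3n
    rw [mul_assoc, div_mul_eq_mul_div, one_mul, le_div_iff₀ hc, one_mul]
    exact h3n.trans (mul_le_mul_of_nonneg_left lM hP.le)
  have q : 1/exp (T-s) ≤ 1/c*P*(M n/exp (T-s)) := by
    rw [← mul_div_assoc]; gcongr
  have q0 : 0 < 1/exp (T-s) := by positivity
  have μ0 : (M n:ℝ)/exp (T-s) = exp (m-(T-s)) := by rw [exp_sub m, ← ml]
  rw [μ0] at q
  have cP : 0 < 1/c*P := by positivity
  have A0 : 0 ≤ F s*s^2/T^3 := by positivity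
  have aP : 0 < al⁻¹*P := by positivity
  have e0 := exp_pos (2*(s-(T-F T)/2))
  rcases le_or_gt m (T-s) with hm | hm
  · have q1 : exp (m-(T-s)) ≤ 1 := exp_le_one_iff.2 (by linarith)
    have qq : 1/exp (T-s) ≤ 1/c*P := q.trans (mul_le_of_le_one_right cP.le q1)
    have i2 : s ≤ T/2+log 2 := by linarith
    rw [if_pos i2]
    by_cases hs2 : s ≤ T/2
    · rw [if_pos hs2, if_pos hs2]
      have b := h1 (M n) (F s) s T (by omega) F0 hF s0 hs2 lg1 lg2 hm
      rw [μ0] at b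
      have b2 : |ws 0 (M n) (exp (T-s))/exp (T-s) - 1/exp (T-s) - al⁻¹*P*om (T/s-1)| ≤ C1*(P*(F s*s^2/T^3 + exp (m-(T-s)))) + 1/c*P*exp (m-(T-s)) := by
        rw [sub_right_comm]
        refine (abs_sub _ _).trans ?_
        rw [abs_of_pos q0]; exact add_le_add b q
      obtain ⟨Z, hZ⟩ : ∃ Z, Z = (if s ≤ (T-F T)/2 then exp (2*(s-(T-F T)/2)) else 0) + (1 - (if s ≤ (T-F T)/2 then 1 else 0)) := ⟨_, rfl⟩
      have hZ2 : exp (m-(T-s)) ≤ Z := by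
        rw [hZ]; split_ifs
        · have : exp (m-(T-s)) ≤ exp (2*(s-(T-F T)/2)) := exp_le_exp.2 (by linarith)
          linarith
        · linarith
      have Z0 : 0 ≤ Z := (exp_pos _).le.trans hZ2
      rw [add_assoc (F s*s^2/T^3), ← hZ]
      refine b2.trans ?_
      have d1 := mul_le_mul_of_nonneg_left hZ2 (show 0 ≤ C1*P+1/c*P by positivity)
      have d2 : 0 ≤ (C2+al⁻¹)*(P*(F s*s^2/T^3+Z)) + 1/c*P*(F s*s^2/T^3) := by positivity
      have : (C1+C2+1/c+al⁻¹)*(P*(F s*s^2/T^3+Z)) = C1*P*(F s*s^2/T^3) + (C1*P+1/c*P)*Z + ((C2+al⁻¹)*(P*(F s*s^2/T^3+Z)) + 1/c*P*(F s*s^2/T^3)) := by ring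
      rw [this]; linarith
    · rw [if_neg hs2, if_neg hs2, if_neg (by linarith), if_neg (by linarith)]
      have := h2 (M n) (exp (T-s)) (by omega) (by rw [ml]; exact exp_le_exp.2 hm)
      have w0 : 0 ≤ ws 0 (M n) (exp (T-s))/exp (T-s) := div_nonneg (ws_nonneg _ _ _) R0.le
      rw [sub_zero]
      refine (abs_sub _ _).trans ?_
      rw [abs_of_pos q0, abs_of_nonneg w0]
      have : 0 ≤ C1*P + al⁻¹*P := by positivity
      linarith
  · have w1 : ws 0 (M n) (exp (T-s)) = 1 := ws_one 0 (one_le_exp (by linarith)) (by rw [ml]; exact exp_lt_exp.2 hm)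
    have i0 : ¬ s ≤ (T-F T)/2 := by linarith
    rw [w1, sub_self, if_neg i0, if_neg i0, zero_sub, abs_neg]
    by_cases hs2 : s ≤ T/2
    · rw [if_pos hs2, if_pos hs2, if_pos (by linarith), abs_of_pos (mul_pos aP (om_pos _))]
      have := mul_le_mul_of_nonneg_left (om_le (T/s-1)) aP.le
      have : 0 ≤ (C1+C2+1/c)*P + (C1+C2+1/c+al⁻¹)*P*(F s*s^2/T^3) := by positivity
      linarith
    · rw [if_neg hs2, if_neg hs2, abs_zero]
      split_ifs <;> positivity

lemma KP.count (h : KP F E M S 1 κ) (hc : ∀ x : ℝ, 1 ≤ x → ∑ n ∈ Finset.Icc 1 ⌊x⌋₊, S.indicator (fun n => ws 0 (M n) (x/n)) n = ⌊x⌋₊) :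
    ∃ C > 0, ∃ T1, ∀ T, T1 ≤ T → |sm (S.indicator fun _ => 1) T/(exp T/2) - al⁻¹*cS M S κ/T| ≤ C*(E T/T) := by
  obtain ⟨C1, hC1, h1⟩ := h.term
  obtain ⟨C2, hC2, h2⟩ := h.err2
  obtain ⟨C3, hC3, h3⟩ := h.win
  obtain ⟨C4, hC4, h4⟩ := h.asq
  obtain ⟨C5, hC5, h5⟩ := h.mainS
  have l1 := log2_lb
  have l2 := log2_ub
  have hal := al_pos
  obtain ⟨T0, hT0⟩ := eventually_atTop.1 (h.ep.lim.eventually (gt_mem_nhds (show (0:ℝ) < 1/4 by norm_num)))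
  refine ⟨16 + C1*(2*C4+C2+5*C3) + al⁻¹*C5, by positivity, max T0 8, fun T hTm => ?_⟩
  have h8 := (le_max_right _ _).trans hTm
  have hE := hT0 T ((le_max_left _ _).trans hTm)
  have hT : 0 < T := by linarith
  have hFT : F T ≤ T/2 := (h.ep.Fle hT).trans (by nlinarith only [hE, hT])
  have F0 := h.ep.lb T hT.le
  have E0 := h.ep.nn hT
  have et : 16 ≤ exp T := by
    have := quadratic_le_exp_of_nonneg hT.le; nlinarith only [this, h8]
  set x := exp T/2 with hx
  have x0 : 0 < x := by linarith
  set τ := (T-F T)/2 with hτ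
  have hxn : ∀ n : ℕ, 1 ≤ n → x/n = exp (T-sn n) := fun n hn => by
    have : (0:ℝ) < n := by exact_mod_cast hn
    rw [exp_sub, sn, exp_log (by positivity), hx, div_div]
  set Bd : ℕ → ℝ := fun n => (if sn n ≤ T/2 then aS M S n*(F (sn n)*sn n^2/T^3) else 0) + (if sn n ≤ τ then aS M S n*exp (2*(sn n-τ)) else 0) +
      ((if sn n ≤ T/2+log 2 then aS M S n else 0) + (-1)*(if sn n ≤ τ then aS M S n else 0)) with hBd
  have tm : ∀ n, 1 ≤ n → sn n ≤ T → |S.indicator (fun n => ws 0 (M n) (x/n)) n/x - S.indicator (fun _ => 1) n/x - al⁻¹*(if sn n ≤ T/2 then aS M S n*om (T/sn n-1) else 0)| ≤ C1*Bd n := fun n hn hs => by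
    by_cases hS : n ∈ S
    · have n0 : (0:ℝ) < n := by exact_mod_cast hn
      have := mul_le_mul_of_nonneg_left (h1 T h8 hFT n hn hs) (show 0 ≤ 1/(n:ℝ) by positivity)
      rw [← abs_of_pos (show 0 < 1/(n:ℝ) by positivity), ← abs_mul, abs_of_pos (show 0 < 1/(n:ℝ) by positivity)] at this
      rw [indicator_of_mem hS, indicator_of_mem hS, hxn n hn]
      have xe : x = n*exp (T-sn n) := by rw [← hxn n hn]; field_simp
      have ea : aS M S n = PiM (M n)/n := if_pos hS
      refine (le_of_eq ?_).trans (this.trans (le_of_eq ?_))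
      · congr 1
        rw [xe, ea]; have := exp_pos (T-sn n)
        split_ifs <;> field_simp <;> ring
      · simp only [hBd, ea]
        split_ifs <;> ring
    · have ea : aS M S n = 0 := if_neg hS
      simp [hBd, ea, indicator_of_notMem hS]
  have tot : |sm (S.indicator (fun n => ws 0 (M n) (x/n))) T/x - sm (S.indicator fun _ => 1) T/x - al⁻¹*sm (fun n => aS M S n*om (T/sn n-1)) (T/2)| ≤ C1*sm Bd T := by
    rw [← sm_mul C1, ← sm_ite (fun n => aS M S n*om (T/sn n-1)) (show T/2 ≤ T by linarith), ← sm_mul al⁻¹, sm, sm, sm, Finset.sum_div, Finset.sum_div, ← Finset.sum_sub_distrib, ← Finset.sum_sub_distrib]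
    refine (Finset.abs_sum_le_sum_abs _ _).trans (Finset.sum_le_sum fun n hn => ?_)
    obtain ⟨n1, n2⟩ := mem_sm.1 hn
    exact tm n n1 n2
  have b1 : sm (fun n => aS M S n*(F (sn n)*sn n^2/T^3)) (T/2) ≤ 2*C4*(E T/T) := by
    have : sm (fun n => aS M S n*(F (sn n)*sn n^2/T^3)) (T/2) ≤ sm (fun n => F T/T^3*(aS M S n*sn n^2)) (T/2) := sm_le fun n hn hs => by
      have := h.ep.mono (sn n) T (by linarith [sn_ge hn]) (by linarith)
      have := aS_nn M S n
      rw [show aS M S n*(F (sn n)*sn n^2/T^3) = F (sn n)*(aS M S n*sn n^2/T^3) by ring, show F T/T^3*(aS M S n*sn n^2) = F T*(aS M S n*sn n^2/T^3) by ring]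
      gcongr
    rw [sm_mul] at this
    refine this.trans ?_
    have k := mul_le_mul_of_nonneg_left (h4 (T/2) (by linarith)) (show 0 ≤ F T/T^3 by positivity)
    have k2 := mul_le_mul_of_nonneg_left (h.ep.F2 hT) hC4.le
    have : F T/T^3*(C4*(T/2)) = C4*(F T/T^2)/2 := by field_simp
    have : 0 ≤ C4*(F T/T^2) := by positivity
    linarith
  have b2 := h2 T h8 hFT
  have b3 : sm (aS M S) (T/2+log 2) - sm (aS M S) τ ≤ 5*C3*(E T/T) := by
    have := h3 T τ (F T/2+log 2) hT (by linarith) (by linarith) (by linarith)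
    rw [show τ+(F T/2+log 2) = T/2+log 2 by rw [hτ]; ring] at this
    refine this.trans ?_
    have k1 := h.ep.F2 hT
    have k2 := h.ep.sq hT
    have k3 := mul_le_mul_of_nonneg_right l2.le (show 0 ≤ 1/T^2 by positivity)
    have : (F T/2+log 2)/T^2 = F T/T^2/2 + log 2*(1/T^2) := by ring
    have E1 : 0 ≤ E T/T := by positivity
    have : (F T/2+log 2)/T^2 + E T/T ≤ 5*(E T/T) := by linarith
    nlinarith only [this, hC3]
  have bB : sm Bd T = sm (fun n => aS M S n*(F (sn n)*sn n^2/T^3)) (T/2) + sm (fun n => aS M S n*exp (2*(sn n-τ))) τ + (sm (aS M S) (T/2+log 2) - sm (aS M S) τ) := by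
    rw [hBd, sm_add, sm_add, sm_add, sm_mul, sm_ite _ (by linarith), sm_ite _ (by linarith), sm_ite _ (by linarith), sm_ite _ (by linarith)]; ring
  have b4 : sm (S.indicator (fun n => ws 0 (M n) (x/n))) T = ⌊x⌋₊ := hc x (by linarith)
  have b5 : |(⌊x⌋₊:ℝ)/x - 1| ≤ 16*(E T/T) := by
    have f1 := Nat.floor_le x0.le
    have f2 := Nat.lt_floor_add_one x
    have f3 := h.ep.sq hT
    have f4 : 1/x ≤ 4*(1/T^2) := by
      rw [← mul_div_assoc, div_le_div_iff₀ x0 (by positivity)]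
      nlinarith only [quadratic_le_exp_of_nonneg hT.le, hT, hx]
    have : |(⌊x⌋₊:ℝ)/x - 1| ≤ 1/x := by
      rw [show (⌊x⌋₊:ℝ)/x - 1 = (⌊x⌋₊-x)/x by field_simp, abs_div, abs_of_pos x0]
      gcongr; rw [abs_le]; constructor <;> linarith
    linarith
  have b6 := h5 T (by linarith)
  rw [b4, bB] at tot
  set Q := sm (fun n => aS M S n*om (T/sn n-1)) (T/2)
  set c := cS M S κ
  have b7 : |al⁻¹*(Q - (1*al - c/T))| ≤ al⁻¹*(C5*(E T/T)) := by rw [abs_mul, abs_of_pos (inv_pos.2 hal)]; gcongr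
  have key : sm (S.indicator fun _ => 1) T/x - al⁻¹*c/T = ((⌊x⌋₊:ℝ)/x - 1) - ((⌊x⌋₊:ℝ)/x - sm (S.indicator fun _ => 1) T/x - al⁻¹*Q) - al⁻¹*(Q - (1*al - c/T)) := by
    field_simp; ring
  rw [key]
  have r1 := abs_sub (((⌊x⌋₊:ℝ)/x - 1) - ((⌊x⌋₊:ℝ)/x - sm (S.indicator fun _ => 1) T/x - al⁻¹*Q)) (al⁻¹*(Q - (1*al - c/T)))
  have r2 := abs_sub ((⌊x⌋₊:ℝ)/x - 1) ((⌊x⌋₊:ℝ)/x - sm (S.indicator fun _ => 1) T/x - al⁻¹*Q)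
  have r3 := mul_le_mul_of_nonneg_left (add_le_add (add_le_add b1 b2) b3) hC1.le
  linarith
end Q6d

section Q7
open Set Filter Topology

variable {F E : ℝ → ℝ} {M : ℕ → ℕ} {S : Set ℕ} {w κ : ℝ}

open Classical in
lemma KPmk {θ : ℕ → ℝ} {f : ℝ → ℝ} (h0 : ∀ n : ℕ, 1 ≤ n → (max 2 n : ℕ) ≤ θ n) (hi : ∀ n : ℕ, 1 ≤ n → θ n ≤ n * f n)
    (hfl : ∃ A : ℝ, ∀ x : ℝ, 16 ≤ x → f x ≤ A * lfun x) (hf : Monotone f) (P : ℕ → Prop)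
    (hP : ∀ n r, 0 < n → 0 < r → rough (Mf θ n) r → (P (n*r) ↔ P n)) (hS : ∀ n, n ∈ S ↔ n ∈ Bset θ ∧ P n)
    (hk : ∃ C > 0, ∀ x : ℝ, 1 ≤ x → |∑ m ∈ (Finset.Icc 1 ⌊x⌋₊).filter P, (1/(m:ℝ))^1 - (w*(log x+eulerMascheroniConstant)+κ)| ≤ C/x) :
    KP (fun s => log (f (exp s))) (fun T => Efun f (exp T)) (Mf θ) S w κ := by
  have f1 : 2 ≤ f 1 := by
    have a := h0 1 le_rfl
    have b := hi 1 le_rfl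
    norm_num at a b; linarith
  refine ⟨EPf hfl hf f1, fun n hn => (Mf_ge h0 hn).2, fun n hn => (Mf_ge h0 hn).1, fun n hn => ?_, ?_⟩
  · have n1 : (1:ℝ) ≤ n := by exact_mod_cast hn
    have a : (Mf θ n:ℝ) ≤ θ n + 1 := by
      have := h0 n hn
      rw [Mf]; push_cast; linarith [Nat.floor_le (show 0 ≤ θ n from (Nat.cast_nonneg _).trans this)]
    have b : f n ≤ f (2*n) := hf (by linarith)
    have c : f 1 ≤ f n := hf n1
    have d : (Mf θ n:ℝ) ≤ 2*n*f (2*n) := by nlinarith [hi n hn]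
    have M0 : (0:ℝ) < Mf θ n := by rw [Mf]; positivity
    rw [sn, exp_log (by positivity), ← log_mul (by positivity) (by linarith)]
    exact log_le_log M0 d
  · obtain ⟨C, hC, h⟩ := hk
    refine ⟨C, hC, fun x hx => ?_⟩
    have := h x hx
    rw [fac_sum h0 1 P hP x, Finset.sum_filter] at this
    convert this using 4
    rw [indicator_apply]; simp [hS]

lemma KPB {θ : ℕ → ℝ} {f : ℝ → ℝ} (h0 : ∀ n : ℕ, 1 ≤ n → (max 2 n : ℕ) ≤ θ n) (hi : ∀ n : ℕ, 1 ≤ n → θ n ≤ n * f n)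
    (hfl : ∃ A : ℝ, ∀ x : ℝ, 16 ≤ x → f x ≤ A * lfun x) (hf : Monotone f) :
    KP (fun s => log (f (exp s))) (fun T => Efun f (exp T)) (Mf θ) (Bset θ) 1 0 := by
  classical
  refine KPmk h0 hi hfl hf (fun _ => True) (fun _ _ _ _ _ => Iff.rfl) (fun n => by simp) ⟨2, two_pos, fun x hx => ?_⟩
  have := harm x (by linarith)
  rw [ws] at this
  convert this using 3
  · refine Finset.sum_congr ?_ fun _ _ => rfl
    ext n; simp [rough0]
  · ring

lemma cntB {θ : ℕ → ℝ} (h0 : ∀ n : ℕ, 1 ≤ n → (max 2 n : ℕ) ≤ θ n) (x : ℝ) : 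
    ∑ n ∈ Finset.Icc 1 ⌊x⌋₊, (Bset θ).indicator (fun n => ws 0 (Mf θ n) (x/n)) n = ⌊x⌋₊ := by
  classical
  have := fac_sum h0 0 (fun _ => True) (fun _ _ _ _ _ => Iff.rfl) x
  rw [Finset.sum_filter, Finset.sum_filter] at this
  simp only [pow_zero, if_true, Finset.sum_const, Nat.card_Icc, add_tsub_cancel_right, nsmul_eq_mul, mul_one, and_true, one_mul] at this
  rw [this]
  refine Finset.sum_congr rfl fun n _ => by rw [indicator_apply]

lemma PL3 : PiM 3 = 1/2 ∧ LM 3 = log 2 := by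
  have : (Finset.range 3).filter Nat.Prime = {2} := by decide
  rw [PiM, LM, this]; norm_num

lemma rough3 {r : ℕ} : rough 3 r ↔ ¬ 2 ∣ r := by
  constructor
  · intro h h2; have := h 2 Nat.prime_two h2; omega
  · intro h p hp hd
    have := hp.two_le
    by_contra h3
    obtain rfl : p = 2 := by omega
    exact h hd

lemma sum2k (k : ℕ) (x : ℝ) (hx : 0 ≤ x) : ∑ m ∈ (Finset.Icc 1 ⌊x⌋₊).filter (fun m => m.factorization 2 = k), (1/(m:ℝ))^1 = 1/2^k*ws 1 3 (x/2^k) := by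
  classical
  rw [ws, Finset.mul_sum]
  symm
  refine Finset.sum_bij (fun r _ => 2^k*r) ?_ ?_ ?_ ?_
  · intro r hr
    rw [Finset.mem_filter, Finset.mem_Icc, Nat.le_floor_iff (by positivity), rough3, le_div_iff₀ (by positivity)] at hr
    have r0 : r ≠ 0 := by omega
    rw [Finset.mem_filter, Finset.mem_Icc, Nat.le_floor_iff hx]
    refine ⟨⟨Nat.mul_pos (by positivity) (by omega), by push_cast; linarith [hr.1.2]⟩, ?_⟩
    rw [Nat.factorization_mul (by positivity) r0]
    simp [Nat.prime_two.factorization_pow, Nat.factorization_eq_zero_of_not_dvd hr.2]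
  · intro a _ b _ h; exact Nat.eq_of_mul_eq_mul_left (by positivity) h
  · intro m hm
    rw [Finset.mem_filter, Finset.mem_Icc, Nat.le_floor_iff hx] at hm
    have m0 : m ≠ 0 := by omega
    have d : 2^k ∣ m := hm.2 ▸ Nat.ordProj_dvd m 2
    refine ⟨m/2^k, ?_, Nat.mul_div_cancel' d⟩
    have e := Nat.mul_div_cancel' d
    rw [Finset.mem_filter, Finset.mem_Icc, Nat.le_floor_iff (by positivity), rough3, le_div_iff₀ (by positivity)]
    refine ⟨⟨Nat.div_pos (Nat.le_of_dvd (by omega) d) (by positivity), ?_⟩, ?_⟩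
    · have : ((2^k*(m/2^k) : ℕ):ℝ) ≤ x := by rw [e]; exact hm.1.2
      rw [Nat.cast_mul] at this; push_cast at this ⊢; linarith
    · have := Nat.not_dvd_ordCompl Nat.prime_two m0
      rwa [hm.2] at this
  · intro r _; push_cast; field_simp

lemma KP2 {θ : ℕ → ℝ} {f : ℝ → ℝ} (h0 : ∀ n : ℕ, 1 ≤ n → (max 2 n : ℕ) ≤ θ n) (hi : ∀ n : ℕ, 1 ≤ n → θ n ≤ n * f n)
    (hfl : ∃ A : ℝ, ∀ x : ℝ, 16 ≤ x → f x ≤ A * lfun x) (hf : Monotone f) (k : ℕ) :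
    KP (fun s => log (f (exp s))) (fun T => Efun f (exp T)) (Mf θ) {n | n ∈ Bset θ ∧ n.factorization 2 = k} (1/2^(k+1)) (-(1/2^(k+1)*((k-1)*log 2))) := by
  classical
  refine KPmk h0 hi hfl hf (fun n => n.factorization 2 = k) (fun n r hn hr h => ?_) (fun n => Iff.rfl) ⟨16, by norm_num, fun x hx => ?_⟩
  · have : ¬ 2 ∣ r := fun h2 => by
      have := h 2 Nat.prime_two h2
      have := (Mf_ge h0 hn).2
      omega
    rw [Nat.factorization_mul (by omega) (by omega)]
    simp [Nat.factorization_eq_zero_of_not_dvd this]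
  · have := DD_bd 3 (R := x/2^k) (by positivity)
    rw [DD, PL3.1, PL3.2, log_div (by positivity) (by positivity), log_pow] at this
    have e := sum2k k x (by linarith)
    have g : |1/2^k*ws 1 3 (x/2^k) - (1/2^(k+1)*(log x+eulerMascheroniConstant)+ -(1/2^(k+1)*((k-1)*log 2)))| ≤ 16/x := ?_
    · rw [← e] at g; convert g
    rw [show 1/2^k*ws 1 3 (x/2^k) - (1/2^(k+1)*(log x+eulerMascheroniConstant)+ -(1/2^(k+1)*((k-1)*log 2))) = 1/2^k*(ws 1 3 (x/2^k) - 1/2*(log x - k*log 2+eulerMascheroniConstant+log 2)) by rw [pow_succ]; field_simp; ring, abs_mul, abs_of_pos (by positivity)]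
    refine (mul_le_mul_of_nonneg_left this (by positivity)).trans (le_of_eq ?_)
    field_simp; norm_num
lemma KP.mb0 (h : KP F E M S w κ) : Tendsto (mb M S w) atTop (𝓝 0) := by
  obtain ⟨H, _, hH⟩ := h.Hbd
  refine tendsto_of_tendsto_of_tendsto_of_le_of_le' tendsto_const_nhds ((tendsto_const_nhds (x := H)).div_atTop tendsto_id) (Eventually.of_forall fun T => h.mb_nn T) ?_
  filter_upwards [eventually_ge_atTop (log 2)] with T hT
  have : 0 < T := by linarith [log2_lb]
  rw [id, le_div_iff₀ this]; linarith [hH T hT]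

lemma KP.clim (h : KP F E M S w κ) : Tendsto (fun T => T*mb M S w T) atTop (𝓝 (cS M S κ)) := by
  obtain ⟨C, _, hb⟩ := h.asym
  rw [tendsto_iff_norm_sub_tendsto_zero]
  refine tendsto_of_tendsto_of_tendsto_of_le_of_le' tendsto_const_nhds (by simpa using h.ep.lim.const_mul C) (Eventually.of_forall fun T => norm_nonneg _) ?_
  filter_upwards [eventually_ge_atTop (log 2)] with T hT using hb T hT

lemma KP.cle {S' : Set ℕ} {w' κ' : ℝ} (h : KP F E M S w κ) (h' : KP F E M S' w' κ') (hs : S' ⊆ S) : cS M S' κ' ≤ cS M S κ := by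
  have hle : ∀ n, 0 ≤ aS M S n + (-1)*aS M S' n := fun n => by
    have := aS_nn M S n
    by_cases hn : n ∈ S'
    · rw [aS, aS, if_pos hn, if_pos (hs hn)]; simp
    · rw [show aS M S' n = 0 from if_neg hn]; simpa
  have mono : Monotone fun T => mb M S' w' T - mb M S w T := fun a b hab => by
    have := sm_mono hle hab
    rw [sm_add, sm_add, sm_mul, sm_mul] at this
    simp only [mb]; linarith
  have lim : Tendsto (fun T => mb M S' w' T - mb M S w T) atTop (𝓝 0) := by simpa using h'.mb0.sub h.mb0
  refine le_of_tendsto_of_tendsto h'.clim h.clim ?_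
  filter_upwards [eventually_ge_atTop 0] with T hT
  exact mul_le_mul_of_nonneg_left (by linarith [mono.ge_of_tendsto lim T]) hT

lemma KP.tlb : ∃ C > 0, ∀ (F E : ℝ → ℝ) (M : ℕ → ℕ) (S : Set ℕ) (w κ : ℝ), KP F E M S w κ → -(C*w) ≤ ∑' n, aS M S n*(LM (M n)-log n) := by
  obtain ⟨C, hC, hb⟩ := LM_bd
  refine ⟨C, hC, fun F E M S w κ h => ?_⟩
  refine ge_of_tendsto (sm_tend (by rw [aS0, zero_mul]) h.sumG) (Eventually.of_forall fun T => ?_)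
  have : sm (fun n => (-C)*aS M S n) T ≤ sm (fun n => aS M S n*(LM (M n)-log n)) T := sm_le fun n hn _ => by
    rw [mul_comm]
    refine mul_le_mul_of_nonneg_left ?_ (aS_nn M S n)
    have a := (abs_le.1 (hb (M n) (by linarith [h.three n hn]))).1
    have := log_le_log (show (0:ℝ) < n by exact_mod_cast hn) (show (n:ℝ) ≤ M n by exact_mod_cast (h.lt n hn).le)
    linarith
  rw [sm_mul] at this
  have := mul_le_mul_of_nonneg_left (h.Nle T) hC.le
  linarith

lemma cpos {θ : ℕ → ℝ} {f : ℝ → ℝ} (h0 : ∀ n : ℕ, 1 ≤ n → (max 2 n : ℕ) ≤ θ n) (hi : ∀ n : ℕ, 1 ≤ n → θ n ≤ n * f n)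
    (hfl : ∃ A : ℝ, ∀ x : ℝ, 16 ≤ x → f x ≤ A * lfun x) (hf : Monotone f) : 0 < cS (Mf θ) (Bset θ) 0 := by
  obtain ⟨C, hC, hb⟩ := KP.tlb
  obtain ⟨k, hk⟩ := exists_nat_gt (C/log 2+1)
  have l := log2_lb
  have K := KP2 h0 hi hfl hf k
  refine lt_of_lt_of_le ?_ ((KPB h0 hi hfl hf).cle K fun n hn => hn.1)
  have b := hb _ _ _ _ _ _ K
  have : C < (k-1)*log 2 := by rw [← div_lt_iff₀ (by linarith)]; linarith
  have w0 : (0:ℝ) < 1/2^(k+1) := by positivity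
  have := mul_lt_mul_of_pos_left this w0
  rw [cS]
  exact div_pos (mul_pos al_pos (by linarith)) (by linarith [al_lt])

lemma cθ_eq (θ : ℕ → ℝ) : cθ θ = al⁻¹*cS (Mf θ) (Bset θ) 0 := by
  have e : ∑' n : Bset θ, (1 / (n : ℝ)) * ((∑ p ∈ primesUpTo (θ n), Real.log p / ((p : ℝ) - 1)) - Real.log n) * ∏ p ∈ primesUpTo (θ n), (1 - 1 / (p : ℝ))
      = ∑' n, aS (Mf θ) (Bset θ) n*(LM (Mf θ n)-log n) := by
    rw [tsum_subtype (Bset θ) fun n : ℕ => (1 / (n : ℝ)) * ((∑ p ∈ primesUpTo (θ n), Real.log p / ((p : ℝ) - 1)) - Real.log n) * ∏ p ∈ primesUpTo (θ n), (1 - 1 / (p : ℝ))]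
    congr 1; ext n
    by_cases h : n ∈ Bset θ
    · rw [indicator_of_mem h, aS, if_pos h, LM, PiM, Mf, primesUpTo]; ring
    · rw [indicator_of_notMem h, aS, if_neg h, zero_mul]
  have := al_pos
  have := al_lt
  rw [cθ, e, cS, ← al, sub_zero]
  field_simp

end Q7

theorem thmimp (θ : ℕ → ℝ) (f : ℝ → ℝ)
    (hθlow : ∀ n : ℕ, 1 ≤ n → (max 2 n : ℕ) ≤ θ n)
    (hθhigh : ∀ n : ℕ, 1 ≤ n → θ n ≤ n * f n)
    (hfl : ∃ A : ℝ, ∀ x : ℝ, 16 ≤ x → f x ≤ A * lfun x)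
    (hfmono : Monotone f)
    (hfdecr : ∃ x₁ : ℝ, AntitoneOn (fun x => Real.log (f x) / Real.log x) (Set.Ici x₁)) :
    0 < cθ θ ∧ ∃ C : ℝ, ∀ x : ℝ, 2 ≤ x →
      |Bcount θ x - cθ θ * x / Real.log x| ≤ C * (cθ θ * x / Real.log x) * Efun f x := by
  have K := KPB hθlow hθhigh hfl hfmono
  have cp : 0 < cθ θ := by rw [cθ_eq]; exact mul_pos (inv_pos.2 al_pos) (cpos hθlow hθhigh hfl hfmono)
  refine ⟨cp, ?_⟩
  obtain ⟨C, hC, T0, hb⟩ := K.count fun x _ => cntB hθlow x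
  rw [← cθ_eq] at hb
  set c := cθ θ
  have l2 := log2_ub
  have l1 := log2_lb
  set T1 := max T0 1
  have T10 : 1 ≤ T1 := le_max_right _ _
  refine ⟨C/c+3+(4*T1^2/c+4*T1), fun x hx => ?_⟩
  have x0 : 0 < x := by linarith
  set t := log x with ht
  have t0 : 0.69 < t := log_ge hx
  have tp : 0 < t := by linarith
  obtain ⟨T, hT⟩ : ∃ T, T = log (2*x) := ⟨_, rfl⟩
  have eT : exp T/2 = x := by rw [hT, exp_log (by positivity)]; ring
  have Tt : T = log 2+t := by rw [hT, log_mul two_ne_zero x0.ne']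
  have eE : Efun f x = Efun f (exp t) := by rw [ht, exp_log x0]
  have hge : 0.3/t ≤ Efun f (exp t) := K.ep.ge tp
  have hanti : Efun f (exp T) ≤ Efun f (exp t) := K.ep.anti t T tp (by linarith)
  have hsq : 1/t^2 ≤ 4*(Efun f (exp t)/t) := K.ep.sq tp
  rw [eE]
  set e := Efun f (exp t)
  have e0 : 0 < e := lt_of_lt_of_le (by positivity) hge
  have hB : Bcount θ x = sm ((Bset θ).indicator fun _ => 1) T := by
    classical
    rw [Bcount, sm, eT, Finset.card_filter]; push_cast
    refine Finset.sum_congr rfl fun n _ => by rw [Set.indicator_apply]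
  rcases le_or_gt T0 T with h | h
  · have b := hb T h
    rw [eT, ← hB] at b
    have b1 : C*(Efun f (exp T)/T) ≤ C*(e/t) := by gcongr; linarith
    have b2 : |c/T - c/t| ≤ c*(3*(e/t)) := by
      have Tp : 0 < T := by linarith
      rw [abs_sub_comm, show c/t - c/T = c*((T-t)/(t*T)) by field_simp, abs_of_nonneg (mul_nonneg cp.le (div_nonneg (by linarith) (by positivity)))]
      gcongr
      calc (T-t)/(t*T) ≤ 0.7/(t*t) := by gcongr <;> linarith
        _ = 0.7*(1/t^2) := by ring
        _ ≤ _ := by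
          have : 0 ≤ e/t := by positivity
          linarith
    have b3 : |Bcount θ x/x - c/t| ≤ C*(e/t) + c*(3*(e/t)) := by
      have := abs_sub_le (Bcount θ x/x) (c/T) (c/t)
      linarith
    have b4 : Bcount θ x - c*x/t = x*(Bcount θ x/x - c/t) := by field_simp
    rw [b4, abs_mul, abs_of_pos x0]
    have b5 := mul_le_mul_of_nonneg_left b3 x0.le
    have b6 : (C/c+3+(4*T1^2/c+4*T1))*(c*x/t)*e = x*(C*(e/t) + c*(3*(e/t))) + (4*T1^2/c+4*T1)*(c*x/t)*e := by field_simp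
    have : 0 ≤ (4*T1^2/c+4*T1)*(c*x/t)*e := by positivity
    rw [b6]; linarith
  · have tT : t ≤ T1 := by linarith [le_max_left T0 1]
    have B0 : 0 ≤ Bcount θ x := Nat.cast_nonneg _
    have B1 : Bcount θ x ≤ x := by
      classical
      refine le_trans ?_ (Nat.floor_le x0.le)
      rw [Bcount]; norm_cast
      refine (Finset.card_filter_le _ _).trans (by simp)
    have e1 : 1 ≤ 4*T1*e := by
      rw [div_le_iff₀ tp] at hge
      nlinarith only [hge, tT, e0, T10]
    have e2 : 1 ≤ T1/t := (one_le_div tp).2 tT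
    have m0 : 0 < c*x/t := by positivity
    have b1 : x ≤ 4*T1^2/c*(c*x/t)*e := by
      rw [show 4*T1^2/c*(c*x/t)*e = x*((T1/t)*(4*T1*e)) by field_simp]
      exact le_mul_of_one_le_right x0.le (one_le_mul_of_one_le_of_one_le e2 e1)
    have b2 : c*x/t ≤ 4*T1*(c*x/t)*e := by
      rw [show 4*T1*(c*x/t)*e = c*x/t*(4*T1*e) by ring]
      exact le_mul_of_one_le_right m0.le e1
    have b3 : 0 ≤ (C/c+3)*(c*x/t)*e := by positivity
    have b4 : (C/c+3+(4*T1^2/c+4*T1))*(c*x/t)*e = (C/c+3)*(c*x/t)*e + 4*T1^2/c*(c*x/t)*e + 4*T1*(c*x/t)*e := by ring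
    rw [b4, abs_le]; constructor <;> linarith
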